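/- Sparse representation of minimizers: Let Ω ⊂ ℝ^d be the closure of a bounded domain, α,β,δ > 0, H a finite-dimensional Hilbert space, K : C_w([0,1];M(Ω)) → H linear and continuous in the sense that if ρ_t^n → ρ_t narrowly in M(Ω) for every t ∈ [0,1] then Kρ^n → Kρ in H, and F : H → ℝ convex, lower semicontinuous and bounded from below. Then the problem min over (ρ,m,μ) ∈ C_w([0,1];M(Ω))×M(X_Ω;ℝ^d)×M(X_Ω) of G(ρ,m,μ) := F(Kρ) + J_{α,β,δ}(ρ,m,μ) admits a solution (ρ̂,m̂,μ̂) of the form (ρ̂,m̂,μ̂) = Σ_{i=1}^p c_i (ρ^i,m^i,μ^i), where p ≤ dim(H), c_i > 0, Σ_{i=1}^p c_i = J_{α,β,δ}(ρ̂,m̂,μ̂), and each (ρ^i,m^i,μ^i) belongs to 𝒞. -/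

import Mathlib

open MeasureTheory Set Filter Topology
open scoped ENNReal NNReal

noncomputable section

namespace Paper

abbrev Euc (d : ℕ) : Type := EuclideanSpace ℝ (Fin d)

abbrev XX (d : ℕ) : Type := ℝ × Euc d

variable {d : ℕ}

/-- `Ω` is the closure of a bounded domain (a nonempty bounded open connected set). -/
def IsClosureOfBoundedDomain (Ω : Set (Euc d)) : Prop :=
  ∃ U : Set (Euc d), IsOpen U ∧ U.Nonempty ∧ IsConnected U ∧
    Bornology.IsBounded U ∧ Ω = closure U

/-- `Ω` is the closure of a bounded convex domain. -/
def IsClosureOfBoundedConvexDomain (Ω : Set (Euc d)) : Prop :=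
  ∃ U : Set (Euc d), IsOpen U ∧ U.Nonempty ∧ Convex ℝ U ∧
    Bornology.IsBounded U ∧ Ω = closure U

/-- clamping of `ℝ` onto `[0,1]`. -/
def clamp (t : ℝ) : ℝ := max 0 (min 1 t)

/-- `t ↦ ρ t` is a narrowly continuous curve (on `[0,1]`) of finite positive
measures concentrated on `Ω`, i.e. an element of `C_w([0,1]; M⁺(Ω))`. -/
def NarrowCurve (Ω : Set (Euc d)) (ρ : ℝ → Measure (Euc d)) : Prop :=
  (∀ t ∈ Icc (0:ℝ) 1, ρ t Ωᶜ = 0 ∧ ρ t Set.univ ≠ ⊤) ∧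
  (∀ φ : Euc d → ℝ, Continuous φ →
      ContinuousOn (fun t => ∫ x, φ x ∂(ρ t)) (Icc (0:ℝ) 1))

/-- Test functions for the continuity equation on `X_Ω = (0,1) × Ω` (no-flux form:
compact support in time, free at the spatial boundary). -/
def IsTest (φ : XX d → ℝ) : Prop :=
  ContDiff ℝ (⊤ : ℕ∞) φ ∧ HasCompactSupport φ ∧
    tsupport φ ⊆ Ioo (0:ℝ) 1 ×ˢ (Set.univ : Set (Euc d))

/-- Distributional solution of `∂ₜ ρ + div (v ρ) = g ρ`. -/
def SolvesCE (ρ : ℝ → Measure (Euc d)) (v : XX d → Euc d) (g : XX d → ℝ) : Prop :=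
  ∀ φ : XX d → ℝ, IsTest φ →
    (∫ t in Ioo (0:ℝ) 1,
      ∫ x, (fderiv ℝ φ (t, x) (1, v (t, x)) + φ (t, x) * g (t, x)) ∂(ρ t)) = 0

/-- The Hellinger–Kantorovich energy `∫₀¹ ∫ (|v|² + g²) dρ_t dt`. -/
def EnergyVG (ρ : ℝ → Measure (Euc d)) (v : XX d → Euc d) (g : XX d → ℝ) : ℝ≥0∞ :=
  ∫⁻ t in Ioo (0:ℝ) 1, ∫⁻ x, ENNReal.ofReal (‖v (t, x)‖ ^ 2 + g (t, x) ^ 2) ∂(ρ t)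

/-- The class `D_{v,g}` of finite-energy narrowly continuous solutions. -/
def Dvg (Ω : Set (Euc d)) (v : XX d → Euc d) (g : XX d → ℝ)
    (ρ : ℝ → Measure (Euc d)) : Prop :=
  NarrowCurve Ω ρ ∧ SolvesCE ρ v g ∧ EnergyVG ρ v g < ⊤

/-- total variation `‖ρ‖_{M(X_Ω)}` of `ρ = dt ⊗ ρ_t`. -/
def TVcurve (ρ : ℝ → Measure (Euc d)) : ℝ≥0∞ :=
  ∫⁻ t in Ioo (0:ℝ) 1, ρ t Set.univ

/-- The cone `𝒞_V = {h δ_γ : h ≥ 0, γ ∈ V}` of weighted Dirac masses. -/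
def coneSet (V : Set (Euc d)) : Set (Measure (Euc d)) :=
  {μ | ∃ (a : ℝ) (x : Euc d), 0 ≤ a ∧ x ∈ V ∧ μ = ENNReal.ofReal a • Measure.dirac x}

/-- The space `𝒮_V` of narrowly continuous curves `[0,1] → 𝒞_V`
(extended to `ℝ` by clamping). -/
structure SCurve (V : Set (Euc d)) where
  toFun : ℝ → Measure (Euc d)
  clamped : ∀ t, toFun t = toFun (clamp t)
  cone : ∀ t, toFun t ∈ coneSet V
  narrow : ∀ φ : Euc d → ℝ, Continuous φ → Continuous fun t => ∫ x, φ x ∂(toFun t)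

/-- The flat distance `D_F` between measures. -/
def flatDist (μ ν : Measure (Euc d)) : ℝ :=
  sSup {r : ℝ | ∃ φ : Euc d → ℝ, Continuous φ ∧ (∀ x, |φ x| ≤ 1) ∧ LipschitzWith 1 φ ∧
        r = (∫ x, φ x ∂μ) - ∫ x, φ x ∂ν}

/-- The supremum distance `D` on `𝒮_V`. -/
def Ddist {V : Set (Euc d)} (η₁ η₂ : SCurve V) : ℝ :=
  sSup {r : ℝ | ∃ t ∈ Icc (0:ℝ) 1, r = flatDist (η₁.toFun t) (η₂.toFun t)}

/-- The topology of `(𝒮_V, D)`, generated by the open `D`-balls. -/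
def Stop (V : Set (Euc d)) : TopologicalSpace (SCurve V) :=
  TopologicalSpace.generateFrom
    {s | ∃ (η₀ : SCurve V) (ε : ℝ), 0 < ε ∧ s = {η | Ddist η₀ η < ε}}

/-- The Borel σ-algebra of `(𝒮_V, D)`. -/
def Sborel (V : Set (Euc d)) : MeasurableSpace (SCurve V) := @borel _ (Stop V)

instance (V : Set (Euc d)) : MeasurableSpace (SCurve V) := Sborel V

/-- `‖h‖_∞` for a curve `ρ_t = h(t) δ_{γ(t)} ∈ 𝒮_V`. -/
def supMass {V : Set (Euc d)} (η : SCurve V) : ℝ≥0∞ :=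
  ⨆ t ∈ Icc (0:ℝ) 1, η.toFun t Set.univ

/-- `AC²[0,1]`: absolutely continuous on `[0,1]` with a.e. derivative in `L²`. -/
def AC2 {F : Type*} [NormedAddCommGroup F] [NormedSpace ℝ F] (f : ℝ → F) : Prop :=
  ∃ f' : ℝ → F, IntegrableOn f' (Icc (0:ℝ) 1) ∧
    IntegrableOn (fun t => ‖f' t‖ ^ 2) (Icc (0:ℝ) 1) ∧
    ∀ t ∈ Icc (0:ℝ) 1, f t = f 0 + ∫ s in (0:ℝ)..t, f' s

/-- `(γ, h)` represents the curve `η ∈ 𝒮_V`, i.e. `η_t = h(t) δ_{γ(t)}` on `[0,1]`. -/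
def Represents {V : Set (Euc d)} (η : SCurve V) (γ : ℝ → Euc d) (h : ℝ → ℝ) : Prop :=
  ∀ t ∈ Icc (0:ℝ) 1, 0 ≤ h t ∧ γ t ∈ V ∧
    η.toFun t = ENNReal.ofReal (h t) • Measure.dirac (γ t)

/-- The set `H_V ⊆ 𝒮_V` of curves `h(t)δ_{γ(t)}` with `h, √h ∈ AC²[0,1]`,
`√h γ ∈ AC²([0,1];ℝ^d)`. -/
def MemH (V : Set (Euc d)) (η : SCurve V) : Prop :=
  ∃ (γ : ℝ → Euc d) (h : ℝ → ℝ), Represents η γ h ∧ AC2 h ∧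
    AC2 (fun t => Real.sqrt (h t)) ∧ AC2 (fun t => Real.sqrt (h t) • γ t)

/-- The set `H_V^{v,g}`: curves in `H_V` solving the characteristic system
`γ' = v(t,γ)` a.e. on `{h>0}` and `h' = g(t,γ) h` a.e. on `(0,1)`. -/
def MemHvg (V : Set (Euc d)) (v : XX d → Euc d) (g : XX d → ℝ) (η : SCurve V) : Prop :=
  ∃ (γ : ℝ → Euc d) (h : ℝ → ℝ), Represents η γ h ∧ AC2 h ∧
    AC2 (fun t => Real.sqrt (h t)) ∧ AC2 (fun t => Real.sqrt (h t) • γ t) ∧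
    (∀ᵐ t ∂(volume.restrict {t | t ∈ Ioo (0:ℝ) 1 ∧ 0 < h t}),
        HasDerivAt γ (v (t, γ t)) t) ∧
    (∀ᵐ t ∂(volume.restrict (Ioo (0:ℝ) 1)),
        HasDerivAt h (g (t, γ t) * h t) t)

/-- The set `𝒮*_V` of curves whose positivity set `{h > 0}` is `[0,1] ∩ (-∞, τ)`. -/
def MemSstar {V : Set (Euc d)} (η : SCurve V) : Prop :=
  ∃ τ : ℝ, {t | t ∈ Icc (0:ℝ) 1 ∧ η.toFun t Set.univ ≠ 0} = Icc (0:ℝ) 1 ∩ Iio τ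

/-- The vanishing time `τ(γ,h) = min { t ∈ [0,1] : h(t) = 0 }` (`∞` if none). -/
def tauS {V : Set (Euc d)} (η : SCurve V) : ℝ≥0∞ :=
  sInf {c : ℝ≥0∞ | ∃ t ∈ Icc (0:ℝ) 1, η.toFun t Set.univ = 0 ∧ c = ENNReal.ofReal t}


open Classical in
/-- The integrand `Ψ_δ(t,x,y)`. -/
def Psi (δ : ℝ) (t : ℝ) (x : Euc d) (y : ℝ) : ℝ≥0∞ :=
  if 0 < t then ENNReal.ofReal ((‖x‖ ^ 2 + δ ^ 2 * y ^ 2) / (2 * t))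
  else if t = 0 ∧ x = 0 ∧ y = 0 then 0 else ⊤

/-- `u` is a density of the signed measure `σ` with respect to `lam`. -/
def IsDensityS (σ : SignedMeasure (XX d)) (lam : Measure (XX d)) (u : XX d → ℝ) : Prop :=
  ∀ s : Set (XX d), MeasurableSet s → σ s = ∫ x in s, u x ∂lam

/-- `w` is a density of the vector measure `m` with respect to `lam`. -/
def IsDensityV (m : VectorMeasure (XX d) (Euc d)) (lam : Measure (XX d))
    (w : XX d → Euc d) : Prop :=
  ∀ s : Set (XX d), MeasurableSet s → m s = ∫ x in s, w x ∂lam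

/-- `r` is a density of the positive measure `P` with respect to `lam`. -/
def IsDensityP (P : Measure (XX d)) (lam : Measure (XX d)) (r : XX d → ℝ) : Prop :=
  ∀ s : Set (XX d), MeasurableSet s → P s = ∫⁻ x in s, ENNReal.ofReal (r x) ∂lam

/-- `(P, m, μ)` is a measure solution of `∂ₜ ρ + div m = μ` (with `P` positive). -/
def SolvesCEMeas (P : Measure (XX d)) (m : VectorMeasure (XX d) (Euc d))
    (μ : SignedMeasure (XX d)) : Prop :=
  ∀ (lam : Measure (XX d)), IsFiniteMeasure lam →
    ∀ (w : XX d → Euc d) (u : XX d → ℝ), Measurable w → Measurable u →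
      IsDensityV m lam w → IsDensityS μ lam u →
      ∀ φ : XX d → ℝ, IsTest φ →
        ((∫ x, fderiv ℝ φ x ((1:ℝ), (0 : Euc d)) ∂P) +
          (∫ x, fderiv ℝ φ x ((0:ℝ), w x) ∂lam) + ∫ x, φ x * u x ∂lam) = 0

/-- The Wasserstein–Fisher–Rao energy `B_δ(ρ,m,μ)` for a positive `ρ`. -/
def BdeltaMeas (δ : ℝ) (P : Measure (XX d)) (m : VectorMeasure (XX d) (Euc d))
    (μ : SignedMeasure (XX d)) : ℝ≥0∞ :=
  sInf {c : ℝ≥0∞ | ∃ lam : Measure (XX d), IsFiniteMeasure lam ∧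
    ∃ (r : XX d → ℝ) (w : XX d → Euc d) (u : XX d → ℝ),
      Measurable r ∧ Measurable w ∧ Measurable u ∧ (∀ x, 0 ≤ r x) ∧
      IsDensityP P lam r ∧ IsDensityV m lam w ∧ IsDensityS μ lam u ∧
      c = ∫⁻ x, Psi δ (r x) (w x) (u x) ∂lam}

open Classical in
/-- The coercive energy `J_{α,β,δ}(ρ,m,μ)` for a positive `ρ`. -/
def JMeas (α β δ : ℝ) (P : Measure (XX d)) (m : VectorMeasure (XX d) (Euc d))
    (μ : SignedMeasure (XX d)) : ℝ≥0∞ :=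
  if SolvesCEMeas P m μ then
    ENNReal.ofReal β * BdeltaMeas δ P m μ + ENNReal.ofReal α * P Set.univ
  else ⊤

/-- `(ρ, m, μ)` is a measure solution of `∂ₜ ρ + div m = μ` (signed case). -/
def SolvesCESigned (ρ : SignedMeasure (XX d)) (m : VectorMeasure (XX d) (Euc d))
    (μ : SignedMeasure (XX d)) : Prop :=
  ∀ (lam : Measure (XX d)), IsFiniteMeasure lam →
    ∀ (r : XX d → ℝ) (w : XX d → Euc d) (u : XX d → ℝ),
      Measurable r → Measurable w → Measurable u →
      IsDensityS ρ lam r → IsDensityV m lam w → IsDensityS μ lam u →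
      ∀ φ : XX d → ℝ, IsTest φ →
        (∫ x, (fderiv ℝ φ x ((1:ℝ), (0 : Euc d)) * r x
          + fderiv ℝ φ x ((0:ℝ), w x) + φ x * u x) ∂lam) = 0

/-- The Wasserstein–Fisher–Rao energy `B_δ(ρ,m,μ)`, signed case. -/
def BdeltaSigned (δ : ℝ) (ρ : SignedMeasure (XX d)) (m : VectorMeasure (XX d) (Euc d))
    (μ : SignedMeasure (XX d)) : ℝ≥0∞ :=
  sInf {c : ℝ≥0∞ | ∃ lam : Measure (XX d), IsFiniteMeasure lam ∧
    ∃ (r : XX d → ℝ) (w : XX d → Euc d) (u : XX d → ℝ),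
      Measurable r ∧ Measurable w ∧ Measurable u ∧
      IsDensityS ρ lam r ∧ IsDensityV m lam w ∧ IsDensityS μ lam u ∧
      c = ∫⁻ x, Psi δ (r x) (w x) (u x) ∂lam}

open Classical in
/-- The coercive energy `J_{α,β,δ}(ρ,m,μ)`, signed case. -/
def JSigned (α β δ : ℝ) (ρ : SignedMeasure (XX d)) (m : VectorMeasure (XX d) (Euc d))
    (μ : SignedMeasure (XX d)) : ℝ≥0∞ :=
  if SolvesCESigned ρ m μ then
    ENNReal.ofReal β * BdeltaSigned δ ρ m μ
      + ENNReal.ofReal α * ρ.totalVariation Set.univ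
  else ⊤

/-- A signed measure on `X = ℝ × ℝ^d` is concentrated on `X_Ω = (0,1) × Ω`. -/
def ConcS (Ω : Set (Euc d)) (ρ : SignedMeasure (XX d)) : Prop :=
  ∀ s : Set (XX d), MeasurableSet s → s ⊆ (Ioo (0:ℝ) 1 ×ˢ Ω)ᶜ → ρ s = 0

/-- A vector measure on `X = ℝ × ℝ^d` is concentrated on `X_Ω = (0,1) × Ω`. -/
def ConcV (Ω : Set (Euc d)) (m : VectorMeasure (XX d) (Euc d)) : Prop :=
  ∀ s : Set (XX d), MeasurableSet s → s ⊆ (Ioo (0:ℝ) 1 ×ˢ Ω)ᶜ → m s = 0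

/-- Integral of `φ` against a signed measure. -/
def sInt {α : Type*} [MeasurableSpace α] (σ : SignedMeasure α) (φ : α → ℝ) : ℝ :=
  (∫ x, φ x ∂σ.toJordanDecomposition.posPart) -
    ∫ x, φ x ∂σ.toJordanDecomposition.negPart

/-- Triples `(ρ, m, μ) ∈ M(X_Ω) × M(X_Ω; ℝ^d) × M(X_Ω)`. -/
abbrev Mtriple (d : ℕ) : Type :=
  SignedMeasure (XX d) × VectorMeasure (XX d) (Euc d) × SignedMeasure (XX d)

/-- `P` is the measure `dt ⊗ ρ_t` associated with the curve `η ∈ 𝒮_V`. -/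
def CurveMeasure {V : Set (Euc d)} (η : SCurve V) (P : Measure (XX d)) : Prop :=
  ∀ s : Set (XX d), MeasurableSet s →
    P s = ∫⁻ t in Ioo (0:ℝ) 1, η.toFun t {x | (t, x) ∈ s}

/-- `h'` and `γ'` are the a.e. derivatives of `h` on `(0,1)` and of `γ` on `{h>0}`. -/
def HasAEDerivs (γ : ℝ → Euc d) (h : ℝ → ℝ) (γ' : ℝ → Euc d) (h' : ℝ → ℝ) : Prop :=
  (∀ᵐ t ∂(volume.restrict (Ioo (0:ℝ) 1)), HasDerivAt h (h' t) t) ∧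
  (∀ᵐ t ∂(volume.restrict {t | t ∈ Ioo (0:ℝ) 1 ∧ 0 < h t}), HasDerivAt γ (γ' t) t)

/-- The triple `p = (ρ, m, μ)` is of characteristic form
`ρ = h dt ⊗ δ_γ`, `m = γ' ρ`, `μ = h' dt ⊗ δ_γ` with the regularity of `H_Ω`. -/
def CharRepr (Ω : Set (Euc d)) (γ : ℝ → Euc d) (h : ℝ → ℝ) (γ' : ℝ → Euc d)
    (h' : ℝ → ℝ) (p : Mtriple d) : Prop :=
  (∀ t ∈ Icc (0:ℝ) 1, 0 ≤ h t ∧ γ t ∈ Ω) ∧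
  AC2 h ∧ AC2 (fun t => Real.sqrt (h t)) ∧ AC2 (fun t => Real.sqrt (h t) • γ t) ∧
  (∀ φ : Euc d → ℝ, Continuous φ →
      ContinuousOn (fun t => h t * φ (γ t)) (Icc (0:ℝ) 1)) ∧
  HasAEDerivs γ h γ' h' ∧
  (∀ s : Set (XX d), MeasurableSet s →
      p.1 s = ∫ t in Ioo (0:ℝ) 1, Set.indicator {u : ℝ | (u, γ u) ∈ s} h t) ∧
  (∀ s : Set (XX d), MeasurableSet s →
      p.2.1 s = ∫ t in Ioo (0:ℝ) 1,
        Set.indicator {u : ℝ | (u, γ u) ∈ s} (fun u => h u • γ' u) t) ∧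
  (∀ s : Set (XX d), MeasurableSet s →
      p.2.2 s = ∫ t in Ioo (0:ℝ) 1, Set.indicator {u : ℝ | (u, γ u) ∈ s} h' t)

/-- The set `𝒞` of extremal characteristic triples. -/
def MemC (α β δ : ℝ) (Ω : Set (Euc d)) (p : Mtriple d) : Prop :=
  ∃ (γ : ℝ → Euc d) (h : ℝ → ℝ) (γ' : ℝ → Euc d) (h' : ℝ → ℝ),
    CharRepr Ω γ h γ' h' p ∧
    IsPreconnected {t | t ∈ Icc (0:ℝ) 1 ∧ 0 < h t} ∧
    JSigned α β δ p.1 p.2.1 p.2.2 = 1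


/-- Curves in `C_w([0,1]; M(Ω))`: narrowly continuous curves of signed measures
concentrated on `Ω`, extended to `ℝ` by clamping. -/
def IsCwCurve (Ω : Set (Euc d)) (f : ℝ → SignedMeasure (Euc d)) : Prop :=
  (∀ t, f t = f (clamp t)) ∧
  (∀ t, ∀ s : Set (Euc d), MeasurableSet s → s ⊆ Ωᶜ → f t s = 0) ∧
  (∀ φ : Euc d → ℝ, Continuous φ → Continuous fun t => sInt (f t) φ)

/-- `r` is a density with respect to `lam` of the measure `dt ⊗ f_t` on `X`. -/
def CwDensity (f : ℝ → SignedMeasure (Euc d)) (lam : Measure (XX d))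
    (r : XX d → ℝ) : Prop :=
  ∀ s : Set (XX d), MeasurableSet s →
    (∫ t in Ioo (0:ℝ) 1,
        sInt (f t) ({x : Euc d | (t, x) ∈ s}.indicator fun _ => (1:ℝ)))
      = ∫ x in s, r x ∂lam

/-- `(f, m, μ)` is a measure solution of `∂ₜ ρ + div m = μ`, `f` a curve. -/
def SolvesCECw (f : ℝ → SignedMeasure (Euc d)) (m : VectorMeasure (XX d) (Euc d))
    (μ : SignedMeasure (XX d)) : Prop :=
  ∀ (lam : Measure (XX d)), IsFiniteMeasure lam →
    ∀ (w : XX d → Euc d) (u : XX d → ℝ), Measurable w → Measurable u →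
      IsDensityV m lam w → IsDensityS μ lam u →
      ∀ φ : XX d → ℝ, IsTest φ →
        ((∫ t in Ioo (0:ℝ) 1, sInt (f t) fun x => fderiv ℝ φ (t, x) ((1:ℝ), (0 : Euc d)))
          + (∫ x, fderiv ℝ φ x ((0:ℝ), w x) ∂lam) + ∫ x, φ x * u x ∂lam) = 0

/-- `B_δ(dt ⊗ f_t, m, μ)`. -/
def BdeltaCw (δ : ℝ) (f : ℝ → SignedMeasure (Euc d)) (m : VectorMeasure (XX d) (Euc d))
    (μ : SignedMeasure (XX d)) : ℝ≥0∞ :=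
  sInf {c : ℝ≥0∞ | ∃ lam : Measure (XX d), IsFiniteMeasure lam ∧
    ∃ (r : XX d → ℝ) (w : XX d → Euc d) (u : XX d → ℝ),
      Measurable r ∧ Measurable w ∧ Measurable u ∧
      CwDensity f lam r ∧ IsDensityV m lam w ∧ IsDensityS μ lam u ∧
      c = ∫⁻ x, Psi δ (r x) (w x) (u x) ∂lam}

/-- `‖dt ⊗ f_t‖_{M(X_Ω)}`. -/
def TVCw (f : ℝ → SignedMeasure (Euc d)) : ℝ≥0∞ :=
  ∫⁻ t in Ioo (0:ℝ) 1, (f t).totalVariation Set.univ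

open Classical in
/-- `J_{α,β,δ}(dt ⊗ f_t, m, μ)`. -/
def JCw (α β δ : ℝ) (f : ℝ → SignedMeasure (Euc d)) (m : VectorMeasure (XX d) (Euc d))
    (μ : SignedMeasure (XX d)) : ℝ≥0∞ :=
  if SolvesCECw f m μ then
    ENNReal.ofReal β * BdeltaCw δ f m μ + ENNReal.ofReal α * TVCw f
  else ⊤

/-- The set `𝒞` in curve form: `(f, m, μ)` with `f_t = h(t) δ_{γ(t)}`,
`m = h γ' dt ⊗ δ_γ`, `μ = h' dt ⊗ δ_γ`, with `H_Ω`-regularity, connected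
positivity set and unit energy. -/
def MemCCw (α β δ : ℝ) (Ω : Set (Euc d)) (f : ℝ → SignedMeasure (Euc d))
    (m : VectorMeasure (XX d) (Euc d)) (μ : SignedMeasure (XX d)) : Prop :=
  ∃ (γ : ℝ → Euc d) (h : ℝ → ℝ) (γ' : ℝ → Euc d) (h' : ℝ → ℝ),
    (∀ t ∈ Icc (0:ℝ) 1, 0 ≤ h t ∧ γ t ∈ Ω) ∧
    AC2 h ∧ AC2 (fun t => Real.sqrt (h t)) ∧ AC2 (fun t => Real.sqrt (h t) • γ t) ∧
    (∀ φ : Euc d → ℝ, Continuous φ →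
        ContinuousOn (fun t => h t * φ (γ t)) (Icc (0:ℝ) 1)) ∧
    HasAEDerivs γ h γ' h' ∧
    (∀ t, f t = h (clamp t) • (Measure.dirac (γ (clamp t))).toSignedMeasure) ∧
    (∀ s : Set (XX d), MeasurableSet s →
        m s = ∫ t in Ioo (0:ℝ) 1,
          Set.indicator {u : ℝ | (u, γ u) ∈ s} (fun u => h u • γ' u) t) ∧
    (∀ s : Set (XX d), MeasurableSet s →
        μ s = ∫ t in Ioo (0:ℝ) 1, Set.indicator {u : ℝ | (u, γ u) ∈ s} h' t) ∧
    IsPreconnected {t | t ∈ Icc (0:ℝ) 1 ∧ 0 < h t} ∧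
    JCw α β δ f m μ = 1

/-- The mollified density `ρ_t ∗ ξ_ε + ε χ_V`. -/
def mollDens (V : Set (Euc d)) (ρ : ℝ → Measure (Euc d)) (ξ : Euc d → ℝ) (ε : ℝ)
    (t : ℝ) (x : Euc d) : ℝ :=
  (∫ y, (ε ^ d)⁻¹ * ξ (ε⁻¹ • (x - y)) ∂(ρ t)) + ε * V.indicator (fun _ => (1:ℝ)) x

/-- The mollified measure `ρ_t^ε = (ρ_t ∗ ξ_ε + ε χ_V) dx`. -/
def mollRho (V : Set (Euc d)) (ρ : ℝ → Measure (Euc d)) (ξ : Euc d → ℝ) (ε : ℝ) :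
    ℝ → Measure (Euc d) :=
  fun t => volume.withDensity fun x => ENNReal.ofReal (mollDens V ρ ξ ε t x)

open Classical in
/-- The mollified velocity field `v^ε = ((v ρ_t) ∗ ξ_ε) / ρ_t^ε`. -/
def mollV (V : Set (Euc d)) (ρ : ℝ → Measure (Euc d)) (v : XX d → Euc d)
    (ξ : Euc d → ℝ) (ε : ℝ) : XX d → Euc d :=
  fun p => if mollDens V ρ ξ ε p.1 p.2 = 0 then 0 else
    (mollDens V ρ ξ ε p.1 p.2)⁻¹ •
      ∫ y, ((ε ^ d)⁻¹ * ξ (ε⁻¹ • (p.2 - y))) • v (p.1, y) ∂(ρ p.1)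

open Classical in
/-- The mollified growth field `g^ε = ((g ρ_t) ∗ ξ_ε) / ρ_t^ε`. -/
def mollG (V : Set (Euc d)) (ρ : ℝ → Measure (Euc d)) (g : XX d → ℝ)
    (ξ : Euc d → ℝ) (ε : ℝ) : XX d → ℝ :=
  fun p => if mollDens V ρ ξ ε p.1 p.2 = 0 then 0 else
    (mollDens V ρ ξ ε p.1 p.2)⁻¹ *
      ∫ y, ((ε ^ d)⁻¹ * ξ (ε⁻¹ • (p.2 - y))) * g (p.1, y) ∂(ρ p.1)


/-! ### Signed integrals -/

/-- bounded measurable function -/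
def BM {X : Type*} [MeasurableSpace X] (φ : X → ℝ) : Prop :=
  Measurable φ ∧ ∃ C : ℝ, ∀ x, |φ x| ≤ C

section SInt
variable {X : Type*} [MeasurableSpace X]

lemma BM.integrable {φ : X → ℝ} (h : BM φ) (μ : Measure X) [IsFiniteMeasure μ] :
    Integrable φ μ := by
  obtain ⟨hm, C, hC⟩ := h
  exact Integrable.of_bound hm.aestronglyMeasurable C (Eventually.of_forall hC)

lemma BM.const (c : ℝ) : BM (fun _ : X => c) := ⟨measurable_const, |c|, fun _ => le_rfl⟩

lemma BM.indicator {s : Set X} (hs : MeasurableSet s) : BM (s.indicator fun _ => (1:ℝ)) := by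
  refine ⟨measurable_const.indicator hs, 1, fun x => ?_⟩
  by_cases hx : x ∈ s <;> simp [hx]

lemma BM.add {φ ψ : X → ℝ} (h : BM φ) (h' : BM ψ) : BM (fun x => φ x + ψ x) := by
  obtain ⟨hm, C, hC⟩ := h
  obtain ⟨hm', C', hC'⟩ := h'
  exact ⟨hm.add hm', C + C', fun x => (abs_add_le _ _).trans (add_le_add (hC x) (hC' x))⟩

lemma BM.mul {φ ψ : X → ℝ} (h : BM φ) (h' : BM ψ) : BM (fun x => φ x * ψ x) := by
  obtain ⟨hm, C, hC⟩ := h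
  obtain ⟨hm', C', hC'⟩ := h'
  refine ⟨hm.mul hm', C * C', fun x => ?_⟩
  rw [abs_mul]
  exact mul_le_mul (hC x) (hC' x) (abs_nonneg _) ((abs_nonneg _).trans (hC x))

lemma BM.sum {ι : Type*} (s : Finset ι) {φ : ι → X → ℝ} (h : ∀ i ∈ s, BM (φ i)) :
    BM (fun x => ∑ i ∈ s, φ i x) := by
  classical
  induction s using Finset.induction_on with
  | empty => simpa using BM.const (X := X) 0
  | insert a s ha ih =>
    simp only [Finset.sum_insert ha]
    exact (h a (by simp)).add (ih fun i hi => h i (by simp [hi]))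

lemma sInt_eq {σ : SignedMeasure X} {μ₁ μ₂ : Measure X} [IsFiniteMeasure μ₁]
    [IsFiniteMeasure μ₂] (hσ : σ = μ₁.toSignedMeasure - μ₂.toSignedMeasure) {φ : X → ℝ}
    (hφ : BM φ) : sInt σ φ = (∫ x, φ x ∂μ₁) - ∫ x, φ x ∂μ₂ := by
  have h1 := SignedMeasure.toSignedMeasure_toJordanDecomposition σ
  unfold JordanDecomposition.toSignedMeasure at h1
  have h2 : σ.toJordanDecomposition.posPart + μ₂ = μ₁ + σ.toJordanDecomposition.negPart := by
    rw [← Measure.toSignedMeasure_eq_toSignedMeasure_iff, Measure.toSignedMeasure_add,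
      Measure.toSignedMeasure_add]
    rw [hσ] at h1 ⊢
    rw [sub_eq_sub_iff_add_eq_add] at h1
    exact h1
  have h3 := congrArg (fun ν => ∫ x, φ x ∂ν) h2
  rw [integral_add_measure (hφ.integrable _) (hφ.integrable _),
    integral_add_measure (hφ.integrable _) (hφ.integrable _)] at h3
  unfold sInt
  linarith

lemma signed_eq_jordan (σ : SignedMeasure X) : σ =
    σ.toJordanDecomposition.posPart.toSignedMeasure -
      σ.toJordanDecomposition.negPart.toSignedMeasure :=
  (SignedMeasure.toSignedMeasure_toJordanDecomposition σ).symm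

lemma sInt_add {σ τ : SignedMeasure X} {φ : X → ℝ} (hφ : BM φ) :
    sInt (σ + τ) φ = sInt σ φ + sInt τ φ := by
  have h : σ + τ =
      (σ.toJordanDecomposition.posPart + τ.toJordanDecomposition.posPart).toSignedMeasure -
      (σ.toJordanDecomposition.negPart + τ.toJordanDecomposition.negPart).toSignedMeasure := by
    rw [Measure.toSignedMeasure_add, Measure.toSignedMeasure_add]
    nth_rewrite 1 [signed_eq_jordan σ, signed_eq_jordan τ]
    abel
  rw [sInt_eq h hφ, integral_add_measure (hφ.integrable _) (hφ.integrable _),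
    integral_add_measure (hφ.integrable _) (hφ.integrable _)]
  unfold sInt
  ring

lemma sInt_neg {σ : SignedMeasure X} {φ : X → ℝ} (hφ : BM φ) :
    sInt (-σ) φ = -sInt σ φ := by
  have h : -σ = σ.toJordanDecomposition.negPart.toSignedMeasure -
      σ.toJordanDecomposition.posPart.toSignedMeasure := by
    nth_rewrite 1 [signed_eq_jordan σ]
    abel
  rw [sInt_eq h hφ]
  unfold sInt
  ring

lemma sInt_smul_nn {σ : SignedMeasure X} (c : ℝ≥0) {φ : X → ℝ} (hφ : BM φ) :
    sInt ((c:ℝ) • σ) φ = c * sInt σ φ := by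
  have h : (c:ℝ) • σ = (c • σ.toJordanDecomposition.posPart).toSignedMeasure -
      (c • σ.toJordanDecomposition.negPart).toSignedMeasure := by
    rw [Measure.toSignedMeasure_smul, Measure.toSignedMeasure_smul]
    nth_rewrite 1 [signed_eq_jordan σ]
    rw [smul_sub]
    rfl
  rw [sInt_eq h hφ]
  simp only [integral_smul_nnreal_measure]
  unfold sInt
  rw [NNReal.smul_def, NNReal.smul_def, smul_eq_mul, smul_eq_mul]
  ring

lemma sInt_smul {σ : SignedMeasure X} (c : ℝ) {φ : X → ℝ} (hφ : BM φ) :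
    sInt (c • σ) φ = c * sInt σ φ := by
  rcases le_total 0 c with hc | hc
  · exact sInt_smul_nn ⟨c, hc⟩ hφ
  · have := sInt_smul_nn (σ := σ) ⟨-c, by linarith⟩ hφ
    have h2 : c • σ = - ((-c) • σ) := by
      ext i hi
      rw [neg_apply, smul_apply, smul_apply]
      simp
    rw [h2, sInt_neg hφ]
    change sInt ((-c) • σ) φ = -c * sInt σ φ at this
    rw [this]
    ring

lemma sInt_add_fun {σ : SignedMeasure X} {φ ψ : X → ℝ} (hφ : BM φ) (hψ : BM ψ) :
    sInt σ (fun x => φ x + ψ x) = sInt σ φ + sInt σ ψ := by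
  unfold sInt
  rw [integral_add (hφ.integrable _) (hψ.integrable _),
    integral_add (hφ.integrable _) (hψ.integrable _)]
  ring

lemma sInt_const_mul {σ : SignedMeasure X} (c : ℝ) (φ : X → ℝ) :
    sInt σ (fun x => c * φ x) = c * sInt σ φ := by
  unfold sInt
  rw [integral_const_mul, integral_const_mul]
  ring

lemma sInt_zero_fun {σ : SignedMeasure X} : sInt σ (fun _ => (0:ℝ)) = 0 := by
  unfold sInt; simp

lemma sInt_sum_fun {ι : Type*} {σ : SignedMeasure X} (s : Finset ι) {φ : ι → X → ℝ}
    (h : ∀ i ∈ s, BM (φ i)) :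
    sInt σ (fun x => ∑ i ∈ s, φ i x) = ∑ i ∈ s, sInt σ (φ i) := by
  classical
  induction s using Finset.induction_on with
  | empty => simpa using sInt_zero_fun
  | insert a s ha ih =>
    simp only [Finset.sum_insert ha]
    rw [sInt_add_fun (h a (by simp)) (BM.sum s fun i hi => h i (by simp [hi])),
      ih fun i hi => h i (by simp [hi])]

lemma sInt_indicator {σ : SignedMeasure X} {s : Set X} (hs : MeasurableSet s) :
    sInt σ (s.indicator fun _ => (1:ℝ)) = σ s := by
  nth_rewrite 2 [signed_eq_jordan σ]
  unfold sInt
  rw [integral_indicator hs, integral_indicator hs]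
  simp [Measure.toSignedMeasure_apply_measurable hs, sub_apply]

lemma sInt_toSigned {μ : Measure X} [IsFiniteMeasure μ] {φ : X → ℝ} (hφ : BM φ) :
    sInt μ.toSignedMeasure φ = ∫ x, φ x ∂μ := by
  have h : μ.toSignedMeasure = μ.toSignedMeasure - (0 : Measure X).toSignedMeasure := by
    simp
  rw [sInt_eq h hφ]
  simp

/-- concentration -/
def Conc (Ω : Set X) (σ : SignedMeasure X) : Prop :=
  ∀ s : Set X, MeasurableSet s → s ⊆ Ωᶜ → σ s = 0

lemma Conc.parts {Ω : Set X} (hΩ : MeasurableSet Ω) {σ : SignedMeasure X} (h : Conc Ω σ) :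
    σ.toJordanDecomposition.posPart Ωᶜ = 0 ∧ σ.toJordanDecomposition.negPart Ωᶜ = 0 := by
  obtain ⟨i, hi1, hi2, hi3, hp, hn⟩ := σ.toJordanDecomposition_spec
  rw [hp, hn, SignedMeasure.toMeasureOfZeroLE_apply _ _ _ hΩ.compl,
    SignedMeasure.toMeasureOfLEZero_apply _ _ _ hΩ.compl]
  constructor
  · have := h (i ∩ Ωᶜ) (hi1.inter hΩ.compl) inter_subset_right
    simp only [this, ENNReal.coe_eq_zero]
    rfl
  · have := h (iᶜ ∩ Ωᶜ) (hi1.compl.inter hΩ.compl) inter_subset_right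
    simp only [this, ENNReal.coe_eq_zero, neg_zero]
    rfl

lemma sInt_congr_on {Ω : Set X} (hΩ : MeasurableSet Ω) {σ : SignedMeasure X} (h : Conc Ω σ)
    {φ ψ : X → ℝ} (he : ∀ x ∈ Ω, φ x = ψ x) : sInt σ φ = sInt σ ψ := by
  obtain ⟨h1, h2⟩ := h.parts hΩ
  unfold sInt
  congr 1
  · apply integral_congr_ae
    have : ∀ᵐ x ∂σ.toJordanDecomposition.posPart, x ∈ Ω := by
      rw [ae_iff]; exact h1
    filter_upwards [this] with x hx using he x hx
  · apply integral_congr_ae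
    have : ∀ᵐ x ∂σ.toJordanDecomposition.negPart, x ∈ Ω := by
      rw [ae_iff]; exact h2
    filter_upwards [this] with x hx using he x hx

lemma Conc.smul {Ω : Set X} {σ : SignedMeasure X} (h : Conc Ω σ) (c : ℝ) : Conc Ω (c • σ) := by
  intro s hs hs'
  rw [smul_apply, h s hs hs', smul_zero]

lemma Conc.add {Ω : Set X} {σ τ : SignedMeasure X} (h : Conc Ω σ) (h' : Conc Ω τ) :
    Conc Ω (σ + τ) := by
  intro s hs hs'
  rw [add_apply, h s hs hs', h' s hs hs', add_zero]

lemma conc_dirac {Ω : Set X} {x : X} (hx : x ∈ Ω) (c : ℝ) :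
    Conc Ω (c • (Measure.dirac x).toSignedMeasure) := by
  intro s hs hs'
  rw [smul_apply, Measure.toSignedMeasure_apply_measurable hs, measureReal_def,
    Measure.dirac_apply' _ hs]
  have : x ∉ s := fun h => hs' h hx
  simp [this]

lemma sInt_dirac [MeasurableSingletonClass X] (c : ℝ) (x : X) (φ : X → ℝ) :
    sInt (c • (Measure.dirac x).toSignedMeasure) φ = c * φ x := by
  rw [sInt_congr_on (measurableSet_singleton x) (conc_dirac (mem_singleton x) c)
    (ψ := fun _ => φ x) (by rintro y rfl; rfl), sInt_smul _ (BM.const _),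
    sInt_toSigned (BM.const _)]
  simp

lemma tv_le_of_eq {σ : SignedMeasure X} {μ₁ μ₂ : Measure X} [IsFiniteMeasure μ₁]
    [IsFiniteMeasure μ₂] (hσ : σ = μ₁.toSignedMeasure - μ₂.toSignedMeasure) :
    σ.totalVariation univ ≤ μ₁ univ + μ₂ univ := by
  obtain ⟨i, hi1, hi2, hi3, hp, hn⟩ := σ.toJordanDecomposition_spec
  unfold SignedMeasure.totalVariation
  rw [Measure.add_apply, hp, hn, SignedMeasure.toMeasureOfZeroLE_apply _ _ _ MeasurableSet.univ,
    SignedMeasure.toMeasureOfLEZero_apply _ _ _ MeasurableSet.univ]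
  have e1 : σ (i ∩ univ) = μ₁.real i - μ₂.real i := by
    rw [inter_univ, hσ, sub_apply, Measure.toSignedMeasure_apply_measurable hi1,
      Measure.toSignedMeasure_apply_measurable hi1]
  have e2 : σ (iᶜ ∩ univ) = μ₁.real iᶜ - μ₂.real iᶜ := by
    rw [inter_univ, hσ, sub_apply,
      Measure.toSignedMeasure_apply_measurable hi1.compl,
      Measure.toSignedMeasure_apply_measurable hi1.compl]
  refine add_le_add ?_ ?_
  · rw [ENNReal.coe_nnreal_eq, ← ofReal_measureReal (μ := μ₁)]
    apply ENNReal.ofReal_le_ofReal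
    simp only [NNReal.coe_mk, e1]
    have := measureReal_mono (μ := μ₁) (subset_univ i)
    have := measureReal_nonneg (μ := μ₂) (s := i)
    linarith
  · rw [ENNReal.coe_nnreal_eq, ← ofReal_measureReal (μ := μ₂)]
    apply ENNReal.ofReal_le_ofReal
    simp only [NNReal.coe_mk, e2]
    have := measureReal_mono (μ := μ₂) (subset_univ iᶜ)
    have := measureReal_nonneg (μ := μ₁) (s := iᶜ)
    linarith

lemma abs_le_tv (σ : SignedMeasure X) {φ : X → ℝ} {c : ℝ} (hb : ∀ x, |φ x| ≤ c) :
    ENNReal.ofReal |sInt σ φ| ≤ ENNReal.ofReal c * σ.totalVariation univ := by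
  have hp : |∫ x, φ x ∂σ.toJordanDecomposition.posPart| ≤
      c * σ.toJordanDecomposition.posPart.real univ :=
    by simpa using norm_integral_le_of_norm_le_const (f := φ) (C := c) (Eventually.of_forall hb)
  have hn : |∫ x, φ x ∂σ.toJordanDecomposition.negPart| ≤
      c * σ.toJordanDecomposition.negPart.real univ :=
    by simpa using norm_integral_le_of_norm_le_const (f := φ) (C := c) (Eventually.of_forall hb)
  unfold SignedMeasure.totalVariation
  rw [Measure.add_apply, ← ofReal_measureReal, ← ofReal_measureReal,
    ← ENNReal.ofReal_add measureReal_nonneg measureReal_nonneg,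
    ← ENNReal.ofReal_mul' (by positivity)]
  apply ENNReal.ofReal_le_ofReal
  unfold sInt
  refine (abs_sub _ _).trans ?_
  linarith

lemma tv_add_le (σ τ : SignedMeasure X) :
    (σ + τ).totalVariation univ ≤ σ.totalVariation univ + τ.totalVariation univ := by
  have h : σ + τ =
      (σ.toJordanDecomposition.posPart + τ.toJordanDecomposition.posPart).toSignedMeasure -
      (σ.toJordanDecomposition.negPart + τ.toJordanDecomposition.negPart).toSignedMeasure := by
    rw [Measure.toSignedMeasure_add, Measure.toSignedMeasure_add]
    nth_rewrite 1 [signed_eq_jordan σ, signed_eq_jordan τ]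
    abel
  refine (tv_le_of_eq h).trans (le_of_eq ?_)
  simp only [SignedMeasure.totalVariation, Measure.add_apply]
  ring

lemma tv_smul_le (σ : SignedMeasure X) (c : ℝ≥0) :
    ((c:ℝ) • σ).totalVariation univ ≤ c * σ.totalVariation univ := by
  have h : (c:ℝ) • σ = (c • σ.toJordanDecomposition.posPart).toSignedMeasure -
      (c • σ.toJordanDecomposition.negPart).toSignedMeasure := by
    rw [Measure.toSignedMeasure_smul, Measure.toSignedMeasure_smul]
    nth_rewrite 1 [signed_eq_jordan σ]
    rw [smul_sub]
    rfl
  refine (tv_le_of_eq h).trans (le_of_eq ?_)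
  simp only [SignedMeasure.totalVariation, Measure.add_apply, Measure.smul_apply, mul_add]
  rfl

lemma tv_toSigned_le (μ : Measure X) [IsFiniteMeasure μ] :
    μ.toSignedMeasure.totalVariation univ ≤ μ univ := by
  have h : μ.toSignedMeasure = μ.toSignedMeasure - (0 : Measure X).toSignedMeasure := by
    simp
  refine (tv_le_of_eq h).trans (by simp)

end SInt

/-! ### Densities -/
section Dens
variable {X : Type*} [MeasurableSpace X]

lemma lintegral_functional_le {E : Type*} [NormedAddCommGroup E] [NormedSpace ℝ E]
    [CompleteSpace E] [MeasurableSpace E] [BorelSpace E] [SecondCountableTopology E]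
    (lam : Measure X) [IsFiniteMeasure lam] {w : X → E} (hw : Measurable w)
    (ℓ : E →L[ℝ] ℝ) {C : ℝ}
    (h : ∀ s, MeasurableSet s → ℓ (∫ x in s, w x ∂lam) ≤ C) :
    ∫⁻ x, ENNReal.ofReal (ℓ (w x)) ∂lam ≤ ENNReal.ofReal C := by
  let s : ℕ → Set X := fun n => {x | ‖w x‖ ≤ n ∧ 0 ≤ ℓ (w x)}
  have hs : ∀ n, MeasurableSet (s n) := fun n =>
    (measurableSet_le hw.norm measurable_const).inter
      (measurableSet_le measurable_const (ℓ.continuous.measurable.comp hw))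
  have hmℓ : Measurable fun x => ENNReal.ofReal (ℓ (w x)) :=
    (ℓ.continuous.measurable.comp hw).ennreal_ofReal
  have hmono : Monotone s := by
    intro m n hmn x hx
    exact ⟨hx.1.trans (by exact_mod_cast hmn), hx.2⟩
  have hlim : Tendsto (fun n => ∫⁻ x, (s n).indicator (fun x => ENNReal.ofReal (ℓ (w x))) x ∂lam)
      atTop (𝓝 (∫⁻ x, ENNReal.ofReal (ℓ (w x)) ∂lam)) := by
    apply lintegral_tendsto_of_tendsto_of_monotone
    · intro n
      exact (hmℓ.indicator (hs n)).aemeasurable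
    · refine Eventually.of_forall fun x m n hmn => ?_
      exact indicator_le_indicator_of_subset (hmono hmn) (fun _ => zero_le) x
    · refine Eventually.of_forall fun x => ?_
      by_cases hx : 0 ≤ ℓ (w x)
      · apply tendsto_const_nhds.congr'
        obtain ⟨N, hN⟩ := exists_nat_ge ‖w x‖
        filter_upwards [eventually_ge_atTop N] with n hn
        rw [indicator_of_mem]
        exact ⟨hN.trans (by exact_mod_cast hn), hx⟩
      · have h0 : ENNReal.ofReal (ℓ (w x)) = 0 := ENNReal.ofReal_of_nonpos (by linarith)
        rw [h0]
        apply tendsto_const_nhds.congr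
        intro n
        by_cases hxs : x ∈ s n <;> simp [hxs, h0]
  refine le_of_tendsto' hlim fun n => ?_
  have hintg : IntegrableOn w (s n) lam := by
    apply Integrable.of_bound hw.aestronglyMeasurable (n:ℝ)
    filter_upwards [ae_restrict_mem (hs n)] with x hx using hx.1
  rw [lintegral_indicator (hs n), ← ofReal_integral_eq_lintegral_ofReal]
  · apply ENNReal.ofReal_le_ofReal
    rw [ContinuousLinearMap.integral_comp_comm ℓ hintg]
    exact h _ (hs n)
  · exact ℓ.integrable_comp hintg
  · filter_upwards [ae_restrict_mem (hs n)] with x hx using hx.2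

lemma integrable_of_setIntegral_bdd (lam : Measure X) [IsFiniteMeasure lam] {w : X → ℝ}
    (hw : Measurable w) {C : ℝ} (h : ∀ s, MeasurableSet s → |∫ x in s, w x ∂lam| ≤ C) :
    Integrable w lam := by
  have h1 := lintegral_functional_le lam hw (ContinuousLinearMap.id ℝ ℝ) (C := C)
    (fun s hs => (le_abs_self _).trans (h s hs))
  have h2 := lintegral_functional_le lam hw (-ContinuousLinearMap.id ℝ ℝ) (C := C)
    (fun s hs => (neg_le_abs _).trans (h s hs))
  refine ⟨hw.aestronglyMeasurable, ?_⟩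
  rw [hasFiniteIntegral_iff_norm]
  have : ∀ x, ENNReal.ofReal ‖w x‖ ≤ ENNReal.ofReal (w x) + ENNReal.ofReal (-w x) := by
    intro x
    rcases le_total 0 (w x) with hx | hx
    · rw [Real.norm_of_nonneg hx]; exact le_self_add
    · rw [Real.norm_of_nonpos hx]; exact le_add_self
  calc ∫⁻ x, ENNReal.ofReal ‖w x‖ ∂lam
      ≤ ∫⁻ x, (ENNReal.ofReal (w x) + ENNReal.ofReal (-w x)) ∂lam := lintegral_mono this
    _ = (∫⁻ x, ENNReal.ofReal (w x) ∂lam) + ∫⁻ x, ENNReal.ofReal (-w x) ∂lam :=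
        lintegral_add_left hw.ennreal_ofReal _
    _ ≤ ENNReal.ofReal C + ENNReal.ofReal C := add_le_add h1 h2
    _ < ⊤ := by simp

lemma integrable_of_setIntegral_bddV (lam : Measure X) [IsFiniteMeasure lam] {w : X → Euc d}
    (hw : Measurable w) {C : Fin d → ℝ}
    (h : ∀ s, MeasurableSet s → ∀ i, |(∫ x in s, w x ∂lam) i| ≤ C i) :
    Integrable w lam := by
  have hi : ∀ i, ∫⁻ x, ENNReal.ofReal |w x i| ∂lam < ⊤ := by
    intro i
    let p : Euc d →L[ℝ] ℝ := EuclideanSpace.proj i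
    have h1 := lintegral_functional_le lam hw p (C := C i)
      (fun s hs => (le_abs_self _).trans (h s hs i))
    have h2 := lintegral_functional_le lam hw (-p) (C := C i)
      (fun s hs => (neg_le_abs _).trans (h s hs i))
    have hwi : Measurable fun x => w x i := p.continuous.measurable.comp hw
    have : ∀ x, ENNReal.ofReal |w x i| ≤ ENNReal.ofReal (w x i) + ENNReal.ofReal (-w x i) := by
      intro x
      rcases le_total 0 (w x i) with hx | hx
      · rw [abs_of_nonneg hx]; exact le_self_add
      · rw [abs_of_nonpos hx]; exact le_add_self
    calc ∫⁻ x, ENNReal.ofReal |w x i| ∂lam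
        ≤ ∫⁻ x, (ENNReal.ofReal (w x i) + ENNReal.ofReal (-w x i)) ∂lam := lintegral_mono this
      _ = (∫⁻ x, ENNReal.ofReal (w x i) ∂lam) + ∫⁻ x, ENNReal.ofReal (-w x i) ∂lam :=
          lintegral_add_left hwi.ennreal_ofReal _
      _ ≤ ENNReal.ofReal (C i) + ENNReal.ofReal (C i) := add_le_add h1 h2
      _ < ⊤ := by simp
  have hintg : ∀ i, Integrable (fun x => w x i) lam := by
    intro i
    refine ⟨((EuclideanSpace.proj (𝕜 := ℝ) i).continuous.measurable.comp hw).aestronglyMeasurable, ?_⟩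
    rw [hasFiniteIntegral_iff_norm]
    exact hi i
  refine (integrable_finsetSum Finset.univ fun i _ => (hintg i).abs).mono'
    hw.aestronglyMeasurable (Eventually.of_forall fun x => ?_)
  rw [EuclideanSpace.norm_eq]
  refine Real.sqrt_le_iff.2 ⟨Finset.sum_nonneg fun i _ => abs_nonneg _, ?_⟩
  calc ∑ i, ‖w x i‖ ^ 2 = ∑ i, |w x i| * |w x i| := by
        refine Finset.sum_congr rfl fun i _ => ?_
        rw [Real.norm_eq_abs, sq]
    _ ≤ ∑ i, |w x i| * ∑ j, |w x j| := by
        refine Finset.sum_le_sum fun i _ => ?_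
        exact mul_le_mul_of_nonneg_left
          (Finset.single_le_sum (f := fun j => |w x j|) (fun j _ => abs_nonneg _) (Finset.mem_univ i))
          (abs_nonneg _)
    _ = (∑ i, |w x i|) ^ 2 := by rw [← Finset.sum_mul, sq]

lemma signed_abs_le (σ : SignedMeasure X) {s : Set X} (hs : MeasurableSet s) :
    |σ s| ≤ (σ.totalVariation univ).toReal := by
  have h := abs_le_tv σ (φ := s.indicator fun _ => (1:ℝ)) (c := 1)
    (fun x => by by_cases hx : x ∈ s <;> simp [hx])
  rw [sInt_indicator hs, ENNReal.ofReal_one, one_mul] at h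
  have hfin : σ.totalVariation univ ≠ ⊤ := by
    unfold SignedMeasure.totalVariation
    exact measure_ne_top _ _
  rw [← ENNReal.ofReal_le_iff_le_toReal hfin]
  exact h

/-- bounded coordinates of vector measures -/
lemma vector_coord_bdd (m : VectorMeasure X (Euc d)) (i : Fin d) :
    ∃ C : ℝ, ∀ s, MeasurableSet s → |m s i| ≤ C := by
  let p : Euc d →L[ℝ] ℝ := EuclideanSpace.proj i
  let σ : SignedMeasure X := m.mapRange p.toLinearMap.toAddMonoidHom p.continuous
  exact ⟨_, fun s hs => signed_abs_le σ hs⟩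

/-- set-integral identity implies integral identity against bounded functions -/
lemma integral_mul_eq_of_setIntegral {lam₁ lam₂ : Measure X} {w₁ w₂ : X → ℝ}
    (h1 : Integrable w₁ lam₁) (h2 : Integrable w₂ lam₂)
    (h : ∀ s, MeasurableSet s → ∫ x in s, w₁ x ∂lam₁ = ∫ x in s, w₂ x ∂lam₂)
    {ψ : X → ℝ} (hψ : BM ψ) : ∫ x, ψ x * w₁ x ∂lam₁ = ∫ x, ψ x * w₂ x ∂lam₂ := by
  have key : ∀ (lam : Measure X) (w : X → ℝ), Integrable w lam →
      ∫ x, ψ x * w x ∂lam = sInt (lam.withDensityᵥ w) ψ := by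
    intro lam w hw
    have := isFiniteMeasure_withDensity_ofReal hw.2
    have := isFiniteMeasure_withDensity_ofReal hw.neg.2
    have hneg : (fun x => ENNReal.ofReal (-w x)) = fun x => ENNReal.ofReal ((-w) x) := rfl
    rw [sInt_eq (μ₁ := lam.withDensity fun x => ENNReal.ofReal (w x))
      (μ₂ := lam.withDensity fun x => ENNReal.ofReal ((-w) x))
      (withDensityᵥ_eq_withDensity_pos_part_sub_withDensity_neg_part hw) hψ]
    rw [integral_withDensity_eq_integral_toReal_smul₀ (hw.aemeasurable.ennreal_ofReal)
      (Eventually.of_forall fun x => ENNReal.ofReal_lt_top),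
      integral_withDensity_eq_integral_toReal_smul₀ (hw.neg.aemeasurable.ennreal_ofReal)
      (Eventually.of_forall fun x => ENNReal.ofReal_lt_top), ← integral_sub]
    · apply integral_congr_ae
      refine Eventually.of_forall fun x => ?_
      simp only [smul_eq_mul, ENNReal.toReal_ofReal', Pi.neg_apply]
      rcases le_total 0 (w x) with hx | hx
      · rw [max_eq_left hx, max_eq_right (by linarith)]; ring
      · rw [max_eq_right hx, max_eq_left (by linarith)]; ring
    · obtain ⟨hm, C, hC⟩ := hψ
      have := hw.pos_part.mul_bdd (g := ψ) (c := C) hm.aestronglyMeasurable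
        (Eventually.of_forall hC)
      simpa [ENNReal.toReal_ofReal'] using this
    · obtain ⟨hm, C, hC⟩ := hψ
      have := hw.neg_part.mul_bdd (g := ψ) (c := C) hm.aestronglyMeasurable
        (Eventually.of_forall hC)
      simpa [ENNReal.toReal_ofReal'] using this
  rw [key _ _ h1, key _ _ h2]
  congr 1
  ext s hs
  rw [withDensityᵥ_apply h1 hs, withDensityᵥ_apply h2 hs, h s hs]

end Dens

lemma IsDensityS.integrable {σ : SignedMeasure (XX d)} {lam : Measure (XX d)}
    [IsFiniteMeasure lam] {u : XX d → ℝ} (hu : Measurable u) (h : IsDensityS σ lam u) :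
    Integrable u lam :=
  integrable_of_setIntegral_bdd lam hu fun s hs => by
    rw [← h s hs]; exact signed_abs_le σ hs

lemma IsDensityV.integrable {m : VectorMeasure (XX d) (Euc d)} {lam : Measure (XX d)}
    [IsFiniteMeasure lam] {w : XX d → Euc d} (hw : Measurable w) (h : IsDensityV m lam w) :
    Integrable w lam := by
  choose C hC using vector_coord_bdd m
  exact integrable_of_setIntegral_bddV lam hw (C := C) fun s hs i => by
    rw [← h s hs]; exact hC i s hs

lemma IsDensityS.unique {σ : SignedMeasure (XX d)} {lam₁ lam₂ : Measure (XX d)}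
    [IsFiniteMeasure lam₁] [IsFiniteMeasure lam₂] {u₁ u₂ : XX d → ℝ}
    (hu₁ : Measurable u₁) (hu₂ : Measurable u₂)
    (h₁ : IsDensityS σ lam₁ u₁) (h₂ : IsDensityS σ lam₂ u₂) {ψ : XX d → ℝ} (hψ : BM ψ) :
    ∫ x, ψ x * u₁ x ∂lam₁ = ∫ x, ψ x * u₂ x ∂lam₂ :=
  integral_mul_eq_of_setIntegral (h₁.integrable hu₁) (h₂.integrable hu₂)
    (fun s hs => (h₁ s hs).symm.trans (h₂ s hs)) hψ

lemma euc_sum_single (v : Euc d) : v = ∑ i, v i • EuclideanSpace.single i (1:ℝ) := by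
  ext j
  simp [Pi.single_apply]

lemma clm_coord (ℓ : XX d →L[ℝ] ℝ) (v : Euc d) :
    ℓ ((0:ℝ), v) = ∑ i, ℓ ((0:ℝ), EuclideanSpace.single i (1:ℝ)) * v i := by
  have h : ((0:ℝ), v) = ∑ i, v i • ((0:ℝ), EuclideanSpace.single i (1:ℝ)) := by
    refine Prod.ext ?_ ?_
    · rw [Prod.fst_sum]; simp
    · rw [Prod.snd_sum]; exact euc_sum_single v
  rw [h, map_sum]
  refine Finset.sum_congr rfl fun i _ => ?_
  rw [map_smul, smul_eq_mul, mul_comm]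

lemma IsDensityV.unique {m : VectorMeasure (XX d) (Euc d)} {lam₁ lam₂ : Measure (XX d)}
    [IsFiniteMeasure lam₁] [IsFiniteMeasure lam₂] {w₁ w₂ : XX d → Euc d}
    (hw₁ : Measurable w₁) (hw₂ : Measurable w₂)
    (h₁ : IsDensityV m lam₁ w₁) (h₂ : IsDensityV m lam₂ w₂) {ℓ : XX d → XX d →L[ℝ] ℝ}
    (hℓ : Continuous ℓ) {C : ℝ} (hC : ∀ x, ‖ℓ x‖ ≤ C) :
    ∫ x, ℓ x ((0:ℝ), w₁ x) ∂lam₁ = ∫ x, ℓ x ((0:ℝ), w₂ x) ∂lam₂ := by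
  have hbm : ∀ i : Fin d, BM fun x => ℓ x ((0:ℝ), EuclideanSpace.single i (1:ℝ)) := by
    intro i
    refine ⟨(hℓ.clm_apply continuous_const).measurable, C * ‖((0:ℝ), EuclideanSpace.single i (1:ℝ))‖, fun x => ?_⟩
    exact ((ℓ x).le_opNorm _).trans (mul_le_mul_of_nonneg_right (hC x) (norm_nonneg _))
  have hcoord : ∀ (lam : Measure (XX d)) [IsFiniteMeasure lam] (w : XX d → Euc d),
      Measurable w → IsDensityV m lam w → ∀ i : Fin d, Integrable (fun x => w x i) lam :=
    fun lam _ w hw h i => (EuclideanSpace.proj (𝕜 := ℝ) i).integrable_comp (h.integrable hw)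
  have hexp : ∀ (lam : Measure (XX d)) [IsFiniteMeasure lam] (w : XX d → Euc d),
      Measurable w → IsDensityV m lam w → ∫ x, ℓ x ((0:ℝ), w x) ∂lam =
      ∑ i, ∫ x, ℓ x ((0:ℝ), EuclideanSpace.single i (1:ℝ)) * w x i ∂lam := by
    intro lam _ w hw h
    simp_rw [clm_coord (ℓ _) (w _)]
    rw [integral_finsetSum]
    intro i _
    obtain ⟨hm, C', hC'⟩ := hbm i
    exact (hcoord lam w hw h i).bdd_mul (c := C') hm.aestronglyMeasurable (Eventually.of_forall hC')
  rw [hexp lam₁ w₁ hw₁ h₁, hexp lam₂ w₂ hw₂ h₂]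
  refine Finset.sum_congr rfl fun i _ => ?_
  refine integral_mul_eq_of_setIntegral (hcoord _ _ hw₁ h₁ i) (hcoord _ _ hw₂ h₂ i) ?_ (hbm i)
  intro s hs
  have e1 := (EuclideanSpace.proj (𝕜 := ℝ) i).integral_comp_comm (h₁.integrable hw₁).integrableOn (μ := lam₁.restrict s)
  have e2 := (EuclideanSpace.proj (𝕜 := ℝ) i).integral_comp_comm (h₂.integrable hw₂).integrableOn (μ := lam₂.restrict s)
  rw [← h₁ s hs] at e1
  rw [← h₂ s hs] at e2
  exact e1.trans e2.symm

/-! ### Narrowly continuous curves -/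

lemma clamp_mem (t : ℝ) : clamp t ∈ Icc (0:ℝ) 1 :=
  ⟨le_max_left _ _, max_le zero_le_one (min_le_left _ _)⟩

lemma clamp_of_mem {t : ℝ} (ht : t ∈ Icc (0:ℝ) 1) : clamp t = t := by
  unfold clamp
  rw [min_eq_right ht.2, max_eq_right ht.1]

lemma clamp_clamp (t : ℝ) : clamp (clamp t) = clamp t := clamp_of_mem (clamp_mem t)

lemma continuous_clamp : Continuous clamp := by
  unfold clamp; fun_prop

lemma exists_bdd_cont {Ω : Set (Euc d)} (hΩ : IsCompact Ω) {φ : Euc d → ℝ} (hφ : Continuous φ) :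
    ∃ ψ : Euc d → ℝ, Continuous ψ ∧ BM ψ ∧ ∀ x ∈ Ω, φ x = ψ x := by
  obtain ⟨C, hC⟩ := hΩ.exists_bound_of_continuousOn hφ.continuousOn
  have hψ : Continuous fun x => max (-|C|) (min |C| (φ x)) := by fun_prop
  refine ⟨fun x => max (-|C|) (min |C| (φ x)), hψ, ⟨hψ.measurable, |C|, fun x => ?_⟩, fun x hx => ?_⟩
  · rw [abs_le]
    exact ⟨le_max_left _ _, max_le (by linarith [abs_nonneg C]) (min_le_left _ _)⟩
  · have h1 : |φ x| ≤ |C| := (hC x hx).trans (le_abs_self C)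
    rw [abs_le] at h1
    simp only
    rw [min_eq_right h1.2, max_eq_right h1.1]

section Cw
variable {Ω : Set (Euc d)}

lemma sInt_add_cont (hΩ : IsCompact Ω) {σ τ : SignedMeasure (Euc d)} (hσ : Conc Ω σ) (hτ : Conc Ω τ)
    {φ : Euc d → ℝ} (hφ : Continuous φ) : sInt (σ + τ) φ = sInt σ φ + sInt τ φ := by
  obtain ⟨ψ, _, hb, he⟩ := exists_bdd_cont hΩ hφ
  rw [sInt_congr_on hΩ.measurableSet (hσ.add hτ) he, sInt_congr_on hΩ.measurableSet hσ he,
    sInt_congr_on hΩ.measurableSet hτ he, sInt_add hb]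

lemma sInt_smul_cont (hΩ : IsCompact Ω) {σ : SignedMeasure (Euc d)} (hσ : Conc Ω σ) (c : ℝ)
    {φ : Euc d → ℝ} (hφ : Continuous φ) : sInt (c • σ) φ = c * sInt σ φ := by
  obtain ⟨ψ, _, hb, he⟩ := exists_bdd_cont hΩ hφ
  rw [sInt_congr_on hΩ.measurableSet (hσ.smul c) he, sInt_congr_on hΩ.measurableSet hσ he,
    sInt_smul c hb]

lemma cw_add (hΩ : IsCompact Ω) {f g : ℝ → SignedMeasure (Euc d)} (hf : IsCwCurve Ω f) (hg : IsCwCurve Ω g) :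
    IsCwCurve Ω (f + g) := by
  refine ⟨fun t => ?_, fun t => Conc.add (hf.2.1 t) (hg.2.1 t), fun φ hφ => ?_⟩
  · rw [Pi.add_apply, Pi.add_apply, hf.1 t, hg.1 t]
  · simp_rw [Pi.add_apply]
    simp_rw [fun t => sInt_add_cont hΩ (hf.2.1 t) (hg.2.1 t) hφ]
    exact (hf.2.2 φ hφ).add (hg.2.2 φ hφ)

lemma cw_smul (hΩ : IsCompact Ω) {f : ℝ → SignedMeasure (Euc d)} (hf : IsCwCurve Ω f) (c : ℝ) :
    IsCwCurve Ω (c • f) := by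
  refine ⟨fun t => ?_, fun t => Conc.smul (hf.2.1 t) c, fun φ hφ => ?_⟩
  · rw [Pi.smul_apply, Pi.smul_apply, hf.1 t]
  · simp_rw [Pi.smul_apply]
    simp_rw [fun t => sInt_smul_cont hΩ (hf.2.1 t) c hφ]
    exact continuous_const.mul (hf.2.2 φ hφ)

lemma cw_zero : IsCwCurve Ω (0 : ℝ → SignedMeasure (Euc d)) := by
  refine ⟨fun t => rfl, fun t s hs hs' => rfl, fun φ hφ => ?_⟩
  have : ∀ t : ℝ, sInt ((0 : ℝ → SignedMeasure (Euc d)) t) φ = 0 := by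
    intro t
    have h := sInt_dirac (0:ℝ) (0 : Euc d) φ
    rwa [zero_smul, zero_mul] at h
  simp_rw [this]
  exact continuous_const

lemma cw_sum (hΩ : IsCompact Ω) {ι : Type*} (s : Finset ι) {f : ι → ℝ → SignedMeasure (Euc d)}
    (hf : ∀ i ∈ s, IsCwCurve Ω (f i)) : IsCwCurve Ω (∑ i ∈ s, f i) := by
  classical
  induction s using Finset.induction_on with
  | empty => simpa using cw_zero
  | insert a s ha ih =>
    rw [Finset.sum_insert ha]
    exact cw_add hΩ (hf a (by simp)) (ih fun i hi => hf i (by simp [hi]))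

lemma cw_dirac {h : ℝ → ℝ} {γ : ℝ → Euc d} (hγ : ∀ t ∈ Icc (0:ℝ) 1, γ t ∈ Ω)
    (hc : ∀ φ : Euc d → ℝ, Continuous φ →
        ContinuousOn (fun t => h t * φ (γ t)) (Icc (0:ℝ) 1)) :
    IsCwCurve Ω (fun t => h (clamp t) • (Measure.dirac (γ (clamp t))).toSignedMeasure) := by
  refine ⟨fun t => ?_, fun t => conc_dirac (hγ _ (clamp_mem t)) _, fun φ hφ => ?_⟩
  · simp only [clamp_clamp]
  · simp_rw [sInt_dirac]
    exact (hc φ hφ).comp_continuous continuous_clamp clamp_mem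

lemma cw_const_dirac {a : ℝ → ℝ} (ha : Continuous a) {x : Euc d} (hx : x ∈ Ω) :
    IsCwCurve Ω (fun t => a (clamp t) • (Measure.dirac x).toSignedMeasure) :=
  cw_dirac (h := a) (γ := fun _ => x) (fun _ _ => hx)
    (fun _ _ => (ha.mul continuous_const).continuousOn)

/-- A uniform bound, via Banach-Steinhaus. -/
lemma cw_bdd (hΩ : IsCompact Ω) {f : ℝ → SignedMeasure (Euc d)} (hf : IsCwCurve Ω f) :
    ∃ C : ℝ, 0 ≤ C ∧ ∀ t, ∀ φ : Euc d → ℝ, Continuous φ → ∀ c, (∀ x ∈ Ω, |φ x| ≤ c) → 0 ≤ c →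
      |sInt (f t) φ| ≤ C * c := by
  let g : ℝ → (BoundedContinuousFunction (Euc d) ℝ) →L[ℝ] ℝ := fun t =>
    LinearMap.mkContinuous
      { toFun := fun φ => sInt (f t) φ
        map_add' := fun φ ψ => sInt_add_fun ⟨φ.continuous.measurable, ‖φ‖, φ.norm_coe_le_norm⟩
          ⟨ψ.continuous.measurable, ‖ψ‖, ψ.norm_coe_le_norm⟩
        map_smul' := fun c φ => sInt_const_mul c φ }
      ((f t).totalVariation univ).toReal
      (by
        intro φ
        have h := abs_le_tv (f t) (φ := φ) (c := ‖φ‖) φ.norm_coe_le_norm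
        have hfin : (f t).totalVariation univ ≠ ⊤ := by
          unfold SignedMeasure.totalVariation
          exact measure_ne_top _ _
        have h2 := ENNReal.toReal_mono (ENNReal.mul_ne_top ENNReal.ofReal_ne_top hfin) h
        rw [ENNReal.toReal_ofReal (abs_nonneg _), ENNReal.toReal_mul,
          ENNReal.toReal_ofReal (norm_nonneg _)] at h2
        rw [mul_comm]
        exact h2)
  have hg : ∀ t φ, g t φ = sInt (f t) φ := fun t φ => rfl
  obtain ⟨C, hC⟩ := banach_steinhaus (g := g) (by
    intro φ
    obtain ⟨C, hC⟩ := (isCompact_Icc (a := (0:ℝ)) (b := 1)).exists_bound_of_continuousOn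
      (hf.2.2 φ φ.continuous).continuousOn
    refine ⟨C, fun t => ?_⟩
    rw [hg, hf.1 t]
    exact hC _ (clamp_mem t))
  refine ⟨max C 0, le_max_right _ _, fun t φ hφ c hc hc0 => ?_⟩
  have hψ : Continuous fun x => max (-c) (min c (φ x)) := by fun_prop
  have hb : ∀ x, ‖max (-c) (min c (φ x))‖ ≤ c := by
    intro x
    rw [Real.norm_eq_abs, abs_le]
    exact ⟨le_max_left _ _, max_le (by linarith) (min_le_left _ _)⟩
  let ψ : BoundedContinuousFunction (Euc d) ℝ := BoundedContinuousFunction.ofNormedAddCommGroup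
    _ hψ c hb
  have he : ∀ x ∈ Ω, φ x = ψ x := by
    intro x hx
    have h1 := hc x hx
    rw [abs_le] at h1
    change φ x = max (-c) (min c (φ x))
    rw [min_eq_right h1.2, max_eq_right h1.1]
  rw [sInt_congr_on hΩ.measurableSet (hf.2.1 t) he, ← hg, ← Real.norm_eq_abs]
  refine ((g t).le_opNorm ψ).trans ?_
  refine mul_le_mul ((hC t).trans (le_max_left _ _)) ?_ (norm_nonneg _) (le_max_right _ _)
  exact BoundedContinuousFunction.norm_ofNormedAddCommGroup_le hψ hc0 hb

/-! ### measurability of slices -/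

lemma measurable_of_closed {f : ℝ → SignedMeasure (Euc d)} (hf : IsCwCurve Ω f)
    {A : Set (Euc d)} (hA : MeasurableSet A) : Measurable fun t => f t A := by
  have huniv : Measurable fun t => f t univ := by
    have h := (hf.2.2 (fun _ => (1:ℝ)) continuous_const).measurable
    have e : ∀ t, sInt (f t) (fun _ => (1:ℝ)) = f t univ := by
      intro t
      rw [← sInt_indicator MeasurableSet.univ, indicator_univ]
    simpa only [e] using h
  induction A, hA using MeasurableSpace.induction_on_inter
    (borel_eq_generateFrom_isClosed (α := Euc d) ▸ BorelSpace.measurable_eq (α := Euc d))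
    isPiSystem_isClosed with
  | empty => simp
  | basic F hF =>
    have hF' : IsClosed F := hF
    let δ : ℕ → ℝ := fun n => 1 / ((n:ℝ) + 1)
    have hδ : ∀ n, 0 < δ n := fun n => by positivity
    let φ : ℕ → Euc d → ℝ := fun n x => (thickenedIndicator (hδ n) F x : ℝ)
    have hφc : ∀ n, Continuous (φ n) := fun n =>
      NNReal.continuous_coe.comp (thickenedIndicator (hδ n) F).continuous
    have hφb : ∀ n x, ‖φ n x‖ ≤ 1 := by
      intro n x
      have := thickenedIndicator_le_one (hδ n) F x
      rw [Real.norm_of_nonneg (NNReal.coe_nonneg _)]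
      exact_mod_cast this
    have hlim : ∀ x, Tendsto (fun n => φ n x) atTop (𝓝 (F.indicator (fun _ => (1:ℝ)) x)) := by
      intro x
      have h := thickenedIndicator_tendsto_indicator_closure hδ
        (tendsto_one_div_add_atTop_nhds_zero_nat (𝕜 := ℝ)) F
      rw [tendsto_pi_nhds] at h
      have h2 := (NNReal.continuous_coe.tendsto _).comp (h x)
      rw [hF'.closure_eq] at h2
      have e : ((F.indicator (fun _ => (1:ℝ≥0)) x : ℝ≥0) : ℝ) = F.indicator (fun _ => (1:ℝ)) x := by
        by_cases hx : x ∈ F <;> simp [hx]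
      rw [← e]
      exact h2
    apply measurable_of_tendsto_metrizable (f := fun n t => sInt (f t) (φ n))
      (fun n => (hf.2.2 (φ n) (hφc n)).measurable)
    rw [tendsto_pi_nhds]
    intro t
    rw [← sInt_indicator hF'.measurableSet]
    unfold sInt
    apply Tendsto.sub
    · exact tendsto_integral_of_dominated_convergence (fun _ => 1)
        (fun n => (hφc n).aestronglyMeasurable) (integrable_const _)
        (fun n => Eventually.of_forall (hφb n)) (Eventually.of_forall hlim)
    · exact tendsto_integral_of_dominated_convergence (fun _ => 1)
        (fun n => (hφc n).aestronglyMeasurable) (integrable_const _)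
        (fun n => Eventually.of_forall (hφb n)) (Eventually.of_forall hlim)
  | compl A hA ih =>
    have : ∀ t, f t Aᶜ = f t univ - f t A := by
      intro t
      have := (f t).of_add_of_sdiff (A := A) (B := univ) hA MeasurableSet.univ (subset_univ _)
      rw [← compl_eq_univ_sdiff] at this
      linarith
    simp_rw [this]
    exact huniv.sub ih
  | iUnion A hd hA ih =>
    apply measurable_of_tendsto_metrizable
      (f := fun n t => ∑ i ∈ Finset.range n, f t (A i))
      (fun n => Finset.measurable_sum _ fun i _ => ih i)
    rw [tendsto_pi_nhds]
    intro t
    exact ((f t).m_iUnion hA hd).tendsto_sum_nat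

lemma measurable_slice {f : ℝ → SignedMeasure (Euc d)} (hf : IsCwCurve Ω f)
    {s : Set (XX d)} (hs : MeasurableSet s) : Measurable fun t => f t {x | (t, x) ∈ s} := by
  have hms : ∀ (t : ℝ) {s : Set (XX d)}, MeasurableSet s → MeasurableSet {x : Euc d | (t, x) ∈ s} :=
    fun t s hs => measurable_prodMk_left hs
  induction s, hs using MeasurableSpace.induction_on_inter
    (generateFrom_prod (α := ℝ) (β := Euc d)).symm isPiSystem_prod with
  | empty => simp
  | basic s hs =>
    obtain ⟨A, hA, B, hB, rfl⟩ := hs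
    have : ∀ t, f t {x | (t, x) ∈ A ×ˢ B} = A.indicator (fun t => f t B) t := by
      intro t
      by_cases ht : t ∈ A <;> simp [ht]
    simp_rw [this]
    exact (measurable_of_closed hf hB).indicator hA
  | compl s hs ih =>
    have : ∀ t, f t {x | (t, x) ∈ sᶜ} = f t univ - f t {x | (t, x) ∈ s} := by
      intro t
      have := (f t).of_add_of_sdiff (A := {x | (t, x) ∈ s}) (B := univ) (hms t hs)
        MeasurableSet.univ (subset_univ _)
      rw [← compl_eq_univ_sdiff] at this
      have e : {x | (t, x) ∈ s}ᶜ = {x | (t, x) ∈ sᶜ} := rfl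
      rw [e] at this
      linarith
    simp_rw [this]
    exact (measurable_of_closed hf MeasurableSet.univ).sub ih
  | iUnion A hd hA ih =>
    apply measurable_of_tendsto_metrizable
      (f := fun n t => ∑ i ∈ Finset.range n, f t {x | (t, x) ∈ A i})
      (fun n => Finset.measurable_sum _ fun i _ => ih i)
    rw [tendsto_pi_nhds]
    intro t
    have e : {x | (t, x) ∈ ⋃ i, A i} = ⋃ i, {x | (t, x) ∈ A i} := by
      ext x; simp
    rw [e]
    refine ((f t).m_iUnion (fun i => hms t (hA i)) ?_).tendsto_sum_nat
    intro i j hij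
    have := hd hij
    rw [Function.onFun, Set.disjoint_left] at this ⊢
    intro x hx hx'
    exact this hx hx'

end Cw

/-! ### The integral identity for curve densities -/

lemma simple_approx {X : Type*} [MeasurableSpace X] {ψ : X → ℝ} (hψ : BM ψ) {ε : ℝ} (hε : 0 < ε) :
    ∃ (s : Finset ℤ) (A : ℤ → Set X) (c : ℤ → ℝ), (∀ k, MeasurableSet (A k)) ∧
      ∀ x, |ψ x - ∑ k ∈ s, c k * (A k).indicator (fun _ => (1:ℝ)) x| ≤ ε := by
  obtain ⟨hm, C, hC⟩ := hψ
  have hmf : Measurable fun x => ⌊ψ x / ε⌋ := Int.measurable_floor.comp (hm.div_const ε)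
  refine ⟨Finset.Icc ⌊-C / ε⌋ ⌊C / ε⌋, fun k => {x | ⌊ψ x / ε⌋ = k}, fun k => ε * k,
    fun k => hmf (measurableSet_singleton k), fun x => ?_⟩
  have hx := abs_le.1 (hC x)
  have hmem : ⌊ψ x / ε⌋ ∈ Finset.Icc ⌊-C / ε⌋ ⌊C / ε⌋ := by
    rw [Finset.mem_Icc]
    exact ⟨Int.floor_le_floor (div_le_div_of_nonneg_right hx.1 hε.le),
      Int.floor_le_floor (div_le_div_of_nonneg_right hx.2 hε.le)⟩
  rw [Finset.sum_eq_single_of_mem _ hmem]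
  · rw [indicator_of_mem (by simp)]
    have h1 := Int.floor_le (ψ x / ε)
    have h2 := Int.lt_floor_add_one (ψ x / ε)
    rw [le_div_iff₀ hε] at h1
    rw [div_lt_iff₀ hε] at h2
    rw [abs_le]
    constructor <;> nlinarith
  · intro k _ hk
    rw [indicator_of_notMem (by simpa using fun h => hk h.symm), mul_zero]

lemma BM.slice {ψ : XX d → ℝ} (hψ : BM ψ) (t : ℝ) : BM fun x => ψ (t, x) := by
  obtain ⟨hm, C, hC⟩ := hψ
  exact ⟨hm.comp measurable_prodMk_left, C, fun x => hC _⟩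

lemma bm_simple {X : Type*} [MeasurableSpace X] (s : Finset ℤ) (A : ℤ → Set X) (c : ℤ → ℝ)
    (hA : ∀ k, MeasurableSet (A k)) :
    BM fun x => ∑ k ∈ s, c k * (A k).indicator (fun _ => (1:ℝ)) x :=
  BM.sum s fun k _ => (BM.const (c k)).mul (BM.indicator (hA k))

lemma sInt_sub_fun {X : Type*} [MeasurableSpace X] {σ : SignedMeasure X} {φ ψ : X → ℝ}
    (hφ : BM φ) (hψ : BM ψ) : sInt σ (fun x => φ x - ψ x) = sInt σ φ - sInt σ ψ := by
  unfold sInt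
  rw [integral_sub (hφ.integrable _) (hψ.integrable _),
    integral_sub (hφ.integrable _) (hψ.integrable _)]
  ring

section
variable {Ω : Set (Euc d)} {f : ℝ → SignedMeasure (Euc d)}

lemma sInt_simple_slice (s : Finset ℤ) (A : ℤ → Set (XX d)) (c : ℤ → ℝ)
    (hA : ∀ k, MeasurableSet (A k)) (t : ℝ) :
    sInt (f t) (fun x => ∑ k ∈ s, c k * (A k).indicator (fun _ => (1:ℝ)) (t, x)) =
      ∑ k ∈ s, c k * f t {x | (t, x) ∈ A k} := by
  have hms : ∀ k, MeasurableSet {x : Euc d | (t, x) ∈ A k} :=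
    fun k => measurable_prodMk_left (hA k)
  have e : ∀ k x, (A k).indicator (fun _ => (1:ℝ)) (t, x) =
      {x : Euc d | (t, x) ∈ A k}.indicator (fun _ => (1:ℝ)) x := fun k x => rfl
  simp_rw [e]
  rw [sInt_sum_fun s fun k _ => (BM.const (c k)).mul (BM.indicator (hms k))]
  refine Finset.sum_congr rfl fun k _ => ?_
  rw [sInt_const_mul, sInt_indicator (hms k)]

lemma measurable_sInt_slice (hf : IsCwCurve Ω f) {ψ : XX d → ℝ} (hψ : BM ψ) :
    Measurable fun t => sInt (f t) (fun x => ψ (t, x)) := by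
  have hpos : ∀ n : ℕ, (0:ℝ) < 1 / ((n:ℝ) + 1) := fun n => by positivity
  choose s A c hA hb using fun n : ℕ => simple_approx hψ (hpos n)
  apply measurable_of_tendsto_metrizable
    (f := fun n t => ∑ k ∈ s n, c n k * f t {x | (t, x) ∈ A n k})
    (fun n => Finset.measurable_sum _ fun k _ => (measurable_slice hf (hA n k)).const_mul _)
  rw [tendsto_pi_nhds]
  intro t
  rw [tendsto_iff_dist_tendsto_zero]
  have hfin : (f t).totalVariation univ ≠ ⊤ := by
    unfold SignedMeasure.totalVariation
    exact measure_ne_top _ _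
  refine squeeze_zero (fun _ => dist_nonneg)
    (g := fun n : ℕ => 1 / ((n:ℝ) + 1) * ((f t).totalVariation univ).toReal) (fun n => ?_) ?_
  · rw [dist_comm, Real.dist_eq, ← sInt_simple_slice (s n) (A n) (c n) (hA n) t,
      ← sInt_sub_fun (hψ.slice t) ((bm_simple (s n) (A n) (c n) (hA n)).slice t)]
    have h := abs_le_tv (f t) (φ := fun x => ψ (t, x) -
      ∑ k ∈ s n, c n k * (A n k).indicator (fun _ => (1:ℝ)) (t, x)) (fun x => hb n (t, x))
    have h2 := ENNReal.toReal_mono (ENNReal.mul_ne_top ENNReal.ofReal_ne_top hfin) h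
    rwa [ENNReal.toReal_ofReal (abs_nonneg _), ENNReal.toReal_mul,
      ENNReal.toReal_ofReal (hpos n).le] at h2
  · have := (tendsto_one_div_add_atTop_nhds_zero_nat (𝕜 := ℝ)).mul_const
      ((f t).totalVariation univ).toReal
    simpa using this

lemma lintegral_sInt_slice_le {ψ : XX d → ℝ} {c : ℝ} (hc : ∀ x, |ψ x| ≤ c) :
    ∫⁻ t in Ioo (0:ℝ) 1, ENNReal.ofReal ‖sInt (f t) (fun x => ψ (t, x))‖ ≤
      ENNReal.ofReal c * TVCw f := by
  unfold TVCw
  rw [← lintegral_const_mul' _ _ ENNReal.ofReal_ne_top]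
  exact lintegral_mono fun t => abs_le_tv (f t) fun x => hc (t, x)

lemma integrable_sInt_slice (hf : IsCwCurve Ω f) (hTV : TVCw f ≠ ⊤) {ψ : XX d → ℝ} (hψ : BM ψ) :
    IntegrableOn (fun t => sInt (f t) (fun x => ψ (t, x))) (Ioo (0:ℝ) 1) := by
  obtain ⟨C, hC⟩ := hψ.2
  refine ⟨(measurable_sInt_slice hf hψ).aestronglyMeasurable, ?_⟩
  rw [hasFiniteIntegral_iff_norm]
  exact (lintegral_sInt_slice_le hC).trans_lt (ENNReal.mul_lt_top ENNReal.ofReal_lt_top hTV.lt_top)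

lemma abs_integral_sInt_slice_le (hTV : TVCw f ≠ ⊤) {ψ : XX d → ℝ} {c : ℝ} (hc0 : 0 ≤ c)
    (hc : ∀ x, |ψ x| ≤ c) :
    |∫ t in Ioo (0:ℝ) 1, sInt (f t) (fun x => ψ (t, x))| ≤ c * (TVCw f).toReal := by
  have h := norm_integral_le_lintegral_norm (μ := volume.restrict (Ioo (0:ℝ) 1))
    (fun t => sInt (f t) (fun x => ψ (t, x)))
  refine h.trans ?_
  have h2 := ENNReal.toReal_mono (ENNReal.mul_ne_top ENNReal.ofReal_ne_top hTV)
    (lintegral_sInt_slice_le (f := f) hc)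
  rwa [ENNReal.toReal_mul, ENNReal.toReal_ofReal hc0] at h2

lemma CwDensity.integrable {lam : Measure (XX d)} [IsFiniteMeasure lam]
    (hTV : TVCw f ≠ ⊤) {r : XX d → ℝ} (hr : Measurable r) (h : CwDensity f lam r) :
    Integrable r lam := by
  refine integrable_of_setIntegral_bdd lam hr (C := 1 * (TVCw f).toReal) fun s hs => ?_
  rw [← h s hs]
  refine abs_integral_sInt_slice_le hTV (ψ := s.indicator fun _ => (1:ℝ)) zero_le_one fun x => ?_
  by_cases hx : x ∈ s <;> simp [hx]

lemma CwDensity.integral_eq {lam : Measure (XX d)} [IsFiniteMeasure lam] (hf : IsCwCurve Ω f)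
    (hTV : TVCw f ≠ ⊤) {r : XX d → ℝ} (hr : Measurable r) (h : CwDensity f lam r)
    {ψ : XX d → ℝ} (hψ : BM ψ) :
    ∫ t in Ioo (0:ℝ) 1, sInt (f t) (fun x => ψ (t, x)) = ∫ x, ψ x * r x ∂lam := by
  have hri := h.integrable hTV hr
  have hψr : ∀ {ψ : XX d → ℝ}, BM ψ → Integrable (fun x => ψ x * r x) lam := by
    rintro ψ ⟨hm, C, hC⟩
    exact hri.bdd_mul (c := C) hm.aestronglyMeasurable (Eventually.of_forall hC)
  have hsimple : ∀ (s : Finset ℤ) (A : ℤ → Set (XX d)) (c : ℤ → ℝ)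
      (_ : ∀ k, MeasurableSet (A k)),
      ∫ t in Ioo (0:ℝ) 1, sInt (f t)
        (fun x => ∑ k ∈ s, c k * (A k).indicator (fun _ => (1:ℝ)) (t, x)) =
      ∫ x, (∑ k ∈ s, c k * (A k).indicator (fun _ => (1:ℝ)) x) * r x ∂lam := by
    intro s A c hA
    have hi : ∀ k, IntegrableOn (fun t => f t {x | (t, x) ∈ A k}) (Ioo (0:ℝ) 1) := by
      intro k
      have := integrable_sInt_slice hf hTV (BM.indicator (hA k))
      refine this.congr_fun (fun t _ => ?_) measurableSet_Ioo
      exact sInt_indicator (measurable_prodMk_left (hA k))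
    simp_rw [sInt_simple_slice s A c hA]
    rw [integral_finsetSum _ fun k _ => (hi k).const_mul (c k)]
    simp_rw [Finset.sum_mul]
    rw [integral_finsetSum _ fun k _ => hψr ((BM.const (c k)).mul (BM.indicator (hA k)))]
    refine Finset.sum_congr rfl fun k _ => ?_
    rw [integral_const_mul]
    have := h (A k) (hA k)
    have e : ∀ t, sInt (f t) ({x : Euc d | (t, x) ∈ A k}.indicator fun _ => (1:ℝ)) =
        f t {x | (t, x) ∈ A k} := fun t => sInt_indicator (measurable_prodMk_left (hA k))
    rw [integral_congr_ae (Eventually.of_forall e)] at this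
    rw [this, ← integral_indicator (hA k), ← integral_const_mul]
    congr 1
    ext x
    by_cases hx : x ∈ A k <;> simp [hx]
  refine eq_of_abs_sub_le_all fun ε hε => ?_
  set M := (TVCw f).toReal + ∫ x, |r x| ∂lam + 1 with hM
  have hMpos : 0 < M := by
    have : 0 ≤ ∫ x, |r x| ∂lam := integral_nonneg fun x => abs_nonneg _
    have := ENNReal.toReal_nonneg (a := TVCw f)
    linarith
  obtain ⟨s, A, c, hA, hb⟩ := simple_approx hψ (div_pos hε hMpos)
  have hbs := bm_simple s A c hA
  have h1 : |(∫ t in Ioo (0:ℝ) 1, sInt (f t) (fun x => ψ (t, x))) -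
      ∫ t in Ioo (0:ℝ) 1, sInt (f t)
        (fun x => ∑ k ∈ s, c k * (A k).indicator (fun _ => (1:ℝ)) (t, x))| ≤
      ε / M * (TVCw f).toReal := by
    rw [← integral_sub (integrable_sInt_slice hf hTV hψ) (integrable_sInt_slice hf hTV hbs)]
    simp_rw [fun t => (sInt_sub_fun (σ := f t) (hψ.slice t) (hbs.slice t)).symm]
    exact abs_integral_sInt_slice_le hTV (ψ := fun x => ψ x -
      ∑ k ∈ s, c k * (A k).indicator (fun _ => (1:ℝ)) x) (div_pos hε hMpos).le hb
  have h2 : |(∫ x, (∑ k ∈ s, c k * (A k).indicator (fun _ => (1:ℝ)) x) * r x ∂lam) -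
      ∫ x, ψ x * r x ∂lam| ≤ ε / M * ∫ x, |r x| ∂lam := by
    rw [← integral_sub (hψr hbs) (hψr hψ), ← integral_const_mul]
    refine (abs_integral_le_integral_abs).trans ?_
    refine integral_mono ((hψr hbs).sub (hψr hψ)).norm (hri.abs.const_mul _) fun x => ?_
    beta_reduce
    rw [← sub_mul, abs_mul, abs_sub_comm]
    exact mul_le_mul_of_nonneg_right (hb x) (abs_nonneg _)
  rw [hsimple s A c hA] at h1
  have h3 := abs_sub_le (∫ t in Ioo (0:ℝ) 1, sInt (f t) (fun x => ψ (t, x)))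
    (∫ x, (∑ k ∈ s, c k * (A k).indicator (fun _ => (1:ℝ)) x) * r x ∂lam)
    (∫ x, ψ x * r x ∂lam)
  calc _ ≤ _ := h3
    _ ≤ ε / M * (TVCw f).toReal + ε / M * ∫ x, |r x| ∂lam := add_le_add h1 h2
    _ ≤ ε / M * M := by rw [← mul_add]; gcongr; linarith
    _ = ε := div_mul_cancel₀ _ hMpos.ne'

end

/-! ### A control problem and its value function -/

/-- bounded measurable controls -/
structure Ctl (d : ℕ) where
  w : ℝ → Euc d
  q : ℝ → ℝ
  hw : Measurable w
  hq : Measurable q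
  C : ℝ
  hwC : ∀ s, ‖w s‖ ≤ C
  hqC : ∀ s, |q s| ≤ C

lemma isFinite_uIoc (a b : ℝ) : IsFiniteMeasure (volume.restrict (uIoc a b)) := ⟨by
  rw [Measure.restrict_apply_univ]; exact measure_Ioc_lt_top⟩

lemma abs_le_of_uIoc {a b s : ℝ} (hs : s ∈ uIoc a b) : |s| ≤ max |a| |b| := by
  rcases le_total a b with h | h
  · rw [uIoc_of_le h] at hs
    exact abs_le_max_abs_abs hs.1.le hs.2
  · rw [uIoc_of_ge h] at hs
    rw [max_comm]
    exact abs_le_max_abs_abs hs.1.le hs.2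

namespace Ctl

/-- displacement -/
def W (c : Ctl d) (s : ℝ) : Euc d := ∫ r in (0:ℝ)..s, c.w r
/-- log growth -/
def Q (c : Ctl d) (s : ℝ) : ℝ := ∫ r in (0:ℝ)..s, c.q r

lemma w_int (c : Ctl d) (a b : ℝ) : IntervalIntegrable c.w volume a b := by
  rw [intervalIntegrable_iff]
  have := isFinite_uIoc a b
  exact Integrable.of_bound c.hw.aestronglyMeasurable c.C (Eventually.of_forall c.hwC)

lemma q_int (c : Ctl d) (a b : ℝ) : IntervalIntegrable c.q volume a b := by
  rw [intervalIntegrable_iff]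
  have := isFinite_uIoc a b
  exact Integrable.of_bound c.hq.aestronglyMeasurable c.C (Eventually.of_forall c.hqC)

lemma continuous_W (c : Ctl d) : Continuous c.W :=
  intervalIntegral.continuous_primitive (fun a b => c.w_int a b) 0

lemma continuous_Q (c : Ctl d) : Continuous c.Q :=
  intervalIntegral.continuous_primitive (fun a b => c.q_int a b) 0

lemma W_sub (c : Ctl d) (t s : ℝ) : c.W s - c.W t = ∫ r in t..s, c.w r :=
  intervalIntegral.integral_interval_sub_left (c.w_int _ _) (c.w_int _ _)

lemma Q_sub (c : Ctl d) (t s : ℝ) : c.Q s - c.Q t = ∫ r in t..s, c.q r :=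
  intervalIntegral.integral_interval_sub_left (c.q_int _ _) (c.q_int _ _)

lemma C_nonneg (c : Ctl d) : 0 ≤ c.C := (norm_nonneg _).trans (c.hwC 0)

/-- running cost -/
def cost (A δ : ℝ) (c : Ctl d) (s : ℝ) : ℝ := A * (‖c.w s‖ ^ 2 + δ ^ 2 * c.q s ^ 2)

/-- running payoff -/
def Fn (ℓ : XX d → ℝ) (A δ : ℝ) (c : Ctl d) (z : XX d) (s : ℝ) : ℝ :=
  Real.exp (c.Q s - c.Q z.1) * (ℓ (s, z.2 + (c.W s - c.W z.1)) - cost A δ c s)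

/-- payoff -/
def G (ℓ : XX d → ℝ) (A δ : ℝ) (c : Ctl d) (z : XX d) : ℝ :=
  ∫ s in z.1..1, Fn ℓ A δ c z s

/-- concatenation with a constant control -/
def concat (c : Ctl d) (T : ℝ) (w0 : Euc d) (q0 : ℝ) : Ctl d where
  w := fun s => if s ≤ T then w0 else c.w s
  q := fun s => if s ≤ T then q0 else c.q s
  hw := Measurable.ite measurableSet_Iic measurable_const c.hw
  hq := Measurable.ite measurableSet_Iic measurable_const c.hq
  C := max c.C (max ‖w0‖ |q0|)
  hwC := fun s => by
    split_ifs
    · exact (le_max_left _ _).trans (le_max_right _ _)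
    · exact (c.hwC s).trans (le_max_left _ _)
  hqC := fun s => by
    split_ifs
    · exact (le_max_right _ _).trans (le_max_right _ _)
    · exact (c.hqC s).trans (le_max_left _ _)

/-- zero control -/
def zero : Ctl d where
  w := fun _ => 0
  q := fun _ => 0
  hw := measurable_const
  hq := measurable_const
  C := 0
  hwC := fun s => by simp
  hqC := fun s => by simp

variable {ℓ : XX d → ℝ} {A δ : ℝ}

lemma measurable_cost (c : Ctl d) : Measurable (cost A δ c) := by
  unfold cost
  exact (((c.hw.norm.pow_const 2).add ((c.hq.pow_const 2).const_mul _))).const_mul _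

lemma measurable_Fn (hℓ : Continuous ℓ) (c : Ctl d) (z : XX d) : Measurable (Fn ℓ A δ c z) := by
  unfold Fn
  have h1 := c.continuous_Q
  have h2 := c.continuous_W
  have h3 : Continuous fun s => ℓ (s, z.2 + (c.W s - c.W z.1)) := by fun_prop
  have h4 : Continuous fun s => Real.exp (c.Q s - c.Q z.1) := by fun_prop
  exact h4.measurable.mul (h3.measurable.sub c.measurable_cost)

lemma abs_cost_le (c : Ctl d) (s : ℝ) : |cost A δ c s| ≤ |A| * (c.C ^ 2 + δ ^ 2 * c.C ^ 2) := by
  unfold cost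
  rw [abs_mul, abs_of_nonneg (a := ‖c.w s‖ ^ 2 + δ ^ 2 * c.q s ^ 2) (by positivity)]
  have h1 := c.hwC s
  have h2 := c.hqC s
  have h3 : ‖c.w s‖ ^ 2 ≤ c.C ^ 2 := by gcongr
  have h4 : c.q s ^ 2 ≤ c.C ^ 2 := sq_le_sq' (by linarith [abs_le.1 h2]) (abs_le.1 h2).2
  gcongr

lemma abs_Q_le (c : Ctl d) {R s : ℝ} (hs : |s| ≤ R) : |c.Q s| ≤ c.C * R := by
  have h := intervalIntegral.norm_integral_le_of_norm_le_const (a := 0) (b := s) (f := c.q)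
    (C := c.C) (fun x _ => c.hqC x)
  rw [sub_zero] at h
  exact h.trans (mul_le_mul_of_nonneg_left hs c.C_nonneg)

lemma abs_Fn_le (c : Ctl d) {Cl : ℝ} (hb : ∀ z, |ℓ z| ≤ Cl) {R : ℝ} {z : XX d} (hz : |z.1| ≤ R)
    {s : ℝ} (hs : |s| ≤ R) :
    |Fn ℓ A δ c z s| ≤ Real.exp (2 * (c.C * R)) * (Cl + |A| * (c.C ^ 2 + δ ^ 2 * c.C ^ 2)) := by
  unfold Fn
  rw [abs_mul, abs_of_pos (Real.exp_pos _)]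
  have h1 := abs_le.1 (c.abs_Q_le hs)
  have h2 := abs_le.1 (c.abs_Q_le hz)
  have h3 : |ℓ (s, z.2 + (c.W s - c.W z.1)) - cost A δ c s| ≤
      Cl + |A| * (c.C ^ 2 + δ ^ 2 * c.C ^ 2) :=
    (abs_sub _ _).trans (add_le_add (hb _) (c.abs_cost_le s))
  refine mul_le_mul (Real.exp_le_exp.2 (by linarith)) h3 (abs_nonneg _) (Real.exp_pos _).le

lemma Fn_int (hℓ : Continuous ℓ) {Cl : ℝ} (hb : ∀ z, |ℓ z| ≤ Cl) (c : Ctl d) (z : XX d) (a b : ℝ) :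
    IntervalIntegrable (Fn ℓ A δ c z) volume a b := by
  rw [intervalIntegrable_iff]
  have : IsFiniteMeasure (volume.restrict (uIoc a b)) := ⟨by
    rw [Measure.restrict_apply_univ]; exact measure_Ioc_lt_top⟩
  refine Integrable.of_bound (measurable_Fn hℓ c z).aestronglyMeasurable
    (Real.exp (2 * (c.C * max |z.1| (max |a| |b|))) * (Cl + |A| * (c.C ^ 2 + δ ^ 2 * c.C ^ 2))) ?_
  filter_upwards [ae_restrict_mem measurableSet_uIoc] with s hs
  refine abs_Fn_le c hb (le_max_left _ _) (le_trans ?_ (le_max_right _ _))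
  exact abs_le_of_uIoc hs

end Ctl

namespace Ctl
variable {ℓ : XX d → ℝ} {A δ : ℝ}

lemma continuous_G (hℓ : Continuous ℓ) {Cl : ℝ} (hb : ∀ z, |ℓ z| ≤ Cl) (c : Ctl d) :
    Continuous (G ℓ A δ c) := by
  have h1 := c.continuous_Q
  have h2 := c.continuous_W
  rw [continuous_iff_continuousAt]
  intro z0
  have key : ContinuousAt (fun p : XX d × ℝ => ∫ s in (1:ℝ)..p.2, Fn ℓ A δ c p.1 s) (z0, z0.1) := by
    set R : ℝ := |z0.1| + 2 with hR
    have := isFinite_uIoc (-R) R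
    have hRp : 0 < R := by positivity
    have hz := abs_le.1 (le_refl |z0.1|)
    refine intervalIntegral.continuousAt_parametric_primitive_of_dominated
      (fun _ => Real.exp (2 * (c.C * R)) * (Cl + |A| * (c.C ^ 2 + δ ^ 2 * c.C ^ 2))) (-R) R
      ?_ ?_ ?_ ?_ ?_ ?_ ?_
    · intro z
      exact (measurable_Fn hℓ c z).aestronglyMeasurable
    · have : ∀ᶠ z : XX d in 𝓝 z0, |z.1| < R := by
        have : Continuous fun z : XX d => |z.1| := by fun_prop
        exact this.continuousAt.eventually_lt continuousAt_const (by linarith)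
      filter_upwards [this] with z hz
      filter_upwards [ae_restrict_mem measurableSet_uIoc] with s hs
      refine abs_Fn_le c hb hz.le ?_
      have := abs_le_of_uIoc hs
      simpa [abs_of_pos hRp] using this
    · rw [intervalIntegrable_iff]
      exact integrable_const _
    · refine Eventually.of_forall fun s => ?_
      have : Continuous fun z : XX d => Fn ℓ A δ c z s := by
        unfold Fn
        fun_prop
      exact this.continuousAt
    · exact ⟨by linarith [abs_nonneg z0.1], by linarith [abs_nonneg z0.1]⟩
    · exact ⟨by linarith, by linarith⟩
    · exact measure_singleton _
  have h3 : G ℓ A δ c = fun z => - ((fun p : XX d × ℝ => ∫ s in (1:ℝ)..p.2, Fn ℓ A δ c p.1 s) (z, z.1)) := by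
    ext z
    simp only [G]
    rw [intervalIntegral.integral_symm]
  rw [h3]
  refine ContinuousAt.neg ?_
  exact ContinuousAt.comp (f := fun z : XX d => (z, z.1)) key (by fun_prop)

lemma concat_W_of_le (c : Ctl d) {t T s : ℝ} (hts : t ≤ s) (hs : s ≤ T) (w0 : Euc d) (q0 : ℝ) :
    (c.concat T w0 q0).W s - (c.concat T w0 q0).W t = (s - t) • w0 := by
  rw [W_sub]
  rw [← intervalIntegral.integral_const]
  refine intervalIntegral.integral_congr fun r hr => ?_
  rw [uIcc_of_le hts] at hr
  simp [concat, hr.2.trans hs]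

lemma concat_Q_of_le (c : Ctl d) {t T s : ℝ} (hts : t ≤ s) (hs : s ≤ T) (w0 : Euc d) (q0 : ℝ) :
    (c.concat T w0 q0).Q s - (c.concat T w0 q0).Q t = (s - t) * q0 := by
  rw [Q_sub]
  rw [← smul_eq_mul, ← intervalIntegral.integral_const]
  refine intervalIntegral.integral_congr fun r hr => ?_
  rw [uIcc_of_le hts] at hr
  simp [concat, hr.2.trans hs]

lemma concat_W_of_ge (c : Ctl d) {T s : ℝ} (hs : T ≤ s) (w0 : Euc d) (q0 : ℝ) :
    (c.concat T w0 q0).W s - (c.concat T w0 q0).W T = c.W s - c.W T := by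
  rw [W_sub, W_sub]
  refine intervalIntegral.integral_congr_ae (Eventually.of_forall fun r hr => ?_)
  rw [uIoc_of_le hs] at hr
  simp [concat, not_le.2 hr.1]

lemma concat_Q_of_ge (c : Ctl d) {T s : ℝ} (hs : T ≤ s) (w0 : Euc d) (q0 : ℝ) :
    (c.concat T w0 q0).Q s - (c.concat T w0 q0).Q T = c.Q s - c.Q T := by
  rw [Q_sub, Q_sub]
  refine intervalIntegral.integral_congr_ae (Eventually.of_forall fun r hr => ?_)
  rw [uIoc_of_le hs] at hr
  simp [concat, not_le.2 hr.1]

lemma G_concat (hℓ : Continuous ℓ) {Cl : ℝ} (hb : ∀ z, |ℓ z| ≤ Cl) (c : Ctl d) {t T : ℝ}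
    (htT : t ≤ T) (hT : T ≤ 1) (x w0 : Euc d) (q0 : ℝ) :
    G ℓ A δ (c.concat T w0 q0) (t, x) =
      (∫ s in t..T, Real.exp ((s - t) * q0) *
        (ℓ (s, x + (s - t) • w0) - A * (‖w0‖ ^ 2 + δ ^ 2 * q0 ^ 2))) +
      Real.exp ((T - t) * q0) * G ℓ A δ c (T, x + (T - t) • w0) := by
  have h0 : G ℓ A δ (c.concat T w0 q0) (t, x) =
      (∫ s in t..T, Fn ℓ A δ (c.concat T w0 q0) (t, x) s) +
      ∫ s in T..1, Fn ℓ A δ (c.concat T w0 q0) (t, x) s :=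
    (intervalIntegral.integral_add_adjacent_intervals (Fn_int hℓ hb _ _ _ _)
      (Fn_int hℓ hb _ _ _ _)).symm
  rw [h0]
  congr 1
  · refine intervalIntegral.integral_congr fun r hr => ?_
    rw [uIcc_of_le htT] at hr
    simp only [Fn, concat_W_of_le c hr.1 hr.2, concat_Q_of_le c hr.1 hr.2, cost]
    simp [concat, hr.2]
  · unfold G
    rw [← intervalIntegral.integral_const_mul]
    refine intervalIntegral.integral_congr_ae (Eventually.of_forall fun r hr => ?_)
    rw [uIoc_of_le hT] at hr
    have e1 := concat_W_of_ge c hr.1.le w0 q0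
    have e2 := concat_Q_of_ge c hr.1.le w0 q0
    have e3 := concat_W_of_le c htT le_rfl w0 q0
    have e4 := concat_Q_of_le c htT le_rfl w0 q0
    have e5 : (c.concat T w0 q0).W r - (c.concat T w0 q0).W t = (T - t) • w0 + (c.W r - c.W T) := by
      rw [← e1, ← e3]; abel
    have e6 : (c.concat T w0 q0).Q r - (c.concat T w0 q0).Q t = (T - t) * q0 + (c.Q r - c.Q T) := by
      rw [← e2, ← e4]; abel
    have e7 : cost A δ (c.concat T w0 q0) r = cost A δ c r := by
      simp [cost, concat, not_le.2 hr.1]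
    simp only [Fn, e5, e6, e7, Real.exp_add, add_assoc]
    ring

end Ctl

lemma abs_exp_sub_one_le' (y : ℝ) : |Real.exp y - 1| ≤ |y| * Real.exp |y| := by
  have h1 := Real.add_one_le_exp (-y)
  have h2 := Real.add_one_le_exp y
  have h3 : Real.exp (-y) * Real.exp y = 1 := by rw [← Real.exp_add]; simp
  have h4 : Real.exp y ≤ Real.exp |y| := Real.exp_le_exp.2 (le_abs_self y)
  have h5 : 1 ≤ Real.exp |y| := Real.one_le_exp (abs_nonneg y)
  have h6 := Real.exp_pos y
  rw [abs_le]
  constructor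
  · nlinarith [neg_abs_le y, abs_nonneg y]
  · have : Real.exp y - 1 ≤ y * Real.exp y := by nlinarith
    have h7 : y * Real.exp y ≤ |y| * Real.exp y := by gcongr; exact le_abs_self y
    have h8 : |y| * Real.exp y ≤ |y| * Real.exp |y| := by gcongr
    linarith

namespace Ctl
variable {ℓ : XX d → ℝ} {A δ : ℝ}

/-- value function -/
def val (ℓ : XX d → ℝ) (A δ : ℝ) (z : XX d) : ℝ := ⨆ c : Ctl d, G ℓ A δ c (clamp z.1, z.2)

lemma G_le (hℓ : Continuous ℓ) {Cl : ℝ} (hb : ∀ z, |ℓ z| ≤ Cl)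
    (H0 : ∀ (c : Ctl d) (x : Euc d), G ℓ A δ c (0, x) ≤ 0) (c : Ctl d) {t : ℝ} (ht : t ∈ Icc (0:ℝ) 1)
    (x : Euc d) : G ℓ A δ c (t, x) ≤ Cl * t := by
  have h := H0 (c.concat t 0 0) x
  rw [G_concat hℓ hb c ht.1 ht.2] at h
  simp only [mul_zero, Real.exp_zero, smul_zero, add_zero, norm_zero, one_mul] at h
  norm_num at h
  have h2 := intervalIntegral.norm_integral_le_of_norm_le_const (a := 0) (b := t)
    (f := fun s => ℓ (s, x)) (C := Cl) (fun s _ => hb _)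
  rw [sub_zero, abs_of_nonneg ht.1] at h2
  have h3 := abs_le.1 h2
  linarith

lemma zero_G (c : XX d) : G ℓ A δ (zero : Ctl d) c = ∫ s in c.1..1, ℓ (s, c.2) := by
  unfold G
  refine intervalIntegral.integral_congr fun s _ => ?_
  simp [Fn, W, Q, zero, cost]

lemma zero_G_ge {Cl : ℝ} (hb : ∀ z, |ℓ z| ≤ Cl) {t : ℝ} (ht : t ∈ Icc (0:ℝ) 1) (x : Euc d) :
    -(Cl * (1 - t)) ≤ G ℓ A δ (zero : Ctl d) (t, x) := by
  rw [zero_G]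
  have h2 := intervalIntegral.norm_integral_le_of_norm_le_const (a := t) (b := 1)
    (f := fun s => ℓ (s, x)) (C := Cl) (fun s _ => hb _)
  rw [abs_of_nonneg (sub_nonneg.2 ht.2)] at h2
  exact (abs_le.1 h2).1

lemma bddAbove_G (hℓ : Continuous ℓ) {Cl : ℝ} (hb : ∀ z, |ℓ z| ≤ Cl)
    (H0 : ∀ (c : Ctl d) (x : Euc d), G ℓ A δ c (0, x) ≤ 0) (z : XX d) :
    BddAbove (range fun c : Ctl d => G ℓ A δ c (clamp z.1, z.2)) := by
  refine ⟨Cl * clamp z.1, ?_⟩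
  rintro _ ⟨c, rfl⟩
  exact G_le hℓ hb H0 c (clamp_mem _) _

lemma val_le (hℓ : Continuous ℓ) {Cl : ℝ} (hb : ∀ z, |ℓ z| ≤ Cl)
    (H0 : ∀ (c : Ctl d) (x : Euc d), G ℓ A δ c (0, x) ≤ 0) (z : XX d) :
    val ℓ A δ z ≤ Cl * clamp z.1 := by
  have : Nonempty (Ctl d) := ⟨zero⟩
  exact ciSup_le fun c => G_le hℓ hb H0 c (clamp_mem _) _

lemma val_ge (hℓ : Continuous ℓ) {Cl : ℝ} (hb : ∀ z, |ℓ z| ≤ Cl)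
    (H0 : ∀ (c : Ctl d) (x : Euc d), G ℓ A δ c (0, x) ≤ 0) (z : XX d) :
    -(Cl * (1 - clamp z.1)) ≤ val ℓ A δ z :=
  (zero_G_ge hb (clamp_mem _) _).trans (le_ciSup (bddAbove_G hℓ hb H0 z) zero)

lemma abs_val_le (hℓ : Continuous ℓ) {Cl : ℝ} (hb : ∀ z, |ℓ z| ≤ Cl)
    (H0 : ∀ (c : Ctl d) (x : Euc d), G ℓ A δ c (0, x) ≤ 0) (z : XX d) :
    |val ℓ A δ z| ≤ Cl := by
  have h1 := val_le hℓ hb H0 z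
  have h2 := val_ge hℓ hb H0 z
  have h3 := clamp_mem z.1
  have h4 : 0 ≤ Cl := (abs_nonneg _).trans (hb 0)
  rw [abs_le]
  constructor <;> nlinarith [h3.1, h3.2]

lemma measurable_val (hℓ : Continuous ℓ) {Cl : ℝ} (hb : ∀ z, |ℓ z| ≤ Cl)
    (H0 : ∀ (c : Ctl d) (x : Euc d), G ℓ A δ c (0, x) ≤ 0) : Measurable (val ℓ A δ) := by
  refine LowerSemicontinuous.measurable ?_
  refine lowerSemicontinuous_ciSup (bddAbove_G hℓ hb H0) fun c => ?_
  refine Continuous.lowerSemicontinuous ?_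
  refine (continuous_G hℓ hb c).comp ?_
  exact (continuous_clamp.comp continuous_fst).prodMk continuous_snd

lemma val_dpp (hℓ : Continuous ℓ) {Cl : ℝ} (hb : ∀ z, |ℓ z| ≤ Cl) {L : ℝ≥0} (hL : LipschitzWith L ℓ)
    (H0 : ∀ (c : Ctl d) (x : Euc d), G ℓ A δ c (0, x) ≤ 0) (w0 : Euc d) (q0 : ℝ) :
    ∃ K : ℝ, ∀ (z : XX d) (τ : ℝ), 0 ≤ z.1 → 0 ≤ τ → τ ≤ 1 → z.1 + τ ≤ 1 →
      τ * (ℓ z - A * (‖w0‖ ^ 2 + δ ^ 2 * q0 ^ 2)) - K * τ ^ 2 +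
        Real.exp (τ * q0) * val ℓ A δ (z + τ • ((1:ℝ), w0)) ≤ val ℓ A δ z := by
  set c0 : ℝ := A * (‖w0‖ ^ 2 + δ ^ 2 * q0 ^ 2) with hc0
  set K : ℝ := |q0| * Real.exp |q0| * (Cl + |c0|) + L * (1 + ‖w0‖) with hK
  refine ⟨K, ?_⟩
  rintro ⟨t, x⟩ τ ht hτ hτ1 htτ
  simp only at ht htτ
  have hCl : 0 ≤ Cl := (abs_nonneg _).trans (hb 0)
  have hKn : 0 ≤ K := by positivity
  have ezt : ((t, x) : XX d) + τ • ((1:ℝ), w0) = (t + τ, x + τ • w0) := by simp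
  have c1 : clamp t = t := clamp_of_mem ⟨ht, by linarith⟩
  have c2 : clamp (t + τ) = t + τ := clamp_of_mem ⟨by linarith, by linarith⟩
  -- integral estimate
  have hI : τ * (ℓ (t, x) - c0) - K * τ ^ 2 ≤ ∫ s in t..(t + τ), Real.exp ((s - t) * q0) *
        (ℓ (s, x + (s - t) • w0) - c0) := by
    have e1 : τ * (ℓ (t, x) - c0) - K * τ ^ 2 = ∫ s in t..(t + τ), (ℓ (t, x) - c0 - K * τ) := by
      rw [intervalIntegral.integral_const]; simp; ring
    rw [e1]
    refine intervalIntegral.integral_mono_on (by linarith) (by simp) ?_ ?_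
    · apply Continuous.intervalIntegrable
      fun_prop
    · intro s hs
      set σ := s - t with hσ
      have hσ0 : 0 ≤ σ := by linarith [hs.1]
      have hστ : σ ≤ τ := by linarith [hs.2]
      have g1 : |Real.exp (σ * q0) - 1| ≤ σ * (|q0| * Real.exp |q0|) := by
        have := abs_exp_sub_one_le' (σ * q0)
        rw [abs_mul, abs_of_nonneg hσ0] at this
        refine this.trans ?_
        rw [mul_assoc]
        gcongr
        nlinarith [abs_nonneg q0]
      have g2 : |ℓ (s, x + σ • w0) - ℓ (t, x)| ≤ σ * (L * (1 + ‖w0‖)) := by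
        have := hL.dist_le_mul (s, x + σ • w0) (t, x)
        rw [Real.dist_eq] at this
        refine this.trans ?_
        have : dist ((s, x + σ • w0) : XX d) (t, x) ≤ σ * (1 + ‖w0‖) := by
          rw [Prod.dist_eq]
          refine max_le ?_ ?_
          · simp only [Real.dist_eq]
            rw [abs_of_nonneg hσ0]
            nlinarith [norm_nonneg w0]
          · simp only [dist_eq_norm, add_sub_cancel_left, norm_smul, Real.norm_eq_abs, abs_of_nonneg hσ0]
            nlinarith [norm_nonneg w0]
        calc _ ≤ L * (σ * (1 + ‖w0‖)) := by gcongr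
          _ = _ := by ring
      have g3 : |ℓ (s, x + σ • w0) - c0| ≤ Cl + |c0| := (abs_sub _ _).trans (by gcongr; exact hb _)
      have g4 : |(Real.exp (σ * q0) - 1) * (ℓ (s, x + σ • w0) - c0)| ≤
          σ * (|q0| * Real.exp |q0|) * (Cl + |c0|) := by
        rw [abs_mul]
        exact mul_le_mul g1 g3 (abs_nonneg _) (by positivity)
      have g5 := (abs_le.1 g4).1
      have g6 := (abs_le.1 g2).1
      have g7 : σ * K ≤ τ * K := by gcongr
      nlinarith
  have hsup : Real.exp (τ * q0) * val ℓ A δ (t + τ, x + τ • w0) ≤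
      val ℓ A δ (t, x) - ∫ s in t..(t + τ), Real.exp ((s - t) * q0) *
        (ℓ (s, x + (s - t) • w0) - c0) := by
    have : Nonempty (Ctl d) := ⟨zero⟩
    rw [← le_div_iff₀' (Real.exp_pos _)]
    refine ciSup_le fun c => ?_
    rw [le_div_iff₀' (Real.exp_pos _)]
    simp only [c2]
    have h := G_concat (A := A) (δ := δ) hℓ hb c (by linarith : t ≤ t + τ) htτ x w0 q0
    rw [add_sub_cancel_left, ← hc0] at h
    have h2 : G ℓ A δ (c.concat (t + τ) w0 q0) (t, x) ≤ val ℓ A δ (t, x) := by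
      have := le_ciSup (bddAbove_G (A := A) (δ := δ) hℓ hb H0 (t, x)) (c.concat (t + τ) w0 q0)
      simpa only [c1, val] using this
    linarith
  rw [ezt]
  linarith

end Ctl

/-! ### mollification -/

/-- a bump of radius `ε` -/
def bmp (d : ℕ) (ε : ℝ) (hε : 0 < ε) : ContDiffBump (0 : XX d) :=
  ⟨ε / 2, ε, half_pos hε, half_lt_self hε⟩

/-- average of `g` against the bump -/
def avg (ε : ℝ) (hε : 0 < ε) (g : XX d → ℝ) : ℝ := ∫ y, (bmp d ε hε).normed volume y * g y

lemma avg_int {ε : ℝ} (hε : 0 < ε) {g : XX d → ℝ} (hg : BM g) :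
    Integrable (fun y => (bmp d ε hε).normed volume y * g y) volume := by
  obtain ⟨C, hC⟩ := hg.2
  exact (bmp d ε hε).integrable_normed.mul_bdd hg.1.aestronglyMeasurable (Eventually.of_forall hC)

lemma avg_mono {ε : ℝ} (hε : 0 < ε) {g1 g2 : XX d → ℝ} (h1 : BM g1) (h2 : BM g2)
    (h : ∀ y, ‖y‖ < ε → g1 y ≤ g2 y) : avg ε hε g1 ≤ avg ε hε g2 := by
  refine integral_mono (avg_int hε h1) (avg_int hε h2) fun y => ?_
  by_cases hy : ‖y‖ < ε
  · exact mul_le_mul_of_nonneg_left (h y hy) ((bmp d ε hε).nonneg_normed y)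
  · have : (bmp d ε hε).normed volume y = 0 := by
      by_contra h0
      have : y ∈ Function.support ((bmp d ε hε).normed volume) := h0
      rw [ContDiffBump.support_normed_eq] at this
      simp [bmp] at this
      exact hy this
    simp [this]

lemma avg_const {ε : ℝ} (hε : 0 < ε) (c : ℝ) : avg ε hε (fun _ : XX d => c) = c := by
  unfold avg
  rw [integral_mul_const, ContDiffBump.integral_normed, one_mul]

lemma avg_add {ε : ℝ} (hε : 0 < ε) {g1 g2 : XX d → ℝ} (h1 : BM g1) (h2 : BM g2) :
    avg ε hε (fun y => g1 y + g2 y) = avg ε hε g1 + avg ε hε g2 := by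
  unfold avg
  rw [← integral_add (avg_int hε h1) (avg_int hε h2)]
  simp only [mul_add]

lemma avg_const_mul {ε : ℝ} (hε : 0 < ε) (c : ℝ) (g : XX d → ℝ) :
    avg ε hε (fun y => c * g y) = c * avg ε hε g := by
  unfold avg
  rw [← integral_const_mul]
  congr 1; ext y; ring

lemma BM.comp {g : XX d → ℝ} (hg : BM g) {T : XX d → XX d} (hT : Measurable T) : BM fun y => g (T y) :=
  ⟨hg.1.comp hT, hg.2.imp fun _ h _ => h _⟩

/-- the mollified (and shifted) function -/
def mol (ε : ℝ) (hε : 0 < ε) (V : XX d → ℝ) (z : XX d) : ℝ :=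
  avg ε hε fun y => V (z - y + (2 * ε, 0))

lemma contDiff_mol {ε : ℝ} (hε : 0 < ε) {V : XX d → ℝ} (hV : BM V) :
    ContDiff ℝ (⊤ : ℕ∞) (mol ε hε V) := by
  have hV2 : BM fun z : XX d => V (z + (2 * ε, 0)) := hV.comp (by fun_prop)
  obtain ⟨C, hC⟩ := hV2.2
  have hl : LocallyIntegrable (fun z : XX d => V (z + (2 * ε, 0))) volume :=
    (locallyIntegrable_const C).mono hV2.1.aestronglyMeasurable
      (Eventually.of_forall fun x => (hC x).trans (le_abs_self C))
  have : (volume : Measure (XX d)).IsAddHaarMeasure :=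
    inferInstanceAs ((volume : Measure ℝ).prod (volume : Measure (Euc d))).IsAddHaarMeasure
  have := HasCompactSupport.contDiff_convolution_left (n := (⊤ : ℕ∞)) (ContinuousLinearMap.lsmul ℝ ℝ)
    ((bmp d ε hε).hasCompactSupport_normed (μ := volume)) (bmp d ε hε).contDiff_normed hl
  exact this

lemma deriv_nonpos_of_right {Φ : ℝ → ℝ} {Φ' ε : ℝ} (hε : 0 < ε) (h : HasDerivAt Φ Φ' 0) (h0 : Φ 0 = 0)
    (hle : ∀ τ, 0 ≤ τ → τ ≤ ε → Φ τ ≤ 0) : Φ' ≤ 0 := by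
  have h1 := h.tendsto_slope_zero_right
  refine le_of_tendsto h1 ?_
  filter_upwards [Ioo_mem_nhdsGT hε] with τ hτ
  rw [zero_add, h0, sub_zero, smul_eq_mul]
  exact mul_nonpos_of_nonneg_of_nonpos (inv_nonneg.2 hτ.1.le) (hle τ hτ.1.le hτ.2.le)

lemma mol_hjb {ε : ℝ} (hε : 0 < ε) (hε1 : ε ≤ 1) {V ℓ : XX d → ℝ} (hV : BM V) (hℓ : BM ℓ)
    {L : ℝ≥0} (hL : LipschitzWith L ℓ) {w0 : Euc d} {q0 c0 K : ℝ}
    (hdpp : ∀ (z : XX d) (τ : ℝ), 0 ≤ z.1 → 0 ≤ τ → τ ≤ 1 → z.1 + τ ≤ 1 →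
      τ * (ℓ z - c0) - K * τ ^ 2 + Real.exp (τ * q0) * V (z + τ • ((1:ℝ), w0)) ≤ V z)
    {z : XX d} (hz0 : 0 ≤ z.1) (hz1 : z.1 + 4 * ε ≤ 1) :
    fderiv ℝ (mol ε hε V) z (1, w0) + q0 * mol ε hε V z ≤ c0 - ℓ z + 3 * L * ε := by
  set Φ : ℝ → ℝ := fun τ => τ * (ℓ z - 3 * L * ε - c0) - K * τ ^ 2 +
    Real.exp (τ * q0) * mol ε hε V (z + τ • ((1:ℝ), w0)) - mol ε hε V z with hΦ
  have hd : HasDerivAt Φ ((ℓ z - 3 * L * ε - c0) +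
      (q0 * mol ε hε V z + fderiv ℝ (mol ε hε V) z (1, w0))) 0 := by
    have d1 : HasDerivAt (fun τ : ℝ => mol ε hε V (z + τ • ((1:ℝ), w0)))
        (fderiv ℝ (mol ε hε V) z (1, w0)) 0 := by
      have e1 : HasFDerivAt (mol ε hε V) (fderiv ℝ (mol ε hε V) z) (z + (0:ℝ) • ((1:ℝ), w0)) := by
        rw [zero_smul, add_zero]
        exact ((contDiff_mol hε hV).differentiable (by simp) z).hasFDerivAt
      have e2 : HasDerivAt (fun τ : ℝ => z + τ • ((1:ℝ), w0)) ((1:ℝ), w0) 0 := by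
        have := ((hasDerivAt_id (0:ℝ)).smul_const ((1:ℝ), w0)).const_add z
        simpa using this
      exact e1.comp_hasDerivAt 0 e2
    have d2 : HasDerivAt (fun τ : ℝ => Real.exp (τ * q0)) q0 0 := by
      have := ((hasDerivAt_id (0:ℝ)).mul_const q0).exp
      simpa using this
    have d3 : HasDerivAt (fun τ : ℝ => τ * (ℓ z - 3 * L * ε - c0)) (ℓ z - 3 * L * ε - c0) 0 := by
      have := (hasDerivAt_id (0:ℝ)).mul_const (ℓ z - 3 * L * ε - c0)
      simpa using this
    have d4 : HasDerivAt (fun τ : ℝ => K * τ ^ 2) 0 0 := by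
      have := ((hasDerivAt_id (0:ℝ)).pow 2).const_mul K
      simpa using this
    have := ((d3.sub d4).add (d2.mul d1)).sub_const (mol ε hε V z)
    simp only [sub_zero, zero_mul, Real.exp_zero, zero_smul, add_zero, one_mul] at this
    exact this
  have hle : ∀ τ, 0 ≤ τ → τ ≤ ε → Φ τ ≤ 0 := by
    intro τ hτ hτε
    have b1 : BM fun y : XX d => V (z - y + (2 * ε, 0)) := hV.comp (by fun_prop)
    have b2 : BM fun y : XX d => V (z + τ • ((1:ℝ), w0) - y + (2 * ε, 0)) := hV.comp (by fun_prop)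
    have key : avg ε hε (fun y => (τ * (ℓ z - 3 * L * ε - c0) - K * τ ^ 2) +
        Real.exp (τ * q0) * V (z + τ • ((1:ℝ), w0) - y + (2 * ε, 0))) ≤
        avg ε hε fun y => V (z - y + (2 * ε, 0)) := by
      refine avg_mono hε ((BM.const _).add ((BM.const _).mul b2)) b1 fun y hy => ?_
      have hy1 : |y.1| < ε := (norm_fst_le y).trans_lt hy
      have hy2 := abs_lt.1 hy1
      have h := hdpp (z - y + (2 * ε, 0)) τ (by simp; linarith) hτ (by linarith) (by simp; linarith)
      have e : z - y + (2 * ε, 0) + τ • ((1:ℝ), w0) = z + τ • ((1:ℝ), w0) - y + (2 * ε, 0) := by abel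
      rw [e] at h
      have hl : |ℓ (z - y + (2 * ε, 0)) - ℓ z| ≤ 3 * L * ε := by
        have := hL.dist_le_mul (z - y + (2 * ε, 0)) z
        rw [Real.dist_eq] at this
        refine this.trans ?_
        have : dist (z - y + ((2 * ε, 0) : XX d)) z ≤ 3 * ε := by
          rw [dist_eq_norm]
          have : z - y + ((2 * ε, 0) : XX d) - z = (2 * ε, 0) - y := by abel
          rw [this]
          refine (norm_sub_le _ _).trans ?_
          have : ‖((2 * ε, 0) : XX d)‖ = 2 * ε := by
            simp [Prod.norm_def, abs_of_pos hε, hε.le]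
          rw [this]; linarith
        calc _ ≤ L * (3 * ε) := by gcongr
          _ = _ := by ring
      have hl1 := (abs_le.1 hl).1
      have : τ * (ℓ z - 3 * L * ε - c0) ≤ τ * (ℓ (z - y + (2 * ε, 0)) - c0) := by
        gcongr; linarith
      linarith
    rw [avg_add hε (BM.const _) ((BM.const _).mul b2), avg_const, avg_const_mul] at key
    simp only [hΦ, mol]
    linarith
  have := deriv_nonpos_of_right hε hd (by simp only [hΦ, zero_smul, add_zero]; simp) hle
  linarith

/-! ### cutoffs -/

lemma smoothTransition_deriv : ∃ C1 : ℝ, 0 ≤ C1 ∧ ∀ x,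
    0 ≤ deriv Real.smoothTransition x ∧ deriv Real.smoothTransition x ≤ C1 ∧
    (deriv Real.smoothTransition x ≠ 0 → x ∈ Icc (0:ℝ) 1) := by
  have hc : Continuous (deriv Real.smoothTransition) :=
    (Real.smoothTransition.contDiff (n := 1)).continuous_deriv le_rfl
  have h0 : ∀ x, deriv Real.smoothTransition x ≠ 0 → x ∈ Icc (0:ℝ) 1 := by
    intro x hx
    by_contra hn
    rw [mem_Icc, not_and_or, not_le, not_le] at hn
    apply hx
    rcases hn with hn | hn
    · have : Real.smoothTransition =ᶠ[𝓝 x] fun _ => (0:ℝ) := by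
        filter_upwards [Iio_mem_nhds hn] with y hy
        exact Real.smoothTransition.zero_of_nonpos (le_of_lt hy)
      rw [this.deriv_eq]; simp
    · have : Real.smoothTransition =ᶠ[𝓝 x] fun _ => (1:ℝ) := by
        filter_upwards [Ioi_mem_nhds hn] with y hy
        exact Real.smoothTransition.one_of_one_le (le_of_lt hy)
      rw [this.deriv_eq]; simp
  obtain ⟨C, hC⟩ := (isCompact_Icc (a := (0:ℝ)) (b := 1)).exists_bound_of_continuousOn hc.continuousOn
  have hCn : 0 ≤ C := (norm_nonneg _).trans (hC 0 (by simp))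
  refine ⟨C, hCn, fun x => ⟨?_, ?_, h0 x⟩⟩
  · exact Real.smoothTransition.monotone.deriv_nonneg
  · by_cases hx : deriv Real.smoothTransition x = 0
    · rw [hx]; exact hCn
    · exact (le_abs_self _).trans (hC x (h0 x hx))

lemma exists_cutoff : ∃ C1 : ℝ, 0 ≤ C1 ∧ ∀ κ : ℝ, 0 < κ → ∃ χ : ℝ → ℝ, ContDiff ℝ (⊤ : ℕ∞) χ ∧
    (∀ t, 0 ≤ χ t) ∧ (∀ t, χ t ≤ 1) ∧ (∀ t, χ t ≠ 0 → κ ≤ t ∧ t ≤ 1 - κ) ∧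
    (∀ t, 2 * κ ≤ t → t ≤ 1 - 2 * κ → χ t = 1) ∧
    ∀ t, ∃ p q : ℝ, deriv χ t = p - q ∧ 0 ≤ p ∧ 0 ≤ q ∧ p ≤ C1 / κ ∧ q ≤ C1 / κ ∧
      (p ≠ 0 → t ∈ Icc κ (2 * κ)) ∧ (q ≠ 0 → t ∈ Icc (1 - 2 * κ) (1 - κ)) := by
  obtain ⟨C1, hC1, h⟩ := smoothTransition_deriv
  refine ⟨C1, hC1, fun κ hκ => ?_⟩
  have hS : ContDiff ℝ (⊤ : ℕ∞) Real.smoothTransition := Real.smoothTransition.contDiff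
  refine ⟨fun t => Real.smoothTransition ((t - κ) / κ) * Real.smoothTransition ((1 - κ - t) / κ),
    ?_, ?_, ?_, ?_, ?_, ?_⟩
  · exact (hS.comp (by fun_prop)).mul (hS.comp (by fun_prop))
  · exact fun t => mul_nonneg (Real.smoothTransition.nonneg _) (Real.smoothTransition.nonneg _)
  · exact fun t => mul_le_one₀ (Real.smoothTransition.le_one _) (Real.smoothTransition.nonneg _)
      (Real.smoothTransition.le_one _)
  · intro t ht
    have h1 := left_ne_zero_of_mul ht
    have h2 := right_ne_zero_of_mul ht
    rw [Ne, Real.smoothTransition.zero_iff_nonpos, not_le, lt_div_iff₀ hκ] at h1 h2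
    constructor <;> linarith
  · intro t h1 h2
    beta_reduce
    rw [Real.smoothTransition.one_of_one_le, Real.smoothTransition.one_of_one_le, one_mul]
    · rw [le_div_iff₀ hκ]; linarith
    · rw [le_div_iff₀ hκ]; linarith
  · intro t
    have hd : ∀ x, HasDerivAt Real.smoothTransition (deriv Real.smoothTransition x) x := fun x =>
      (hS.differentiable (by simp) x).hasDerivAt
    have d1 : HasDerivAt (fun t => Real.smoothTransition ((t - κ) / κ))
        (deriv Real.smoothTransition ((t - κ) / κ) * (1 / κ)) t :=
      (hd _).comp t (((hasDerivAt_id t).sub_const κ).div_const κ)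
    have d2 : HasDerivAt (fun t => Real.smoothTransition ((1 - κ - t) / κ))
        (deriv Real.smoothTransition ((1 - κ - t) / κ) * (-1 / κ)) t :=
      (hd _).comp t (((hasDerivAt_id t).const_sub (1 - κ)).div_const κ)
    have d3 := (d1.mul d2).deriv
    set s1 := deriv Real.smoothTransition ((t - κ) / κ)
    set s2 := deriv Real.smoothTransition ((1 - κ - t) / κ)
    have n1 := Real.smoothTransition.nonneg ((t - κ) / κ)
    have n2 := Real.smoothTransition.nonneg ((1 - κ - t) / κ)
    have l1 := Real.smoothTransition.le_one ((t - κ) / κ)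
    have l2 := Real.smoothTransition.le_one ((1 - κ - t) / κ)
    obtain ⟨a1, a2, a3⟩ := h ((t - κ) / κ)
    obtain ⟨b1, b2, b3⟩ := h ((1 - κ - t) / κ)
    have hκ' : 0 < 1 / κ := by positivity
    refine ⟨s1 * (1 / κ) * Real.smoothTransition ((1 - κ - t) / κ),
      Real.smoothTransition ((t - κ) / κ) * (s2 * (1 / κ)), ?_, by positivity, by positivity,
      ?_, ?_, ?_, ?_⟩
    · refine Eq.trans ?_ (d3.trans ?_)
      · rfl
      · ring
    · calc _ ≤ s1 * (1 / κ) * 1 := by gcongr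
        _ ≤ C1 * (1 / κ) * 1 := by gcongr
        _ = C1 / κ := by ring
    · calc _ ≤ 1 * (s2 * (1 / κ)) := by gcongr
        _ ≤ 1 * (C1 * (1 / κ)) := by gcongr
        _ = C1 / κ := by ring
    · intro hp
      have := a3 (left_ne_zero_of_mul (left_ne_zero_of_mul hp))
      rw [mem_Icc, le_div_iff₀ hκ, div_le_iff₀ hκ] at this
      constructor <;> linarith
    · intro hp
      have := b3 (left_ne_zero_of_mul (right_ne_zero_of_mul hp))
      rw [mem_Icc, le_div_iff₀ hκ, div_le_iff₀ hκ] at this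
      constructor <;> linarith

lemma measurable_Psi {α : Type*} [MeasurableSpace α] (δ : ℝ) {r u : α → ℝ} {w : α → Euc d}
    (hr : Measurable r) (hw : Measurable w) (hu : Measurable u) :
    Measurable fun x => Psi δ (r x) (w x) (u x) := by
  unfold Psi
  refine Measurable.ite (measurableSet_lt measurable_const hr) ?_ (Measurable.ite ?_ measurable_const measurable_const)
  · exact (((hw.norm.pow_const 2).add ((hu.pow_const 2).const_mul _)).div (hr.const_mul 2)).ennreal_ofReal
  · exact (hr (measurableSet_singleton 0)).inter ((hw (measurableSet_singleton 0)).inter (hu (measurableSet_singleton 0)))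

/-- Case analysis for finite `Psi`. -/
lemma Psi_cases {δ r u : ℝ} {w : Euc d} (h : Psi δ r w u ≠ ⊤) :
    (0 < r ∧ (Psi δ r w u).toReal = (‖w‖ ^ 2 + δ ^ 2 * u ^ 2) / (2 * r)) ∨
      (r = 0 ∧ w = 0 ∧ u = 0) := by
  unfold Psi at *
  split_ifs at h with h1 h2
  · left
    refine ⟨h1, ?_⟩
    rw [if_pos h1, ENNReal.toReal_ofReal (by positivity)]
  · right; exact h2
  · exact absurd rfl h

lemma integrable_clm_apply {lam : Measure (XX d)} {D : XX d → XX d →L[ℝ] ℝ} (hD : Continuous D) {C : ℝ}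
    (hC : ∀ x, ‖D x‖ ≤ C) {w : XX d → Euc d} (hw : Integrable w lam) :
    Integrable (fun x => D x ((0:ℝ), w x)) lam := by
  have h2 : Integrable (fun x => (((0:ℝ), w x) : XX d)) lam := (integrable_zero _ _ _).prodMk hw
  refine (h2.norm.const_mul C).mono ?_ ?_
  · exact isBoundedBilinearMap_apply.continuous.comp_aestronglyMeasurable
      (hD.aestronglyMeasurable.prodMk h2.aestronglyMeasurable)
  · refine Eventually.of_forall fun x => ?_
    refine ((D x).le_opNorm _).trans ?_
    rw [Real.norm_eq_abs]
    refine le_trans ?_ (le_abs_self _)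
    gcongr
    exact hC x

lemma mol_bounds {ε : ℝ} (hε : 0 < ε) {V : XX d → ℝ} (hV : BM V) {Cl : ℝ} (hCl : 0 ≤ Cl)
    (h1 : ∀ z, V z ≤ Cl * clamp z.1) (h2 : ∀ z, -(Cl * (1 - clamp z.1)) ≤ V z) {z : XX d}
    (hz0 : 0 ≤ z.1) (hz1 : z.1 ≤ 1) :
    mol ε hε V z ≤ Cl * (z.1 + 3 * ε) ∧ -(Cl * (1 - z.1)) ≤ mol ε hε V z := by
  have b1 : BM fun y : XX d => V (z - y + (2 * ε, 0)) := hV.comp (by fun_prop)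
  constructor
  · rw [← avg_const (d := d) hε (Cl * (z.1 + 3 * ε))]
    refine avg_mono hε b1 (BM.const _) fun y hy => ?_
    have hy2 := abs_lt.1 ((norm_fst_le y).trans_lt hy)
    refine (h1 _).trans ?_
    gcongr
    unfold clamp
    simp only [Prod.fst_add, Prod.fst_sub]
    refine max_le (by linarith) ((min_le_right _ _).trans (by linarith))
  · rw [← avg_const (d := d) hε (-(Cl * (1 - z.1)))]
    refine avg_mono hε (BM.const _) b1 fun y hy => ?_
    have hy2 := abs_lt.1 ((norm_fst_le y).trans_lt hy)
    refine le_trans ?_ (h2 _)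
    gcongr
    unfold clamp
    simp only [Prod.fst_add, Prod.fst_sub]
    refine le_trans ?_ (le_max_right _ _)
    exact le_min hz1 (by linarith)

set_option maxHeartbeats 1000000 in
theorem duality {Ω : Set (Euc d)} (hΩ : Bornology.IsBounded Ω) {ℓ : XX d → ℝ} {A δ Cl Cm : ℝ} (hA : 0 ≤ A)
    (hb : ∀ z, |ℓ z| ≤ Cl) {L : ℝ≥0} (hL : LipschitzWith L ℓ)
    (H0 : ∀ (c : Ctl d) (x : Euc d), Ctl.G ℓ A δ c (0, x) ≤ 0)
    {lam : Measure (XX d)} [IsFiniteMeasure lam] {r u : XX d → ℝ} {w : XX d → Euc d}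
    (hr : Measurable r) (hw : Measurable w) (hu : Measurable u)
    (hri : Integrable r lam) (hwi : Integrable w lam) (hui : Integrable u lam)
    (hΨ : ∫⁻ x, Psi δ (r x) (w x) (u x) ∂lam ≠ ⊤)
    (hsupp : ∀ᵐ x ∂lam, r x ≠ 0 → x ∈ Ioo (0:ℝ) 1 ×ˢ Ω)
    (hCE : ∀ ψ : XX d → ℝ, IsTest ψ → ∫ x, (fderiv ℝ ψ x ((1:ℝ), (0 : Euc d)) * r x
          + fderiv ℝ ψ x ((0:ℝ), w x) + ψ x * u x) ∂lam = 0)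
    (hstrip : ∀ a b : ℝ, 0 ≤ a → a ≤ b → b ≤ 1 →
      ∫ x in (Icc a b ×ˢ univ : Set (XX d)), r x ∂lam ≤ Cm * (b - a)) :
    ∫ x, ℓ x * r x ∂lam ≤ 2 * A * (∫⁻ x, Psi δ (r x) (w x) (u x) ∂lam).toReal := by
  have hℓ := hL.continuous
  have hCl : 0 ≤ Cl := (abs_nonneg _).trans (hb 0)
  have hPm := measurable_Psi δ hr hw hu
  set P : XX d → ℝ := fun x => (Psi δ (r x) (w x) (u x)).toReal with hP
  have hPi : Integrable P lam := integrable_toReal_of_lintegral_ne_top hPm.aemeasurable hΨ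
  have hPe : (∫⁻ x, Psi δ (r x) (w x) (u x) ∂lam).toReal = ∫ x, P x ∂lam :=
    (integral_toReal hPm.aemeasurable (ae_lt_top hPm hΨ)).symm
  rw [hPe]
  have hfin : ∀ᵐ x ∂lam, Psi δ (r x) (w x) (u x) ≠ ⊤ := (ae_lt_top hPm hΨ).mono fun x h => h.ne
  obtain ⟨R, hR0, hR⟩ : ∃ R : ℝ, 0 < R ∧ Ω ⊆ Metric.ball 0 R := by
    obtain ⟨R, hR⟩ := hΩ.subset_ball (0 : Euc d)
    exact ⟨max R 1, by positivity, hR.trans (Metric.ball_subset_ball (le_max_left _ _))⟩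
  let ζ : ContDiffBump (0 : Euc d) := ⟨R, R + 1, hR0, by linarith⟩
  have hVBM : BM (Ctl.val ℓ A δ) := ⟨Ctl.measurable_val hℓ hb H0, Cl, Ctl.abs_val_le hℓ hb H0⟩
  obtain ⟨C1, hC1, hcut⟩ := exists_cutoff
  set D : ℝ := 5 * C1 * Cl + Cl with hD
  have hDn : 0 ≤ D := by positivity
  -- main estimate
  have main : ∀ κ : ℝ, 0 < κ → κ < 1 / 10 →
      ∫ x, ℓ x * r x ∂lam ≤ 2 * A * ∫ x, P x ∂lam + κ * (4 * D * Cm + 3 * L * ∫ x, r x ∂lam) := by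
    intro κ hκ hκ1
    obtain ⟨χ, hχs, hχ0, hχ1, hχsupp, hχeq, hχd⟩ := hcut κ hκ
    set ε : ℝ := κ / 10 with hεdef
    have hε : 0 < ε := by positivity
    set Vε : XX d → ℝ := mol ε hε (Ctl.val ℓ A δ) with hVε
    have hVs : ContDiff ℝ (⊤ : ℕ∞) Vε := contDiff_mol hε hVBM
    set ψ : XX d → ℝ := fun z => χ z.1 * ζ z.2 * Vε z with hψ
    have hζs : ContDiff ℝ (⊤ : ℕ∞) ζ := ζ.contDiff
    have hψs : ContDiff ℝ (⊤ : ℕ∞) ψ :=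
      ((hχs.comp contDiff_fst).mul (hζs.comp contDiff_snd)).mul hVs
    have hts : tsupport ψ ⊆ Icc κ (1 - κ) ×ˢ Metric.closedBall 0 (R + 1) := by
      refine closure_minimal ?_ (isClosed_Icc.prod Metric.isClosed_closedBall)
      intro z hz
      have hz1 := left_ne_zero_of_mul hz
      have h1 := left_ne_zero_of_mul hz1
      have h2 : z.2 ∈ Function.support ζ := right_ne_zero_of_mul hz1
      rw [ζ.support_eq] at h2
      exact ⟨hχsupp _ h1, Metric.ball_subset_closedBall h2⟩
    have hcs : HasCompactSupport ψ :=
      (isCompact_Icc.prod (isCompact_closedBall _ _)).of_isClosed_subset (isClosed_tsupport _) hts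
    have htest : IsTest ψ := by
      refine ⟨hψs, hcs, hts.trans ?_⟩
      intro z hz
      exact ⟨⟨by linarith [hz.1.1], by linarith [hz.1.2]⟩, mem_univ _⟩
    have hI := hCE ψ htest
    -- bounds for ψ and its derivative
    have hDc : Continuous (fderiv ℝ ψ) := hψs.continuous_fderiv (by simp)
    obtain ⟨Cψ, hCψ⟩ := hcs.exists_bound_of_continuous hψs.continuous
    obtain ⟨Cd, hCd⟩ := (hcs.fderiv (𝕜 := ℝ)).exists_bound_of_continuous hDc
    have i1 : Integrable (fun x => fderiv ℝ ψ x ((1:ℝ), (0 : Euc d)) * r x) lam := by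
      refine hri.bdd_mul (c := Cd * ‖(((1:ℝ), (0 : Euc d)) : XX d)‖) ?_ ?_
      · exact (hDc.clm_apply continuous_const).aestronglyMeasurable
      · refine Eventually.of_forall fun x => ((fderiv ℝ ψ x).le_opNorm _).trans ?_
        gcongr
        exact hCd x
    have i2 : Integrable (fun x => fderiv ℝ ψ x ((0:ℝ), w x)) lam := integrable_clm_apply hDc hCd hwi
    have i3 : Integrable (fun x => ψ x * u x) lam :=
      hui.bdd_mul hψs.continuous.aestronglyMeasurable (Eventually.of_forall hCψ)
    have i4 : Integrable (fun x => ℓ x * r x) lam :=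
      hri.bdd_mul hℓ.aestronglyMeasurable (Eventually.of_forall hb)
    set E1 : Set (XX d) := Icc 0 (2 * κ) ×ˢ univ with hE1
    set E2 : Set (XX d) := Icc (1 - 2 * κ) 1 ×ˢ univ with hE2
    have mE1 : MeasurableSet E1 := measurableSet_Icc.prod MeasurableSet.univ
    have mE2 : MeasurableSet E2 := measurableSet_Icc.prod MeasurableSet.univ
    have key : ∀ᵐ x ∂lam, (fderiv ℝ ψ x ((1:ℝ), (0 : Euc d)) * r x
          + fderiv ℝ ψ x ((0:ℝ), w x) + ψ x * u x) ≤
        D * (E1.indicator r x + E2.indicator r x) + (2 * A * P x + 3 * L * κ * r x - ℓ x * r x) := by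
      filter_upwards [hfin, hsupp] with x hx hxs
      rcases Psi_cases hx with ⟨hr0, hPx⟩ | ⟨e1, e2, e3⟩
      swap
      · have hPx : P x = 0 := by simp [hP, Psi, e1, e2, e3]
        have f1 : E1.indicator r x = 0 := by
          by_cases h : x ∈ E1 <;> simp [h, e1]
        have f2 : E2.indicator r x = 0 := by
          by_cases h : x ∈ E2 <;> simp [h, e1]
        rw [hPx, f1, f2, e1, e2, e3]
        have : ((0:ℝ), (0:Euc d)) = 0 := rfl
        rw [this, map_zero]
        simp
      obtain ⟨hx1, hx2⟩ := hxs hr0.ne'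
      have hPx' : P x = (‖w x‖ ^ 2 + δ ^ 2 * u x ^ 2) / (2 * r x) := hPx
      -- derivative of ψ at x
      have hev : ψ =ᶠ[𝓝 x] fun z => χ z.1 * Vε z := by
        have : ∀ᶠ z : XX d in 𝓝 x, z.2 ∈ Metric.ball (0 : Euc d) R :=
          continuous_snd.continuousAt.eventually (Metric.isOpen_ball.mem_nhds (hR hx2))
        filter_upwards [this] with z hz
        have : ζ z.2 = 1 := ζ.one_of_mem_closedBall (Metric.ball_subset_closedBall hz)
        simp [hψ, this]
      have hψx : ψ x = χ x.1 * Vε x := hev.eq_of_nhds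
      have hχd1 : HasFDerivAt (fun z : XX d => χ z.1)
          (deriv χ x.1 • ContinuousLinearMap.fst ℝ ℝ (Euc d)) x :=
        ((hχs.differentiable (by simp) x.1).hasDerivAt).comp_hasFDerivAt x hasFDerivAt_fst
      have hVd : HasFDerivAt Vε (fderiv ℝ Vε x) x := (hVs.differentiable (by simp) x).hasFDerivAt
      have hfd : fderiv ℝ ψ x = χ x.1 • fderiv ℝ Vε x +
          Vε x • (deriv χ x.1 • ContinuousLinearMap.fst ℝ ℝ (Euc d)) := by
        rw [hev.fderiv_eq]
        exact (hχd1.mul hVd).fderiv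
      -- HJB
      obtain ⟨K, hK⟩ := Ctl.val_dpp hℓ hb hL H0 ((r x)⁻¹ • w x) ((r x)⁻¹ * u x)
      have hVb := mol_bounds hε hVBM hCl (Ctl.val_le hℓ hb H0) (Ctl.val_ge hℓ hb H0) hx1.1.le hx1.2.le
      rw [← hVε] at hVb
      -- split w
      have hsplit : fderiv ℝ Vε x ((1:ℝ), (r x)⁻¹ • w x) =
          fderiv ℝ Vε x ((1:ℝ), (0:Euc d)) + (r x)⁻¹ * fderiv ℝ Vε x ((0:ℝ), w x) := by
        rw [← smul_eq_mul, ← map_smul, ← map_add]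
        simp
      have hχpart : χ x.1 * (fderiv ℝ Vε x ((1:ℝ), (0:Euc d)) * r x + fderiv ℝ Vε x ((0:ℝ), w x) + Vε x * u x)
          ≤ χ x.1 * (2 * A * P x - ℓ x * r x + 3 * L * ε * r x) := by
        by_cases hc : χ x.1 = 0
        · simp [hc]
        refine mul_le_mul_of_nonneg_left ?_ (hχ0 _)
        have hx3 := hχsupp _ hc
        have hj := mol_hjb hε (by linarith) hVBM ⟨hℓ.measurable, Cl, hb⟩ hL hK hx1.1.le (by linarith)
        rw [← hVε, hsplit] at hj
        have hj2 := mul_le_mul_of_nonneg_left hj hr0.le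
        have e1 : r x * (fderiv ℝ Vε x ((1:ℝ), (0:Euc d)) + (r x)⁻¹ * fderiv ℝ Vε x ((0:ℝ), w x) +
            (r x)⁻¹ * u x * Vε x) = fderiv ℝ Vε x ((1:ℝ), (0:Euc d)) * r x + fderiv ℝ Vε x ((0:ℝ), w x) + Vε x * u x := by
          field_simp
        have e2 : r x * (A * (‖(r x)⁻¹ • w x‖ ^ 2 + δ ^ 2 * ((r x)⁻¹ * u x) ^ 2) - ℓ x + 3 * L * ε) =
            2 * A * P x - ℓ x * r x + 3 * L * ε * r x := by
          rw [hPx', norm_smul, Real.norm_eq_abs, abs_of_pos (inv_pos.2 hr0)]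
          field_simp
        rw [e1, e2] at hj2
        exact hj2
      have hP0 : 0 ≤ P x := ENNReal.toReal_nonneg
      have n1 : 0 ≤ E1.indicator r x := by
        by_cases h : x ∈ E1
        · rw [indicator_of_mem h]; exact hr0.le
        · rw [indicator_of_notMem h]
      have n2 : 0 ≤ E2.indicator r x := by
        by_cases h : x ∈ E2
        · rw [indicator_of_mem h]; exact hr0.le
        · rw [indicator_of_notMem h]
      -- derivative of cutoff
      have hχ' : deriv χ x.1 * Vε x * r x ≤ 5 * C1 * Cl * (E1.indicator r x + E2.indicator r x) := by
        obtain ⟨p, q, epq, hp0, hq0, hp, hq, hps, hqs⟩ := hχd x.1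
        have t1 : p * Vε x * r x ≤ 5 * C1 * Cl * E1.indicator r x := by
          by_cases hp1 : p = 0
          · rw [hp1]; simp only [zero_mul]; positivity
          have ht := hps hp1
          have : x ∈ E1 := ⟨⟨hx1.1.le, ht.2⟩, mem_univ _⟩
          rw [indicator_of_mem this]
          have v1 : Vε x ≤ Cl * (5 * κ) := hVb.1.trans (by gcongr; linarith [ht.2])
          have : p * Vε x ≤ 5 * C1 * Cl := by
            calc p * Vε x ≤ p * (Cl * (5 * κ)) := by gcongr
              _ ≤ C1 / κ * (Cl * (5 * κ)) := by gcongr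
              _ = 5 * C1 * Cl := by field_simp
          gcongr
        have t2 : -(q * Vε x * r x) ≤ 5 * C1 * Cl * E2.indicator r x := by
          by_cases hp1 : q = 0
          · rw [hp1]; simp only [zero_mul, neg_zero]; positivity
          have ht := hqs hp1
          have : x ∈ E2 := ⟨⟨ht.1, hx1.2.le⟩, mem_univ _⟩
          rw [indicator_of_mem this]
          have v1 : -Vε x ≤ Cl * (5 * κ) := by
            have : Cl * (1 - x.1) ≤ Cl * (5 * κ) := by gcongr; linarith [ht.1]
            linarith [hVb.2]
          have : q * (-Vε x) ≤ 5 * C1 * Cl := by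
            calc q * (-Vε x) ≤ q * (Cl * (5 * κ)) := by gcongr
              _ ≤ C1 / κ * (Cl * (5 * κ)) := by gcongr
              _ = 5 * C1 * Cl := by field_simp
          calc -(q * Vε x * r x) = q * (-Vε x) * r x := by ring
            _ ≤ 5 * C1 * Cl * r x := by gcongr
        rw [epq]
        linarith
      have h1χ : (1 - χ x.1) * (ℓ x * r x) ≤ Cl * (E1.indicator r x + E2.indicator r x) := by
        by_cases hm : 2 * κ ≤ x.1 ∧ x.1 ≤ 1 - 2 * κ
        · rw [hχeq _ hm.1 hm.2]
          simp only [sub_self, zero_mul]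
          positivity
        have hle : (1 - χ x.1) * (ℓ x * r x) ≤ Cl * r x := by
          have a1 := hχ0 x.1
          have a2 := hχ1 x.1
          have a3 : ℓ x * r x ≤ Cl * r x := by gcongr; exact (le_abs_self _).trans (hb x)
          have a4 : 0 ≤ Cl * r x := by positivity
          nlinarith
        have hge : r x ≤ E1.indicator r x + E2.indicator r x := by
          rw [not_and_or, not_le, not_le] at hm
          rcases hm with hm | hm
          · have : x ∈ E1 := ⟨⟨hx1.1.le, hm.le⟩, mem_univ _⟩
            rw [indicator_of_mem this r]; linarith
          · have : x ∈ E2 := ⟨⟨hm.le, hx1.2.le⟩, mem_univ _⟩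
            rw [indicator_of_mem this r]; linarith
        calc _ ≤ Cl * r x := hle
          _ ≤ _ := by gcongr
      have hexp : fderiv ℝ ψ x ((1:ℝ), (0 : Euc d)) * r x + fderiv ℝ ψ x ((0:ℝ), w x) + ψ x * u x =
          deriv χ x.1 * Vε x * r x + χ x.1 * (fderiv ℝ Vε x ((1:ℝ), (0:Euc d)) * r x +
            fderiv ℝ Vε x ((0:ℝ), w x) + Vε x * u x) := by
        rw [hfd, hψx]
        simp only [add_apply, smul_apply,
          ContinuousLinearMap.coe_fst', smul_eq_mul]
        ring
      rw [hexp]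
      have b1 : χ x.1 * (2 * A * P x) ≤ 2 * A * P x := by
        have : 0 ≤ 2 * A * P x := by positivity
        nlinarith [hχ1 x.1]
      have b2 : χ x.1 * (3 * L * ε * r x) ≤ 3 * L * κ * r x := by
        have h1 : 0 ≤ 3 * L * ε * r x := by positivity
        have h2 : 3 * L * ε * r x ≤ 3 * L * κ * r x := by gcongr; linarith
        nlinarith [hχ1 x.1, hχ0 x.1]
      rw [hD]
      nlinarith
    have hintg := integral_mono_ae ((i1.add i2).add i3) (((((hri.indicator mE1).add (hri.indicator mE2)).const_mul D)).add
      (((hPi.const_mul (2 * A)).add (hri.const_mul (3 * L * κ))).sub i4)) key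
    simp only [Pi.add_apply] at hintg
    have hsum : ∫ x, (D * (E1.indicator r x + E2.indicator r x) + (2 * A * P x + 3 * L * κ * r x - ℓ x * r x)) ∂lam =
        D * (∫ x in E1, r x ∂lam + ∫ x in E2, r x ∂lam) +
          (2 * A * ∫ x, P x ∂lam + 3 * L * κ * ∫ x, r x ∂lam - ∫ x, ℓ x * r x ∂lam) := by
      rw [integral_add, integral_const_mul, integral_add (hri.indicator mE1) (hri.indicator mE2),
        integral_indicator mE1, integral_indicator mE2, integral_sub, integral_add, integral_const_mul,
        integral_const_mul]
      · exact hPi.const_mul (2 * A)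
      · exact hri.const_mul (3 * L * κ)
      · exact (hPi.const_mul (2 * A)).add (hri.const_mul (3 * L * κ))
      · exact i4
      · exact ((hri.indicator mE1).add (hri.indicator mE2)).const_mul D
      · exact (((hPi.const_mul (2 * A)).add (hri.const_mul (3 * L * κ))).sub i4)
    have s1 := hstrip 0 (2 * κ) le_rfl (by linarith) (by linarith)
    have s2 := hstrip (1 - 2 * κ) 1 (by linarith) (by linarith) le_rfl
    have s3 : D * (∫ x in E1, r x ∂lam + ∫ x in E2, r x ∂lam) ≤ D * (Cm * (2 * κ) + Cm * (2 * κ)) := by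
      gcongr
      · linarith
      · linarith
    have hfinal := (hI.symm.le.trans hintg)
    simp only [Pi.sub_apply, Pi.add_apply] at hfinal
    rw [hsum] at hfinal
    linarith
  -- limit κ → 0
  set X := ∫ x, ℓ x * r x ∂lam
  set Y := 2 * A * ∫ x, P x ∂lam
  set Z := 4 * D * Cm + 3 * L * ∫ x, r x ∂lam
  have hlim : Tendsto (fun κ : ℝ => Y + κ * Z) (𝓝[>] 0) (𝓝 (Y + 0 * Z)) := by
    have : Continuous fun κ : ℝ => Y + κ * Z := by fun_prop
    exact this.continuousAt.mono_left nhdsWithin_le_nhds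
  rw [zero_mul, add_zero] at hlim
  refine ge_of_tendsto hlim ?_
  filter_upwards [Ioo_mem_nhdsGT (by norm_num : (0:ℝ) < 1 / 10)] with κ hκ
  exact main κ hκ.1 hκ.2

/-! ### generalized cone curves -/

/-- Lebesgue measure on `[0,1]` -/
def v01 : Measure ℝ := volume.restrict (Icc (0:ℝ) 1)

instance : IsProbabilityMeasure v01 := ⟨by
  rw [v01, Measure.restrict_apply_univ, Real.volume_Icc]; simp⟩

/-- square integrable derivative data on `[0,1]` -/
structure L2D {F : Type*} [NormedAddCommGroup F] [MeasurableSpace F] (a : ℝ → F) : Prop where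
  meas : Measurable a
  mem : MemLp a 2 v01
  zero : ∀ s, s ∉ Icc (0:ℝ) 1 → a s = 0

namespace L2D
variable {F : Type*} [NormedAddCommGroup F] [MeasurableSpace F] {a a' : ℝ → F}

lemma int01 (h : L2D a) : Integrable a v01 := h.mem.integrable (by norm_num)

lemma integrable (h : L2D a) : Integrable a volume := by
  have h1 : a = (Icc (0:ℝ) 1).indicator a := by
    ext s
    by_cases hs : s ∈ Icc (0:ℝ) 1
    · rw [indicator_of_mem hs]
    · rw [indicator_of_notMem hs, h.zero s hs]
  rw [h1, integrable_indicator_iff measurableSet_Icc]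
  exact h.int01

lemma ii (h : L2D a) (s t : ℝ) : IntervalIntegrable a volume s t := h.integrable.intervalIntegrable

lemma sq (h : L2D a) : Integrable (fun s => ‖a s‖ ^ 2) v01 := h.mem.integrable_norm_pow (by norm_num)

lemma restr (h : L2D a) {I : Set ℝ} (hI : MeasurableSet I) : L2D (I.indicator a) where
  meas := h.meas.indicator hI
  mem := h.mem.indicator hI
  zero := fun s hs => by
    by_cases hsI : s ∈ I
    · rw [indicator_of_mem hsI, h.zero s hs]
    · rw [indicator_of_notMem hsI]

lemma smul [NormedSpace ℝ F] [BorelSpace F] [SecondCountableTopology F] (h : L2D a) (c : ℝ) :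
    L2D (fun s => c • a s) where
  meas := h.meas.const_smul c
  mem := h.mem.const_smul c
  zero := fun s hs => by simp [h.zero s hs]

variable [NormedSpace ℝ F]

/-- clamping the primitive -/
lemma prim_clamp (h : L2D a) (t : ℝ) : ∫ s in (0:ℝ)..clamp t, a s = ∫ s in (0:ℝ)..t, a s := by
  have key : ∫ s in (clamp t)..t, a s = 0 := by
    rw [← intervalIntegral.integral_zero (a := clamp t) (b := t) (μ := volume) (E := F)]
    refine intervalIntegral.integral_congr_uIoo fun s hs => ?_
    apply h.zero
    intro hs2
    rcases lt_or_ge t 0 with h0 | h0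
    · have : clamp t = 0 := by unfold clamp; rw [min_eq_right (by linarith), max_eq_left h0.le]
      rw [this, uIoo_of_ge h0.le] at hs
      linarith [hs.2, hs2.1]
    · rcases lt_or_ge 1 t with h1 | h1
      · have : clamp t = 1 := by unfold clamp; rw [min_eq_left h1.le, max_eq_right zero_le_one]
        rw [this, uIoo_of_le h1.le] at hs
        linarith [hs.1, hs2.2]
      · rw [clamp_of_mem ⟨h0, h1⟩] at hs
        simp at hs
  rw [← intervalIntegral.integral_add_adjacent_intervals (h.ii 0 (clamp t)) (h.ii (clamp t) t), key, add_zero]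

lemma continuous_prim (h : L2D a) : Continuous fun t => ∫ s in (0:ℝ)..t, a s :=
  intervalIntegral.continuous_primitive (fun s t => h.ii s t) 0

/-- modulus of continuity -/
lemma prim_mod (h : L2D a) {ε : ℝ} (hε : 0 < ε) (s t : ℝ) :
    ‖(∫ r in (0:ℝ)..t, a r) - ∫ r in (0:ℝ)..s, a r‖ ≤ ε * (∫ r, ‖a r‖ ^ 2 ∂v01) + |t - s| / (4 * ε) := by
  rw [intervalIntegral.integral_interval_sub_left (h.ii _ _) (h.ii _ _)]
  refine (intervalIntegral.norm_integral_le_integral_norm_uIoc).trans ?_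
  have hsq : Integrable (fun r => ‖a r‖ ^ 2) volume := by
    have h1 : (fun r => ‖a r‖ ^ 2) = (Icc (0:ℝ) 1).indicator fun r => ‖a r‖ ^ 2 := by
      ext s
      by_cases hs : s ∈ Icc (0:ℝ) 1
      · rw [indicator_of_mem hs]
      · rw [indicator_of_notMem hs, h.zero s hs]; simp
    rw [h1, integrable_indicator_iff measurableSet_Icc]
    exact h.sq
  have hle : ∫ r, ‖a r‖ ^ 2 ∂v01 = ∫ r, ‖a r‖ ^ 2 := by
    rw [v01]
    refine setIntegral_eq_integral_of_forall_compl_eq_zero fun s hs => ?_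
    rw [h.zero s hs]; simp
  have := isFinite_uIoc s t
  calc ∫ r in uIoc s t, ‖a r‖ ≤ ∫ r in uIoc s t, (ε * ‖a r‖ ^ 2 + 1 / (4 * ε)) := by
        refine integral_mono (h.integrable.norm.integrableOn) ((hsq.integrableOn.const_mul ε).add (integrable_const _)) fun r => ?_
        have h0 : 0 ≤ ε * (‖a r‖ - 1 / (2 * ε)) ^ 2 := by positivity
        have e : ε * (‖a r‖ - 1 / (2 * ε)) ^ 2 = ε * ‖a r‖ ^ 2 + 1 / (4 * ε) - ‖a r‖ := by field_simp; ring
        linarith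
    _ = ε * (∫ r in uIoc s t, ‖a r‖ ^ 2) + |t - s| / (4 * ε) := by
        rw [integral_add (hsq.integrableOn.const_mul ε) (integrable_const _), integral_const_mul, integral_const]
        congr 1
        simp [measureReal_def, uIoc, smul_eq_mul]
        rw [max_sub_min_eq_abs]
        ring
    _ ≤ _ := by
        rw [hle]
        gcongr
        · exact Eventually.of_forall fun r => by positivity
        · exact Measure.restrict_le_self

end L2D

lemma weak_cpt {F : Type*} [NormedAddCommGroup F] [InnerProductSpace ℝ F] [CompleteSpace F]
    [MeasurableSpace F] [BorelSpace F] [SecondCountableTopology F]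
    {f : ℕ → ℝ → F} (hf : ∀ n, L2D (f n)) {C : ℝ} (hC : ∀ n, ∫ s, ‖f n s‖ ^ 2 ∂v01 ≤ C) :
    ∃ φ : ℕ → ℕ, StrictMono φ ∧ ∃ g : ℝ → F, L2D g ∧ ∀ h : ℝ → F, MemLp h 2 v01 →
      Tendsto (fun n => ∫ s, inner ℝ (h s) (f (φ n) s) ∂v01) atTop (𝓝 (∫ s, inner ℝ (h s) (g s) ∂v01)) := by
  have : Fact ((1:ℝ≥0∞) ≤ 2) := ⟨by norm_num⟩
  have : Fact ((2:ℝ≥0∞) ≠ ⊤) := ⟨by norm_num⟩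
  let x : ℕ → Lp F 2 v01 := fun n => (hf n).mem.toLp (f n)
  have hx : ∀ n, ‖x n‖ ≤ Real.sqrt C := by
    intro n
    apply Real.le_sqrt_of_sq_le
    rw [← real_inner_self_eq_norm_sq, L2.inner_def]
    refine le_trans (le_of_eq ?_) (hC n)
    refine integral_congr_ae ?_
    filter_upwards [(hf n).mem.coeFn_toLp] with s hs
    rw [hs, real_inner_self_eq_norm_sq]
  let y : ℕ → WeakDual ℝ (Lp F 2 v01) := fun n => StrongDual.toWeakDual (InnerProductSpace.toDual ℝ _ (x n))
  have hy : ∀ n, y n ∈ WeakDual.toStrongDual ⁻¹' Metric.closedBall (0 : StrongDual ℝ (Lp F 2 v01)) (Real.sqrt C) := by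
    intro n
    refine (mem_closedBall_zero_iff (E := StrongDual ℝ (Lp F 2 v01))).2 ?_
    refine le_trans (le_of_eq ?_) (hx n)
    exact (InnerProductSpace.toDual ℝ _).norm_map (x n)
  obtain ⟨ℓ, -, φ, hφ, hlim⟩ := WeakDual.isSeqCompact_closedBall ℝ (Lp F 2 v01) 0 (Real.sqrt C) hy
  let g0 : Lp F 2 v01 := (InnerProductSpace.toDual ℝ _).symm (WeakDual.toStrongDual ℓ)
  have hg0m : Measurable (g0 : ℝ → F) := (Lp.stronglyMeasurable g0).measurable
  have hgae : (Icc (0:ℝ) 1).indicator (g0 : ℝ → F) =ᵐ[v01] g0 := by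
    unfold v01
    exact indicator_ae_eq_restrict measurableSet_Icc
  refine ⟨φ, hφ, (Icc (0:ℝ) 1).indicator g0, ⟨hg0m.indicator measurableSet_Icc,
    (Lp.memLp g0).indicator measurableSet_Icc, fun s hs => indicator_of_notMem hs _⟩, ?_⟩
  intro h hh
  have h1 : Tendsto (fun n => y (φ n) (hh.toLp h)) atTop (𝓝 (ℓ (hh.toLp h))) :=
    ((WeakDual.eval_continuous (hh.toLp h)).tendsto ℓ).comp hlim
  have e1 : ∀ n, y (φ n) (hh.toLp h) = ∫ s, inner ℝ (h s) (f (φ n) s) ∂v01 := by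
    intro n
    have : y (φ n) (hh.toLp h) = inner ℝ (x (φ n)) (hh.toLp h) := rfl
    rw [this, real_inner_comm, L2.inner_def]
    refine integral_congr_ae ?_
    filter_upwards [(hf (φ n)).mem.coeFn_toLp, hh.coeFn_toLp] with s hs hs2
    rw [hs, hs2]
  have e2 : ℓ (hh.toLp h) = ∫ s, inner ℝ (h s) ((Icc (0:ℝ) 1).indicator (g0 : ℝ → F) s) ∂v01 := by
    have : ℓ (hh.toLp h) = inner ℝ g0 (hh.toLp h) := by
      rw [InnerProductSpace.toDual_symm_apply]; rfl
    rw [this, real_inner_comm, L2.inner_def]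
    refine integral_congr_ae ?_
    filter_upwards [hgae, hh.coeFn_toLp] with s hs hs2
    rw [hs, hs2]
  rw [← e2]
  simpa only [e1] using h1

/-- weak convergence tested against constants on intervals: convergence of primitives -/
lemma weak_prim {F : Type*} [NormedAddCommGroup F] [InnerProductSpace ℝ F] [FiniteDimensional ℝ F]
    [MeasurableSpace F] [BorelSpace F]
    {f : ℕ → ℝ → F} (hf : ∀ n, L2D (f n)) {g : ℝ → F} (hg : L2D g)
    (hw : ∀ h : ℝ → F, MemLp h 2 v01 →
      Tendsto (fun n => ∫ s, inner ℝ (h s) (f n s) ∂v01) atTop (𝓝 (∫ s, inner ℝ (h s) (g s) ∂v01))) (t : ℝ) :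
    Tendsto (fun n => ∫ s in (0:ℝ)..t, f n s) atTop (𝓝 (∫ s in (0:ℝ)..t, g s)) := by
  have : CompleteSpace F := FiniteDimensional.complete ℝ F
  have key : ∀ (v : F) (a : ℝ → F), L2D a → ∫ s, inner ℝ ((Ioc 0 (clamp t)).indicator (fun _ => v) s) (a s) ∂v01
      = inner ℝ v (∫ s in (0:ℝ)..t, a s) := by
    intro v a ha
    have hc := clamp_mem t
    rw [← ha.prim_clamp, intervalIntegral.integral_of_le hc.1]
    have : ∀ s, inner ℝ ((Ioc 0 (clamp t)).indicator (fun _ => v) s) (a s)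
        = (Ioc 0 (clamp t)).indicator (fun s => inner ℝ v (a s)) s := by
      intro s
      by_cases hs : s ∈ Ioc 0 (clamp t)
      · simp [hs]
      · simp [hs]
    simp only [this]
    rw [integral_indicator measurableSet_Ioc, v01, Measure.restrict_restrict measurableSet_Ioc,
      inter_eq_left.2 (show Ioc 0 (clamp t) ⊆ Icc 0 1 from fun s hs => ⟨hs.1.le, hs.2.trans hc.2⟩)]
    exact integral_inner (ha.integrable.integrableOn) v
  have hweak : ∀ v : F, Tendsto (fun n => inner ℝ v (∫ s in (0:ℝ)..t, f n s)) atTop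
      (𝓝 (inner ℝ v (∫ s in (0:ℝ)..t, g s))) := by
    intro v
    have := hw ((Ioc 0 (clamp t)).indicator fun _ => v) ((memLp_const v).indicator measurableSet_Ioc)
    rw [key v g hg] at this
    exact this.congr fun n => key v (f n) (hf n)
  let b := stdOrthonormalBasis ℝ F
  have e : ∀ x : F, x = ∑ i, (inner ℝ (b i) x) • b i := fun x => (b.sum_repr' x).symm
  rw [e (∫ s in (0:ℝ)..t, g s)]
  refine (tendsto_finsetSum _ fun i _ => (hweak (b i)).smul_const (b i)).congr fun n => ?_
  exact (e _).symm

/-- locally uniform convergence of primitives -/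
lemma weak_prim_unif {F : Type*} [NormedAddCommGroup F] [InnerProductSpace ℝ F] [FiniteDimensional ℝ F]
    [MeasurableSpace F] [BorelSpace F]
    {f : ℕ → ℝ → F} (hf : ∀ n, L2D (f n)) {g : ℝ → F} (hg : L2D g)
    {C : ℝ} (hC : ∀ n, ∫ s, ‖f n s‖ ^ 2 ∂v01 ≤ C)
    (hw : ∀ h : ℝ → F, MemLp h 2 v01 →
      Tendsto (fun n => ∫ s, inner ℝ (h s) (f n s) ∂v01) atTop (𝓝 (∫ s, inner ℝ (h s) (g s) ∂v01))) (t : ℝ) :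
    Tendsto (fun p : ℕ × ℝ => ∫ s in (0:ℝ)..p.2, f p.1 s) (atTop ×ˢ 𝓝 t) (𝓝 (∫ s in (0:ℝ)..t, g s)) := by
  have h1 : Tendsto (fun p : ℕ × ℝ => ∫ s in (0:ℝ)..t, f p.1 s) (atTop ×ˢ 𝓝 t) (𝓝 (∫ s in (0:ℝ)..t, g s)) :=
    (weak_prim hf hg hw t).comp tendsto_fst
  have h2 : Tendsto (fun p : ℕ × ℝ => (∫ s in (0:ℝ)..p.2, f p.1 s) - ∫ s in (0:ℝ)..t, f p.1 s) (atTop ×ˢ 𝓝 t) (𝓝 0) := by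
    have hC0 : 0 ≤ C := le_trans (integral_nonneg fun s => by positivity) (hC 0)
    rw [Metric.tendsto_nhds]
    intro ε hε
    have hη : 0 < ε / (2 * (C + 1)) := by positivity
    set η := ε / (2 * (C + 1))
    have hn : ∀ᶠ s in 𝓝 t, |s - t| < ε * (4 * η) / 2 := by
      have := Metric.ball_mem_nhds t (show 0 < ε * (4 * η) / 2 by positivity)
      filter_upwards [this] with s hs
      rwa [Metric.mem_ball, Real.dist_eq] at hs
    filter_upwards [tendsto_snd.eventually hn] with p hp
    rw [dist_zero_right]
    refine ((hf p.1).prim_mod hη t p.2).trans_lt ?_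
    have a1 : η * ∫ r, ‖f p.1 r‖ ^ 2 ∂v01 ≤ η * C := by gcongr; exact hC _
    have a2 : η * C ≤ ε / 2 := by
      simp only [η]; rw [div_mul_eq_mul_div, div_le_div_iff₀ (by positivity) (by positivity)]; nlinarith
    have a3 : |p.2 - t| / (4 * η) < ε / 2 := by
      rw [div_lt_iff₀ (by positivity)]; linarith
    linarith
  have := h2.add h1
  simpa using this

/-- generalized cone curves: `u = √h`, `z = √h γ`, `w = √h γ'` -/
structure GC (d : ℕ) where
  u0 : ℝ
  z0 : Euc d
  a : ℝ → ℝ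
  b : ℝ → Euc d
  w : ℝ → Euc d
  ha : L2D a
  hb : L2D b
  hw : L2D w

namespace GC

/-- square root of the mass -/
def u (η : GC d) (t : ℝ) : ℝ := η.u0 + ∫ s in (0:ℝ)..t, η.a s
/-- position times square root of the mass -/
def z (η : GC d) (t : ℝ) : Euc d := η.z0 + ∫ s in (0:ℝ)..t, η.b s

lemma continuous_u (η : GC d) : Continuous η.u := continuous_const.add η.ha.continuous_prim
lemma continuous_z (η : GC d) : Continuous η.z := continuous_const.add η.hb.continuous_prim

lemma u_clamp (η : GC d) (t : ℝ) : η.u (clamp t) = η.u t := by simp [u, η.ha.prim_clamp]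
lemma z_clamp (η : GC d) (t : ℝ) : η.z (clamp t) = η.z t := by simp [z, η.hb.prim_clamp]

lemma u_zero (η : GC d) : η.u 0 = η.u0 := by simp [u]
lemma z_zero (η : GC d) : η.z 0 = η.z0 := by simp [z]

lemma ae_deriv (η : GC d) : ∀ᵐ t, HasDerivAt η.u (η.a t) t ∧ HasDerivAt η.z (η.b t) t := by
  filter_upwards [LocallyIntegrable.ae_hasDerivAt_integral η.ha.integrable.locallyIntegrable,
    LocallyIntegrable.ae_hasDerivAt_integral η.hb.integrable.locallyIntegrable] with t h1 h2
  exact ⟨(h1 0).const_add _, (h2 0).const_add _⟩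

/-- constraint -/
structure Ok (S : Set (Euc d)) (η : GC d) : Prop where
  nn : ∀ t, 0 ≤ η.u t
  pos : ∀ t, ∃ x ∈ S, η.z t = η.u t • x
  con : ∀ᵐ t ∂v01, η.u t • η.b t = η.u t • η.w t + η.a t • η.z t

/-- energy -/
def E (α β δ : ℝ) (η : GC d) : ℝ :=
  ∫ t, (β / 2 * (‖η.w t‖ ^ 2 + 4 * δ ^ 2 * ‖η.a t‖ ^ 2) + α * ‖η.u t‖ ^ 2) ∂v01

lemma u_sq_int (η : GC d) : Integrable (fun t => ‖η.u t‖ ^ 2) v01 :=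
  ((η.continuous_u.norm.pow 2).continuousOn (s := Icc 0 1)).integrableOn_compact isCompact_Icc

lemma E_eq (α β δ : ℝ) (η : GC d) : η.E α β δ = β / 2 * ((∫ t, ‖η.w t‖ ^ 2 ∂v01) + 4 * δ ^ 2 * ∫ t, ‖η.a t‖ ^ 2 ∂v01)
    + α * ∫ t, ‖η.u t‖ ^ 2 ∂v01 := by
  unfold E
  rw [integral_add, integral_const_mul, integral_const_mul, integral_add, integral_const_mul]
  · exact η.hw.sq
  · exact η.ha.sq.const_mul _
  · exact (η.hw.sq.add (η.ha.sq.const_mul _)).const_mul _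
  · exact η.u_sq_int.const_mul _

lemma E_nonneg {α β δ : ℝ} (hα : 0 ≤ α) (hβ : 0 ≤ β) (η : GC d) : 0 ≤ η.E α β δ := by
  unfold E
  exact integral_nonneg fun t => by positivity

lemma Ok.norm_z {S : Set (Euc d)} {η : GC d} (h : η.Ok S) {R : ℝ} (hR : ∀ x ∈ S, ‖x‖ ≤ R) (t : ℝ) :
    ‖η.z t‖ ≤ R * η.u t := by
  obtain ⟨x, hx, e⟩ := h.pos t
  rw [e, norm_smul, Real.norm_of_nonneg (h.nn t), mul_comm]
  exact mul_le_mul_of_nonneg_right (hR x hx) (h.nn t)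

/-- on the zero set of `u`, the derivatives vanish -/
lemma Ok.ae_zero {S : Set (Euc d)} {η : GC d} (h : η.Ok S) (hS : Bornology.IsBounded S) :
    ∀ᵐ t, η.u t = 0 → η.a t = 0 ∧ η.b t = 0 := by
  obtain ⟨R, hR⟩ := hS.exists_norm_le
  filter_upwards [η.ae_deriv] with t ⟨h1, h2⟩ h0
  have ha : η.a t = 0 := by
    have : IsLocalMin η.u t := Eventually.of_forall fun s => by rw [h0]; exact h.nn s
    exact this.hasDerivAt_eq_zero h1
  refine ⟨ha, ?_⟩
  have hz : ∀ s, ‖η.z s‖ ≤ R * η.u s := h.norm_z hR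
  ext i
  have hzi : HasDerivAt (fun s => η.z s i) (η.b t i) t := by
    have := (EuclideanSpace.proj i : Euc d →L[ℝ] ℝ).hasFDerivAt.comp_hasDerivAt t h2
    exact this
  have h3 : HasDerivAt (fun s => R * η.u s - η.z s i) (R * η.a t - η.b t i) t := (h1.const_mul R).sub hzi
  have hle : ∀ s, η.z s i ≤ ‖η.z s‖ := fun s => (le_abs_self _).trans (PiLp.norm_apply_le (η.z s) i)
  have hz0 : η.z t = 0 := by
    have := hz t
    rw [h0, mul_zero] at this
    exact norm_le_zero_iff.1 this
  have : IsLocalMin (fun s => R * η.u s - η.z s i) t := Eventually.of_forall fun s => by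
    simp only [h0, hz0]
    have := (hle s).trans (hz s)
    simp
    linarith
  have := this.hasDerivAt_eq_zero h3
  rw [ha] at this
  simp at this ⊢
  exact this

lemma v01_of_ae {p : ℝ → Prop} (h : ∀ᵐ t, p t) : ∀ᵐ t ∂v01, p t := ae_restrict_of_ae h

lemma Ok.norm_b {S : Set (Euc d)} {η : GC d} (h : η.Ok S) {R : ℝ} (hR : ∀ x ∈ S, ‖x‖ ≤ R) :
    ∀ᵐ t ∂v01, ‖η.b t‖ ≤ ‖η.w t‖ + |η.a t| * R := by
  have hS : Bornology.IsBounded S := isBounded_iff_forall_norm_le.2 ⟨R, hR⟩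
  filter_upwards [h.con, v01_of_ae (h.ae_zero hS)] with t h1 h2
  have hR0 : 0 ≤ R := by
    obtain ⟨x, hx, -⟩ := h.pos 0
    exact (norm_nonneg x).trans (hR x hx)
  rcases eq_or_lt_of_le (h.nn t) with h0 | h0
  · rw [(h2 h0.symm).2]
    simp
    positivity
  · obtain ⟨x, hx, e⟩ := h.pos t
    have : η.b t = η.w t + η.a t • x := by
      have h3 : η.u t • η.b t = η.u t • (η.w t + η.a t • x) := by
        rw [h1, e, smul_add, smul_comm]
      exact smul_right_injective _ h0.ne' h3
    rw [this]
    refine (norm_add_le _ _).trans ?_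
    rw [norm_smul, Real.norm_eq_abs]
    gcongr
    exact hR x hx

lemma bounds {α β δ : ℝ} (hα : 0 < α) (hβ : 0 < β) (hδ : 0 < δ) {η : GC d} (hE : η.E α β δ ≤ 1) :
    (∫ t, ‖η.w t‖ ^ 2 ∂v01 ≤ 2 / β) ∧ (∫ t, ‖η.a t‖ ^ 2 ∂v01 ≤ 1 / (2 * β * δ ^ 2)) ∧ ∫ t, ‖η.u t‖ ^ 2 ∂v01 ≤ 1 / α := by
  rw [E_eq] at hE
  have h1 : 0 ≤ ∫ t, ‖η.w t‖ ^ 2 ∂v01 := integral_nonneg fun t => by positivity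
  have h2 : 0 ≤ ∫ t, ‖η.a t‖ ^ 2 ∂v01 := integral_nonneg fun t => by positivity
  have h3 : 0 ≤ ∫ t, ‖η.u t‖ ^ 2 ∂v01 := integral_nonneg fun t => by positivity
  generalize (∫ t, ‖η.w t‖ ^ 2 ∂v01) = W at *
  generalize (∫ t, ‖η.a t‖ ^ 2 ∂v01) = A at *
  generalize (∫ t, ‖η.u t‖ ^ 2 ∂v01) = U at *
  have e1 : 0 ≤ β * W := by positivity
  have e2 : 0 ≤ β * δ ^ 2 * A := by positivity
  have e3 : 0 ≤ α * U := by positivity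
  refine ⟨?_, ?_, ?_⟩
  · rw [le_div_iff₀ hβ]; nlinarith
  · rw [le_div_iff₀ (by positivity)]; nlinarith
  · rw [le_div_iff₀ hα]; nlinarith

lemma u_bound {α β δ : ℝ} (hα : 0 < α) (hβ : 0 < β) (hδ : 0 < δ) : ∃ C, 0 ≤ C ∧ ∀ η : GC d, η.E α β δ ≤ 1 →
    ∀ t, |η.u t| ≤ C := by
  refine ⟨(1 + 1 / α) / 2 + (1 / (2 * β * δ ^ 2) + 1 / 4), by positivity, fun η hE t => ?_⟩
  obtain ⟨-, h2, h3⟩ := bounds hα hβ hδ hE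
  have key : ∀ s ∈ Icc (0:ℝ) 1, |η.u t| ≤ (1 + ‖η.u s‖ ^ 2) / 2 + (1 / (2 * β * δ ^ 2) + 1 / 4) := by
    intro s hs
    have := η.ha.prim_mod one_pos s (clamp t)
    rw [η.ha.prim_clamp] at this
    have e : η.u t - η.u s = (∫ r in (0:ℝ)..t, η.a r) - ∫ r in (0:ℝ)..s, η.a r := by simp [u]
    rw [← e] at this
    have h4 : |clamp t - s| ≤ 1 := by
      have := clamp_mem t
      rw [abs_le]; constructor <;> linarith [hs.1, hs.2, this.1, this.2]
    have h5 : |η.u t| ≤ ‖η.u t - η.u s‖ + |η.u s| := by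
      have := norm_add_le (η.u t - η.u s) (η.u s)
      rw [sub_add_cancel] at this
      exact this
    rw [Real.norm_eq_abs (η.u s)]
    nlinarith [sq_nonneg (|η.u s| - 1)]
  have i1 : Integrable (fun s => 1 + ‖η.u s‖ ^ 2) v01 := (integrable_const _).add η.u_sq_int
  have h6 : ∫ s, |η.u t| ∂v01 ≤ ∫ s, ((1 + ‖η.u s‖ ^ 2) / 2 + (1 / (2 * β * δ ^ 2) + 1 / 4)) ∂v01 := by
    refine integral_mono_ae (integrable_const _) ((i1.div_const _).add (integrable_const _)) ?_
    unfold v01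
    filter_upwards [ae_restrict_mem measurableSet_Icc] with s hs using key s hs
  rw [integral_add (i1.div_const _) (integrable_const _), integral_div,
    integral_add (integrable_const _) η.u_sq_int] at h6
  simp at h6 ⊢
  simp at h3
  linarith

end GC

/-- weak convergence in `L²([0,1])` -/
def WeakTo {F : Type*} [NormedAddCommGroup F] [InnerProductSpace ℝ F] (f : ℕ → ℝ → F) (g : ℝ → F) : Prop :=
  ∀ h : ℝ → F, MemLp h 2 v01 →
    Tendsto (fun n => ∫ s, inner ℝ (h s) (f n s) ∂v01) atTop (𝓝 (∫ s, inner ℝ (h s) (g s) ∂v01))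

lemma WeakTo.sub {F : Type*} [NormedAddCommGroup F] [InnerProductSpace ℝ F] {f : ℕ → ℝ → F} {g : ℝ → F}
    (h : WeakTo f g) {φ : ℕ → ℕ} (hφ : StrictMono φ) : WeakTo (fun n => f (φ n)) g := fun h' hh =>
  (h h' hh).comp hφ.tendsto_atTop

lemma memLp_inner {F : Type*} [NormedAddCommGroup F] [InnerProductSpace ℝ F] {f g : ℝ → F}
    (hf : MemLp f 2 v01) (hg : MemLp g 2 v01) : Integrable (fun s => (inner ℝ (f s) (g s) : ℝ)) v01 := by
  have i1 : Integrable (fun s => ‖f s‖ ^ 2) v01 := hf.integrable_norm_pow (by norm_num)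
  have i2 : Integrable (fun s => ‖g s‖ ^ 2) v01 := hg.integrable_norm_pow (by norm_num)
  refine (i1.add i2).mono' (hf.1.inner hg.1) (Eventually.of_forall fun s => ?_)
  refine (norm_inner_le_norm _ _).trans ?_
  simp only [Pi.add_apply]
  nlinarith [sq_nonneg (‖f s‖ - ‖g s‖), sq_nonneg ‖f s‖, sq_nonneg ‖g s‖]

lemma strong_weak {F : Type*} [NormedAddCommGroup F] [InnerProductSpace ℝ F]
    {f : ℕ → ℝ → F} {g : ℝ → F} (hf : ∀ n, MemLp (f n) 2 v01) {C : ℝ} (hC : ∀ n, ∫ s, ‖f n s‖ ^ 2 ∂v01 ≤ C)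
    (hw : WeakTo f g) {p : ℕ → ℝ → F} {q : ℝ → F} (hp : ∀ n, MemLp (p n) 2 v01) (hq : MemLp q 2 v01)
    (hpq : Tendsto (fun n => ∫ s, ‖p n s - q s‖ ^ 2 ∂v01) atTop (𝓝 0)) :
    Tendsto (fun n => ∫ s, inner ℝ (p n s) (f n s) ∂v01) atTop (𝓝 (∫ s, inner ℝ (q s) (g s) ∂v01)) := by
  have hC0 : 0 ≤ C := le_trans (integral_nonneg fun s => by positivity) (hC 0)
  have h2 : Tendsto (fun n => ∫ s, inner ℝ (p n s - q s) (f n s) ∂v01) atTop (𝓝 0) := by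
    rw [Metric.tendsto_nhds]
    intro ε hε
    have hη : 0 < ε / (C + 1) := by positivity
    set η := ε / (C + 1) with hηd
    have hlt : ∀ᶠ n in atTop, ∫ s, ‖p n s - q s‖ ^ 2 ∂v01 < ε * η :=
      hpq.eventually (gt_mem_nhds (by positivity))
    filter_upwards [hlt] with n hn
    rw [dist_zero_right]
    have i1 : Integrable (fun s => ‖p n s - q s‖ ^ 2) v01 := ((hp n).sub hq).integrable_norm_pow (by norm_num)
    have i2 : Integrable (fun s => ‖f n s‖ ^ 2) v01 := (hf n).integrable_norm_pow (by norm_num)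
    have h3 : ‖∫ s, inner ℝ (p n s - q s) (f n s) ∂v01‖ ≤ ∫ s, (1 / (2 * η) * ‖p n s - q s‖ ^ 2 + η / 2 * ‖f n s‖ ^ 2) ∂v01 := by
      refine norm_integral_le_of_norm_le ((i1.const_mul _).add (i2.const_mul _)) (Eventually.of_forall fun s => ?_)
      refine (norm_inner_le_norm _ _).trans ?_
      have h0 : 0 ≤ (1 / (2 * η)) * (‖p n s - q s‖ - η * ‖f n s‖) ^ 2 := by positivity
      have e : (1 / (2 * η)) * (‖p n s - q s‖ - η * ‖f n s‖) ^ 2 = 1 / (2 * η) * ‖p n s - q s‖ ^ 2 + η / 2 * ‖f n s‖ ^ 2 - ‖p n s - q s‖ * ‖f n s‖ := by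
        field_simp; ring
      linarith
    rw [integral_add (i1.const_mul _) (i2.const_mul _), integral_const_mul, integral_const_mul] at h3
    refine h3.trans_lt ?_
    have a1 : 1 / (2 * η) * ∫ s, ‖p n s - q s‖ ^ 2 ∂v01 < ε / 2 := by
      rw [div_mul_eq_mul_div, div_lt_div_iff₀ (by positivity) (by positivity)]; nlinarith
    have a2 : η / 2 * ∫ s, ‖f n s‖ ^ 2 ∂v01 ≤ η / 2 * C := by gcongr; exact hC n
    have a3 : η / 2 * C ≤ ε / 2 := by
      rw [hηd, div_div, div_mul_eq_mul_div, div_le_div_iff₀ (by positivity) (by positivity)]; nlinarith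
    linarith
  have := h2.add (hw q hq)
  rw [zero_add] at this
  refine this.congr fun n => ?_
  rw [← integral_add]
  · refine integral_congr_ae (Eventually.of_forall fun s => ?_)
    simp only
    rw [← inner_add_left, sub_add_cancel]
  · have := ((hp n).sub hq)
    exact memLp_inner this (hf n)
  · exact memLp_inner hq (hf n)

lemma strong_of_ptwise {F : Type*} [NormedAddCommGroup F]
    {p : ℕ → ℝ → F} {q : ℝ → F} (hp : ∀ n, AEStronglyMeasurable (p n) v01) (hq : AEStronglyMeasurable q v01) {C : ℝ}
    (hpC : ∀ n s, ‖p n s‖ ≤ C) (hqC : ∀ s, ‖q s‖ ≤ C) (hlim : ∀ s, Tendsto (fun n => p n s) atTop (𝓝 (q s))) :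
    Tendsto (fun n => ∫ s, ‖p n s - q s‖ ^ 2 ∂v01) atTop (𝓝 0) := by
  rw [← integral_zero ℝ ℝ (μ := v01)]
  refine tendsto_integral_of_dominated_convergence (fun _ => (2 * C) ^ 2) (fun n => ((hp n).sub hq).norm.pow 2) (integrable_const _) ?_ ?_
  · refine fun n => Eventually.of_forall fun s => ?_
    rw [Real.norm_of_nonneg (by positivity)]
    gcongr
    refine (norm_sub_le _ _).trans ?_
    linarith [hpC n s, hqC s]
  · refine Eventually.of_forall fun s => ?_
    have := (((hlim s).sub_const (q s)).norm).pow 2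
    simpa using this

lemma memLp_bdd {F : Type*} [NormedAddCommGroup F] {p : ℝ → F} (hp : AEStronglyMeasurable p v01) {C : ℝ}
    (h : ∀ s, ‖p s‖ ≤ C) : MemLp p 2 v01 := MemLp.of_bound hp C (Eventually.of_forall h)

namespace GC

theorem compactness {S : Set (Euc d)} (hS : IsCompact S) {α β δ : ℝ} (hα : 0 < α) (hβ : 0 < β) (hδ : 0 < δ)
    (η : ℕ → GC d) (hok : ∀ n, (η n).Ok S) (hE : ∀ n, (η n).E α β δ ≤ 1) :
    ∃ φ : ℕ → ℕ, StrictMono φ ∧ ∃ η' : GC d, η'.Ok S ∧ η'.E α β δ ≤ 1 ∧ ∀ t,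
      Tendsto (fun p : ℕ × ℝ => (η (φ p.1)).u p.2) (atTop ×ˢ 𝓝 t) (𝓝 (η'.u t)) ∧
      Tendsto (fun p : ℕ × ℝ => (η (φ p.1)).z p.2) (atTop ×ˢ 𝓝 t) (𝓝 (η'.z t)) := by
  obtain ⟨R, hR⟩ := hS.isBounded.exists_norm_le
  have hR0 : 0 ≤ R := by
    obtain ⟨x, hx, -⟩ := (hok 0).pos 0
    exact (norm_nonneg x).trans (hR x hx)
  obtain ⟨Cu, hCu0, hCu⟩ := u_bound (d := d) hα hβ hδ
  have hu : ∀ n t, |(η n).u t| ≤ Cu := fun n t => hCu _ (hE n) t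
  have hz : ∀ n t, ‖(η n).z t‖ ≤ R * Cu := fun n t => ((hok n).norm_z hR t).trans
    (mul_le_mul_of_nonneg_left ((le_abs_self _).trans (hu n t)) hR0)
  have hbd := fun n => bounds hα hβ hδ (hE n)
  set Cw := 2 / β
  set Ca := 1 / (2 * β * δ ^ 2)
  have hbb : ∀ n, ∫ t, ‖(η n).b t‖ ^ 2 ∂v01 ≤ 2 * Cw + 2 * R ^ 2 * Ca := by
    intro n
    have i1 := (η n).hw.sq
    have i2 := (η n).ha.sq
    calc ∫ t, ‖(η n).b t‖ ^ 2 ∂v01 ≤ ∫ t, (2 * ‖(η n).w t‖ ^ 2 + 2 * R ^ 2 * ‖(η n).a t‖ ^ 2) ∂v01 := by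
          refine integral_mono_ae (η n).hb.sq ((i1.const_mul _).add (i2.const_mul _)) ?_
          filter_upwards [(hok n).norm_b hR] with t ht
          rw [Real.norm_eq_abs]
          have h0 : 0 ≤ ‖(η n).b t‖ := norm_nonneg _
          nlinarith [sq_nonneg (‖(η n).w t‖ - |(η n).a t| * R), norm_nonneg ((η n).w t), abs_nonneg ((η n).a t)]
      _ = 2 * (∫ t, ‖(η n).w t‖ ^ 2 ∂v01) + 2 * R ^ 2 * ∫ t, ‖(η n).a t‖ ^ 2 ∂v01 := by
          rw [integral_add (i1.const_mul _) (i2.const_mul _), integral_const_mul, integral_const_mul]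
      _ ≤ _ := by gcongr; exacts [(hbd n).1, (hbd n).2.1]
  -- extraction
  obtain ⟨φ1, hφ1, a, ha, hwa⟩ := weak_cpt (fun n => (η n).ha) (fun n => (hbd n).2.1)
  obtain ⟨φ2, hφ2, b, hb, hwb⟩ := weak_cpt (fun n => (η (φ1 n)).hb) (fun n => hbb (φ1 n))
  obtain ⟨φ3, hφ3, w, hw, hww⟩ := weak_cpt (fun n => (η (φ1 (φ2 n))).hw) (fun n => (hbd (φ1 (φ2 n))).1)
  have hcpt : IsCompact (Metric.closedBall (0:ℝ) Cu ×ˢ Metric.closedBall (0 : Euc d) (R * Cu)) :=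
    (isCompact_closedBall _ _).prod (isCompact_closedBall _ _)
  obtain ⟨⟨u0, z0⟩, -, φ4, hφ4, hlim⟩ := hcpt.tendsto_subseq
    (x := fun n => ((η (φ1 (φ2 (φ3 n)))).u0, (η (φ1 (φ2 (φ3 n)))).z0)) (fun n => by
      rw [mem_prod, mem_closedBall_zero_iff, mem_closedBall_zero_iff]
      exact ⟨by rw [← u_zero]; exact hu _ _, by rw [← z_zero]; exact hz _ _⟩)
  set φ : ℕ → ℕ := fun n => φ1 (φ2 (φ3 (φ4 n))) with hφd
  have hφ : StrictMono φ := hφ1.comp (hφ2.comp (hφ3.comp hφ4))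
  have Wa : WeakTo (fun n => (η (φ n)).a) a := WeakTo.sub (f := fun n => (η (φ1 n)).a) hwa (hφ2.comp (hφ3.comp hφ4))
  have Wb : WeakTo (fun n => (η (φ n)).b) b := WeakTo.sub (f := fun n => (η (φ1 (φ2 n))).b) hwb (hφ3.comp hφ4)
  have Ww : WeakTo (fun n => (η (φ n)).w) w := WeakTo.sub (f := fun n => (η (φ1 (φ2 (φ3 n)))).w) hww hφ4
  have hu0 : Tendsto (fun n => (η (φ n)).u0) atTop (𝓝 u0) := (continuous_fst.tendsto _).comp hlim
  have hz0 : Tendsto (fun n => (η (φ n)).z0) atTop (𝓝 z0) := (continuous_snd.tendsto _).comp hlim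
  let η' : GC d := ⟨u0, z0, a, b, w, ha, hb, hw⟩
  have Hu : ∀ t, Tendsto (fun p : ℕ × ℝ => (η (φ p.1)).u p.2) (atTop ×ˢ 𝓝 t) (𝓝 (η'.u t)) := fun t =>
    (hu0.comp tendsto_fst).add (weak_prim_unif (fun n => (η (φ n)).ha) ha (fun n => (hbd (φ n)).2.1) Wa t)
  have Hz : ∀ t, Tendsto (fun p : ℕ × ℝ => (η (φ p.1)).z p.2) (atTop ×ˢ 𝓝 t) (𝓝 (η'.z t)) := fun t =>
    (hz0.comp tendsto_fst).add (weak_prim_unif (fun n => (η (φ n)).hb) hb (fun n => hbb (φ n)) Wb t)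
  have hdiag : ∀ t : ℝ, Tendsto (fun n : ℕ => (n, t)) atTop (atTop ×ˢ 𝓝 t) := fun t =>
    tendsto_id.prodMk tendsto_const_nhds
  have Pu : ∀ t, Tendsto (fun n => (η (φ n)).u t) atTop (𝓝 (η'.u t)) := fun t => (Hu t).comp (hdiag t)
  have Pz : ∀ t, Tendsto (fun n => (η (φ n)).z t) atTop (𝓝 (η'.z t)) := fun t => (Hz t).comp (hdiag t)
  have hu' : ∀ t, ‖η'.u t‖ ≤ Cu := fun t => le_of_tendsto (Pu t).norm (Eventually.of_forall fun n => hu _ t)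
  have hz' : ∀ t, ‖η'.z t‖ ≤ R * Cu := fun t => le_of_tendsto (Pz t).norm (Eventually.of_forall fun n => hz _ t)
  refine ⟨φ, hφ, η', ⟨?_, ?_, ?_⟩, ?_, fun t => ⟨Hu t, Hz t⟩⟩
  · exact fun t => ge_of_tendsto' (Pu t) fun n => (hok _).nn t
  · intro t
    choose x hxS hx using fun n => (hok (φ n)).pos t
    obtain ⟨y, hyS, ψ, hψ, hy⟩ := hS.tendsto_subseq hxS
    refine ⟨y, hyS, ?_⟩
    have h1 := (Pz t).comp hψ.tendsto_atTop
    have h2 := ((Pu t).comp hψ.tendsto_atTop).smul hy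
    refine tendsto_nhds_unique h1 (h2.congr fun n => ?_)
    simp only [Function.comp_apply]
    rw [hx]
  · have key : ∀ (e : ℝ → Euc d) (Ce : ℝ), Measurable e → (∀ s, ‖e s‖ ≤ Ce) →
        ∫ s, inner ℝ (e s) (η'.u s • b s - η'.u s • w s - a s • η'.z s) ∂v01 = 0 := by
      intro e Ce he hCe
      have hCe0 : 0 ≤ Ce := (norm_nonneg _).trans (hCe 0)
      have m1 : ∀ ξ : GC d, AEStronglyMeasurable (fun s => ξ.u s • e s) v01 := fun ξ =>
        (ξ.continuous_u.measurable.smul he).aestronglyMeasurable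
      have m2 : ∀ ξ : GC d, AEStronglyMeasurable (fun s => inner ℝ (e s) (ξ.z s)) v01 := fun ξ =>
        (he.inner ξ.continuous_z.measurable).aestronglyMeasurable
      have b1 : ∀ (ξ : GC d), (∀ t, ‖ξ.u t‖ ≤ Cu) → ∀ s, ‖ξ.u s • e s‖ ≤ Cu * Ce := fun ξ h s => by
        rw [norm_smul]; exact mul_le_mul (h s) (hCe s) (norm_nonneg _) hCu0
      have b2 : ∀ (ξ : GC d), (∀ t, ‖ξ.z t‖ ≤ R * Cu) → ∀ s, ‖inner ℝ (e s) (ξ.z s)‖ ≤ Ce * (R * Cu) := fun ξ h s =>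
        (norm_inner_le_norm _ _).trans (mul_le_mul (hCe s) (h s) (norm_nonneg _) hCe0)
      have s1 := strong_of_ptwise (fun n => m1 (η (φ n))) (m1 η') (fun n => b1 (η (φ n)) (hu (φ n))) (b1 η' hu')
        (fun s => (Pu s).smul_const (e s))
      have s2 := strong_of_ptwise (fun n => m2 (η (φ n))) (m2 η') (fun n => b2 (η (φ n)) (hz (φ n))) (b2 η' hz')
        (fun s => (tendsto_const_nhds (x := e s)).inner (Pz s))
      have M1 : ∀ ξ : GC d, (∀ t, ‖ξ.u t‖ ≤ Cu) → MemLp (fun s => ξ.u s • e s) 2 v01 := fun ξ h => memLp_bdd (m1 ξ) (b1 ξ h)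
      have M2 : ∀ ξ : GC d, (∀ t, ‖ξ.z t‖ ≤ R * Cu) → MemLp (fun s => (inner ℝ (e s) (ξ.z s) : ℝ)) 2 v01 := fun ξ h => memLp_bdd (m2 ξ) (b2 ξ h)
      have t1 := strong_weak (fun n => (η (φ n)).hb.mem) (fun n => hbb (φ n)) Wb (fun n => M1 _ (hu (φ n))) (M1 η' hu') s1
      have t2 := strong_weak (fun n => (η (φ n)).hw.mem) (fun n => (hbd (φ n)).1) Ww (fun n => M1 _ (hu (φ n))) (M1 η' hu') s1
      have t3 := strong_weak (fun n => (η (φ n)).ha.mem) (fun n => (hbd (φ n)).2.1) Wa (fun n => M2 _ (hz (φ n))) (M2 η' hz') s2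
      have t := (t1.sub t2).sub t3
      have comb : ∀ ξ : GC d, (∀ t, ‖ξ.u t‖ ≤ Cu) → (∀ t, ‖ξ.z t‖ ≤ R * Cu) →
          (∫ s, inner ℝ (ξ.u s • e s) (ξ.b s) ∂v01) - (∫ s, inner ℝ (ξ.u s • e s) (ξ.w s) ∂v01) - (∫ s, inner ℝ (inner ℝ (e s) (ξ.z s) : ℝ) (ξ.a s) ∂v01)
          = ∫ s, inner ℝ (e s) (ξ.u s • ξ.b s - ξ.u s • ξ.w s - ξ.a s • ξ.z s) ∂v01 := by
        intro ξ h1 h2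
        have j1 : Integrable (fun s => (inner ℝ (ξ.u s • e s) (ξ.b s) : ℝ)) v01 := memLp_inner (M1 ξ h1) ξ.hb.mem
        have j2 : Integrable (fun s => (inner ℝ (ξ.u s • e s) (ξ.w s) : ℝ)) v01 := memLp_inner (M1 ξ h1) ξ.hw.mem
        have j3 : Integrable (fun s => (inner ℝ (inner ℝ (e s) (ξ.z s) : ℝ) (ξ.a s) : ℝ)) v01 := memLp_inner (M2 ξ h2) ξ.ha.mem
        have j12 : Integrable (fun s => (inner ℝ (ξ.u s • e s) (ξ.b s) : ℝ) - inner ℝ (ξ.u s • e s) (ξ.w s)) v01 := j1.sub j2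
        rw [← integral_sub j1 j2, ← integral_sub j12 j3]
        refine integral_congr_ae (Eventually.of_forall fun s => ?_)
        simp only [Pi.sub_apply, inner_sub_right, inner_smul_right, real_inner_smul_left]
        simp
      have hz0 := tendsto_nhds_unique t (tendsto_const_nhds.congr (f₁ := fun _ => (0:ℝ)) fun n => by
        rw [comb (η (φ n)) (hu (φ n)) (hz (φ n))]
        symm
        refine integral_eq_zero_of_ae ?_
        filter_upwards [(hok (φ n)).con] with s hs
        rw [hs]; simp)
      rw [← hz0]
      exact (comb η' hu' hz').symm
    have hintg : Integrable (fun s => η'.u s • b s - η'.u s • w s - a s • η'.z s) v01 := by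
      have hb' : ∀ f : ℝ → Euc d, Integrable f v01 → Integrable (fun s => η'.u s • f s) v01 := fun f hf =>
        hf.bdd_smul _ η'.continuous_u.aestronglyMeasurable (Eventually.of_forall hu')
      refine ((hb' b hb.int01).sub (hb' w hw.int01)).sub ?_
      exact ha.int01.smul_bdd (R * Cu) η'.continuous_z.aestronglyMeasurable (Eventually.of_forall hz')
    have h0 := hintg.ae_eq_zero_of_forall_setIntegral_eq_zero (fun A hA _ => by
      refine ext_inner_left ℝ fun v => ?_
      rw [inner_zero_right, ← integral_inner hintg.integrableOn v]
      have := key (A.indicator fun _ => v) ‖v‖ (measurable_const.indicator hA) (fun s => by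
        by_cases hs : s ∈ A
        · simp [hs]
        · simp [hs])
      rw [← integral_indicator hA, ← this]
      refine integral_congr_ae (Eventually.of_forall fun s => ?_)
      by_cases hs : s ∈ A
      · simp [hs]
      · simp [hs])
    filter_upwards [h0] with s hs
    have hs' : η'.u s • b s - η'.u s • w s - a s • η'.z s = 0 := hs
    rw [sub_sub, sub_eq_zero] at hs'
    exact hs'
  · have q1 := Ww w hw.mem
    have q2 := Wa a ha.mem
    have q3 : Tendsto (fun n => ∫ t, ‖(η (φ n)).u t‖ ^ 2 ∂v01) atTop (𝓝 (∫ t, ‖η'.u t‖ ^ 2 ∂v01)) := by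
      refine tendsto_integral_of_dominated_convergence (fun _ => Cu ^ 2) (fun n => (η (φ n)).u_sq_int.1) (integrable_const _) ?_ ?_
      · refine fun n => Eventually.of_forall fun s => ?_
        rw [Real.norm_of_nonneg (by positivity)]
        gcongr
        exact hu _ s
      · exact Eventually.of_forall fun s => (Pu s).norm.pow 2
    have lim : Tendsto (fun n => β / 2 * ((2 * (∫ s, inner ℝ (w s) ((η (φ n)).w s) ∂v01) - ∫ s, ‖w s‖ ^ 2 ∂v01)
        + 4 * δ ^ 2 * (2 * (∫ s, inner ℝ (a s) ((η (φ n)).a s) ∂v01) - ∫ s, ‖a s‖ ^ 2 ∂v01)) + α * ∫ t, ‖(η (φ n)).u t‖ ^ 2 ∂v01)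
        atTop (𝓝 (η'.E α β δ)) := by
      have := (((((q1.const_mul 2).sub_const (∫ s, ‖w s‖ ^ 2 ∂v01)).add
        (((q2.const_mul 2).sub_const (∫ s, ‖a s‖ ^ 2 ∂v01)).const_mul (4 * δ ^ 2))).const_mul (β / 2)).add (q3.const_mul α))
      convert this using 2
      rw [E_eq]
      simp only [real_inner_self_eq_norm_sq]
      simp only [η']
      ring
    have cs : ∀ {F : Type} [NormedAddCommGroup F] [InnerProductSpace ℝ F] (f g : ℝ → F), MemLp f 2 v01 → MemLp g 2 v01 →
        2 * (∫ s, inner ℝ (f s) (g s) ∂v01) - (∫ s, ‖f s‖ ^ 2 ∂v01) ≤ ∫ s, ‖g s‖ ^ 2 ∂v01 := by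
      intro F _ _ f g hf hg
      have i1 : Integrable (fun s => ‖f s‖ ^ 2) v01 := hf.integrable_norm_pow (by norm_num)
      have i2 : Integrable (fun s => ‖g s‖ ^ 2) v01 := hg.integrable_norm_pow (by norm_num)
      have i3 : Integrable (fun s => (inner ℝ (f s) (g s) : ℝ)) v01 := memLp_inner hf hg
      rw [← integral_const_mul, ← integral_sub (i3.const_mul _) i1]
      refine integral_mono ((i3.const_mul _).sub i1) i2 fun s => ?_
      have := norm_sub_sq_real (f s) (g s)
      simp only [Pi.sub_apply]
      nlinarith [sq_nonneg ‖f s - g s‖]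
    refine le_of_tendsto lim (Eventually.of_forall fun n => ?_)
    refine le_trans ?_ (hE (φ n))
    rw [E_eq]
    gcongr
    · exact cs w _ hw.mem (η (φ n)).hw.mem
    · exact cs a _ ha.mem (η (φ n)).ha.mem

end GC

lemma cone_tendsto {ι : Type*} {l : Filter ι} {u : ι → ℝ} {z : ι → Euc d} {U : ℝ} {Z : Euc d}
    {g : ι → Euc d → ℝ} {G : Euc d → ℝ} {C : ℝ} (hb : ∀ i, u i ≠ 0 → |g i ((u i)⁻¹ • z i)| ≤ C)
    (hu : Tendsto u l (𝓝 U)) (hz : Tendsto z l (𝓝 Z))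
    (hg : U ≠ 0 → Tendsto (fun p : ι × Euc d => g p.1 p.2) (l ×ˢ 𝓝 (U⁻¹ • Z)) (𝓝 (G (U⁻¹ • Z)))) :
    Tendsto (fun i => u i ^ 2 * g i ((u i)⁻¹ • z i)) l (𝓝 (U ^ 2 * G (U⁻¹ • Z))) := by
  by_cases hU : U = 0
  · have h0 : Tendsto (fun i => u i ^ 2 * C) l (𝓝 0) := by
      have := (hu.pow 2).mul_const C
      rw [hU] at this
      simpa using this
    rw [hU]
    simp only [ne_eq, OfNat.ofNat_ne_zero, not_false_eq_true, zero_pow, zero_mul]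
    refine squeeze_zero_norm (fun i => ?_) h0
    rw [norm_mul, Real.norm_of_nonneg (sq_nonneg _), Real.norm_eq_abs]
    by_cases hi : u i = 0
    · simp [hi]
    · exact mul_le_mul_of_nonneg_left (hb i hi) (sq_nonneg _)
  · refine (hu.pow 2).mul ((hg hU).comp (tendsto_id.prodMk ?_))
    exact (hu.inv₀ hU).smul hz

namespace GC

/-- curve of measures -/
def f (η : GC d) (t : ℝ) : SignedMeasure (Euc d) :=
  (η.u t) ^ 2 • (Measure.dirac ((η.u t)⁻¹ • η.z t)).toSignedMeasure

lemma sInt_f (η : GC d) (t : ℝ) (φ : Euc d → ℝ) : sInt (η.f t) φ = η.u t ^ 2 * φ ((η.u t)⁻¹ • η.z t) :=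
  sInt_dirac _ _ _

lemma Ok.mem {S : Set (Euc d)} {η : GC d} (h : η.Ok S) {t : ℝ} (ht : η.u t ≠ 0) : (η.u t)⁻¹ • η.z t ∈ S := by
  obtain ⟨x, hx, e⟩ := h.pos t
  rwa [e, inv_smul_smul₀ ht]

lemma f_conc {S : Set (Euc d)} {η : GC d} (h : η.Ok S) (t : ℝ) : Conc S (η.f t) := by
  by_cases ht : η.u t = 0
  · intro s hs hs'
    simp [f, ht]
  · exact conc_dirac (h.mem ht) _

lemma f_tendsto {S : Set (Euc d)} (hS : IsCompact S) {ι : Type*} {l : Filter ι} (η : ι → GC d) (τ : ι → ℝ)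
    (hok : ∀ i, (η i).Ok S) {η' : GC d} {t : ℝ}
    (hu : Tendsto (fun i => (η i).u (τ i)) l (𝓝 (η'.u t))) (hz : Tendsto (fun i => (η i).z (τ i)) l (𝓝 (η'.z t)))
    {φ : Euc d → ℝ} (hφ : Continuous φ) :
    Tendsto (fun i => sInt ((η i).f (τ i)) φ) l (𝓝 (sInt (η'.f t) φ)) := by
  obtain ⟨C, hC⟩ := hS.exists_bound_of_continuousOn hφ.continuousOn
  simp only [sInt_f]
  exact cone_tendsto (g := fun _ => φ) (fun i hi => hC _ ((hok i).mem hi)) hu hz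
    fun _ => (hφ.tendsto _).comp tendsto_snd

lemma f_clamp (η : GC d) (t : ℝ) : η.f (clamp t) = η.f t := by
  simp only [f, u_clamp, z_clamp]

lemma Ok.cw {S : Set (Euc d)} (hS : IsCompact S) {η : GC d} (h : η.Ok S) : IsCwCurve S η.f := by
  refine ⟨fun t => (f_clamp η t).symm, f_conc h, fun φ hφ => ?_⟩
  rw [continuous_iff_continuousAt]
  intro t
  exact f_tendsto hS (fun _ => η) id (fun _ => h) η.continuous_u.continuousAt η.continuous_z.continuousAt hφ

/-! scaling -/

/-- rescaling -/
def sc (k : ℝ) (η : GC d) : GC d where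
  u0 := k * η.u0
  z0 := k • η.z0
  a := fun s => k • η.a s
  b := fun s => k • η.b s
  w := fun s => k • η.w s
  ha := η.ha.smul k
  hb := η.hb.smul k
  hw := η.hw.smul k

lemma sc_u (k : ℝ) (η : GC d) (t : ℝ) : (sc k η).u t = k * η.u t := by
  simp only [u, sc]
  rw [intervalIntegral.integral_smul, smul_eq_mul]; ring

lemma sc_z (k : ℝ) (η : GC d) (t : ℝ) : (sc k η).z t = k • η.z t := by
  simp only [z, sc]
  rw [intervalIntegral.integral_smul, smul_add]

lemma sc_ok {S : Set (Euc d)} {η : GC d} (h : η.Ok S) {k : ℝ} (hk : 0 ≤ k) : (sc k η).Ok S where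
  nn := fun t => by rw [sc_u]; exact mul_nonneg hk (h.nn t)
  pos := fun t => by
    obtain ⟨x, hx, e⟩ := h.pos t
    exact ⟨x, hx, by rw [sc_z, sc_u, e, smul_smul]⟩
  con := by
    filter_upwards [h.con] with t ht
    rw [sc_u, sc_z]
    simp only [sc, mul_smul]
    rw [smul_comm (η.u t) k, ht, smul_add, smul_add, smul_comm (η.u t) k]
    congr 1
    rw [smul_eq_mul, mul_smul, smul_comm (η.a t) k]

lemma sc_f {k : ℝ} (hk : k ≠ 0) (η : GC d) : (sc k η).f = k ^ 2 • η.f := by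
  ext1 t
  have e : (k * η.u t)⁻¹ • k • η.z t = (η.u t)⁻¹ • η.z t := by
    rw [mul_inv, mul_comm k⁻¹, mul_smul, inv_smul_smul₀ hk]
  simp only [f, Pi.smul_apply, sc_u, sc_z, e]
  generalize (Measure.dirac ((η.u t)⁻¹ • η.z t)).toSignedMeasure = q
  rw [smul_smul, mul_pow]

lemma sc_E (α β δ k : ℝ) (η : GC d) : (sc k η).E α β δ = k ^ 2 * η.E α β δ := by
  unfold E
  rw [← integral_const_mul]
  congr 1
  ext t
  rw [sc_u]
  simp only [sc, norm_mul, norm_smul, mul_pow, Real.norm_eq_abs, sq_abs]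
  ring

lemma u_eq_zero {α β δ : ℝ} (hα : 0 < α) (hβ : 0 < β) (hδ : 0 < δ) {η : GC d} (hE : η.E α β δ = 0) (t : ℝ) : η.u t = 0 := by
  have h3 : ∫ t, ‖η.u t‖ ^ 2 ∂v01 = 0 := by
    rw [E_eq] at hE
    have h1 : 0 ≤ ∫ t, ‖η.w t‖ ^ 2 ∂v01 := integral_nonneg fun t => by positivity
    have h2 : 0 ≤ ∫ t, ‖η.a t‖ ^ 2 ∂v01 := integral_nonneg fun t => by positivity
    have h3 : 0 ≤ ∫ t, ‖η.u t‖ ^ 2 ∂v01 := integral_nonneg fun t => by positivity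
    have e2 : 0 ≤ β / 2 * ((∫ t, ‖η.w t‖ ^ 2 ∂v01) + 4 * δ ^ 2 * ∫ t, ‖η.a t‖ ^ 2 ∂v01) := by positivity
    have e3 : α * (∫ t, ‖η.u t‖ ^ 2 ∂v01) = 0 := by nlinarith [mul_nonneg hα.le h3]
    rcases mul_eq_zero.1 e3 with h | h
    · exact absurd h hα.ne'
    · exact h
  rw [integral_eq_zero_iff_of_nonneg (fun t => by positivity) η.u_sq_int] at h3
  have := Measure.eqOn_Icc_of_ae_eq volume (zero_ne_one) h3 (η.continuous_u.norm.pow 2).continuousOn continuousOn_const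
    (clamp_mem t)
  simpa [u_clamp] using this

lemma f_eq_zero {α β δ : ℝ} (hα : 0 < α) (hβ : 0 < β) (hδ : 0 < δ) {η : GC d} (hE : η.E α β δ = 0) : η.f = 0 := by
  ext1 t
  simp [f, u_eq_zero hα hβ hδ hE t]

/-! splitting -/

lemma prim_indicator {F : Type*} [NormedAddCommGroup F] [NormedSpace ℝ F] [MeasurableSpace F] {a : ℝ → F} (h : L2D a) {c e t : ℝ}
    (hc : 0 ≤ c) (ht : 0 ≤ t) :
    ∫ s in (0:ℝ)..t, (Ioc c e).indicator a s = (∫ s in (0:ℝ)..(max c (min e t)), a s) - ∫ s in (0:ℝ)..c, a s := by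
  rw [intervalIntegral.integral_interval_sub_left (h.ii _ _) (h.ii _ _), intervalIntegral.integral_of_le ht,
    intervalIntegral.integral_of_le (le_max_left _ _), setIntegral_indicator measurableSet_Ioc]
  congr 2
  ext s
  simp only [mem_inter_iff, mem_Ioc, le_max_iff, le_min_iff]
  constructor
  · rintro ⟨⟨h1, h2⟩, h3, h4⟩
    exact ⟨h3, Or.inr ⟨h4, h2⟩⟩
  · rintro ⟨h1, h2 | h2⟩
    · exact absurd h1 (not_lt.2 h2)
    · exact ⟨⟨by linarith, h2.2⟩, h1, h2.1⟩

/-- part of a curve on an interval -/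
def pt1 (η : GC d) (c e : ℝ) : GC d where
  u0 := η.u c
  z0 := η.z c
  a := (Ioc c e).indicator η.a
  b := (Ioc c e).indicator η.b
  w := (Ioc c e).indicator η.w
  ha := η.ha.restr measurableSet_Ioc
  hb := η.hb.restr measurableSet_Ioc
  hw := η.hw.restr measurableSet_Ioc

/-- part of a curve off an interval -/
def pt2 (η : GC d) (c e : ℝ) : GC d where
  u0 := η.u0 - η.u c
  z0 := η.z0 - η.z c
  a := (Ioc c e)ᶜ.indicator η.a
  b := (Ioc c e)ᶜ.indicator η.b
  w := (Ioc c e)ᶜ.indicator η.w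
  ha := η.ha.restr measurableSet_Ioc.compl
  hb := η.hb.restr measurableSet_Ioc.compl
  hw := η.hw.restr measurableSet_Ioc.compl

/-- splitting interval -/
structure Comp (η : GC d) (c e : ℝ) : Prop where
  hc : 0 ≤ c
  ce : c < e
  he : e ≤ 1
  pos : ∀ t ∈ Ioo c e, 0 < η.u t
  zc : η.u c = 0 ∨ c = 0
  ze : η.u e = 0 ∨ e = 1

lemma pt1_u (η : GC d) {c e t : ℝ} (hc : 0 ≤ c) (ht : 0 ≤ t) : (η.pt1 c e).u t = η.u (max c (min e t)) := by
  have := prim_indicator η.ha (e := e) hc ht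
  simp only [u, pt1] at this ⊢
  rw [this]; ring

lemma pt1_z (η : GC d) {c e t : ℝ} (hc : 0 ≤ c) (ht : 0 ≤ t) : (η.pt1 c e).z t = η.z (max c (min e t)) := by
  have := prim_indicator η.hb (e := e) hc ht
  simp only [z, pt1] at this ⊢
  rw [this]; abel

lemma prim_compl {F : Type*} [NormedAddCommGroup F] [NormedSpace ℝ F] [MeasurableSpace F] {a : ℝ → F} (h : L2D a) (c e t : ℝ) :
    ∫ s in (0:ℝ)..t, (Ioc c e)ᶜ.indicator a s = (∫ s in (0:ℝ)..t, a s) - ∫ s in (0:ℝ)..t, (Ioc c e).indicator a s := by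
  rw [← intervalIntegral.integral_sub (h.ii _ _) ((h.restr measurableSet_Ioc).ii _ _)]
  congr 1
  ext s
  rw [indicator_compl]; rfl

lemma pt_u (η : GC d) (c e t : ℝ) : (η.pt2 c e).u t = η.u t - (η.pt1 c e).u t := by
  have := prim_compl η.ha c e t
  simp only [u, pt1, pt2] at this ⊢
  rw [this]; ring

lemma pt_z (η : GC d) (c e t : ℝ) : (η.pt2 c e).z t = η.z t - (η.pt1 c e).z t := by
  have := prim_compl η.hb c e t
  simp only [z, pt1, pt2] at this ⊢
  rw [this]; abel

lemma z_eq_zero {S : Set (Euc d)} {η : GC d} (h : η.Ok S) {t : ℝ} (ht : η.u t = 0) : η.z t = 0 := by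
  obtain ⟨x, -, e⟩ := h.pos t
  rw [e, ht, zero_smul]

/-- values of the two parts -/
lemma Comp.cases {S : Set (Euc d)} {η : GC d} (h : η.Ok S) {c e : ℝ} (hce : η.Comp c e) {t : ℝ} (ht : t ∈ Icc (0:ℝ) 1) :
    (t ∈ Icc c e ∧ (η.pt1 c e).u t = η.u t ∧ (η.pt1 c e).z t = η.z t ∧ (η.pt2 c e).u t = 0 ∧ (η.pt2 c e).z t = 0) ∨
    (t ∉ Icc c e ∧ (η.pt2 c e).u t = η.u t ∧ (η.pt2 c e).z t = η.z t ∧ (η.pt1 c e).u t = 0 ∧ (η.pt1 c e).z t = 0) := by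
  rw [pt_u, pt_z, pt1_u _ hce.hc ht.1, pt1_z _ hce.hc ht.1]
  by_cases htc : t ∈ Icc c e
  · left
    rw [min_eq_right htc.2, max_eq_right htc.1]
    simp [htc]
  · right
    have hz : η.u (max c (min e t)) = 0 := by
      rcases lt_or_ge t c with h1 | h1
      · rw [max_eq_left ((min_le_right _ _).trans h1.le)]
        rcases hce.zc with h2 | h2
        · exact h2
        · linarith [ht.1]
      · have h2 : e < t := by
          by_contra h3
          exact htc ⟨h1, not_lt.1 h3⟩
        rw [min_eq_left h2.le, max_eq_right hce.ce.le]
        rcases hce.ze with h2 | h2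
        · exact h2
        · linarith [ht.2]
    rw [hz, z_eq_zero h hz]
    simp [htc]

lemma ok_of_icc {S : Set (Euc d)} {η : GC d} (h1 : ∀ t ∈ Icc (0:ℝ) 1, 0 ≤ η.u t ∧ ∃ x ∈ S, η.z t = η.u t • x)
    (h2 : ∀ᵐ t ∂v01, η.u t • η.b t = η.u t • η.w t + η.a t • η.z t) : η.Ok S where
  nn := fun t => by rw [← u_clamp]; exact (h1 _ (clamp_mem t)).1
  pos := fun t => by rw [← u_clamp, ← z_clamp]; exact (h1 _ (clamp_mem t)).2
  con := h2

lemma v01_mem : ∀ᵐ t ∂v01, t ∈ Icc (0:ℝ) 1 := ae_restrict_mem measurableSet_Icc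

lemma v01_ne (c : ℝ) : ∀ᵐ t ∂v01, t ≠ c := v01_of_ae (Measure.ae_ne volume c)

lemma Comp.ok1 {S : Set (Euc d)} {η : GC d} (h : η.Ok S) {c e : ℝ} (hce : η.Comp c e) : (η.pt1 c e).Ok S := by
  obtain ⟨x0, hx0, -⟩ := h.pos 0
  refine ok_of_icc (fun t ht => ?_) ?_
  · rcases hce.cases h ht with ⟨-, e1, e2, -, -⟩ | ⟨-, -, -, e1, e2⟩
    · rw [e1, e2]; exact ⟨h.nn t, h.pos t⟩
    · rw [e1, e2]; exact ⟨le_rfl, x0, hx0, by simp⟩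
  · filter_upwards [h.con, v01_mem, v01_ne c] with t ht htm htc
    rcases hce.cases h htm with ⟨m, e1, e2, -, -⟩ | ⟨m, -, -, e1, e2⟩
    · have : t ∈ Ioc c e := ⟨lt_of_le_of_ne m.1 htc.symm, m.2⟩
      rw [e1, e2]
      simpa [pt1, this] using ht
    · rw [e1, e2]; simp

lemma Comp.ok2 {S : Set (Euc d)} {η : GC d} (h : η.Ok S) {c e : ℝ} (hce : η.Comp c e) : (η.pt2 c e).Ok S := by
  obtain ⟨x0, hx0, -⟩ := h.pos 0
  refine ok_of_icc (fun t ht => ?_) ?_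
  · rcases hce.cases h ht with ⟨-, -, -, e1, e2⟩ | ⟨-, e1, e2, -, -⟩
    · rw [e1, e2]; exact ⟨le_rfl, x0, hx0, by simp⟩
    · rw [e1, e2]; exact ⟨h.nn t, h.pos t⟩
  · filter_upwards [h.con, v01_mem] with t ht htm
    rcases hce.cases h htm with ⟨m, -, -, e1, e2⟩ | ⟨m, e1, e2, -, -⟩
    · rw [e1, e2]; simp
    · have : t ∈ (Ioc c e)ᶜ := fun h => m ⟨h.1.le, h.2⟩
      rw [e1, e2]
      simp only [pt2, indicator_of_mem this]
      exact ht

lemma Comp.f_add {S : Set (Euc d)} {η : GC d} (h : η.Ok S) {c e : ℝ} (hce : η.Comp c e) :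
    η.f = (η.pt1 c e).f + (η.pt2 c e).f := by
  ext1 t
  rw [Pi.add_apply, ← f_clamp η, ← f_clamp (η.pt1 c e), ← f_clamp (η.pt2 c e)]
  rcases hce.cases h (clamp_mem t) with ⟨m, e1, e2, e3, e4⟩ | ⟨m, e1, e2, e3, e4⟩
  · simp [f, e1, e2, e3]
  · simp [f, e1, e2, e3]

lemma E_int (α β δ : ℝ) (η : GC d) :
    Integrable (fun t => β / 2 * (‖η.w t‖ ^ 2 + 4 * δ ^ 2 * ‖η.a t‖ ^ 2) + α * ‖η.u t‖ ^ 2) v01 :=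
  ((η.hw.sq.add (η.ha.sq.const_mul _)).const_mul _).add (η.u_sq_int.const_mul _)

lemma Comp.E_add {S : Set (Euc d)} {η : GC d} (h : η.Ok S) {c e : ℝ} (hce : η.Comp c e) (α β δ : ℝ) :
    η.E α β δ = (η.pt1 c e).E α β δ + (η.pt2 c e).E α β δ := by
  unfold E
  rw [← integral_add (E_int _ _ _ _) (E_int _ _ _ _)]
  refine integral_congr_ae ?_
  filter_upwards [v01_mem, v01_ne c] with t htm htc
  rcases hce.cases h htm with ⟨m, e1, -, e2, -⟩ | ⟨m, e1, -, e2, -⟩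
  · have : t ∈ Ioc c e := ⟨lt_of_le_of_ne m.1 htc.symm, m.2⟩
    rw [e1, e2]
    simp [pt1, pt2, this]
  · have : t ∉ Ioc c e := fun h => m ⟨h.1.le, h.2⟩
    rw [e1, e2]
    simp [pt1, pt2, this]

lemma Comp.E_pos {S : Set (Euc d)} {η : GC d} (h : η.Ok S) {c e : ℝ} (hce : η.Comp c e) {α β δ : ℝ} (hα : 0 < α) (hβ : 0 < β)
    (hδ : 0 < δ) : 0 < (η.pt1 c e).E α β δ := by
  refine lt_of_le_of_ne (E_nonneg hα.le hβ.le _) fun h0 => ?_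
  have hm : (c + e) / 2 ∈ Ioo c e := ⟨by linarith [hce.ce], by linarith [hce.ce]⟩
  have h1 := u_eq_zero hα hβ hδ h0.symm ((c + e) / 2)
  rw [pt1_u _ hce.hc (by linarith [hce.hc, hm.1]), min_eq_right hm.2.le, max_eq_right hm.1.le] at h1
  exact (hce.pos _ hm).ne' h1

lemma Comp.pt1 {S : Set (Euc d)} {η : GC d} (h : η.Ok S) {c e : ℝ} (hce : η.Comp c e) : (η.pt1 c e).Comp c e := by
  have hh : ∀ t ∈ Icc c e, (η.pt1 c e).u t = η.u t := fun t ht => by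
    rw [pt1_u _ hce.hc (hce.hc.trans ht.1), min_eq_right ht.2, max_eq_right ht.1]
  refine ⟨hce.hc, hce.ce, hce.he, fun t ht => ?_, ?_, ?_⟩
  · rw [hh t ⟨ht.1.le, ht.2.le⟩]; exact hce.pos t ht
  · rw [hh c ⟨le_rfl, hce.ce.le⟩]; exact hce.zc
  · rw [hh e ⟨hce.ce.le, le_rfl⟩]; exact hce.ze

lemma exists_comp {S : Set (Euc d)} {η : GC d} (h : η.Ok S) {t0 : ℝ} (ht0 : t0 ∈ Icc (0:ℝ) 1) (hpos : 0 < η.u t0) :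
    ∃ c e, η.Comp c e := by
  have hcl : IsClosed {s | η.u s = 0} := isClosed_eq η.continuous_u continuous_const
  obtain ⟨c, hc0, hct, hcz, hcp⟩ : ∃ c, 0 ≤ c ∧ c ≤ t0 ∧ (η.u c = 0 ∨ c = 0) ∧ ∀ t, c < t → t ≤ t0 → 0 < η.u t := by
    by_cases hne : (Icc 0 t0 ∩ {s | η.u s = 0}).Nonempty
    · have hcp : IsCompact (Icc 0 t0 ∩ {s | η.u s = 0}) := isCompact_Icc.inter_right hcl
      have hm := hcp.sSup_mem hne
      refine ⟨_, hm.1.1, hm.1.2, Or.inl hm.2, fun t h1 h2 => lt_of_le_of_ne (h.nn t) fun h3 => ?_⟩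
      exact absurd (le_csSup hcp.bddAbove ⟨⟨hm.1.1.trans h1.le, h2⟩, h3.symm⟩) (not_le.2 h1)
    · refine ⟨0, le_rfl, ht0.1, Or.inr rfl, fun t h1 h2 => lt_of_le_of_ne (h.nn t) fun h3 => ?_⟩
      exact hne ⟨t, ⟨h1.le, h2⟩, h3.symm⟩
  obtain ⟨e, he0, het, hez, hep⟩ : ∃ e, e ≤ 1 ∧ t0 ≤ e ∧ (η.u e = 0 ∨ e = 1) ∧ ∀ t, t < e → t0 ≤ t → 0 < η.u t := by
    by_cases hne : (Icc t0 1 ∩ {s | η.u s = 0}).Nonempty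
    · have hcp : IsCompact (Icc t0 1 ∩ {s | η.u s = 0}) := isCompact_Icc.inter_right hcl
      have hm := hcp.sInf_mem hne
      refine ⟨_, hm.1.2, hm.1.1, Or.inl hm.2, fun t h1 h2 => lt_of_le_of_ne (h.nn t) fun h3 => ?_⟩
      exact absurd (csInf_le hcp.bddBelow ⟨⟨h2, h1.le.trans hm.1.2⟩, h3.symm⟩) (not_le.2 h1)
    · refine ⟨1, le_rfl, ht0.2, Or.inr rfl, fun t h1 h2 => lt_of_le_of_ne (h.nn t) fun h3 => ?_⟩
      exact hne ⟨t, ⟨h2, h1.le⟩, h3.symm⟩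
  refine ⟨c, e, hc0, ?_, he0, fun t ht => ?_, hcz, hez⟩
  · refine lt_of_le_of_ne (hct.trans het) fun hce => ?_
    have h1 : c = t0 := le_antisymm hct (hce ▸ het)
    have h2 : e = t0 := hce ▸ h1
    rw [h1] at hcz
    rw [h2] at hez
    rcases hcz with h3 | h3
    · exact hpos.ne' h3
    · rcases hez with h4 | h4
      · exact hpos.ne' h4
      · linarith
  · rcases le_total t t0 with h1 | h1
    · exact hcp t ht.1 h1
    · exact hep t ht.2 h1

end GC

/-- continuity equation for one choice of densities -/
def CEd (f : ℝ → SignedMeasure (Euc d)) (lam : Measure (XX d)) (w : XX d → Euc d) (u : XX d → ℝ) : Prop :=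
  ∀ φ : XX d → ℝ, IsTest φ →
    ((∫ t in Ioo (0:ℝ) 1, sInt (f t) fun x => fderiv ℝ φ (t, x) ((1:ℝ), (0 : Euc d)))
      + (∫ x, fderiv ℝ φ x ((0:ℝ), w x) ∂lam) + ∫ x, φ x * u x ∂lam) = 0

/-- admissible triples with energy at most `C` -/
def Adm (α β δ : ℝ) (Ω : Set (Euc d)) (f : ℝ → SignedMeasure (Euc d)) (m : VectorMeasure (XX d) (Euc d))
    (μ : SignedMeasure (XX d)) (C : ℝ≥0∞) : Prop :=
  IsCwCurve Ω f ∧ ∃ (lam : Measure (XX d)) (r : XX d → ℝ) (w : XX d → Euc d) (u : XX d → ℝ) (g : ℝ → ℝ≥0∞),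
    IsFiniteMeasure lam ∧ Measurable r ∧ Measurable w ∧ Measurable u ∧ Measurable g ∧
    CwDensity f lam r ∧ IsDensityV m lam w ∧ IsDensityS μ lam u ∧ CEd f lam w u ∧
    (∀ t, (f t).totalVariation univ ≤ g t) ∧ (∫⁻ t in Ioo (0:ℝ) 1, g t) ≠ ⊤ ∧
    ENNReal.ofReal β * (∫⁻ x, Psi δ (r x) (w x) (u x) ∂lam) + ENNReal.ofReal α * (∫⁻ t in Ioo (0:ℝ) 1, g t) ≤ C

lemma IsTest.bm {φ : XX d → ℝ} (h : IsTest φ) : BM φ := by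
  obtain ⟨C, hC⟩ := h.2.1.exists_bound_of_continuous h.1.continuous
  exact ⟨h.1.continuous.measurable, C, hC⟩

lemma IsTest.fderiv_cont {φ : XX d → ℝ} (h : IsTest φ) : Continuous (fderiv ℝ φ) :=
  h.1.continuous_fderiv (by simp)

lemma IsTest.fderiv_bdd {φ : XX d → ℝ} (h : IsTest φ) : ∃ C, ∀ x, ‖fderiv ℝ φ x‖ ≤ C :=
  (h.2.1.fderiv (𝕜 := ℝ)).exists_bound_of_continuous h.fderiv_cont

lemma IsTest.bm_dt {φ : XX d → ℝ} (h : IsTest φ) (v : XX d) : BM fun x => fderiv ℝ φ x v := by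
  obtain ⟨C, hC⟩ := h.fderiv_bdd
  refine ⟨(h.fderiv_cont.clm_apply continuous_const).measurable, C * ‖v‖, fun x => ?_⟩
  exact ((fderiv ℝ φ x).le_opNorm v).trans (mul_le_mul_of_nonneg_right (hC x) (norm_nonneg _))

lemma CEd.solves {f : ℝ → SignedMeasure (Euc d)} {m : VectorMeasure (XX d) (Euc d)}
    {μ : SignedMeasure (XX d)} {lam : Measure (XX d)} [IsFiniteMeasure lam] {w : XX d → Euc d} {u : XX d → ℝ}
    (hw : Measurable w) (hu : Measurable u) (hm : IsDensityV m lam w) (hμ : IsDensityS μ lam u)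
    (h : CEd f lam w u) : SolvesCECw f m μ := by
  intro lam' hf w' u' hw' hu' hm' hμ' φ hφ
  obtain ⟨C, hC⟩ := hφ.fderiv_bdd
  rw [hm'.unique hw' hw hm hφ.fderiv_cont hC, hμ'.unique hu' hu hμ hφ.bm]
  exact h φ hφ

lemma Adm.le {α β δ : ℝ} {Ω : Set (Euc d)} {f : ℝ → SignedMeasure (Euc d)} {m : VectorMeasure (XX d) (Euc d)}
    {μ : SignedMeasure (XX d)} {C : ℝ≥0∞} (h : Adm α β δ Ω f m μ C) : JCw α β δ f m μ ≤ C := by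
  obtain ⟨hf, lam, r, w, u, g, hl, hr, hw, hu, hg, h1, h2, h3, h4, h5, h6, h7⟩ := h
  unfold JCw
  rw [if_pos (h4.solves hw hu h2 h3)]
  refine le_trans ?_ h7
  gcongr
  · exact sInf_le ⟨lam, hl, r, w, u, hr, hw, hu, h1, h2, h3, rfl⟩
  · exact lintegral_mono h5

lemma Adm.mono {α β δ : ℝ} {Ω : Set (Euc d)} {f : ℝ → SignedMeasure (Euc d)} {m : VectorMeasure (XX d) (Euc d)}
    {μ : SignedMeasure (XX d)} {C C' : ℝ≥0∞} (h : Adm α β δ Ω f m μ C) (hC : C ≤ C') : Adm α β δ Ω f m μ C' := by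
  obtain ⟨hf, lam, r, w, u, g, hl, hr, hw, hu, hg, h1, h2, h3, h4, h5, h6, h7⟩ := h
  exact ⟨hf, lam, r, w, u, g, hl, hr, hw, hu, hg, h1, h2, h3, h4, h5, h6, h7.trans hC⟩

lemma sInt_zero_curve (φ : Euc d → ℝ) : sInt (0 : SignedMeasure (Euc d)) φ = 0 := by
  have h := sInt_dirac (0:ℝ) (0 : Euc d) φ
  simpa using h

lemma tv_zero' : (0 : SignedMeasure (Euc d)).totalVariation univ = 0 := by
  have := tv_smul_le (0 : SignedMeasure (Euc d)) 0
  simpa using this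

lemma Adm.zero {α β δ : ℝ} {Ω : Set (Euc d)} : Adm α β δ Ω (0 : ℝ → SignedMeasure (Euc d)) 0 0 0 := by
  refine ⟨cw_zero, 0, 0, 0, 0, 0, inferInstance, measurable_const, measurable_const, measurable_const, measurable_const,
    fun s hs => ?_, fun s hs => ?_, fun s hs => ?_, fun φ hφ => ?_, fun t => ?_, ?_, ?_⟩
  · simp [sInt_zero_curve]
  · simp
  · simp
  · simp [sInt_zero_curve]
  · simp [tv_zero']
  · simp
  · simp

lemma Psi_smul_le (δ : ℝ) {c : ℝ} (hc : 0 ≤ c) (r u : ℝ) (w : Euc d) :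
    Psi δ (c * r) (c • w) (c * u) ≤ ENNReal.ofReal c * Psi δ r w u := by
  rcases hc.eq_or_lt with rfl | hc
  · simp [Psi]
  by_cases hT : Psi δ r w u = ⊤
  · rw [hT, ENNReal.mul_top (by simpa using hc)]; exact le_top
  rcases Psi_cases hT with ⟨h1, -⟩ | ⟨rfl, rfl, rfl⟩
  · have h2 : 0 < c * r := mul_pos hc h1
    rw [Psi, Psi, if_pos h2, if_pos h1, ← ENNReal.ofReal_mul hc.le]
    refine le_of_eq ?_
    congr 1
    rw [norm_smul, Real.norm_of_nonneg hc.le]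
    field_simp
  · simp [Psi]

lemma Psi_add_le (δ : ℝ) (r₁ u₁ : ℝ) (w₁ : Euc d) (r₂ u₂ : ℝ) (w₂ : Euc d) :
    Psi δ (r₁ + r₂) (w₁ + w₂) (u₁ + u₂) ≤ Psi δ r₁ w₁ u₁ + Psi δ r₂ w₂ u₂ := by
  by_cases hT : Psi δ r₁ w₁ u₁ = ⊤
  · rw [hT, top_add]; exact le_top
  by_cases hT2 : Psi δ r₂ w₂ u₂ = ⊤
  · rw [hT2, add_top]; exact le_top
  rcases Psi_cases hT with ⟨h1, -⟩ | ⟨rfl, rfl, rfl⟩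
  · rcases Psi_cases hT2 with ⟨h2, -⟩ | ⟨rfl, rfl, rfl⟩
    · rw [Psi, Psi, Psi, if_pos h1, if_pos h2, if_pos (add_pos h1 h2), ← ENNReal.ofReal_add (by positivity) (by positivity)]
      apply ENNReal.ofReal_le_ofReal
      have key : ∀ x y : ℝ, (x + y) ^ 2 / (2 * (r₁ + r₂)) ≤ x ^ 2 / (2 * r₁) + y ^ 2 / (2 * r₂) := by
        intro x y
        rw [div_add_div _ _ (by positivity) (by positivity), div_le_div_iff₀ (by positivity) (by positivity)]
        nlinarith [mul_nonneg (mul_pos h1 h2).le (sq_nonneg (x * r₂ - y * r₁)), sq_nonneg (x * r₂ - y * r₁),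
          mul_pos h1 h2]
      have k1 := key ‖w₁‖ ‖w₂‖
      have k2 := mul_le_mul_of_nonneg_left (key u₁ u₂) (sq_nonneg δ)
      have k3 : ‖w₁ + w₂‖ ^ 2 / (2 * (r₁ + r₂)) ≤ (‖w₁‖ + ‖w₂‖) ^ 2 / (2 * (r₁ + r₂)) := by
        gcongr
        exact norm_add_le _ _
      calc _ = ‖w₁ + w₂‖ ^ 2 / (2 * (r₁ + r₂)) + δ ^ 2 * ((u₁ + u₂) ^ 2 / (2 * (r₁ + r₂))) := by ring
        _ ≤ (‖w₁‖ ^ 2 / (2 * r₁) + ‖w₂‖ ^ 2 / (2 * r₂)) + δ ^ 2 * (u₁ ^ 2 / (2 * r₁) + u₂ ^ 2 / (2 * r₂)) :=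
          add_le_add (k3.trans k1) k2
        _ = _ := by ring
    · simp
  · simp

lemma Adm.smul {α β δ : ℝ} {Ω : Set (Euc d)} (hΩ : IsCompact Ω) {f : ℝ → SignedMeasure (Euc d)} {m : VectorMeasure (XX d) (Euc d)}
    {μ : SignedMeasure (XX d)} {C : ℝ≥0∞} (h : Adm α β δ Ω f m μ C) {c : ℝ} (hc : 0 ≤ c) :
    Adm α β δ Ω (c • f) (c • m) (c • μ) (ENNReal.ofReal c * C) := by
  obtain ⟨hf, lam, r, w, u, g, hl, hr, hw, hu, hg, h1, h2, h3, h4, h5, h6, h7⟩ := h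
  refine ⟨cw_smul hΩ hf c, lam, fun x => c * r x, fun x => c • w x, fun x => c * u x, fun t => ENNReal.ofReal c * g t, hl, hr.const_mul c, hw.const_smul c, hu.const_mul c,
    hg.const_mul _, fun s hs => ?_, fun s hs => ?_, fun s hs => ?_, fun φ hφ => ?_, fun t => ?_, ?_, ?_⟩
  · rw [integral_const_mul, ← h1 s hs, ← integral_const_mul]
    congr 1
    ext t
    exact sInt_smul _ (BM.indicator (measurable_prodMk_left hs))
  · rw [integral_smul, ← h2 s hs]; rfl
  · rw [integral_const_mul, ← h3 s hs]; rfl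
  · have e1 : ∀ t, sInt ((c • f) t) (fun x => fderiv ℝ φ (t, x) ((1:ℝ), (0 : Euc d))) = c * sInt (f t) (fun x => fderiv ℝ φ (t, x) ((1:ℝ), (0 : Euc d))) :=
      fun t => sInt_smul _ ((hφ.bm_dt (1, 0)).slice t)
    have e2 : ∀ x, fderiv ℝ φ x ((0:ℝ), c • w x) = c * fderiv ℝ φ x ((0:ℝ), w x) := fun x => by
      have : ((0:ℝ), c • w x) = c • ((0:ℝ), w x) := by simp
      rw [this, map_smul, smul_eq_mul]
    have e3 : ∀ x, φ x * (c * u x) = c * (φ x * u x) := fun x => by ring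
    simp_rw [e1, e2, e3]
    rw [integral_const_mul, integral_const_mul, integral_const_mul, ← mul_add, ← mul_add, h4 φ hφ, mul_zero]
  · have := tv_smul_le (f t) ⟨c, hc⟩
    refine this.trans ?_
    rw [show ENNReal.ofReal c = ((NNReal.mk c hc : ℝ≥0) : ℝ≥0∞) by rw [ENNReal.ofReal, Real.toNNReal_of_nonneg hc]]
    exact mul_le_mul_right (h5 t) _
  · rw [lintegral_const_mul _ hg]
    exact ENNReal.mul_ne_top ENNReal.ofReal_ne_top h6
  · rw [lintegral_const_mul _ hg]
    calc _ ≤ ENNReal.ofReal β * (ENNReal.ofReal c * ∫⁻ x, Psi δ (r x) (w x) (u x) ∂lam) + ENNReal.ofReal α * (ENNReal.ofReal c * ∫⁻ t in Ioo (0:ℝ) 1, g t) := by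
          gcongr
          rw [← lintegral_const_mul _ (measurable_Psi δ hr hw hu)]
          exact lintegral_mono fun x => Psi_smul_le δ hc _ _ _
      _ = ENNReal.ofReal c * (ENNReal.ofReal β * (∫⁻ x, Psi δ (r x) (w x) (u x) ∂lam) + ENNReal.ofReal α * (∫⁻ t in Ioo (0:ℝ) 1, g t)) := by ring
      _ ≤ _ := by gcongr

lemma Adm.add {α β δ : ℝ} {Ω : Set (Euc d)} (hΩ : IsCompact Ω) {f₁ f₂ : ℝ → SignedMeasure (Euc d)} {m₁ m₂ : VectorMeasure (XX d) (Euc d)}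
    {μ₁ μ₂ : SignedMeasure (XX d)} {C₁ C₂ : ℝ≥0∞} (h : Adm α β δ Ω f₁ m₁ μ₁ C₁) (h' : Adm α β δ Ω f₂ m₂ μ₂ C₂) :
    Adm α β δ Ω (f₁ + f₂) (m₁ + m₂) (μ₁ + μ₂) (C₁ + C₂) := by
  obtain ⟨hf, lam, r, w, u, g, hl, hr, hw, hu, hg, h1, h2, h3, h4, h5, h6, h7⟩ := h
  obtain ⟨hf', lam', r', w', u', g', hl', hr', hw', hu', hg', h1', h2', h3', h4', h5', h6', h7'⟩ := h'
  have hT : TVCw f₁ ≠ ⊤ := ne_top_of_le_ne_top h6 (lintegral_mono h5)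
  have hT' : TVCw f₂ ≠ ⊤ := ne_top_of_le_ne_top h6' (lintegral_mono h5')
  have ac : lam ≪ lam + lam' := Measure.absolutelyContinuous_of_le (Measure.le_add_right le_rfl)
  have ac' : lam' ≪ lam + lam' := Measure.absolutelyContinuous_of_le (Measure.le_add_left le_rfl)
  have : lam.HaveLebesgueDecomposition (lam + lam') := Measure.haveLebesgueDecomposition_of_sigmaFinite _ _
  have : lam'.HaveLebesgueDecomposition (lam + lam') := Measure.haveLebesgueDecomposition_of_sigmaFinite _ _
  set D := lam.rnDeriv (lam + lam') with hD
  set D' := lam'.rnDeriv (lam + lam') with hD'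
  have mD : Measurable D := Measure.measurable_rnDeriv _ _
  have mD' : Measurable D' := Measure.measurable_rnDeriv _ _
  have fD : ∀ᵐ x ∂(lam + lam'), D x < ⊤ := Measure.rnDeriv_lt_top _ _
  have fD' : ∀ᵐ x ∂(lam + lam'), D' x < ⊤ := Measure.rnDeriv_lt_top _ _
  have ir := h1.integrable hT hr
  have ir' := h1'.integrable hT' hr'
  have iw := h2.integrable hw
  have iw' := h2'.integrable hw'
  have iu := h3.integrable hu
  have iu' := h3'.integrable hu'
  have jr : Integrable (fun x => (D x).toReal • r x) (lam + lam') := (integrable_rnDeriv_smul_iff ac).2 ir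
  have jr' : Integrable (fun x => (D' x).toReal • r' x) (lam + lam') := (integrable_rnDeriv_smul_iff ac').2 ir'
  have ju : Integrable (fun x => (D x).toReal • u x) (lam + lam') := (integrable_rnDeriv_smul_iff ac).2 iu
  have ju' : Integrable (fun x => (D' x).toReal • u' x) (lam + lam') := (integrable_rnDeriv_smul_iff ac').2 iu'
  have jw : Integrable (fun x => (D x).toReal • w x) (lam + lam') := (integrable_rnDeriv_smul_iff ac).2 iw
  have jw' : Integrable (fun x => (D' x).toReal • w' x) (lam + lam') := (integrable_rnDeriv_smul_iff ac').2 iw'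
  refine ⟨cw_add hΩ hf hf', lam + lam', fun x => (D x).toReal • r x + (D' x).toReal • r' x,
    fun x => (D x).toReal • w x + (D' x).toReal • w' x, fun x => (D x).toReal • u x + (D' x).toReal • u' x, fun t => g t + g' t, inferInstance,
    (mD.ennreal_toReal.smul hr).add (mD'.ennreal_toReal.smul hr'), (mD.ennreal_toReal.smul hw).add (mD'.ennreal_toReal.smul hw'),
    (mD.ennreal_toReal.smul hu).add (mD'.ennreal_toReal.smul hu'),
    hg.add hg', fun s hs => ?_, fun s hs => ?_, fun s hs => ?_, fun φ hφ => ?_, fun t => ?_, ?_, ?_⟩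
  · rw [integral_add jr.integrableOn jr'.integrableOn, setIntegral_rnDeriv_smul ac hs, setIntegral_rnDeriv_smul ac' hs,
      ← h1 s hs, ← h1' s hs, ← integral_add (f := fun t => sInt (f₁ t) ({x : Euc d | (t, x) ∈ s}.indicator fun _ => (1:ℝ)))
        (g := fun t => sInt (f₂ t) ({x : Euc d | (t, x) ∈ s}.indicator fun _ => (1:ℝ)))
        (integrable_sInt_slice hf hT (BM.indicator hs)) (integrable_sInt_slice hf' hT' (BM.indicator hs))]
    congr 1
    ext t
    exact sInt_add (BM.indicator (measurable_prodMk_left hs))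
  · rw [integral_add jw.integrableOn jw'.integrableOn, setIntegral_rnDeriv_smul ac hs, setIntegral_rnDeriv_smul ac' hs,
      ← h2 s hs, ← h2' s hs]; rfl
  · rw [integral_add ju.integrableOn ju'.integrableOn, setIntegral_rnDeriv_smul ac hs, setIntegral_rnDeriv_smul ac' hs,
      ← h3 s hs, ← h3' s hs]; rfl
  · obtain ⟨C, hC⟩ := hφ.fderiv_bdd
    obtain ⟨Cφ, hCφ⟩ := hφ.bm.2
    have e1 : ∀ t, sInt ((f₁ + f₂) t) (fun x => fderiv ℝ φ (t, x) ((1:ℝ), (0 : Euc d))) =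
        sInt (f₁ t) (fun x => fderiv ℝ φ (t, x) ((1:ℝ), (0 : Euc d))) + sInt (f₂ t) (fun x => fderiv ℝ φ (t, x) ((1:ℝ), (0 : Euc d))) :=
      fun t => sInt_add ((hφ.bm_dt (1, 0)).slice t)
    have e2 : ∀ x, fderiv ℝ φ x ((0:ℝ), (D x).toReal • w x + (D' x).toReal • w' x) =
        (D x).toReal • fderiv ℝ φ x ((0:ℝ), w x) + (D' x).toReal • fderiv ℝ φ x ((0:ℝ), w' x) := fun x => by
      have : ((0:ℝ), (D x).toReal • w x + (D' x).toReal • w' x) = (D x).toReal • ((0:ℝ), w x) + (D' x).toReal • ((0:ℝ), w' x) := by simp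
      rw [this, map_add, map_smul, map_smul]
    have e3 : ∀ x, φ x * ((D x).toReal • u x + (D' x).toReal • u' x) = (D x).toReal • (φ x * u x) + (D' x).toReal • (φ x * u' x) :=
      fun x => by simp only [smul_eq_mul]; ring
    simp_rw [e1, e2, e3]
    have i2 : Integrable (fun x => fderiv ℝ φ x ((0:ℝ), w x)) lam := integrable_clm_apply hφ.fderiv_cont hC iw
    have i2' : Integrable (fun x => fderiv ℝ φ x ((0:ℝ), w' x)) lam' := integrable_clm_apply hφ.fderiv_cont hC iw'
    have i3 : Integrable (fun x => φ x * u x) lam := iu.bdd_mul (c := Cφ) hφ.bm.1.aestronglyMeasurable (ae_of_all _ hCφ)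
    have i3' : Integrable (fun x => φ x * u' x) lam' := iu'.bdd_mul (c := Cφ) hφ.bm.1.aestronglyMeasurable (ae_of_all _ hCφ)
    rw [integral_add (integrable_sInt_slice hf hT (hφ.bm_dt (1, 0))) (integrable_sInt_slice hf' hT' (hφ.bm_dt (1, 0))),
      integral_add ((integrable_rnDeriv_smul_iff ac).2 i2) ((integrable_rnDeriv_smul_iff ac').2 i2'),
      integral_add ((integrable_rnDeriv_smul_iff ac).2 i3) ((integrable_rnDeriv_smul_iff ac').2 i3'),
      integral_rnDeriv_smul ac, integral_rnDeriv_smul ac, integral_rnDeriv_smul ac', integral_rnDeriv_smul ac']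
    linarith [h4 φ hφ, h4' φ hφ]
  · exact (tv_add_le _ _).trans (add_le_add (h5 t) (h5' t))
  · rw [lintegral_add_left hg]
    exact ENNReal.add_ne_top.2 ⟨h6, h6'⟩
  · rw [lintegral_add_left hg]
    have key : ∫⁻ x, Psi δ ((D x).toReal • r x + (D' x).toReal • r' x) ((D x).toReal • w x + (D' x).toReal • w' x)
        ((D x).toReal • u x + (D' x).toReal • u' x) ∂(lam + lam') ≤
        (∫⁻ x, Psi δ (r x) (w x) (u x) ∂lam) + ∫⁻ x, Psi δ (r' x) (w' x) (u' x) ∂lam' := by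
      rw [← lintegral_rnDeriv_mul ac (measurable_Psi δ hr hw hu).aemeasurable, ← lintegral_rnDeriv_mul ac' (measurable_Psi δ hr' hw' hu').aemeasurable,
        ← lintegral_add_left (f := fun x => D x * Psi δ (r x) (w x) (u x)) (mD.mul (measurable_Psi δ hr hw hu))]
      refine lintegral_mono_ae ?_
      filter_upwards [fD, fD'] with x hx hx'
      refine (Psi_add_le _ _ _ _ _ _ _).trans (add_le_add ?_ ?_)
      · exact (Psi_smul_le δ ENNReal.toReal_nonneg _ _ _).trans (by rw [ENNReal.ofReal_toReal hx.ne])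
      · exact (Psi_smul_le δ ENNReal.toReal_nonneg _ _ _).trans (by rw [ENNReal.ofReal_toReal hx'.ne])
    calc _ ≤ ENNReal.ofReal β * ((∫⁻ x, Psi δ (r x) (w x) (u x) ∂lam) + ∫⁻ x, Psi δ (r' x) (w' x) (u' x) ∂lam') +
          ENNReal.ofReal α * ((∫⁻ t in Ioo (0:ℝ) 1, g t) + ∫⁻ t in Ioo (0:ℝ) 1, g' t) := by gcongr
      _ = _ := by rw [mul_add, mul_add]; exact add_add_add_comm _ _ _ _
      _ ≤ _ := add_le_add h7 h7'

lemma Adm.sum {α β δ : ℝ} {Ω : Set (Euc d)} (hΩ : IsCompact Ω) {ι : Type*} (s : Finset ι) {f : ι → ℝ → SignedMeasure (Euc d)}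
    {m : ι → VectorMeasure (XX d) (Euc d)} {μ : ι → SignedMeasure (XX d)} {C : ι → ℝ≥0∞} (h : ∀ i, Adm α β δ Ω (f i) (m i) (μ i) (C i))
    {c : ι → ℝ} (hc : ∀ i, 0 ≤ c i) :
    Adm α β δ Ω (∑ i ∈ s, c i • f i) (∑ i ∈ s, c i • m i) (∑ i ∈ s, c i • μ i) (∑ i ∈ s, ENNReal.ofReal (c i) * C i) := by
  classical
  induction s using Finset.induction_on with
  | empty => simpa using Adm.zero
  | insert a s ha ih =>
    rw [Finset.sum_insert ha, Finset.sum_insert ha, Finset.sum_insert ha, Finset.sum_insert ha]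
    exact ((h a).smul hΩ (hc a)).add hΩ ih

lemma ac_of_le {k g : ℝ → ℝ} {a b M : ℝ} (hg : AbsolutelyContinuousOnInterval g a b) (h : ∀ s t, |k s - k t| ≤ M * |g s - g t|) :
    AbsolutelyContinuousOnInterval k a b := by
  have h0 := Tendsto.const_mul M hg
  rw [mul_zero] at h0
  refine squeeze_zero (fun E => Finset.sum_nonneg fun i _ => dist_nonneg) (fun E => ?_) h0
  rw [Finset.mul_sum]
  exact Finset.sum_le_sum fun i _ => by rw [Real.dist_eq, Real.dist_eq]; exact h _ _

lemma cone_lip {φ : XX d → ℝ} {C L U R : ℝ} (hL0 : 0 ≤ L) (hC : ∀ x, |φ x| ≤ C) (hL : ∀ x y, |φ x - φ y| ≤ L * ‖x - y‖)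
    {t s u₁ u₂ : ℝ} {x₁ x₂ : Euc d} (h1 : 0 ≤ u₁) (h1' : u₁ ≤ U) (h2 : 0 ≤ u₂) (h2' : u₂ ≤ U) (hR : ‖x₁‖ ≤ R) :
    |u₁ ^ 2 * φ (t, x₁) - u₂ ^ 2 * φ (s, x₂)| ≤
      2 * U * C * |u₁ - u₂| + U ^ 2 * L * |t - s| + L * U * (R * |u₁ - u₂| + ‖u₁ • x₁ - u₂ • x₂‖) := by
  have hU : 0 ≤ U := h1.trans h1'
  have hC0 : 0 ≤ C := (abs_nonneg _).trans (hC (t, x₁))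
  have e : u₁ ^ 2 * φ (t, x₁) - u₂ ^ 2 * φ (s, x₂) = (u₁ + u₂) * (u₁ - u₂) * φ (t, x₁) + u₂ ^ 2 * (φ (t, x₁) - φ (s, x₂)) := by ring
  have a1 : |(u₁ + u₂) * (u₁ - u₂) * φ (t, x₁)| ≤ 2 * U * C * |u₁ - u₂| := by
    rw [abs_mul, abs_mul, abs_of_nonneg (add_nonneg h1 h2)]
    calc (u₁ + u₂) * |u₁ - u₂| * |φ (t, x₁)| ≤ (2 * U) * |u₁ - u₂| * C := by
          gcongr
          · linarith
          · exact hC _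
      _ = _ := by ring
  have a2 : ‖((t, x₁) : XX d) - (s, x₂)‖ ≤ |t - s| + ‖x₁ - x₂‖ := by
    rw [Prod.mk_sub_mk, Prod.norm_mk, Real.norm_eq_abs]
    exact max_le (le_add_of_nonneg_right (norm_nonneg _)) (le_add_of_nonneg_left (abs_nonneg _))
  have a3 : u₂ * ‖x₁ - x₂‖ ≤ R * |u₁ - u₂| + ‖u₁ • x₁ - u₂ • x₂‖ := by
    have : u₂ * ‖x₁ - x₂‖ = ‖(u₂ - u₁) • x₁ + (u₁ • x₁ - u₂ • x₂)‖ := by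
      rw [← Real.norm_of_nonneg h2, ← norm_smul, Real.norm_of_nonneg h2]
      congr 1
      rw [smul_sub, sub_smul]; abel
    rw [this]
    refine (norm_add_le _ _).trans (add_le_add ?_ le_rfl)
    rw [norm_smul, Real.norm_eq_abs, abs_sub_comm, mul_comm]
    gcongr
  have a4 : |u₂ ^ 2 * (φ (t, x₁) - φ (s, x₂))| ≤ U ^ 2 * L * |t - s| + L * U * (R * |u₁ - u₂| + ‖u₁ • x₁ - u₂ • x₂‖) := by
    rw [abs_mul, abs_of_nonneg (sq_nonneg u₂)]
    calc u₂ ^ 2 * |φ (t, x₁) - φ (s, x₂)| ≤ u₂ ^ 2 * (L * (|t - s| + ‖x₁ - x₂‖)) := by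
          gcongr
          exact (hL _ _).trans (mul_le_mul_of_nonneg_left a2 hL0)
      _ = u₂ ^ 2 * (L * |t - s|) + L * u₂ * (u₂ * ‖x₁ - x₂‖) := by ring
      _ ≤ U ^ 2 * (L * |t - s|) + L * U * (R * |u₁ - u₂| + ‖u₁ • x₁ - u₂ • x₂‖) := by
          have : 0 ≤ u₂ * ‖x₁ - x₂‖ := mul_nonneg h2 (norm_nonneg _)
          have : 0 ≤ R * |u₁ - u₂| + ‖u₁ • x₁ - u₂ • x₂‖ := this.trans a3
          gcongr
      _ = _ := by ring
  rw [e]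
  refine (abs_add_le _ _).trans ?_
  linarith

namespace GC

lemma u_ac (η : GC d) (s t : ℝ) : AbsolutelyContinuousOnInterval η.u s t := by
  have h := (η.ha.ii s t).absolutelyContinuousOnInterval_intervalIntegral (c := s) left_mem_uIcc
  have := ac_of_le (k := η.u) (M := 1) h fun x y => by
    rw [one_mul]
    apply le_of_eq
    congr 1
    simp only [u]
    rw [← intervalIntegral.integral_interval_sub_left (η.ha.ii 0 x) (η.ha.ii 0 s),
      ← intervalIntegral.integral_interval_sub_left (η.ha.ii 0 y) (η.ha.ii 0 s)]
    ring
  exact this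

/-- trajectory -/
def gam (η : GC d) (x0 : Euc d) (t : ℝ) : Euc d := if η.u t = 0 then x0 else (η.u t)⁻¹ • η.z t

lemma measurable_gam (η : GC d) (x0 : Euc d) : Measurable (η.gam x0) :=
  Measurable.ite (η.continuous_u.measurable (measurableSet_singleton 0)) measurable_const
    (η.continuous_u.measurable.inv.smul η.continuous_z.measurable)

lemma gam_mem {S : Set (Euc d)} {η : GC d} (h : η.Ok S) {x0 : Euc d} (hx : x0 ∈ S) (t : ℝ) : η.gam x0 t ∈ S := by
  unfold gam
  split_ifs with h0
  · exact hx
  · exact h.mem h0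

lemma u_gam {S : Set (Euc d)} {η : GC d} (h : η.Ok S) (x0 : Euc d) (t : ℝ) : η.u t • η.gam x0 t = η.z t := by
  unfold gam
  split_ifs with h0
  · rw [h0, zero_smul, z_eq_zero h h0]
  · rw [smul_inv_smul₀ h0]

lemma f_gam (η : GC d) (x0 : Euc d) (t : ℝ) : η.f t = (η.u t) ^ 2 • (Measure.dirac (η.gam x0 t)).toSignedMeasure := by
  by_cases h0 : η.u t = 0
  · simp [f, h0]
  · have : η.gam x0 t = (η.u t)⁻¹ • η.z t := by rw [gam, if_neg h0]
    simp only [f, this]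

lemma sInt_gam (η : GC d) (x0 : Euc d) (t : ℝ) (φ : Euc d → ℝ) : sInt (η.f t) φ = η.u t ^ 2 * φ (η.gam x0 t) := by
  rw [f_gam η x0]; exact sInt_dirac _ _ _

lemma gam_deriv {S : Set (Euc d)} {η : GC d} (h : η.Ok S) (x0 : Euc d) :
    ∀ᵐ t ∂v01, η.u t ≠ 0 → HasDerivAt (η.gam x0) ((η.u t)⁻¹ • η.w t) t := by
  filter_upwards [v01_of_ae η.ae_deriv, h.con] with t ⟨h1, h2⟩ h3 h0
  have h4 := (h1.inv h0).smul h2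
  have e : (fun s => (η.u s)⁻¹ • η.z s) =ᶠ[𝓝 t] η.gam x0 := by
    filter_upwards [η.continuous_u.continuousAt.eventually_ne h0] with s hs
    rw [gam, if_neg hs]
  refine (h4.congr_of_eventuallyEq e.symm).congr_deriv ?_
  have h5 : η.b t = η.w t + (η.u t)⁻¹ • η.a t • η.z t := by
    rw [← inv_smul_smul₀ h0 (η.b t), h3, smul_add, inv_smul_smul₀ h0]
  simp only [Pi.inv_apply]
  rw [h5, smul_add, add_assoc, smul_smul, smul_smul, ← add_smul]
  convert add_zero _
  rw [div_eq_mul_inv, show (η.u t)⁻¹ * (η.u t)⁻¹ * η.a t + -η.a t * (η.u t ^ 2)⁻¹ = 0 by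
    rw [pow_two, mul_inv]; ring, zero_smul]

lemma k_ac {S : Set (Euc d)} (hS : IsCompact S) {η : GC d} (h : η.Ok S) {x0 : Euc d} (hx : x0 ∈ S) {φ : XX d → ℝ} (hφ : IsTest φ) :
    AbsolutelyContinuousOnInterval (fun t => η.u t ^ 2 * φ (t, η.gam x0 t)) 0 1 := by
  obtain ⟨C, hC⟩ := hφ.bm.2
  obtain ⟨L, hL⟩ := hφ.fderiv_bdd
  obtain ⟨R, hR⟩ := hS.isBounded.exists_norm_le
  obtain ⟨U, hU⟩ := isCompact_Icc.exists_bound_of_continuousOn (η.continuous_u.continuousOn (s := Icc (0:ℝ) 1))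
  have hU' : ∀ t, η.u t ≤ U := fun t => by
    rw [← u_clamp]; exact (le_abs_self _).trans (hU _ (clamp_mem t))
  have hU0 : 0 ≤ U := (h.nn 0).trans (hU' 0)
  have hL0 : 0 ≤ L := (norm_nonneg _).trans (hL 0)
  have hC0 : 0 ≤ C := (abs_nonneg _).trans (hC 0)
  have hR0 : 0 ≤ R := (norm_nonneg _).trans (hR _ hx)
  have hlip : ∀ x y, |φ x - φ y| ≤ L * ‖x - y‖ := fun x y =>
    Convex.norm_image_sub_le_of_norm_fderiv_le (𝕜 := ℝ) (fun z _ => hφ.1.differentiable (by simp) z) (fun z _ => hL z) convex_univ (mem_univ y) (mem_univ x)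
  have hG : ∀ s t, IntervalIntegrable (fun r => 1 + ‖η.a r‖ + ‖η.b r‖) volume s t := fun s t =>
    (intervalIntegrable_const.add (η.ha.ii s t).norm).add (η.hb.ii s t).norm
  have hg := (hG 0 1).absolutelyContinuousOnInterval_intervalIntegral (c := 0) left_mem_uIcc
  refine ac_of_le (M := 2 * U * C + U ^ 2 * L + L * U * (R + 1)) hg fun s t => ?_
  rw [intervalIntegral.integral_interval_sub_left (hG _ _) (hG _ _)]
  set g := |∫ r in t..s, (1 + ‖η.a r‖ + ‖η.b r‖)| with hgdef
  have b1 : |s - t| ≤ g := by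
    have := intervalIntegral.norm_integral_le_abs_of_norm_le (f := fun _ => (1:ℝ)) (a := t) (b := s) (μ := volume)
      (ae_of_all _ fun r => by rw [norm_one]; linarith [norm_nonneg (η.a r), norm_nonneg (η.b r)]) (hG t s)
    rwa [intervalIntegral.integral_const, smul_eq_mul, mul_one, Real.norm_eq_abs] at this
  have b2 : |η.u s - η.u t| ≤ g := by
    have := intervalIntegral.norm_integral_le_abs_of_norm_le (f := η.a) (a := t) (b := s) (μ := volume)
      (ae_of_all _ fun r => by linarith [norm_nonneg (η.a r), norm_nonneg (η.b r)]) (hG t s)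
    rwa [← intervalIntegral.integral_interval_sub_left (η.ha.ii 0 s) (η.ha.ii 0 t), ← add_sub_add_left_eq_sub _ _ η.u0] at this
  have b3 : ‖η.z s - η.z t‖ ≤ g := by
    have := intervalIntegral.norm_integral_le_abs_of_norm_le (f := η.b) (a := t) (b := s) (μ := volume)
      (ae_of_all _ fun r => by linarith [norm_nonneg (η.a r), norm_nonneg (η.b r)]) (hG t s)
    rwa [← intervalIntegral.integral_interval_sub_left (η.hb.ii 0 s) (η.hb.ii 0 t), ← add_sub_add_left_eq_sub _ _ η.z0] at this
  have key := cone_lip (t := s) (s := t) (x₁ := η.gam x0 s) (x₂ := η.gam x0 t) hL0 hC hlip (h.nn s) (hU' s) (h.nn t) (hU' t) (hR _ (gam_mem h hx s))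
  rw [u_gam h, u_gam h] at key
  refine key.trans ?_
  have hg0 : 0 ≤ g := abs_nonneg _
  calc _ ≤ 2 * U * C * g + U ^ 2 * L * g + L * U * (R * g + g) := by gcongr
    _ = _ := by ring

lemma k_deriv {S : Set (Euc d)} {η : GC d} (h : η.Ok S) (x0 : Euc d) {φ : XX d → ℝ} (hφ : IsTest φ) :
    ∀ᵐ t ∂v01, HasDerivAt (fun t => η.u t ^ 2 * φ (t, η.gam x0 t))
      (2 * η.u t * η.a t * φ (t, η.gam x0 t) + η.u t ^ 2 * fderiv ℝ φ (t, η.gam x0 t) (1, 0) +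
        fderiv ℝ φ (t, η.gam x0 t) (0, η.u t • η.w t)) t := by
  obtain ⟨C, hC⟩ := hφ.bm.2
  filter_upwards [v01_of_ae η.ae_deriv, gam_deriv h x0] with t ⟨h1, _⟩ h3
  by_cases h0 : η.u t = 0
  · have h4 := h1.pow 2
    rw [h0] at h4 ⊢
    simp only [mul_zero, zero_mul, ne_eq, OfNat.ofNat_ne_zero, not_false_eq_true, zero_pow, zero_smul, zero_add, Nat.add_one_sub_one, pow_one, Nat.cast_ofNat] at h4 ⊢
    rw [show (((0:ℝ), (0 : Euc d)) : XX d) = 0 from rfl, map_zero]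
    rw [hasDerivAt_iff_isLittleO] at h4 ⊢
    refine Asymptotics.IsBigO.trans_isLittleO (Asymptotics.IsBigO.of_bound C (Eventually.of_forall fun s => ?_)) h4
    simp only [Pi.pow_apply, h0, ne_eq, OfNat.ofNat_ne_zero, not_false_eq_true, zero_pow, zero_mul, sub_zero, smul_zero]
    rw [norm_mul, mul_comm]
    exact mul_le_mul_of_nonneg_right (hC _) (norm_nonneg _)
  · have h4 := h1.pow 2
    have h5 : HasDerivAt (fun s => (s, η.gam x0 s)) ((1:ℝ), (η.u t)⁻¹ • η.w t) t := (hasDerivAt_id t).prodMk (h3 h0)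
    have h6 : HasFDerivAt φ (fderiv ℝ φ (t, η.gam x0 t)) (t, η.gam x0 t) := (hφ.1.differentiable (by simp) _).hasFDerivAt
    have h7 := h4.mul (h6.comp_hasDerivAt t h5)
    refine h7.congr_deriv ?_
    have e : ((1:ℝ), (η.u t)⁻¹ • η.w t) = ((1:ℝ), (0 : Euc d)) + ((η.u t)⁻¹ ^ 2) • ((0:ℝ), η.u t • η.w t) := by
      ext1
      · simp
      · simp only [Prod.snd_add, Prod.smul_snd, zero_add, smul_smul]
        congr 1
        field_simp
    rw [e, map_add, map_smul, smul_eq_mul]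
    simp only [Nat.cast_ofNat, Pi.pow_apply, Nat.add_one_sub_one, pow_one, Function.comp]
    field_simp
    ring

end GC

namespace GC

lemma ioo_v01 : (volume.restrict (Ioo (0:ℝ) 1)) = v01 := by
  rw [v01]; exact Measure.restrict_congr_set Ioo_ae_eq_Icc

lemma u_bdd (η : GC d) : ∃ U, ∀ t, ‖η.u t‖ ≤ U := by
  obtain ⟨U, hU⟩ := isCompact_Icc.exists_bound_of_continuousOn (η.continuous_u.continuousOn (s := Icc (0:ℝ) 1))
  exact ⟨U, fun t => by rw [← u_clamp]; exact hU _ (clamp_mem t)⟩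

lemma int_uw (η : GC d) : Integrable (fun t => η.u t • η.w t) v01 := by
  obtain ⟨U, hU⟩ := η.u_bdd
  exact η.hw.int01.bdd_smul U η.continuous_u.aestronglyMeasurable (ae_of_all _ hU)

lemma int_ua (η : GC d) : Integrable (fun t => 2 * η.u t * η.a t) v01 := by
  obtain ⟨U, hU⟩ := η.u_bdd
  refine η.ha.int01.bdd_mul (c := 2 * U) (continuous_const.mul η.continuous_u).aestronglyMeasurable (ae_of_all _ fun t => ?_)
  rw [norm_mul]
  simpa using hU t

/-- lifted Lebesgue measure -/
def lam (η : GC d) (x0 : Euc d) : Measure (XX d) := Measure.map (fun t => (t, η.gam x0 t)) v01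

lemma measurable_lift (η : GC d) (x0 : Euc d) : Measurable fun t => (t, η.gam x0 t) := measurable_id.prodMk (η.measurable_gam x0)

instance (η : GC d) (x0 : Euc d) : IsFiniteMeasure (η.lam x0) := by unfold lam; infer_instance

lemma lam_int {F : Type*} [NormedAddCommGroup F] [NormedSpace ℝ F] [MeasurableSpace F] [BorelSpace F] [SecondCountableTopology F]
    (η : GC d) (x0 : Euc d) {g : XX d → F} (hg : Measurable g) :
    ∫ x, g x ∂(η.lam x0) = ∫ t, g (t, η.gam x0 t) ∂v01 :=
  integral_map (η.measurable_lift x0).aemeasurable hg.aestronglyMeasurable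

lemma lam_setInt {F : Type*} [NormedAddCommGroup F] [NormedSpace ℝ F] [MeasurableSpace F] [BorelSpace F] [SecondCountableTopology F]
    (η : GC d) (x0 : Euc d) {g : XX d → F} (hg : Measurable g) {s : Set (XX d)} (hs : MeasurableSet s) :
    ∫ x in s, g x ∂(η.lam x0) = ∫ t in Ioo (0:ℝ) 1, indicator {t | (t, η.gam x0 t) ∈ s} (fun t => g (t, η.gam x0 t)) t := by
  rw [lam, setIntegral_map hs hg.aestronglyMeasurable (η.measurable_lift x0).aemeasurable, ioo_v01,
    integral_indicator (s := {t | (t, η.gam x0 t) ∈ s}) ((η.measurable_lift x0) hs)]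
  rfl

theorem Ok.triple {Ω : Set (Euc d)} (hΩ : IsCompact Ω) {η : GC d} (h : η.Ok Ω) {α β δ : ℝ} (hα : 0 ≤ α) (hβ : 0 ≤ β) :
    ∃ m μ, Adm α β δ Ω η.f m μ (ENNReal.ofReal (η.E α β δ)) ∧
      (IsPreconnected {t | t ∈ Icc (0:ℝ) 1 ∧ 0 < η.u t} → JCw α β δ η.f m μ = 1 → MemCCw α β δ Ω η.f m μ) := by
  obtain ⟨x0, hx0, -⟩ := h.pos 0
  have mw : Measurable fun x : XX d => η.u x.1 • η.w x.1 := (η.continuous_u.measurable.comp measurable_fst).smul (η.hw.meas.comp measurable_fst)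
  have mu : Measurable fun x : XX d => 2 * η.u x.1 * η.a x.1 := ((η.continuous_u.measurable.comp measurable_fst).const_mul 2).mul (η.ha.meas.comp measurable_fst)
  have mr : Measurable fun x : XX d => η.u x.1 ^ 2 := (η.continuous_u.measurable.comp measurable_fst).pow_const 2
  have iw : Integrable (fun x : XX d => η.u x.1 • η.w x.1) (η.lam x0) :=
    (integrable_map_measure mw.aestronglyMeasurable (η.measurable_lift x0).aemeasurable).2 η.int_uw
  have iu : Integrable (fun x : XX d => 2 * η.u x.1 * η.a x.1) (η.lam x0) :=
    (integrable_map_measure mu.aestronglyMeasurable (η.measurable_lift x0).aemeasurable).2 η.int_ua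
  have hm : IsDensityV ((η.lam x0).withDensityᵥ fun x : XX d => η.u x.1 • η.w x.1) (η.lam x0) fun x : XX d => η.u x.1 • η.w x.1 :=
    fun s hs => withDensityᵥ_apply iw hs
  have hμ : IsDensityS ((η.lam x0).withDensityᵥ fun x : XX d => 2 * η.u x.1 * η.a x.1) (η.lam x0) fun x : XX d => 2 * η.u x.1 * η.a x.1 :=
    fun s hs => withDensityᵥ_apply iu hs
  obtain ⟨U, hU⟩ := η.u_bdd
  refine ⟨_, _, ⟨h.cw hΩ, η.lam x0, fun x => η.u x.1 ^ 2, fun x => η.u x.1 • η.w x.1, fun x => 2 * η.u x.1 * η.a x.1,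
    fun t => ENNReal.ofReal (η.u t ^ 2), inferInstance, mr, mw, mu, (η.continuous_u.pow 2).measurable.ennreal_ofReal, fun s hs => ?_, hm, hμ,
    fun φ hφ => ?_, fun t => ?_, ?_, ?_⟩, fun hp hJ => ?_⟩
  · rw [lam_setInt η x0 mr hs]
    congr 1
    ext t
    rw [sInt_gam η x0]
    by_cases ht : (t, η.gam x0 t) ∈ s
    · rw [indicator_of_mem (s := {x | (t, x) ∈ s}) ht, indicator_of_mem (s := {t | (t, η.gam x0 t) ∈ s}) ht, mul_one]
    · rw [indicator_of_notMem (s := {x | (t, x) ∈ s}) ht, indicator_of_notMem (s := {t | (t, η.gam x0 t) ∈ s}) ht, mul_zero]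
  · obtain ⟨C, hC⟩ := hφ.bm.2
    obtain ⟨L, hL⟩ := hφ.fderiv_bdd
    have cD := hφ.fderiv_cont
    have m2 : Measurable fun x : XX d => fderiv ℝ φ x ((0:ℝ), η.u x.1 • η.w x.1) :=
      (isBoundedBilinearMap_apply (𝕜 := ℝ) (E := XX d) (F := ℝ)).continuous.measurable.comp (cD.measurable.prodMk (measurable_const.prodMk mw))
    have m3 : Measurable fun x : XX d => φ x * (2 * η.u x.1 * η.a x.1) := hφ.bm.1.mul mu
    rw [lam_int η x0 m2, lam_int η x0 m3, ioo_v01]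
    simp_rw [sInt_gam η x0]
    have j1 : Integrable (fun t => η.u t ^ 2 * fderiv ℝ φ (t, η.gam x0 t) (1, 0)) v01 := by
      obtain ⟨C1, hC1⟩ := (hφ.bm_dt (1, 0)).2
      refine ((((η.continuous_u.pow 2).continuousOn (s := Icc 0 1)).integrableOn_compact isCompact_Icc) : Integrable _ v01).mul_bdd (c := C1)
        ((hφ.bm_dt (1, 0)).1.comp (η.measurable_lift x0)).aestronglyMeasurable (ae_of_all _ fun t => hC1 _)
    have j2 : Integrable (fun t => fderiv ℝ φ (t, η.gam x0 t) ((0:ℝ), η.u t • η.w t)) v01 :=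
      (integrable_map_measure m2.aestronglyMeasurable (η.measurable_lift x0).aemeasurable).1 (integrable_clm_apply cD hL iw)
    have j3 : Integrable (fun t => φ (t, η.gam x0 t) * (2 * η.u t * η.a t)) v01 :=
      η.int_ua.bdd_mul (c := C) (hφ.bm.1.comp (η.measurable_lift x0)).aestronglyMeasurable (ae_of_all _ fun t => hC _)
    have j12 : Integrable (fun t => η.u t ^ 2 * fderiv ℝ φ (t, η.gam x0 t) (1, 0) + fderiv ℝ φ (t, η.gam x0 t) ((0:ℝ), η.u t • η.w t)) v01 := j1.add j2
    rw [← integral_add j1 j2, ← integral_add j12 j3]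
    have hk := (k_ac hΩ h hx0 hφ).integral_deriv_eq_sub
    have z0 : ∀ t x, t ∉ Ioo (0:ℝ) 1 → φ (t, x) = 0 := fun t x ht => by
      by_contra hne
      exact ht (hφ.2.2 (subset_tsupport _ hne)).1
    rw [z0 1 _ (by simp), z0 0 _ (by simp), mul_zero, mul_zero, sub_zero, intervalIntegral.integral_of_le zero_le_one,
      Measure.restrict_congr_set Ioc_ae_eq_Icc] at hk
    refine Eq.trans (integral_congr_ae ?_) hk
    filter_upwards [k_deriv h x0 hφ] with t ht
    rw [ht.deriv]
    ring
  · rw [f_gam η x0]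
    have := tv_smul_le (Measure.dirac (η.gam x0 t)).toSignedMeasure (Real.toNNReal (η.u t ^ 2))
    rw [Real.coe_toNNReal _ (sq_nonneg _)] at this
    refine this.trans ?_
    calc _ ≤ (Real.toNNReal (η.u t ^ 2) : ℝ≥0∞) * 1 := by
          gcongr
          exact (tv_toSigned_le _).trans (by simp)
      _ = _ := by rw [mul_one]; rfl
  · rw [ioo_v01]
    refine ne_top_of_le_ne_top ?_ (lintegral_mono (g := fun _ => ENNReal.ofReal (U ^ 2)) fun t => ENNReal.ofReal_le_ofReal ?_)
    · simp
    · rw [← sq_abs, ← Real.norm_eq_abs]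
      exact pow_le_pow_left₀ (norm_nonneg _) (hU t) 2
  · rw [ioo_v01, lam, lintegral_map (measurable_Psi δ mr mw mu) (η.measurable_lift x0)]
    have mP : Measurable fun t => Psi δ (η.u t ^ 2) (η.u t • η.w t) (2 * η.u t * η.a t) :=
      measurable_Psi δ (η.continuous_u.pow 2).measurable (η.continuous_u.measurable.smul η.hw.meas) ((η.continuous_u.measurable.const_mul 2).mul η.ha.meas)
    rw [E, ofReal_integral_eq_lintegral_ofReal (E_int α β δ η) (ae_of_all _ fun t => by positivity),
      ← lintegral_const_mul _ mP, ← lintegral_const_mul (f := fun t => ENNReal.ofReal (η.u t ^ 2)) _ (η.continuous_u.pow 2).measurable.ennreal_ofReal,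
      ← lintegral_add_left (mP.const_mul _)]
    refine lintegral_mono fun t => ?_
    show ENNReal.ofReal β * Psi δ (η.u t ^ 2) (η.u t • η.w t) (2 * η.u t * η.a t) + ENNReal.ofReal α * ENNReal.ofReal (η.u t ^ 2) ≤ _
    rw [ENNReal.ofReal_add (by positivity) (by positivity), ← ENNReal.ofReal_mul hα, Real.norm_eq_abs (η.u t), sq_abs]
    gcongr
    by_cases h0 : η.u t = 0
    · simp [Psi, h0]
    · have hp : 0 < η.u t ^ 2 := by positivity
      rw [Psi, if_pos hp, ← ENNReal.ofReal_mul hβ]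
      refine ENNReal.ofReal_le_ofReal (le_of_eq ?_)
      rw [norm_smul, Real.norm_eq_abs, Real.norm_eq_abs, mul_pow, sq_abs, sq_abs]
      field_simp
      ring
  · refine ⟨η.gam x0, fun t => η.u t ^ 2, fun t => (η.u t)⁻¹ • η.w t, fun t => 2 * η.u t * η.a t, fun t ht => ⟨sq_nonneg _, gam_mem h hx0 t⟩,
      ?_, ?_, ?_, fun φ hφ => ?_, ⟨?_, ?_⟩, fun t => ?_, fun s hs => ?_, fun s hs => ?_, ?_, hJ⟩
    · refine ⟨fun t => 2 * η.u t * η.a t, η.int_ua, ?_, fun t ht => ?_⟩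
      · have : Integrable (fun t => (4 * η.u t ^ 2) * ‖η.a t‖ ^ 2) v01 := by
          refine η.ha.sq.bdd_mul (c := 4 * U ^ 2) (continuous_const.mul (η.continuous_u.pow 2)).aestronglyMeasurable (ae_of_all _ fun t => ?_)
          rw [norm_mul, norm_pow]
          have := pow_le_pow_left₀ (norm_nonneg _) (hU t) 2
          simp only [Real.norm_ofNat]
          linarith
        refine this.congr (ae_of_all _ fun t => ?_)
        simp only [norm_mul, Real.norm_ofNat, Real.norm_eq_abs, mul_pow, sq_abs]
        ring
      · have hk := ((η.u_ac 0 t).fun_mul (η.u_ac 0 t)).integral_deriv_eq_sub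
        have : ∫ s in (0:ℝ)..t, 2 * η.u s * η.a s = η.u t * η.u t - η.u 0 * η.u 0 := by
          rw [← hk]
          refine intervalIntegral.integral_congr_ae ?_
          filter_upwards [η.ae_deriv] with s hs _
          rw [(hs.1.fun_mul hs.1).deriv]
          ring
        rw [this]; ring
    · simp_rw [Real.sqrt_sq (h.nn _)]
      refine ⟨η.a, η.ha.int01, η.ha.sq, fun t ht => ?_⟩
      show η.u t = η.u 0 + _
      rw [u_zero]; rfl
    · simp_rw [Real.sqrt_sq (h.nn _), u_gam h]
      refine ⟨η.b, η.hb.int01, η.hb.sq, fun t ht => ?_⟩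
      show η.z t = η.z 0 + _
      rw [z_zero]; rfl
    · have := (h.cw hΩ).2.2 φ hφ
      simp_rw [sInt_gam η x0] at this
      exact this.continuousOn
    · filter_upwards [ae_restrict_of_ae η.ae_deriv] with t ht
      exact (ht.1.fun_pow 2).congr_deriv (by simp)
    · rw [ae_restrict_iff']
      · have := gam_deriv h x0
        rw [v01, ae_restrict_iff' measurableSet_Icc] at this
        filter_upwards [this] with t ht ht2
        refine ht ⟨ht2.1.1.le, ht2.1.2.le⟩ fun h0 => ?_
        have := ht2.2
        simp [h0] at this
      · exact measurableSet_Ioo.inter (measurableSet_lt measurable_const (η.continuous_u.pow 2).measurable)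
    · rw [← f_clamp η]; exact f_gam η x0 _
    · rw [hm s hs, lam_setInt η x0 mw hs]
      congr 1
      ext1 t
      congr 1
      ext1 t
      by_cases h0 : η.u t = 0
      · simp [h0]
      · simp only [smul_smul]
        congr 1
        field_simp
    · rw [hμ s hs, lam_setInt η x0 mu hs]
    · convert hp using 4 with t
      constructor
      · exact fun h1 => lt_of_le_of_ne (h.nn t) fun h0 => by simp [← h0] at h1
      · exact fun h1 => by positivity

end GC

/-- coordinatewise clamp to a box -/
def boxT (R : ℝ) (x : Euc d) : Euc d := WithLp.toLp 2 fun i => max (-R) (min R (x i))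

/-- the box -/
def box (d : ℕ) (R : ℝ) : Set (Euc d) := {x | ∀ i, x i ∈ Icc (-R) R}

lemma boxT_apply (R : ℝ) (x : Euc d) (i : Fin d) : boxT R x i = max (-R) (min R (x i)) := rfl

lemma boxT_mem {R : ℝ} (hR : 0 ≤ R) (x : Euc d) : boxT R x ∈ box d R := fun i => by
  rw [boxT_apply]
  exact ⟨le_max_left _ _, max_le (by linarith) (min_le_left _ _)⟩

lemma boxT_of_mem {R : ℝ} {x : Euc d} (hx : x ∈ box d R) : boxT R x = x := by
  ext i
  rw [boxT_apply, min_eq_right (hx i).2, max_eq_right (hx i).1]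

lemma boxT_lip (R : ℝ) : LipschitzWith 1 (boxT R : Euc d → Euc d) := by
  refine LipschitzWith.of_dist_le_mul fun x y => ?_
  rw [NNReal.coe_one, one_mul, EuclideanSpace.dist_eq, EuclideanSpace.dist_eq]
  refine Real.sqrt_le_sqrt (Finset.sum_le_sum fun i _ => pow_le_pow_left₀ dist_nonneg ?_ 2)
  rw [boxT_apply, boxT_apply, Real.dist_eq, Real.dist_eq]
  refine (abs_max_sub_max_le_max _ _ _ _).trans ?_
  refine max_le (by simp) ((abs_min_sub_min_le_max _ _ _ _).trans (max_le (by simp) le_rfl))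

lemma box_compact (R : ℝ) : IsCompact (box d R) := by
  have : box d R = (EuclideanSpace.equiv (Fin d) ℝ) ⁻¹' (Set.pi univ fun _ => Icc (-R) R) := by
    ext x
    exact ⟨fun h i _ => h i, fun h i => h i trivial⟩
  rw [this]
  exact (EuclideanSpace.equiv (Fin d) ℝ).toHomeomorph.isCompact_preimage.2 (isCompact_univ_pi fun _ => isCompact_Icc)

lemma exists_box {Ω : Set (Euc d)} (hΩ : Bornology.IsBounded Ω) : ∃ R, 0 ≤ R ∧ Ω ⊆ box d R := by
  obtain ⟨R, hR⟩ := hΩ.exists_norm_le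
  refine ⟨max R 0, le_max_right _ _, fun x hx i => ?_⟩
  have := (PiLp.norm_apply_le x i).trans ((hR x hx).trans (le_max_left R 0))
  rw [Real.norm_eq_abs] at this
  exact abs_le.1 this

lemma prim_real {k b : ℝ → ℝ} {K : ℝ≥0} (hk : LipschitzOnWith K k (Icc 0 1)) (hb : ∀ᵐ t ∂v01, HasDerivAt k (b t) t)
    {t : ℝ} (ht : t ∈ Icc (0:ℝ) 1) : ∫ s in (0:ℝ)..t, b s = k t - k 0 := by
  have hac : AbsolutelyContinuousOnInterval k 0 t :=
    (hk.mono (by rw [uIcc_of_le ht.1]; exact Icc_subset_Icc_right ht.2)).absolutelyContinuousOnInterval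
  rw [← hac.integral_deriv_eq_sub]
  refine intervalIntegral.integral_congr_ae ?_
  rw [v01, ae_restrict_iff' measurableSet_Icc] at hb
  filter_upwards [hb] with s hs hs'
  rw [uIoc_of_le ht.1] at hs'
  exact (hs ⟨hs'.1.le, hs'.2.trans ht.2⟩).deriv.symm

lemma prim_euc {k b : ℝ → Euc d} {K : ℝ≥0} (hk : LipschitzOnWith K k (Icc 0 1)) (hb : ∀ᵐ t ∂v01, HasDerivAt k (b t) t)
    (hi : Integrable b volume) {t : ℝ} (ht : t ∈ Icc (0:ℝ) 1) : ∫ s in (0:ℝ)..t, b s = k t - k 0 := by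
  ext i
  have h1 : LipschitzOnWith K (fun t => k t i) (Icc 0 1) := by
    refine LipschitzOnWith.of_dist_le_mul fun x hx y hy => ?_
    refine le_trans ?_ (hk.dist_le_mul x hx y hy)
    rw [Real.dist_eq, dist_eq_norm]
    have := PiLp.norm_apply_le (k x - k y) i
    simpa using this
  have h2 : ∀ᵐ t ∂v01, HasDerivAt (fun t => k t i) (b t i) t := by
    filter_upwards [hb] with t ht
    exact ((EuclideanSpace.proj (𝕜 := ℝ) i).hasFDerivAt.comp_hasDerivAt t ht)
  have := prim_real h1 h2 ht
  have e := (EuclideanSpace.proj i : Euc d →L[ℝ] ℝ).intervalIntegral_comp_comm (hi.intervalIntegrable (a := 0) (b := t))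
  exact (e.symm.trans this :)

lemma norm_deriv_le_of_dist {k g : ℝ → Euc d} {a b : Euc d} {t : ℝ} (hk : HasDerivAt k a t) (hg : HasDerivAt g b t)
    (h : ∀ s, ‖k s - k t‖ ≤ ‖g s - g t‖) : ‖a‖ ≤ ‖b‖ := by
  refine le_of_tendsto_of_tendsto (hasDerivAt_iff_tendsto_slope.1 hk).norm (hasDerivAt_iff_tendsto_slope.1 hg).norm
    (Eventually.of_forall fun s => ?_)
  simp only [slope_def_module, norm_smul]
  exact mul_le_mul_of_nonneg_left (h s) (norm_nonneg _)

lemma L2D.of_bdd {F : Type*} [NormedAddCommGroup F] [MeasurableSpace F] [BorelSpace F] [SecondCountableTopology F] {a : ℝ → F}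
    (ha : Measurable a) {C : ℝ} (hC : ∀ t ∈ Icc (0:ℝ) 1, ‖a t‖ ≤ C) : L2D ((Icc (0:ℝ) 1).indicator a) where
  meas := ha.indicator measurableSet_Icc
  mem := by
    refine MemLp.of_bound (ha.indicator measurableSet_Icc).aestronglyMeasurable (max C 0) (ae_of_all _ fun t => ?_)
    by_cases ht : t ∈ Icc (0:ℝ) 1
    · rw [indicator_of_mem ht]; exact (hC t ht).trans (le_max_left _ _)
    · rw [indicator_of_notMem ht]; simp
  zero := fun s hs => indicator_of_notMem hs _

/-- a control gives a generalized cone curve -/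
theorem Ctl.toGC (c : Ctl d) (x : Euc d) {R : ℝ} (hR : 0 ≤ R) {α β δ : ℝ} (hβ : 0 ≤ β) : ∃ η : GC d, η.Ok (box d R) ∧
    (∀ t ∈ Icc (0:ℝ) 1, η.u t = Real.exp (c.Q t / 2) ∧ η.z t = Real.exp (c.Q t / 2) • boxT R (x + c.W t)) ∧
    η.E α β δ ≤ ∫ s, (Real.exp (c.Q s) * (α + Ctl.cost (β / 2) δ c s)) ∂v01 := by
  have hC := c.C_nonneg
  have hQ : ∀ t ∈ Icc (0:ℝ) 1, |c.Q t| ≤ c.C := fun t ht => by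
    have := c.abs_Q_le (R := 1) (s := t) (by rw [abs_of_nonneg ht.1]; exact ht.2)
    simpa using this
  have hQd : ∀ t s, |c.Q t - c.Q s| ≤ c.C * |t - s| := fun t s => by
    rw [c.Q_sub, ← Real.norm_eq_abs]
    exact intervalIntegral.norm_integral_le_of_norm_le_const fun r _ => c.hqC r
  have hWd : ∀ t s, ‖c.W t - c.W s‖ ≤ c.C * |t - s| := fun t s => by
    rw [c.W_sub]
    exact intervalIntegral.norm_integral_le_of_norm_le_const fun r _ => c.hwC r
  set v : ℝ → ℝ := fun t => Real.exp (c.Q t / 2) with hv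
  have cv : Continuous v := Real.continuous_exp.comp (c.continuous_Q.div_const 2)
  set V : ℝ := Real.exp (c.C / 2) with hVdef
  have hV : ∀ t ∈ Icc (0:ℝ) 1, v t ≤ V := fun t ht => Real.exp_le_exp.2 (by have := abs_le.1 (hQ t ht); linarith)
  have hv0 : ∀ t, 0 < v t := fun t => Real.exp_pos _
  have hvd : ∀ t ∈ Icc (0:ℝ) 1, ∀ s ∈ Icc (0:ℝ) 1, |v t - v s| ≤ V * (c.C / 2) * |t - s| := fun t ht s hs => by
    have h1 : ∀ a b : ℝ, a ≤ c.C / 2 → b ≤ c.C / 2 → |Real.exp a - Real.exp b| ≤ V * |a - b| := fun a b ha hb => by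
      have := Convex.norm_image_sub_le_of_norm_deriv_le (f := Real.exp) (C := V) (s := Iic (c.C / 2)) (x := b) (y := a)
        (fun y _ => Real.differentiableAt_exp) (fun y hy => by
          rw [Real.deriv_exp, Real.norm_of_nonneg (Real.exp_pos _).le]; exact Real.exp_le_exp.2 hy) (convex_Iic _) hb ha
      simpa using this
    refine (h1 _ _ (by have := abs_le.1 (hQ t ht); linarith) (by have := abs_le.1 (hQ s hs); linarith)).trans ?_
    rw [mul_assoc]
    refine mul_le_mul_of_nonneg_left ?_ (Real.exp_pos _).le
    rw [← sub_div, abs_div, abs_two]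
    have := hQd t s
    linarith
  set γ : ℝ → Euc d := fun t => boxT R (x + c.W t) with hγ
  have hγd' : ∀ t s, ‖γ t - γ s‖ ≤ ‖c.W t - c.W s‖ := fun t s => by
    have := (boxT_lip R).dist_le_mul (x + c.W t) (x + c.W s)
    rw [NNReal.coe_one, one_mul, dist_eq_norm, dist_eq_norm, add_sub_add_left_eq_sub] at this
    exact this
  have hγd : ∀ t s, ‖γ t - γ s‖ ≤ c.C * |t - s| := fun t s => (hγd' t s).trans (hWd t s)
  have lγ : LipschitzWith ⟨c.C, hC⟩ γ := LipschitzWith.of_dist_le_mul fun t s => by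
    rw [dist_eq_norm, Real.dist_eq]; exact hγd t s
  obtain ⟨B, hB⟩ := (box_compact (d := d) R).isBounded.exists_norm_le
  have hγB : ∀ t, ‖γ t‖ ≤ B := fun t => hB _ (boxT_mem hR _)
  have hB0 : 0 ≤ B := (norm_nonneg _).trans (hγB 0)
  set g : ℝ → Euc d := deriv γ with hg
  have mg : Measurable g := measurable_deriv γ
  have hgC : ∀ t, ‖g t‖ ≤ c.C := fun t => norm_deriv_le_of_lipschitz lγ
  have dγ : ∀ᵐ t : ℝ, HasDerivAt γ (g t) t := by
    filter_upwards [lγ.ae_differentiableAt (μ := volume)] with t ht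
    exact ht.hasDerivAt
  have wi : LocallyIntegrable c.w volume := by
    refine (locallyIntegrable_const c.C).mono c.hw.aestronglyMeasurable (ae_of_all _ fun t => ?_)
    rw [Real.norm_of_nonneg hC]; exact c.hwC t
  have qi : LocallyIntegrable c.q volume := by
    refine (locallyIntegrable_const c.C).mono c.hq.aestronglyMeasurable (ae_of_all _ fun t => ?_)
    rw [Real.norm_of_nonneg hC]; exact c.hqC t
  have dW : ∀ᵐ t : ℝ, HasDerivAt c.W (c.w t) t := by
    filter_upwards [LocallyIntegrable.ae_hasDerivAt_integral wi] with t h using h 0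
  have dQ : ∀ᵐ t : ℝ, HasDerivAt c.Q (c.q t) t := by
    filter_upwards [LocallyIntegrable.ae_hasDerivAt_integral qi] with t h using h 0
  have dv : ∀ᵐ t : ℝ, HasDerivAt v (c.q t / 2 * v t) t := by
    filter_upwards [dQ] with t h
    exact ((h.div_const 2).exp).congr_deriv (by ring)
  have gw : ∀ᵐ t : ℝ, ‖g t‖ ≤ ‖c.w t‖ := by
    filter_upwards [dγ, dW] with t h1 h2
    exact norm_deriv_le_of_dist h1 h2 fun s => hγd' s t
  let a : ℝ → ℝ := fun t => c.q t / 2 * v t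
  let w : ℝ → Euc d := fun t => v t • g t
  let b : ℝ → Euc d := fun t => v t • g t + (c.q t / 2 * v t) • γ t
  have ma : Measurable a := (c.hq.div_const 2).mul cv.measurable
  have mw : Measurable w := cv.measurable.smul mg
  have mb : Measurable b := mw.add (ma.smul lγ.continuous.measurable)
  have ba : ∀ t ∈ Icc (0:ℝ) 1, ‖a t‖ ≤ c.C / 2 * V := fun t ht => by
    rw [norm_mul, norm_div, Real.norm_ofNat, Real.norm_of_nonneg (hv0 t).le]
    have := c.hqC t
    rw [← Real.norm_eq_abs] at this
    have := hV t ht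
    gcongr
  have bw : ∀ t ∈ Icc (0:ℝ) 1, ‖w t‖ ≤ V * c.C := fun t ht => by
    rw [norm_smul, Real.norm_of_nonneg (hv0 t).le]
    have := hV t ht
    have := hgC t
    gcongr
  have bb : ∀ t ∈ Icc (0:ℝ) 1, ‖b t‖ ≤ V * c.C + c.C / 2 * V * B := fun t ht => by
    refine (norm_add_le _ _).trans (add_le_add (bw t ht) ?_)
    rw [norm_smul]
    have := ba t ht
    have := hγB t
    gcongr
  let η : GC d := ⟨v 0, v 0 • γ 0, (Icc (0:ℝ) 1).indicator a, (Icc (0:ℝ) 1).indicator b, (Icc (0:ℝ) 1).indicator w,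
    L2D.of_bdd ma ba, L2D.of_bdd mb bb, L2D.of_bdd mw bw⟩
  have lv : LipschitzOnWith ⟨V * (c.C / 2), by positivity⟩ v (Icc 0 1) := LipschitzOnWith.of_dist_le_mul fun t ht s hs => by
    rw [Real.dist_eq, Real.dist_eq]; exact hvd t ht s hs
  have lz : LipschitzOnWith ⟨V * c.C + V * (c.C / 2) * B, by positivity⟩ (fun t => v t • γ t) (Icc 0 1) :=
    LipschitzOnWith.of_dist_le_mul fun t ht s hs => by
      rw [dist_eq_norm, Real.dist_eq]
      have : v t • γ t - v s • γ s = v t • (γ t - γ s) + (v t - v s) • γ s := by rw [smul_sub, sub_smul]; abel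
      rw [this]
      refine (norm_add_le _ _).trans ?_
      rw [norm_smul, norm_smul, Real.norm_of_nonneg (hv0 t).le, Real.norm_eq_abs]
      have h1 := hvd t ht s hs
      have h2 := hV t ht
      have h3 := hγd t s
      have h4 := hγB s
      calc _ ≤ V * (c.C * |t - s|) + (V * (c.C / 2) * |t - s|) * B := by gcongr
        _ = (V * c.C + V * (c.C / 2) * B) * |t - s| := by ring
  have hu : ∀ t ∈ Icc (0:ℝ) 1, η.u t = v t := fun t ht => by
    have := prim_real (b := η.a) lv (by
      rw [v01, ae_restrict_iff' measurableSet_Icc]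
      filter_upwards [dv] with s h hs
      show HasDerivAt v ((Icc (0:ℝ) 1).indicator a s) s
      rw [indicator_of_mem hs]; exact h) ht
    show v 0 + _ = _
    rw [this]; ring
  have hz : ∀ t ∈ Icc (0:ℝ) 1, η.z t = v t • γ t := fun t ht => by
    have := prim_euc (b := η.b) lz (by
      rw [v01, ae_restrict_iff' measurableSet_Icc]
      filter_upwards [dv, dγ] with s h h' hs
      show HasDerivAt (fun t => v t • γ t) ((Icc (0:ℝ) 1).indicator b s) s
      rw [indicator_of_mem hs]; exact h.smul h') η.hb.integrable ht
    show v 0 • γ 0 + _ = _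
    rw [this]; abel
  refine ⟨η, ⟨fun t => ?_, fun t => ?_, ?_⟩, fun t ht => ⟨hu t ht, hz t ht⟩, ?_⟩
  · rw [← GC.u_clamp, hu _ (clamp_mem t)]; exact (hv0 _).le
  · rw [← GC.u_clamp, ← GC.z_clamp, hu _ (clamp_mem t), hz _ (clamp_mem t)]
    exact ⟨_, boxT_mem hR _, rfl⟩
  · rw [v01, ae_restrict_iff' measurableSet_Icc]
    refine ae_of_all _ fun t ht => ?_
    show η.u t • (Icc (0:ℝ) 1).indicator b t = η.u t • (Icc (0:ℝ) 1).indicator w t + (Icc (0:ℝ) 1).indicator a t • η.z t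
    rw [indicator_of_mem ht, indicator_of_mem ht, indicator_of_mem ht, hu t ht, hz t ht]
    show v t • (v t • g t + (c.q t / 2 * v t) • γ t) = v t • (v t • g t) + (c.q t / 2 * v t) • v t • γ t
    rw [smul_add, smul_comm (v t) (c.q t / 2 * v t)]
  · have hvv : ∀ s, Real.exp (c.Q s) = v s ^ 2 := fun s => by
      rw [hv, ← Real.exp_nat_mul]; congr 1; push_cast; ring
    refine integral_mono_ae (GC.E_int α β δ η) ?_ ?_
    · refine Integrable.bdd_mul (c := V ^ 2) (Integrable.of_bound (C := |α| + |β / 2| * (c.C ^ 2 + δ ^ 2 * c.C ^ 2)) (measurable_const.add c.measurable_cost).aestronglyMeasurable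
        (ae_of_all _ fun s => ?_)) (Real.continuous_exp.comp c.continuous_Q).aestronglyMeasurable ?_
      · exact (norm_add_le _ _).trans (add_le_add le_rfl (c.abs_cost_le s))
      · rw [v01, ae_restrict_iff' measurableSet_Icc]
        refine ae_of_all _ fun t ht => ?_
        rw [hvv, Real.norm_of_nonneg (sq_nonneg _)]
        exact pow_le_pow_left₀ (hv0 t).le (hV t ht) 2
    · rw [v01, EventuallyLE, ae_restrict_iff' measurableSet_Icc]
      filter_upwards [gw] with t hgt ht
      show β / 2 * (‖(Icc (0:ℝ) 1).indicator w t‖ ^ 2 + 4 * δ ^ 2 * ‖(Icc (0:ℝ) 1).indicator a t‖ ^ 2) + α * ‖η.u t‖ ^ 2 ≤ _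
      rw [indicator_of_mem ht, indicator_of_mem ht, hu t ht, hvv, Ctl.cost]
      show β / 2 * (‖v t • g t‖ ^ 2 + 4 * δ ^ 2 * ‖c.q t / 2 * v t‖ ^ 2) + α * ‖v t‖ ^ 2 ≤ _
      rw [norm_smul, Real.norm_eq_abs, Real.norm_eq_abs, mul_pow, sq_abs, sq_abs]
      have h1 : ‖g t‖ ^ 2 ≤ ‖c.w t‖ ^ 2 := pow_le_pow_left₀ (norm_nonneg _) hgt 2
      have h2 : β / 2 * (v t ^ 2 * ‖g t‖ ^ 2) ≤ β / 2 * (v t ^ 2 * ‖c.w t‖ ^ 2) := by gcongr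
      nlinarith [h2]

/-- Lipschitz partition of unity on a set -/
structure Part {X : Type*} [PseudoMetricSpace X] (S : Set X) (r : ℝ) where
  t : Finset X
  χ : X → X → ℝ
  mem : ∀ p ∈ t, p ∈ S
  nn : ∀ p x, 0 ≤ χ p x
  le1 : ∀ p ∈ t, ∀ x, χ p x ≤ 1
  sum : ∀ x ∈ S, ∑ p ∈ t, χ p x = 1
  supp : ∀ p x, χ p x ≠ 0 → dist x p < r
  lip : ∀ p ∈ t, ∃ K : ℝ≥0, LipschitzWith K (χ p)
  pos : ∀ p ∈ t, 0 < χ p p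

lemma lip_real {X : Type*} [PseudoMetricSpace X] {f : X → ℝ} {K : ℝ} (hK : 0 ≤ K) (h : ∀ x y, |f x - f y| ≤ K * dist x y) :
    ∃ K : ℝ≥0, LipschitzWith K f :=
  ⟨⟨K, hK⟩, LipschitzWith.of_dist_le_mul fun x y => by rw [Real.dist_eq]; exact h x y⟩

theorem exists_part {X : Type*} [PseudoMetricSpace X] {S : Set X} (hS : IsCompact S) (hne : S.Nonempty) {r : ℝ} (hr : 0 < r) :
    Nonempty (Part S r) := by
  obtain ⟨t0, ht0, hfin, hcov⟩ := hS.finite_cover_balls (e := r / 2) (by positivity)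
  set t : Finset X := hfin.toFinset
  have htS : ∀ p ∈ t, p ∈ S := fun p hp => ht0 (hfin.mem_toFinset.1 hp)
  let g : X → X → ℝ := fun p x => max 0 (r - dist x p)
  have g0 : ∀ p x, 0 ≤ g p x := fun p x => le_max_left _ _
  let D : X → ℝ := fun x => ∑ p ∈ t, g p x + Metric.infDist x S
  have gl : ∀ p x y, |g p x - g p y| ≤ dist x y := fun p x y => by
    refine (abs_max_sub_max_le_max _ _ _ _).trans (max_le (by simp) ?_)
    have := abs_dist_sub_le x y p
    rw [show r - dist x p - (r - dist y p) = -(dist x p - dist y p) by ring, abs_neg]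
    exact this
  have gs : ∀ p x, p ∈ t → g p x ≤ ∑ p ∈ t, g p x := fun p x hp => Finset.single_le_sum (f := fun p => g p x) (fun q _ => g0 q x) hp
  have gD : ∀ p x, p ∈ t → g p x ≤ D x := fun p x hp => (gs p x hp).trans (le_add_of_nonneg_right Metric.infDist_nonneg)
  have Dl : ∀ x y, |D x - D y| ≤ (t.card + 1) * dist x y := fun x y => by
    have e : D x - D y = ∑ p ∈ t, (g p x - g p y) + (Metric.infDist x S - Metric.infDist y S) := by
      rw [Finset.sum_sub_distrib]; ring
    rw [e]
    refine (abs_add_le _ _).trans ?_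
    rw [add_mul, one_mul]
    refine add_le_add ((Finset.abs_sum_le_sum_abs _ _).trans ?_) ?_
    · exact (Finset.sum_le_sum fun p _ => gl p x y).trans (by simp)
    · have := (Metric.lipschitz_infDist_pt S).dist_le_mul x y
      rwa [NNReal.coe_one, one_mul, Real.dist_eq] at this
  have Dr : ∀ x, r / 4 ≤ D x := fun x => by
    by_cases h : ∃ p ∈ t, dist x p < 3 * r / 4
    · obtain ⟨p, hp, h⟩ := h
      refine le_trans ?_ (gD p x hp)
      exact le_max_of_le_right (by linarith)
    · push Not at h
      have : r / 4 ≤ Metric.infDist x S := by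
        refine (Metric.le_infDist hne).2 fun y hy => ?_
        obtain ⟨p, hp, hyp⟩ := mem_iUnion₂.1 (hcov hy)
        have := h p (hfin.mem_toFinset.2 hp)
        have := dist_triangle x y p
        rw [Metric.mem_ball] at hyp
        linarith
      exact this.trans (le_add_of_nonneg_left (Finset.sum_nonneg fun p _ => g0 p x))
  have D0 : ∀ x, 0 < D x := fun x => lt_of_lt_of_le (by positivity) (Dr x)
  refine ⟨⟨t, fun p x => g p x / D x, htS, fun p x => div_nonneg (g0 p x) (D0 x).le,
    fun p hp x => (div_le_one (D0 x)).2 (gD p x hp), fun x hx => ?_, fun p x h => ?_, fun p hp => ?_, fun p hp => ?_⟩⟩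
  · rw [← Finset.sum_div, div_eq_one_iff_eq (D0 x).ne']
    simp [D, Metric.infDist_zero_of_mem hx]
  · by_contra hh
    refine h ?_
    rw [show g p x = 0 from max_eq_left (by linarith), zero_div]
  · refine lip_real (K := (4 / r) * (t.card + 2)) (by positivity) fun x y => ?_
    have e : g p x / D x - g p y / D y = ((g p x - g p y) + (g p y / D y) * (D y - D x)) / D x := by
      have := (D0 x).ne'
      have := (D0 y).ne'
      field_simp
      ring
    rw [e, abs_div, abs_of_pos (D0 x), div_le_iff₀ (D0 x)]
    have h1 : |g p x - g p y + g p y / D y * (D y - D x)| ≤ (t.card + 2) * dist x y := by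
      refine (abs_add_le _ _).trans ?_
      rw [abs_mul, abs_of_nonneg (div_nonneg (g0 p y) (D0 y).le)]
      have h2 := Dl y x
      rw [dist_comm] at h2
      have h3 : g p y / D y ≤ 1 := (div_le_one (D0 y)).2 (gD p y hp)
      have h4 := gl p x y
      have h5 : g p y / D y * |D y - D x| ≤ 1 * |D y - D x| := by gcongr
      linarith
    refine h1.trans ?_
    have h6 : 1 ≤ 4 / r * D x := by
      have := mul_le_mul_of_nonneg_left (Dr x) (show 0 ≤ 4 / r by positivity)
      refine le_trans (le_of_eq ?_) this
      field_simp
    have : 0 ≤ (t.card + 2 : ℝ) * dist x y := by positivity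
    nlinarith
  · refine div_pos (lt_max_of_lt_right ?_) (D0 p)
    rw [dist_self]; linarith

/-- bounded Lipschitz -/
def BL {X : Type*} [PseudoMetricSpace X] (f : X → ℝ) : Prop := (∃ C, ∀ x, |f x| ≤ C) ∧ ∃ K : ℝ≥0, LipschitzWith K f

namespace BL
variable {X : Type*} [PseudoMetricSpace X] {f g : X → ℝ}

lemma const (c : ℝ) : BL fun _ : X => c := ⟨⟨|c|, fun _ => le_rfl⟩, 0, LipschitzWith.const c⟩

lemma add (hf : BL f) (hg : BL g) : BL fun x => f x + g x := by
  obtain ⟨⟨C, hC⟩, K, hK⟩ := hf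
  obtain ⟨⟨C', hC'⟩, K', hK'⟩ := hg
  exact ⟨⟨C + C', fun x => (abs_add_le _ _).trans (add_le_add (hC x) (hC' x))⟩, _, hK.add hK'⟩

lemma sum {ι : Type*} (s : Finset ι) {f : ι → X → ℝ} (h : ∀ i ∈ s, BL (f i)) : BL fun x => ∑ i ∈ s, f i x := by
  classical
  induction s using Finset.induction_on with
  | empty => simpa using const 0
  | insert a s ha ih =>
    simp only [Finset.sum_insert ha]
    exact (h a (Finset.mem_insert_self _ _)).add (ih fun i hi => h i (Finset.mem_insert_of_mem hi))

lemma mul (hf : BL f) (hg : BL g) : BL fun x => f x * g x := by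
  obtain ⟨⟨C, hC⟩, K, hK⟩ := hf
  obtain ⟨⟨C', hC'⟩, K', hK'⟩ := hg
  refine ⟨⟨max C 0 * max C' 0, fun x => ?_⟩, lip_real (K := max C 0 * K' + max C' 0 * K) (by positivity) fun x y => ?_⟩
  · rw [abs_mul]
    have := (hC x).trans (le_max_left C 0)
    have := (hC' x).trans (le_max_left C' 0)
    gcongr
  · have h1 := hK.dist_le_mul x y
    have h2 := hK'.dist_le_mul x y
    rw [Real.dist_eq] at h1 h2
    have h3 := (hC x).trans (le_max_left C 0)
    have h4 := (hC' y).trans (le_max_left C' 0)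
    have e : f x * g x - f y * g y = f x * (g x - g y) + g y * (f x - f y) := by ring
    rw [e]
    refine (abs_add_le _ _).trans ?_
    rw [abs_mul, abs_mul]
    calc _ ≤ max C 0 * (K' * dist x y) + max C' 0 * (K * dist x y) := by gcongr
      _ = _ := by ring

lemma comp {Y : Type*} [PseudoMetricSpace Y] {T : Y → X} {K : ℝ≥0} (hf : BL f) (hT : LipschitzWith K T) : BL fun y => f (T y) := by
  obtain ⟨⟨C, hC⟩, K', hK'⟩ := hf
  exact ⟨⟨C, fun y => hC _⟩, _, hK'.comp hT⟩

lemma cont (hf : BL f) : Continuous f := hf.2.choose_spec.continuous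
end BL

lemma Part.bl {X : Type*} [PseudoMetricSpace X] {S : Set X} {r : ℝ} (P : Part S r) {p : X} (hp : p ∈ P.t) : BL (P.χ p) :=
  ⟨⟨1, fun x => by rw [abs_of_nonneg (P.nn p x)]; exact P.le1 p hp x⟩, P.lip p hp⟩

/-- linear and sequentially continuous maps on curves -/
structure LinC (Ω : Set (Euc d)) {V : Type*} [NormedAddCommGroup V] [NormedSpace ℝ V] (L : (ℝ → SignedMeasure (Euc d)) → V) : Prop where
  add : ∀ f g, IsCwCurve Ω f → IsCwCurve Ω g → L (f + g) = L f + L g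
  smul : ∀ (c : ℝ) f, IsCwCurve Ω f → L (c • f) = c • L f
  cont : ∀ (fn : ℕ → ℝ → SignedMeasure (Euc d)) (f : ℝ → SignedMeasure (Euc d)),
      (∀ n, IsCwCurve Ω (fn n)) → IsCwCurve Ω f →
      (∀ t ∈ Icc (0:ℝ) 1, ∀ φ : Euc d → ℝ, Continuous φ →
        Tendsto (fun n => sInt (fn n t) φ) atTop (𝓝 (sInt (f t) φ))) →
      Tendsto (fun n => L (fn n)) atTop (𝓝 (L f))

lemma LinC.zero {Ω : Set (Euc d)} {V : Type*} [NormedAddCommGroup V] [NormedSpace ℝ V] {L : (ℝ → SignedMeasure (Euc d)) → V}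
    (h : LinC Ω L) : L 0 = 0 := by
  have := h.smul 0 0 cw_zero
  simpa using this

lemma LinC.sum {Ω : Set (Euc d)} (hΩ : IsCompact Ω) {V : Type*} [NormedAddCommGroup V] [NormedSpace ℝ V] {L : (ℝ → SignedMeasure (Euc d)) → V}
    (h : LinC Ω L) {ι : Type*} (s : Finset ι) {c : ι → ℝ} {f : ι → ℝ → SignedMeasure (Euc d)} (hf : ∀ i ∈ s, IsCwCurve Ω (f i)) :
    L (∑ i ∈ s, c i • f i) = ∑ i ∈ s, c i • L (f i) := by
  classical
  induction s using Finset.induction_on with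
  | empty => simpa using h.zero
  | insert a s ha ih =>
    have hf' : ∀ i ∈ s, IsCwCurve Ω (f i) := fun i hi => hf i (Finset.mem_insert_of_mem hi)
    have h1 := hf a (Finset.mem_insert_self _ _)
    rw [Finset.sum_insert ha, Finset.sum_insert ha, h.add _ _ (cw_smul hΩ h1 _) (cw_sum hΩ _ fun i hi => cw_smul hΩ (hf' i hi) _),
      h.smul _ _ h1, ih hf']

lemma sInt_curve_sum {Ω : Set (Euc d)} (hΩ : IsCompact Ω) {ι : Type*} (s : Finset ι) {c : ι → ℝ} {f : ι → ℝ → SignedMeasure (Euc d)}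
    (hf : ∀ i ∈ s, IsCwCurve Ω (f i)) (t : ℝ) {φ : Euc d → ℝ} (hφ : Continuous φ) :
    sInt ((∑ i ∈ s, c i • f i) t) φ = ∑ i ∈ s, c i * sInt (f i t) φ := by
  classical
  induction s using Finset.induction_on with
  | empty => simp [sInt_zero_curve]
  | insert a s ha ih =>
    have hf' : ∀ i ∈ s, IsCwCurve Ω (f i) := fun i hi => hf i (Finset.mem_insert_of_mem hi)
    have h1 := hf a (Finset.mem_insert_self _ _)
    have h2 : IsCwCurve Ω (∑ i ∈ s, c i • f i) := cw_sum hΩ _ fun i hi => cw_smul hΩ (hf' i hi) _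
    rw [Finset.sum_insert ha, Finset.sum_insert ha, Pi.add_apply, sInt_add_cont hΩ ((cw_smul hΩ h1 _).2.1 t) (h2.2.1 t) hφ, Pi.smul_apply,
      sInt_smul_cont hΩ (h1.2.1 t) _ hφ, ih hf']

/-- regularizer -/
structure Reg (Ω S : Set (Euc d)) (r : ℝ) where
  τ : Part (Icc (0:ℝ) 1) r
  σ : Part S r
  pr : Euc d → Euc d
  pr_mem : ∀ y, pr y ∈ Ω
  pr_dist : ∀ y, dist y (pr y) = Metric.infDist y Ω

lemma exists_reg {Ω S : Set (Euc d)} (hΩ : IsCompact Ω) (hne : Ω.Nonempty) (hS : IsCompact S) (hΩS : Ω ⊆ S) {r : ℝ} (hr : 0 < r) :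
    Nonempty (Reg Ω S r) := by
  obtain ⟨τ⟩ := exists_part (isCompact_Icc (a := (0:ℝ)) (b := 1)) ⟨0, by simp⟩ hr
  obtain ⟨σ⟩ := exists_part hS (hne.mono hΩS) hr
  choose pr h1 h2 using fun y => hΩ.exists_infDist_eq_dist hne y
  exact ⟨⟨τ, σ, pr, h1, fun y => (h2 y).symm⟩⟩

namespace Reg
variable {Ω S : Set (Euc d)} {r : ℝ}

/-- index set -/
def idx (G : Reg Ω S r) : Finset (ℝ × Euc d) := G.τ.t ×ˢ G.σ.t
/-- basic curves -/
def e (G : Reg Ω S r) (p : ℝ × Euc d) : ℝ → SignedMeasure (Euc d) :=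
  fun t => G.τ.χ p.1 (clamp t) • (Measure.dirac (G.pr p.2)).toSignedMeasure
/-- normalized kernel -/
def κ (G : Reg Ω S r) (k s : ℝ) : ℝ := (∫ s, G.τ.χ k s ∂v01)⁻¹ * G.τ.χ k s
/-- spatial interpolation -/
def P (G : Reg Ω S r) (φ : Euc d → ℝ) (y : Euc d) : ℝ := ∑ i ∈ G.σ.t, φ (G.pr i) * G.σ.χ i y
/-- coefficients -/
def coef (G : Reg Ω S r) (g : ℝ → SignedMeasure (Euc d)) (p : ℝ × Euc d) : ℝ := ∫ s, G.κ p.1 s * sInt (g s) (G.σ.χ p.2) ∂v01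
/-- regularized curve -/
def R (G : Reg Ω S r) (g : ℝ → SignedMeasure (Euc d)) : ℝ → SignedMeasure (Euc d) := ∑ p ∈ G.idx, G.coef g p • G.e p
/-- dual function -/
def Φ (G : Reg Ω S r) (L : (ℝ → SignedMeasure (Euc d)) → ℝ) (z : XX d) : ℝ :=
  ∑ p ∈ G.idx, L (G.e p) * (G.κ p.1 z.1 * G.σ.χ p.2 z.2)

variable (G : Reg Ω S r)

lemma mem_idx {p : ℝ × Euc d} (hp : p ∈ G.idx) : p.1 ∈ G.τ.t ∧ p.2 ∈ G.σ.t := Finset.mem_product.1 hp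

lemma e_cw {p : ℝ × Euc d} (hp : p ∈ G.idx) : IsCwCurve Ω (G.e p) :=
  cw_const_dirac (G.τ.bl (G.mem_idx hp).1).cont (G.pr_mem _)

lemma R_cw (hΩ : IsCompact Ω) (g : ℝ → SignedMeasure (Euc d)) : IsCwCurve Ω (G.R g) :=
  cw_sum hΩ _ fun _ hi => cw_smul hΩ (G.e_cw hi) _

lemma v01_cont {f : ℝ → ℝ} (hf : Continuous f) : Integrable f v01 :=
  (hf.continuousOn (s := Icc 0 1)).integrableOn_compact isCompact_Icc

lemma I_pos {k : ℝ} (hk : k ∈ G.τ.t) : 0 < ∫ s, G.τ.χ k s ∂v01 := by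
  have hc := (G.τ.bl hk).cont
  rw [integral_pos_iff_support_of_nonneg (fun s => G.τ.nn k s) (v01_cont hc)]
  have ho : IsOpen (Function.support (G.τ.χ k)) := hc.isOpen_support
  have hm := G.τ.mem k hk
  rw [v01, Measure.restrict_apply ho.measurableSet]
  have hcl : k ∈ closure (Ioo (0:ℝ) 1) := by rw [closure_Ioo (by norm_num)]; exact hm
  obtain ⟨y, hy⟩ := mem_closure_iff.1 hcl _ ho (G.τ.pos k hk).ne'
  exact lt_of_lt_of_le ((ho.inter isOpen_Ioo).measure_pos volume ⟨y, hy⟩) (measure_mono (inter_subset_inter_right _ Ioo_subset_Icc_self))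

lemma κ_bl {k : ℝ} (hk : k ∈ G.τ.t) : BL (G.κ k) := (BL.const _).mul (G.τ.bl hk)

lemma κ_nn {k : ℝ} (hk : k ∈ G.τ.t) (s : ℝ) : 0 ≤ G.κ k s := mul_nonneg (inv_nonneg.2 (G.I_pos hk).le) (G.τ.nn k s)

lemma κ_int {k : ℝ} (hk : k ∈ G.τ.t) : ∫ s, G.κ k s ∂v01 = 1 := by
  unfold κ
  rw [integral_const_mul, inv_mul_cancel₀ (G.I_pos hk).ne']

lemma BL.bm {X : Type*} [PseudoMetricSpace X] [MeasurableSpace X] [BorelSpace X] {f : X → ℝ} (hf : BL f) : BM f := ⟨hf.cont.measurable, hf.1⟩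

lemma χ_cont {S' : Set (Euc d)} {g : ℝ → SignedMeasure (Euc d)} (hg : IsCwCurve S' g) {i : Euc d} (hi : i ∈ G.σ.t) :
    Continuous fun s => sInt (g s) (G.σ.χ i) := hg.2.2 _ (G.σ.bl hi).cont

lemma P_cont (φ : Euc d → ℝ) : Continuous (G.P φ) :=
  continuous_finsetSum _ fun _ hi => continuous_const.mul (G.σ.bl hi).cont

lemma sInt_P (σ : SignedMeasure (Euc d)) (φ : Euc d → ℝ) : sInt σ (G.P φ) = ∑ i ∈ G.σ.t, φ (G.pr i) * sInt σ (G.σ.χ i) := by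
  unfold P
  rw [sInt_sum_fun _ fun i hi => (BM.const _).mul (BL.bm (G.σ.bl hi))]
  exact Finset.sum_congr rfl fun i _ => sInt_const_mul _ _

lemma sInt_R (hΩ : IsCompact Ω) {S' : Set (Euc d)} {g : ℝ → SignedMeasure (Euc d)} (hg : IsCwCurve S' g) {φ : Euc d → ℝ} (hφ : Continuous φ)
    {t : ℝ} (ht : t ∈ Icc (0:ℝ) 1) :
    sInt (G.R g t) φ = ∑ k ∈ G.τ.t, G.τ.χ k t * ∫ s, G.κ k s * sInt (g s) (G.P φ) ∂v01 := by
  rw [R, sInt_curve_sum hΩ _ (fun p hp => G.e_cw hp) t hφ, idx, Finset.sum_product]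
  refine Finset.sum_congr rfl fun k hk => ?_
  have : ∫ s, G.κ k s * sInt (g s) (G.P φ) ∂v01 = ∑ i ∈ G.σ.t, φ (G.pr i) * G.coef g (k, i) := by
    simp_rw [sInt_P, Finset.mul_sum]
    rw [integral_finsetSum]
    · refine Finset.sum_congr rfl fun i hi => ?_
      rw [coef, ← integral_const_mul]
      congr 1; ext s; ring
    · exact fun i hi => v01_cont ((G.κ_bl hk).cont.mul (continuous_const.mul (G.χ_cont hg hi)))
  rw [this, Finset.mul_sum]
  refine Finset.sum_congr rfl fun i hi => ?_
  rw [e, sInt_dirac, clamp_of_mem ht]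
  ring

lemma L_R (hΩ : IsCompact Ω) {S' : Set (Euc d)} {g : ℝ → SignedMeasure (Euc d)} (hg : IsCwCurve S' g)
    {L : (ℝ → SignedMeasure (Euc d)) → ℝ} (hL : LinC Ω L) : L (G.R g) = ∫ s, sInt (g s) (fun x => G.Φ L (s, x)) ∂v01 := by
  rw [R, hL.sum hΩ _ fun p hp => G.e_cw hp]
  have : ∀ s, sInt (g s) (fun x => G.Φ L (s, x)) = ∑ p ∈ G.idx, (L (G.e p) * G.κ p.1 s) * sInt (g s) (G.σ.χ p.2) := fun s => by
    have : (fun x => G.Φ L (s, x)) = fun x => ∑ p ∈ G.idx, (L (G.e p) * G.κ p.1 s) * G.σ.χ p.2 x := by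
      ext x
      exact Finset.sum_congr rfl fun p _ => by ring
    rw [this, sInt_sum_fun _ fun p hp => (BM.const _).mul (BL.bm (G.σ.bl (G.mem_idx hp).2))]
    exact Finset.sum_congr rfl fun i _ => sInt_const_mul _ _
  simp_rw [this]
  rw [integral_finsetSum]
  · refine Finset.sum_congr rfl fun p hp => ?_
    rw [smul_eq_mul, coef, mul_comm, ← integral_const_mul]
    congr 1; ext s; ring
  · exact fun p hp => v01_cont ((continuous_const.mul (G.κ_bl (G.mem_idx hp).1).cont).mul (G.χ_cont hg (G.mem_idx hp).2))

lemma Φ_bl (L : (ℝ → SignedMeasure (Euc d)) → ℝ) : BL (G.Φ L) := by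
  refine BL.sum _ fun p hp => (BL.const _).mul (BL.mul ?_ ?_)
  · exact (G.κ_bl (G.mem_idx hp).1).comp LipschitzWith.prod_fst
  · exact (G.σ.bl (G.mem_idx hp).2).comp LipschitzWith.prod_snd

lemma R_est (hΩ : IsCompact Ω) {S' : Set (Euc d)} {g : ℝ → SignedMeasure (Euc d)} (hg : IsCwCurve S' g) {φ : Euc d → ℝ} (hφ : Continuous φ)
    {t : ℝ} (ht : t ∈ Icc (0:ℝ) 1) {c ε : ℝ} (h : ∀ s, dist s t < 2 * r → |sInt (g s) (G.P φ) - c| ≤ ε) :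
    |sInt (G.R g t) φ - c| ≤ ε := by
  have cP : Continuous fun s => sInt (g s) (G.P φ) := hg.2.2 _ (G.P_cont φ)
  have e : sInt (G.R g t) φ - c = ∑ k ∈ G.τ.t, G.τ.χ k t * ∫ s, G.κ k s * (sInt (g s) (G.P φ) - c) ∂v01 := by
    have h1 : c = ∑ k ∈ G.τ.t, G.τ.χ k t * c := by rw [← Finset.sum_mul, G.τ.sum t ht, one_mul]
    rw [G.sInt_R hΩ hg hφ ht]
    nth_rewrite 1 [h1]
    rw [← Finset.sum_sub_distrib]
    refine Finset.sum_congr rfl fun k hk => ?_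
    simp_rw [mul_sub]
    rw [integral_sub (f := fun s => G.κ k s * sInt (g s) (G.P φ)) (g := fun s => G.κ k s * c) (v01_cont ((G.κ_bl hk).cont.mul cP)) (v01_cont ((G.κ_bl hk).cont.mul continuous_const)), integral_mul_const, G.κ_int hk]
    ring
  have hb : ∀ k ∈ G.τ.t, |G.τ.χ k t * ∫ s, G.κ k s * (sInt (g s) (G.P φ) - c) ∂v01| ≤ G.τ.χ k t * ε := fun k hk => by
    rw [abs_mul, abs_of_nonneg (G.τ.nn k t)]
    by_cases h0 : G.τ.χ k t = 0
    · simp [h0]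
    refine mul_le_mul_of_nonneg_left ?_ (G.τ.nn k t)
    have h2 : ‖∫ s, G.κ k s * (sInt (g s) (G.P φ) - c) ∂v01‖ ≤ ∫ s, G.κ k s * ε ∂v01 := by
      refine norm_integral_le_of_norm_le (v01_cont ((G.κ_bl hk).cont.mul continuous_const)) (ae_of_all _ fun s => ?_)
      rw [norm_mul, Real.norm_of_nonneg (G.κ_nn hk s), Real.norm_eq_abs]
      by_cases h3 : G.τ.χ k s = 0
      · simp [κ, h3]
      · refine mul_le_mul_of_nonneg_left (h s ?_) (G.κ_nn hk s)
        have := G.τ.supp k t h0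
        have := G.τ.supp k s h3
        have := dist_triangle_right s t k
        linarith
    rwa [integral_mul_const, G.κ_int hk, one_mul, Real.norm_eq_abs] at h2
  rw [e]
  refine (Finset.abs_sum_le_sum_abs _ _).trans ((Finset.sum_le_sum hb).trans ?_)
  rw [← Finset.sum_mul, G.τ.sum t ht, one_mul]

lemma P_est {φ : Euc d → ℝ} {y : Euc d} (hy : y ∈ S) {c ε : ℝ} (h : ∀ x ∈ Ω, dist x y < 2 * r + Metric.infDist y Ω → |φ x - c| ≤ ε) :
    |G.P φ y - c| ≤ ε := by
  have e : G.P φ y - c = ∑ i ∈ G.σ.t, (φ (G.pr i) - c) * G.σ.χ i y := by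
    simp_rw [sub_mul]
    rw [Finset.sum_sub_distrib, ← Finset.mul_sum, G.σ.sum y hy, mul_one]; rfl
  rw [e]
  refine (Finset.abs_sum_le_sum_abs _ _).trans ?_
  have : ∀ i ∈ G.σ.t, |(φ (G.pr i) - c) * G.σ.χ i y| ≤ ε * G.σ.χ i y := fun i hi => by
    rw [abs_mul, abs_of_nonneg (G.σ.nn i y)]
    by_cases h0 : G.σ.χ i y = 0
    · simp [h0]
    refine mul_le_mul_of_nonneg_right (h _ (G.pr_mem i) ?_) (G.σ.nn i y)
    have h1 := G.σ.supp i y h0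
    have h2 := G.pr_dist i
    have h3 : Metric.infDist i Ω ≤ Metric.infDist y Ω + dist i y := Metric.infDist_le_infDist_add_dist
    have h4 := dist_triangle (G.pr i) i y
    rw [dist_comm (G.pr i) i] at h4
    rw [dist_comm] at h1
    linarith
  refine (Finset.sum_le_sum this).trans ?_
  rw [← Finset.mul_sum, G.σ.sum y hy, mul_one]

end Reg

namespace Reg
variable {Ω S : Set (Euc d)}

lemma R_tendsto (hΩ : IsCompact Ω) {r : ℕ → ℝ} (G : ∀ n, Reg Ω S (r n)) (hr : Tendsto r atTop (𝓝 0)) {S' : Set (Euc d)}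
    {g : ℕ → ℝ → SignedMeasure (Euc d)} (hg : ∀ n, IsCwCurve S' (g n)) {f : ℝ → SignedMeasure (Euc d)} (hf : IsCwCurve Ω f)
    (h : ∀ φ : Euc d → ℝ, Continuous φ → ∀ t ∈ Icc (0:ℝ) 1,
      Tendsto (fun p : ℕ × ℝ => sInt (g p.1 p.2) ((G p.1).P φ)) (atTop ×ˢ 𝓝 t) (𝓝 (sInt (f t) φ)))
    {V : Type*} [NormedAddCommGroup V] [NormedSpace ℝ V] {L : (ℝ → SignedMeasure (Euc d)) → V} (hL : LinC Ω L) :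
    Tendsto (fun n => L ((G n).R (g n))) atTop (𝓝 (L f)) := by
  refine hL.cont _ _ (fun n => (G n).R_cw hΩ _) hf fun t ht φ hφ => ?_
  rw [Metric.tendsto_nhds]
  intro ε hε
  have h1 := (Metric.tendsto_nhds.1 (h φ hφ t ht)) (ε / 2) (half_pos hε)
  obtain ⟨pa, ha, pb, hb, hab⟩ := eventually_prod_iff.1 h1
  obtain ⟨ρ, hρ, hb'⟩ := Metric.eventually_nhds_iff.1 hb
  have hr' : ∀ᶠ n in atTop, r n < ρ / 2 := hr.eventually_lt_const (by positivity)
  filter_upwards [ha, hr'] with n hn hrn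
  refine lt_of_le_of_lt ?_ (half_lt_self hε)
  rw [Real.dist_eq]
  refine (G n).R_est hΩ (hg n) hφ ht fun s hs => ?_
  have := hab hn (hb' (y := s) (by linarith))
  rw [Real.dist_eq] at this
  exact this.le

lemma R_tendsto_self (hΩ : IsCompact Ω) (hΩS : Ω ⊆ S) {r : ℕ → ℝ} (G : ∀ n, Reg Ω S (r n)) (hr : Tendsto r atTop (𝓝 0))
    {f : ℝ → SignedMeasure (Euc d)} (hf : IsCwCurve Ω f)
    {V : Type*} [NormedAddCommGroup V] [NormedSpace ℝ V] {L : (ℝ → SignedMeasure (Euc d)) → V} (hL : LinC Ω L) :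
    Tendsto (fun n => L ((G n).R f)) atTop (𝓝 (L f)) := by
  refine R_tendsto hΩ G hr (fun _ => hf) hf (fun φ hφ t ht => ?_) hL
  obtain ⟨ψ, cψ, bψ, he⟩ := exists_bdd_cont hΩ hφ
  have hP : ∀ n, (G n).P φ = (G n).P ψ := fun n => by
    ext y
    exact Finset.sum_congr rfl fun i _ => by rw [he _ ((G n).pr_mem i)]
  simp_rw [hP]
  rw [sInt_congr_on hΩ.measurableSet (hf.2.1 t) he]
  have hc : Tendsto (fun p : ℕ × ℝ => sInt (f p.2) ψ) (atTop ×ˢ 𝓝 t) (𝓝 (sInt (f t) ψ)) :=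
    ((hf.2.2 ψ cψ).tendsto t).comp tendsto_snd
  obtain ⟨C, hC0, hC⟩ := cw_bdd hΩ hf
  have hd : Tendsto (fun p : ℕ × ℝ => sInt (f p.2) ((G p.1).P ψ) - sInt (f p.2) ψ) (atTop ×ˢ 𝓝 t) (𝓝 0) := by
    rw [Metric.tendsto_nhds]
    intro ε hε
    have hu := hΩ.uniformContinuousOn_of_continuous cψ.continuousOn
    obtain ⟨ρ, hρ, hu⟩ := Metric.uniformContinuousOn_iff.1 hu (ε / (C + 1)) (by positivity)
    have hr' : ∀ᶠ n in atTop, r n < ρ / 2 := hr.eventually_lt_const (by positivity)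
    filter_upwards [tendsto_fst.eventually hr'] with p hp
    rw [dist_zero_right, Real.norm_eq_abs]
    have bP : BM ((G p.1).P ψ) := BM.sum _ fun i hi => (BM.const _).mul (BL.bm ((G p.1).σ.bl hi))
    rw [← sInt_sub_fun bP bψ]
    have := hC p.2 (fun x => (G p.1).P ψ x - ψ x) (((G p.1).P_cont ψ).sub cψ) (ε / (C + 1)) (fun x hx => ?_) (by positivity)
    · refine lt_of_le_of_lt this ?_
      rw [← mul_div_assoc, div_lt_iff₀ (by positivity)]
      nlinarith
    · refine (G p.1).P_est (hΩS hx) fun y hy hxy => ?_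
      rw [Metric.infDist_zero_of_mem hx] at hxy
      have := hu y hy x hx (by linarith)
      rw [Real.dist_eq] at this
      exact this.le
  simpa using hd.add hc

end Reg

lemma P_cone {Ω : Set (Euc d)} {R : ℝ} (hR : 0 ≤ R) (hΩ : IsCompact Ω) (hΩS : Ω ⊆ box d R) {r : ℕ → ℝ} (G : ∀ n, Reg Ω (box d R) (r n)) (hr : Tendsto r atTop (𝓝 0))
    {η : ℕ → GC d} (hok : ∀ n, (η n).Ok (box d R)) {η' : GC d} (hok' : η'.Ok Ω) {t : ℝ}
    (hu : Tendsto (fun p : ℕ × ℝ => (η p.1).u p.2) (atTop ×ˢ 𝓝 t) (𝓝 (η'.u t)))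
    (hz : Tendsto (fun p : ℕ × ℝ => (η p.1).z p.2) (atTop ×ˢ 𝓝 t) (𝓝 (η'.z t))) {φ : Euc d → ℝ} (hφ : Continuous φ) :
    Tendsto (fun p : ℕ × ℝ => sInt ((η p.1).f p.2) ((G p.1).P φ)) (atTop ×ˢ 𝓝 t) (𝓝 (sInt (η'.f t) φ)) := by
  obtain ⟨C, hC⟩ := hΩ.exists_bound_of_continuousOn hφ.continuousOn
  simp only [GC.sInt_f]
  have := cone_tendsto (l := (atTop ×ˢ 𝓝 t : Filter (ℕ × ℝ))) (g := fun p y => (G p.1).P φ (boxT R y)) (G := φ) (C := C) (fun p _ => ?_) hu hz fun hU => ?_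
  · refine this.congr fun p => ?_
    by_cases h0 : (η p.1).u p.2 = 0
    · simp [h0]
    · rw [boxT_of_mem ((hok p.1).mem h0)]
  · have := (G p.1).P_est (φ := φ) (c := 0) (ε := C) (boxT_mem hR (((η p.1).u p.2)⁻¹ • (η p.1).z p.2)) fun x hx _ => by simpa using hC x hx
    simpa using this
  · have hy0 := hok'.mem hU
    generalize (η'.u t)⁻¹ • η'.z t = y0 at hy0
    rw [Metric.tendsto_nhds]
    intro ε hε
    obtain ⟨ρ, hρ, hc⟩ := Metric.continuous_iff.1 hφ y0 (ε / 2) (half_pos hε)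
    have hr' : ∀ᶠ n in atTop, r n < ρ / 4 := hr.eventually_lt_const (by positivity)
    have h1 : ∀ᶠ q : (ℕ × ℝ) × Euc d in (atTop ×ˢ 𝓝 t) ×ˢ 𝓝 y0, r q.1.1 < ρ / 4 := (tendsto_fst.comp tendsto_fst).eventually hr'
    have h2 : ∀ᶠ q : (ℕ × ℝ) × Euc d in (atTop ×ˢ 𝓝 t) ×ˢ 𝓝 y0, dist q.2 y0 < ρ / 4 := tendsto_snd.eventually (Metric.ball_mem_nhds y0 (by positivity))
    filter_upwards [h1, h2] with q hq1 hq2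
    refine lt_of_le_of_lt ?_ (half_lt_self hε)
    rw [Real.dist_eq]
    have h3 : dist (boxT R q.2) y0 ≤ dist q.2 y0 := by
      have := (boxT_lip R).dist_le_mul q.2 y0
      rwa [boxT_of_mem (hΩS hy0), NNReal.coe_one, one_mul] at this
    refine (G q.1.1).P_est (boxT_mem hR _) fun x hx hxy => ?_
    have h4 := Metric.infDist_le_dist_of_mem (x := boxT R q.2) hy0
    have h5 := dist_triangle x (boxT R q.2) y0
    have := hc x (by linarith)
    rw [Real.dist_eq] at this
    exact this.le

lemma GC.Ok.of_box {Ω S : Set (Euc d)} (hne : Ω.Nonempty) (hcl : IsClosed Ω) {η : GC d} (h : η.Ok S)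
    (hd : ∀ t ∈ Icc (0:ℝ) 1, sInt (η.f t) (fun x => Metric.infDist x Ω) = 0) : η.Ok Ω := by
  refine ⟨h.nn, fun t => ?_, h.con⟩
  by_cases h0 : η.u t = 0
  · obtain ⟨x, hx⟩ := hne
    obtain ⟨y, -, e⟩ := h.pos t
    exact ⟨x, hx, by rw [e, h0, zero_smul, zero_smul]⟩
  · have := hd (clamp t) (clamp_mem t)
    rw [GC.f_clamp, GC.sInt_f] at this
    have := (mul_eq_zero.1 this).resolve_left (pow_ne_zero 2 h0)
    exact ⟨_, (hcl.mem_iff_infDist_zero hne).2 this, by rw [smul_inv_smul₀ h0]⟩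

lemma GC.meas_y (η : GC d) : Measurable fun s => (s, (η.u s)⁻¹ • η.z s) :=
  measurable_id.prodMk (η.continuous_u.measurable.inv.smul η.continuous_z.measurable)

lemma GC.int_BL (η : GC d) {ψ : XX d → ℝ} (hψ : BL ψ) : Integrable (fun s => η.u s ^ 2 * ψ (s, (η.u s)⁻¹ • η.z s)) v01 := by
  obtain ⟨C, hC⟩ := hψ.1
  exact (Reg.v01_cont (η.continuous_u.pow 2)).mul_bdd (c := C) (hψ.cont.measurable.comp η.meas_y).aestronglyMeasurable (ae_of_all _ fun s => hC _)

theorem no_viol {Ω : Set (Euc d)} {R : ℝ} (hR : 0 ≤ R) (hΩ : IsCompact Ω) (hne : Ω.Nonempty) (hΩS : Ω ⊆ box d R)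
    {r : ℕ → ℝ} (G : ∀ n, Reg Ω (box d R) (r n)) (hr : Tendsto r atTop (𝓝 0))
    {α β δ : ℝ} (hα : 0 < α) (hβ : 0 < β) (hδ : 0 < δ)
    {L : (ℝ → SignedMeasure (Euc d)) → ℝ} (hL : LinC Ω L) {s M : ℝ} (hs : ∀ η : GC d, η.Ok Ω → η.E α β δ ≤ 1 → L η.f ≤ s) (hM : s < M) (hM0 : 0 ≤ M)
    {η : ℕ → GC d} (hok : ∀ n, (η n).Ok (box d R)) (hE : ∀ n, (η n).E α β δ ≤ 1)
    {C N : ℕ → ℝ} (hC : ∀ n z, |(G n).Φ L z| ≤ C n) (hN : ∀ n, 0 < N n) (hN' : Tendsto N atTop atTop)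
    (hv : ∀ n, M ≤ (∫ t, (η n).u t ^ 2 * (G n).Φ L (t, ((η n).u t)⁻¹ • (η n).z t) ∂v01) -
      N n * (1 + C n) * ∫ t, sInt ((η n).f t) (fun x => Metric.infDist x Ω) ∂v01) : False := by
  have cI : Continuous fun x : Euc d => Metric.infDist x Ω := Metric.continuous_infDist_pt Ω
  have hC0 : ∀ n, 0 ≤ C n := fun n => (abs_nonneg _).trans (hC n 0)
  have D0 : ∀ n, 0 ≤ ∫ t, sInt ((η n).f t) (fun x => Metric.infDist x Ω) ∂v01 := fun n =>
    integral_nonneg fun t => by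
      rw [GC.sInt_f]; exact mul_nonneg (sq_nonneg _) Metric.infDist_nonneg
  have hu2 : ∀ n, ∫ t, (η n).u t ^ 2 ∂v01 ≤ 1 / α := fun n => by
    have := (GC.bounds hα hβ hδ (hE n)).2.2
    simpa using this
  have h1 : ∀ n, ∫ t, (η n).u t ^ 2 * (G n).Φ L (t, ((η n).u t)⁻¹ • (η n).z t) ∂v01 ≤ C n * (1 / α) := fun n => by
    refine le_trans ?_ (mul_le_mul_of_nonneg_left (hu2 n) (hC0 n))
    rw [← integral_const_mul]
    refine integral_mono ((η n).int_BL ((G n).Φ_bl L)) ((Reg.v01_cont ((η n).continuous_u.pow 2)).const_mul _) fun t => ?_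
    show (η n).u t ^ 2 * _ ≤ C n * (η n).u t ^ 2
    rw [mul_comm (C n)]
    exact mul_le_mul_of_nonneg_left ((le_abs_self _).trans (hC n _)) (sq_nonneg _)
  have h2 : ∀ n, ∫ t, sInt ((η n).f t) (fun x => Metric.infDist x Ω) ∂v01 ≤ 1 / α * (N n)⁻¹ := fun n => by
    have a1 := hv n
    have a2 := h1 n
    have a3 := D0 n
    generalize (∫ t, sInt ((η n).f t) (fun x => Metric.infDist x Ω) ∂v01) = D at *
    have a4 : N n * (1 + C n) * D ≤ C n * (1 / α) := by linarith
    have a5 : (1 + C n) * (N n * D) ≤ (1 + C n) * (1 / α) := by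
      have : 0 < 1 / α := by positivity
      nlinarith
    have a6 := le_of_mul_le_mul_left a5 (by linarith [hC0 n])
    rw [← div_eq_mul_inv, le_div_iff₀ (hN n)]
    linarith
  obtain ⟨φ, hφ, η', hok', hE', hlim⟩ := GC.compactness (box_compact R) hα hβ hδ η hok hE
  have hφt := hφ.tendsto_atTop
  obtain ⟨U, hU0, hU⟩ := GC.u_bound (d := d) hα hβ hδ
  obtain ⟨B, hB⟩ := (box_compact (d := d) R).exists_bound_of_continuousOn cI.continuousOn
  have hfix : ∀ t : ℝ, Tendsto (fun n : ℕ => (n, t)) atTop (atTop ×ˢ 𝓝 t) := fun t => tendsto_id.prodMk tendsto_const_nhds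
  have h3 : Tendsto (fun n => ∫ t, sInt ((η (φ n)).f t) (fun x => Metric.infDist x Ω) ∂v01) atTop
      (𝓝 (∫ t, sInt (η'.f t) (fun x => Metric.infDist x Ω) ∂v01)) := by
    refine tendsto_integral_of_dominated_convergence (fun _ => U ^ 2 * |B|) (fun n => (((hok (φ n)).cw (box_compact R)).2.2 _ cI).aestronglyMeasurable)
      (integrable_const _) (fun n => ae_of_all _ fun t => ?_) (ae_of_all _ fun t => ?_)
    · rw [GC.sInt_f, norm_mul, norm_pow]
      by_cases h0 : (η (φ n)).u t = 0
      · rw [h0]; simp; positivity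
      have b1 := hU _ (hE (φ n)) t
      have b2 := (hB _ ((hok (φ n)).mem h0)).trans (le_abs_self B)
      rw [Real.norm_eq_abs]
      gcongr
    · exact GC.f_tendsto (box_compact R) (fun n => η (φ n)) (fun _ => t) (fun n => hok _) ((hlim t).1.comp (hfix t)) ((hlim t).2.comp (hfix t)) cI
  have h4 : ∫ t, sInt (η'.f t) (fun x => Metric.infDist x Ω) ∂v01 ≤ 0 := by
    refine le_of_tendsto_of_tendsto' h3 (?_ : Tendsto (fun n => 1 / α * (N (φ n))⁻¹) atTop (𝓝 0)) fun n => h2 (φ n)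
    have := ((tendsto_inv_atTop_zero.comp (hN'.comp hφt)).const_mul (1 / α))
    simpa using this
  have hnn : ∀ t, 0 ≤ sInt (η'.f t) (fun x => Metric.infDist x Ω) := fun t => by
    rw [GC.sInt_f]; exact mul_nonneg (sq_nonneg _) Metric.infDist_nonneg
  have cI' : Continuous fun t => sInt (η'.f t) (fun x => Metric.infDist x Ω) := (hok'.cw (box_compact R)).2.2 _ cI
  have h5 : ∀ t ∈ Icc (0:ℝ) 1, sInt (η'.f t) (fun x => Metric.infDist x Ω) = 0 := by
    have e0 := le_antisymm h4 (integral_nonneg hnn)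
    rw [integral_eq_zero_iff_of_nonneg hnn (Reg.v01_cont cI'), v01] at e0
    have := Measure.eqOn_Icc_of_ae_eq (μ := volume) (zero_ne_one (α := ℝ)) e0 cI'.continuousOn continuousOn_const
    exact this
  have hokΩ : η'.Ok Ω := hok'.of_box hne hΩ.isClosed h5
  have h6 : Tendsto (fun n => L ((G (φ n)).R (η (φ n)).f)) atTop (𝓝 (L η'.f)) :=
    Reg.R_tendsto hΩ (fun n => G (φ n)) (hr.comp hφt) (fun n => (hok (φ n)).cw (box_compact R)) (hokΩ.cw hΩ)
      (fun ψ hψ t _ => P_cone hR hΩ hΩS (fun n => G (φ n)) (hr.comp hφt) (fun n => hok (φ n)) hokΩ (hlim t).1 (hlim t).2 hψ) hL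
  have h7 : M ≤ L η'.f := by
    refine ge_of_tendsto' h6 fun n => ?_
    rw [(G (φ n)).L_R hΩ ((hok (φ n)).cw (box_compact R)) hL]
    simp only [GC.sInt_f]
    have a1 := hv (φ n)
    have a2 : 0 ≤ N (φ n) * (1 + C (φ n)) * ∫ t, sInt ((η (φ n)).f t) (fun x => Metric.infDist x Ω) ∂v01 :=
      mul_nonneg (mul_nonneg (hN _).le (by linarith [hC0 (φ n)])) (D0 _)
    linarith
  linarith [hs η' hokΩ hE']

/-! ### The main inequality -/

lemma cw_supp {Ω : Set (Euc d)} (hΩ : IsCompact Ω) {f : ℝ → SignedMeasure (Euc d)} (hf : IsCwCurve Ω f)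
    {lam : Measure (XX d)} {r : XX d → ℝ} (hri : Integrable r lam)
    (h : CwDensity f lam r) : ∀ᵐ x ∂lam, r x ≠ 0 → x ∈ Ioo (0:ℝ) 1 ×ˢ Ω := by
  have hT : MeasurableSet (Ioo (0:ℝ) 1 ×ˢ Ω) := measurableSet_Ioo.prod hΩ.isClosed.measurableSet
  have h0 : r =ᵐ[lam.restrict (Ioo (0:ℝ) 1 ×ˢ Ω)ᶜ] 0 := by
    refine hri.restrict.ae_eq_zero_of_forall_setIntegral_eq_zero fun s hs _ => ?_
    rw [Measure.restrict_restrict hs, ← h _ (hs.inter hT.compl)]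
    refine setIntegral_eq_zero_of_forall_eq_zero fun t ht => ?_
    have hms : MeasurableSet {x : Euc d | (t, x) ∈ s ∩ (Ioo (0:ℝ) 1 ×ˢ Ω)ᶜ} := measurable_prodMk_left (hs.inter hT.compl)
    rw [sInt_indicator hms]
    exact hf.2.1 t _ hms fun x hx hxΩ => hx.2 ⟨ht, hxΩ⟩
  rw [Filter.EventuallyEq, ae_restrict_iff' hT.compl] at h0
  filter_upwards [h0] with x hx hr
  by_contra hc
  exact hr (hx hc)

lemma cw_strip {Ω : Set (Euc d)} (hΩ : IsCompact Ω) {f : ℝ → SignedMeasure (Euc d)} (hf : IsCwCurve Ω f)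
    {lam : Measure (XX d)} {r : XX d → ℝ} (h : CwDensity f lam r) : ∃ Cm : ℝ, ∀ a b : ℝ, 0 ≤ a → a ≤ b → b ≤ 1 →
      ∫ x in (Icc a b ×ˢ univ : Set (XX d)), r x ∂lam ≤ Cm * (b - a) := by
  obtain ⟨C, hC0, hC⟩ := cw_bdd hΩ hf
  refine ⟨C, fun a b ha hab hb => ?_⟩
  rw [← h _ (measurableSet_Icc.prod MeasurableSet.univ)]
  have e : ∀ t, sInt (f t) ({x : Euc d | (t, x) ∈ (Icc a b ×ˢ univ : Set (XX d))}.indicator fun _ => (1:ℝ)) =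
      (Icc a b).indicator (fun t => sInt (f t) fun _ => 1) t := fun t => by
    by_cases ht : t ∈ Icc a b
    · rw [indicator_of_mem ht]
      congr 1
      ext x
      rw [indicator_of_mem (show x ∈ {x : Euc d | (t, x) ∈ (Icc a b ×ˢ univ : Set (XX d))} from ⟨ht, trivial⟩)]
    · rw [indicator_of_notMem ht, ← sInt_zero_fun (σ := f t)]
      congr 1
      ext x
      rw [indicator_of_notMem (show x ∉ {x : Euc d | (t, x) ∈ (Icc a b ×ˢ univ : Set (XX d))} from fun h => ht h.1)]
  simp_rw [e]
  rw [setIntegral_indicator measurableSet_Icc]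
  refine (le_abs_self _).trans ?_
  have := norm_setIntegral_le_of_norm_le_const (μ := volume) (s := Ioo (0:ℝ) 1 ∩ Icc a b) (f := fun t => sInt (f t) fun _ => 1) (C := C)
    ((measure_mono inter_subset_right).trans_lt measure_Icc_lt_top) fun t _ => by
      simpa using hC t (fun _ => 1) continuous_const 1 (fun _ _ => by simp) zero_le_one
  refine this.trans (mul_le_mul_of_nonneg_left ?_ hC0)
  refine (measureReal_mono inter_subset_right measure_Icc_lt_top.ne).trans ?_
  rw [Real.volume_real_Icc_of_le hab]

lemma duality_cw {Ω : Set (Euc d)} (hΩ : IsCompact Ω) {ℓ : XX d → ℝ} (hℓ : BL ℓ) {A δ : ℝ} (hA : 0 ≤ A)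
    (H0 : ∀ (c : Ctl d) (x : Euc d), Ctl.G ℓ A δ c (0, x) ≤ 0)
    {f : ℝ → SignedMeasure (Euc d)} {m : VectorMeasure (XX d) (Euc d)} {μ : SignedMeasure (XX d)}
    (hf : IsCwCurve Ω f) (hTV : TVCw f ≠ ⊤) (hce : SolvesCECw f m μ)
    {lam : Measure (XX d)} [IsFiniteMeasure lam] {r u : XX d → ℝ} {w : XX d → Euc d}
    (hr : Measurable r) (hw : Measurable w) (hu : Measurable u) (hd : CwDensity f lam r) (hm : IsDensityV m lam w)
    (hμ : IsDensityS μ lam u) (hΨ : ∫⁻ x, Psi δ (r x) (w x) (u x) ∂lam ≠ ⊤) :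
    ∫ t in Ioo (0:ℝ) 1, sInt (f t) (fun x => ℓ (t, x)) ≤ 2 * A * (∫⁻ x, Psi δ (r x) (w x) (u x) ∂lam).toReal := by
  obtain ⟨⟨C, hC⟩, L, hL⟩ := id hℓ
  have hri := hd.integrable hTV hr
  have hwi := hm.integrable hw
  have hui := hμ.integrable hu
  obtain ⟨Cm, hCm⟩ := cw_strip hΩ hf hd
  rw [hd.integral_eq hf hTV hr (Reg.BL.bm hℓ)]
  refine duality hΩ.isBounded hA hC hL H0 hr hw hu hri hwi hui hΨ (cw_supp hΩ hf hri hd) (fun ψ hψ => ?_) hCm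
  have h1 := hce lam inferInstance w u hw hu hm hμ ψ hψ
  rw [hd.integral_eq hf hTV hr (hψ.bm_dt ((1:ℝ), (0 : Euc d)))] at h1
  obtain ⟨B, hB⟩ := hψ.fderiv_bdd
  obtain ⟨mb, B2, hB2⟩ := hψ.bm
  have i1 : Integrable (fun x => fderiv ℝ ψ x ((1:ℝ), (0 : Euc d)) * r x) lam := by
    obtain ⟨mb, B2, hB2⟩ := hψ.bm_dt ((1:ℝ), (0 : Euc d))
    exact hri.bdd_mul (c := B2) mb.aestronglyMeasurable (ae_of_all _ hB2)
  have i3 : Integrable (fun x => ψ x * u x) lam := hui.bdd_mul (c := B2) mb.aestronglyMeasurable (ae_of_all _ hB2)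
  have i2 : Integrable (fun x => fderiv ℝ ψ x ((0:ℝ), w x)) lam := integrable_clm_apply hψ.fderiv_cont hB hwi
  rw [integral_add (f := fun x => fderiv ℝ ψ x ((1:ℝ), (0 : Euc d)) * r x + fderiv ℝ ψ x ((0:ℝ), w x)) (g := fun x => ψ x * u x) (i1.add i2) i3,
    integral_add (f := fun x => fderiv ℝ ψ x ((1:ℝ), (0 : Euc d)) * r x) (g := fun x => fderiv ℝ ψ x ((0:ℝ), w x)) i1 i2]
  exact h1

lemma GC.sc_sInt {k : ℝ} (hk : k ≠ 0) (η : GC d) (t : ℝ) (φ : Euc d → ℝ) : sInt ((GC.sc k η).f t) φ = k ^ 2 * sInt (η.f t) φ := by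
  have e : (k * η.u t)⁻¹ • k • η.z t = (η.u t)⁻¹ • η.z t := by
    rw [mul_inv, mul_comm k⁻¹, mul_smul, inv_smul_smul₀ hk]
  rw [GC.sInt_f, GC.sInt_f, GC.sc_u, GC.sc_z, e]
  ring

/-- penalized payoff -/
def ell (Ω : Set (Euc d)) (R p q : ℝ) (Φ : XX d → ℝ) (z : XX d) : ℝ :=
  Φ (z.1, boxT R z.2) - p * Metric.infDist (boxT R z.2) Ω - q

lemma bl_dist (Ω : Set (Euc d)) {R : ℝ} (hR : 0 ≤ R) : BL fun y : Euc d => Metric.infDist (boxT R y) Ω := by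
  have cI : Continuous fun x : Euc d => Metric.infDist x Ω := Metric.continuous_infDist_pt Ω
  obtain ⟨B, hB⟩ := (box_compact (d := d) R).exists_bound_of_continuousOn cI.continuousOn
  exact ⟨⟨B, fun y => hB _ (boxT_mem hR y)⟩, _, (Metric.lipschitz_infDist_pt Ω).comp (boxT_lip R)⟩

lemma bl_ell (Ω : Set (Euc d)) {R : ℝ} (hR : 0 ≤ R) (p q : ℝ) {Φ : XX d → ℝ} (hΦ : BL Φ) : BL (ell Ω R p q Φ) := by
  have h1 : BL fun z : XX d => Φ (z.1, boxT R z.2) :=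
    hΦ.comp (LipschitzWith.prodMk LipschitzWith.prod_fst ((boxT_lip R).comp LipschitzWith.prod_snd))
  have h2 : BL fun z : XX d => (-p) * Metric.infDist (boxT R z.2) Ω :=
    (BL.const (-p)).mul ((bl_dist Ω hR).comp LipschitzWith.prod_snd)
  have := (h1.add h2).add (BL.const (-q))
  convert this using 2 with z
  unfold ell
  ring

lemma viol_curve {Ω : Set (Euc d)} {R : ℝ} (hR : 0 ≤ R) {α β δ M p : ℝ} (hα : 0 < α) (hβ : 0 < β) (hδ : 0 < δ) (hM : 0 < M)
    {Φ : XX d → ℝ} (hΦ : BL Φ) {c : Ctl d} {x : Euc d} (hv : 0 < Ctl.G (ell Ω R p (M * α) Φ) (M * β / 2) δ c (0, x)) :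
    ∃ η : GC d, η.Ok (box d R) ∧ η.E α β δ ≤ 1 ∧
      M ≤ (∫ t, η.u t ^ 2 * Φ (t, (η.u t)⁻¹ • η.z t) ∂v01) - p * ∫ t, sInt (η.f t) (fun x => Metric.infDist x Ω) ∂v01 := by
  obtain ⟨η, hok, huz, hE⟩ := c.toGC x hR (α := α) (β := β) (δ := δ) hβ.le
  have cI : Continuous fun x : Euc d => Metric.infDist x Ω := Metric.continuous_infDist_pt Ω
  have i1 := η.int_BL hΦ
  have i2 : Integrable (fun t => sInt (η.f t) (fun x => Metric.infDist x Ω)) v01 := Reg.v01_cont ((hok.cw (box_compact R)).2.2 _ cI)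
  have hell := bl_ell Ω hR p (M * α) hΦ
  have hW0 : c.W 0 = 0 := intervalIntegral.integral_same
  have hQ0 : c.Q 0 = 0 := intervalIntegral.integral_same
  have i3 : Integrable (Ctl.Fn (ell Ω R p (M * α) Φ) (M * β / 2) δ c (0, x)) v01 := by
    have := Ctl.Fn_int (A := M * β / 2) (δ := δ) hell.cont hell.1.choose_spec c (0, x) 0 1
    rw [intervalIntegrable_iff_integrableOn_Icc_of_le zero_le_one] at this
    exact this
  have eG : Ctl.G (ell Ω R p (M * α) Φ) (M * β / 2) δ c (0, x) = ∫ s, Ctl.Fn (ell Ω R p (M * α) Φ) (M * β / 2) δ c (0, x) s ∂v01 := by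
    rw [Ctl.G, intervalIntegral.integral_of_le zero_le_one, ← integral_Icc_eq_integral_Ioc, v01]
  have key : (∫ t, η.u t ^ 2 * Φ (t, (η.u t)⁻¹ • η.z t) ∂v01) - p * (∫ t, sInt (η.f t) (fun x => Metric.infDist x Ω) ∂v01)
      - Ctl.G (ell Ω R p (M * α) Φ) (M * β / 2) δ c (0, x) = M * ∫ s, (Real.exp (c.Q s) * (α + Ctl.cost (β / 2) δ c s)) ∂v01 := by
    rw [eG, ← integral_const_mul, ← integral_const_mul, ← integral_sub i1 (i2.const_mul p)]
    have i4 : Integrable (fun t => η.u t ^ 2 * Φ (t, (η.u t)⁻¹ • η.z t) - p * sInt (η.f t) (fun x => Metric.infDist x Ω)) v01 := i1.sub (i2.const_mul p)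
    rw [← integral_sub i4 i3]
    refine setIntegral_congr_fun measurableSet_Icc fun t ht => ?_
    obtain ⟨e1, e2⟩ := huz t ht
    have e3 : (η.u t)⁻¹ • η.z t = boxT R (x + c.W t) := by
      rw [e1, e2, inv_smul_smul₀ (Real.exp_pos _).ne']
    have e4 : η.u t ^ 2 = Real.exp (c.Q t) := by
      rw [e1, ← Real.exp_nat_mul]; congr 1; push_cast; ring
    simp only [GC.sInt_f, e3, e4, Ctl.Fn, hW0, hQ0, sub_zero, ell, Ctl.cost]
    ring
  have hEpos : 0 < η.E α β δ := by
    rcases (GC.E_nonneg hα.le hβ.le (δ := δ) η).lt_or_eq with h | h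
    · exact h
    · have := GC.u_eq_zero hα hβ hδ h.symm 0
      rw [(huz 0 (by simp)).1] at this
      exact absurd this (Real.exp_pos _).ne'
  have hk : (Real.sqrt (η.E α β δ))⁻¹ ≠ 0 := (inv_pos.2 (Real.sqrt_pos.2 hEpos)).ne'
  have hk2 : ((Real.sqrt (η.E α β δ))⁻¹) ^ 2 = (η.E α β δ)⁻¹ := by rw [inv_pow, Real.sq_sqrt hEpos.le]
  refine ⟨GC.sc (Real.sqrt (η.E α β δ))⁻¹ η, GC.sc_ok hok (inv_nonneg.2 (Real.sqrt_nonneg _)), ?_, ?_⟩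
  · rw [GC.sc_E, hk2, inv_mul_cancel₀ hEpos.ne']
  · have e1 : ∀ t, (GC.sc (Real.sqrt (η.E α β δ))⁻¹ η).u t ^ 2 * Φ (t, ((GC.sc (Real.sqrt (η.E α β δ))⁻¹ η).u t)⁻¹ • (GC.sc (Real.sqrt (η.E α β δ))⁻¹ η).z t)
        = (η.E α β δ)⁻¹ * (η.u t ^ 2 * Φ (t, (η.u t)⁻¹ • η.z t)) := fun t => by
      have := GC.sc_sInt hk η t (fun x => Φ (t, x))
      rw [GC.sInt_f, GC.sInt_f, hk2] at this
      exact this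
    simp only [e1, GC.sc_sInt hk, hk2]
    rw [integral_const_mul, integral_const_mul]
    have : M * η.E α β δ ≤ M * ∫ s, (Real.exp (c.Q s) * (α + Ctl.cost (β / 2) δ c s)) ∂v01 := mul_le_mul_of_nonneg_left hE hM.le
    rw [← key] at this
    have h2 : M * η.E α β δ ≤ (∫ t, η.u t ^ 2 * Φ (t, (η.u t)⁻¹ • η.z t) ∂v01) - p * (∫ t, sInt (η.f t) (fun x => Metric.infDist x Ω) ∂v01) := by linarith
    have h3 := mul_le_mul_of_nonneg_left h2 (inv_nonneg.2 hEpos.le)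
    rw [mul_comm M, inv_mul_cancel_left₀ hEpos.ne'] at h3
    linarith

theorem main_M {Ω : Set (Euc d)} (hΩ : IsCompact Ω) (hne : Ω.Nonempty)
    {α β δ : ℝ} (hα : 0 < α) (hβ : 0 < β) (hδ : 0 < δ)
    {L : (ℝ → SignedMeasure (Euc d)) → ℝ} (hL : LinC Ω L) {s M : ℝ} (hs : ∀ η : GC d, η.Ok Ω → η.E α β δ ≤ 1 → L η.f ≤ s) (hM : s < M) (hM0 : 0 < M)
    {f : ℝ → SignedMeasure (Euc d)} {m : VectorMeasure (XX d) (Euc d)} {μ : SignedMeasure (XX d)}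
    (hf : IsCwCurve Ω f) (hTV : TVCw f ≠ ⊤) (hce : SolvesCECw f m μ)
    {lam : Measure (XX d)} [IsFiniteMeasure lam] {r u : XX d → ℝ} {w : XX d → Euc d}
    (hr : Measurable r) (hw : Measurable w) (hu : Measurable u) (hd : CwDensity f lam r) (hm : IsDensityV m lam w)
    (hμ : IsDensityS μ lam u) (hΨ : ∫⁻ x, Psi δ (r x) (w x) (u x) ∂lam ≠ ⊤) :
    L f ≤ M * (β * (∫⁻ x, Psi δ (r x) (w x) (u x) ∂lam).toReal + α * (TVCw f).toReal) := by
  obtain ⟨R, hR, hΩS⟩ := exists_box hΩ.isBounded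
  have hrn : ∀ n : ℕ, (0:ℝ) < 1 / ((n:ℝ) + 1) := fun n => by positivity
  let G : ∀ n : ℕ, Reg Ω (box d R) (1 / ((n:ℝ) + 1)) := fun n => (exists_reg hΩ hne (box_compact R) hΩS (hrn n)).some
  have hr0 : Tendsto (fun n : ℕ => 1 / ((n:ℝ) + 1)) atTop (𝓝 0) := tendsto_one_div_add_atTop_nhds_zero_nat
  choose C hC using fun n => ((G n).Φ_bl L).1
  let N : ℕ → ℝ := fun n => (n:ℝ) + 1
  have hN : ∀ n, 0 < N n := fun n => by positivity
  have hN' : Tendsto N atTop atTop := tendsto_atTop_add_const_right _ _ tendsto_natCast_atTop_atTop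
  have hfreq : ∃ᶠ n in atTop, ∀ (c : Ctl d) (x : Euc d), Ctl.G (ell Ω R (N n * (1 + C n)) (M * α) ((G n).Φ L)) (M * β / 2) δ c (0, x) ≤ 0 := by
    intro hev
    obtain ⟨n0, hn0⟩ := eventually_atTop.1 hev
    have : ∀ n, ∃ η : GC d, η.Ok (box d R) ∧ η.E α β δ ≤ 1 ∧
      M ≤ (∫ t, η.u t ^ 2 * (G (n + n0)).Φ L (t, (η.u t)⁻¹ • η.z t) ∂v01) - N (n + n0) * (1 + C (n + n0)) * ∫ t, sInt (η.f t) (fun x => Metric.infDist x Ω) ∂v01 := fun n => by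
      have h := hn0 (n + n0) (by omega)
      push Not at h
      obtain ⟨c, x, h⟩ := h
      exact viol_curve hR hα hβ hδ hM0 ((G _).Φ_bl L) h
    choose η h1 h2 h3 using this
    exact no_viol hR hΩ hne hΩS (fun n => G (n + n0)) (hr0.comp (tendsto_add_atTop_nat n0)) hα hβ hδ hL hs hM hM0.le h1 h2 (C := fun n => C (n + n0))
      (N := fun n => N (n + n0)) (fun n => hC _) (fun n => hN _) (hN'.comp (tendsto_add_atTop_nat n0)) h3
  have hlim := Reg.R_tendsto_self hΩ hΩS G hr0 hf hL
  refine le_of_tendsto_of_frequently hlim (hfreq.mono fun n hn => ?_)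
  have hb := bl_ell Ω hR (N n * (1 + C n)) (M * α) ((G n).Φ_bl L)
  have h1 := duality_cw hΩ hb (by positivity) hn hf hTV hce hr hw hu hd hm hμ hΨ
  have e1 : ∀ t, sInt (f t) (fun x => ell Ω R (N n * (1 + C n)) (M * α) ((G n).Φ L) (t, x)) = sInt (f t) (fun x => (G n).Φ L (t, x)) - M * α * sInt (f t) fun _ => 1 := fun t => by
    have b1 : BM fun x => (G n).Φ L (t, x) := (Reg.BL.bm ((G n).Φ_bl L)).slice t
    rw [← sInt_const_mul, ← sInt_sub_fun b1 (BM.const _)]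
    refine sInt_congr_on hΩ.isClosed.measurableSet (hf.2.1 t) fun x hx => ?_
    simp only [ell, boxT_of_mem (hΩS hx), Metric.infDist_zero_of_mem hx]
    ring
  have e2 := (G n).L_R hΩ hf hL
  rw [← GC.ioo_v01] at e2
  simp only [e1] at h1
  have j1 : Integrable (fun t => sInt (f t) (fun x => (G n).Φ L (t, x))) (volume.restrict (Ioo (0:ℝ) 1)) := integrable_sInt_slice hf hTV (Reg.BL.bm ((G n).Φ_bl L))
  have j2 : Integrable (fun t => sInt (f t) (fun _ => (1:ℝ))) (volume.restrict (Ioo (0:ℝ) 1)) := integrable_sInt_slice hf hTV (ψ := fun _ => 1) (BM.const 1)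
  rw [integral_sub j1 (j2.const_mul _), integral_const_mul, ← e2] at h1
  have h2 := (le_abs_self _).trans (abs_integral_sInt_slice_le hTV (ψ := fun _ => (1:ℝ)) zero_le_one (fun x => by simp))
  have h3 := mul_le_mul_of_nonneg_left h2 (show 0 ≤ M * α by positivity)
  linarith

theorem main_ineq {Ω : Set (Euc d)} (hΩ : IsCompact Ω) (hne : Ω.Nonempty)
    {α β δ : ℝ} (hα : 0 < α) (hβ : 0 < β) (hδ : 0 < δ)
    {L : (ℝ → SignedMeasure (Euc d)) → ℝ} (hL : LinC Ω L) {s : ℝ} (hs0 : 0 ≤ s) (hs : ∀ η : GC d, η.Ok Ω → η.E α β δ ≤ 1 → L η.f ≤ s)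
    {f : ℝ → SignedMeasure (Euc d)} {m : VectorMeasure (XX d) (Euc d)} {μ : SignedMeasure (XX d)}
    (hf : IsCwCurve Ω f) (hJ : JCw α β δ f m μ ≠ ⊤) : L f ≤ s * (JCw α β δ f m μ).toReal := by
  unfold JCw at hJ ⊢
  by_cases hce : SolvesCECw f m μ
  swap
  · rw [if_neg hce] at hJ; exact absurd rfl hJ
  rw [if_pos hce] at hJ ⊢
  have hTV : TVCw f ≠ ⊤ := fun h => by
    rw [h, ENNReal.mul_top (by simpa using hα)] at hJ
    simp at hJ
  have hB : BdeltaCw δ f m μ ≠ ⊤ := fun h => by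
    rw [h, ENNReal.mul_top (by simpa using hβ)] at hJ
    simp at hJ
  have hM : ∀ M, s < M → L f ≤ M * (β * (BdeltaCw δ f m μ).toReal + α * (TVCw f).toReal) := fun M hM => by
    have hM0 : 0 < M := hs0.trans_lt hM
    refine le_of_forall_pos_le_add fun ε hε => ?_
    have hlt : BdeltaCw δ f m μ < BdeltaCw δ f m μ + ENNReal.ofReal (ε / (M * β)) :=
      ENNReal.lt_add_right hB (by simpa using by positivity)
    obtain ⟨c, ⟨lam, hlam, r, w, u, hr, hw, hu, hd, hm, hμ, rfl⟩, hc⟩ := sInf_lt_iff.1 hlt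
    have h1 := main_M hΩ hne hα hβ hδ hL hs hM hM0 hf hTV hce hr hw hu hd hm hμ hc.ne_top
    have h2 := ENNReal.toReal_mono (by simp [hB]) hc.le
    rw [ENNReal.toReal_add hB ENNReal.ofReal_ne_top, ENNReal.toReal_ofReal (by positivity)] at h2
    refine h1.trans ?_
    have h3 : M * (β * (∫⁻ x, Psi δ (r x) (w x) (u x) ∂lam).toReal) ≤ M * (β * ((BdeltaCw δ f m μ).toReal + ε / (M * β))) := by gcongr
    have h4 : M * (β * (ε / (M * β))) = ε := by field_simp
    nlinarith
  rw [ENNReal.toReal_add (ENNReal.mul_ne_top ENNReal.ofReal_ne_top hB) (ENNReal.mul_ne_top ENNReal.ofReal_ne_top hTV), ENNReal.toReal_mul, ENNReal.toReal_mul,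
    ENNReal.toReal_ofReal hα.le, ENNReal.toReal_ofReal hβ.le]
  have hlim : Tendsto (fun M => M * (β * (BdeltaCw δ f m μ).toReal + α * (TVCw f).toReal)) (𝓝[>] s) (𝓝 (s * (β * (BdeltaCw δ f m μ).toReal + α * (TVCw f).toReal))) :=
    ((continuous_id.mul continuous_const).tendsto s).mono_left nhdsWithin_le_nhds
  exact ge_of_tendsto hlim (by filter_upwards [self_mem_nhdsWithin] with M h using hM M h)

/-! ### Convex geometry in finite dimension -/

lemma compact_convexHull {H : Type*} [NormedAddCommGroup H] [NormedSpace ℝ H] [FiniteDimensional ℝ H] {B : Set H} (hB : IsCompact B) :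
    IsCompact (convexHull ℝ B) := by
  rcases B.eq_empty_or_nonempty with rfl | ⟨b0, hb0⟩
  · simp
  let n := Module.finrank ℝ H + 1
  let Φ : (Fin n → ℝ) × (Fin n → H) → H := fun p => ∑ i, p.1 i • p.2 i
  have hΦ : Continuous Φ := continuous_finsetSum _ fun i _ =>
    ((continuous_apply i).comp continuous_fst).smul ((continuous_apply i).comp continuous_snd)
  have hc : IsCompact (stdSimplex ℝ (Fin n) ×ˢ (Set.pi univ fun _ : Fin n => B)) := (isCompact_stdSimplex ℝ (Fin n)).prod (isCompact_univ_pi fun _ => hB)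
  have : convexHull ℝ B = Φ '' (stdSimplex ℝ (Fin n) ×ˢ (Set.pi univ fun _ : Fin n => B)) := by
    ext x
    constructor
    · intro hx
      obtain ⟨ι, _, z, w, hz, hi, hw, hw1, rfl⟩ := eq_pos_convex_span_of_mem_convexHull hx
      have hcard : Fintype.card ι ≤ n := by
        refine hi.card_le_finrank_succ.trans ?_
        exact Nat.add_le_add_right (Submodule.finrank_le _) 1
      obtain ⟨e⟩ : Nonempty (ι ↪ Fin n) := Function.Embedding.nonempty_of_card_le (by simpa using hcard)
      classical
      refine ⟨(Function.extend e w 0, Function.extend e z fun _ => b0), ⟨⟨fun i => ?_, ?_⟩, fun i _ => ?_⟩, ?_⟩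
      · by_cases hi : ∃ a, e a = i
        · obtain ⟨a, rfl⟩ := hi
          show 0 ≤ Function.extend e w 0 (e a)
          rw [e.injective.extend_apply]; exact (hw a).le
        · show 0 ≤ Function.extend e w 0 i
          rw [Function.extend_apply' _ _ _ hi]; rfl
      · show ∑ i, Function.extend e w 0 i = 1
        rw [← hw1]
        refine (Fintype.sum_of_injective e e.injective _ _ (fun i hi => ?_) fun i => ?_).symm
        · rw [Function.extend_apply' _ _ _ hi]; rfl
        · rw [e.injective.extend_apply]
      · by_cases hi : ∃ a, e a = i
        · obtain ⟨a, rfl⟩ := hi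
          show Function.extend e z (fun _ => b0) (e a) ∈ B
          rw [e.injective.extend_apply]; exact hz ⟨a, rfl⟩
        · show Function.extend e z (fun _ => b0) i ∈ B
          rw [Function.extend_apply' _ _ _ hi]; exact hb0
      · show ∑ i, Function.extend e w 0 i • Function.extend e z (fun _ => b0) i = _
        refine (Fintype.sum_of_injective e e.injective _ _ (fun i hi => ?_) fun i => ?_).symm
        · rw [Function.extend_apply' _ _ _ hi]; simp
        · rw [e.injective.extend_apply, e.injective.extend_apply]
    · rintro ⟨⟨w, z⟩, ⟨⟨hw, hw1⟩, hz⟩, rfl⟩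
      exact (convex_convexHull ℝ B).sum_mem (fun i _ => hw i) hw1 fun i _ => subset_convexHull ℝ B (hz i trivial)
  rw [this]
  exact hc.image hΦ

lemma minkowski_aux (n : ℕ) : ∀ (H : Type) [NormedAddCommGroup H] [NormedSpace ℝ H] [FiniteDimensional ℝ H], Module.finrank ℝ H = n →
    ∀ D : Set H, IsCompact D → Convex ℝ D → D ⊆ convexHull ℝ (D.extremePoints ℝ) := by
  induction n with
  | zero =>
    intro H _ _ _ hH D hD hc x hx
    have := Module.finrank_zero_iff.1 hH
    rw [Set.extremePoints_eq_self]
    exact subset_convexHull ℝ D hx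
  | succ n ih =>
    intro H _ _ _ hH D hD hc x hx
    by_contra hxE
    -- a supporting functional
    obtain ⟨l, hl0, hl⟩ : ∃ l : StrongDual ℝ H, l ≠ 0 ∧ ∀ y ∈ D, l y ≤ l x := by
      have hcl := closure_convexHull_extremePoints hD hc
      set E := convexHull ℝ (D.extremePoints ℝ) with hE
      have hEc : Convex ℝ E := convex_convexHull ℝ _
      by_cases hintg : (interior E).Nonempty
      · obtain ⟨l, hl⟩ := geometric_hahn_banach_open_point hEc.interior isOpen_interior fun h => hxE (interior_subset h)
        refine ⟨l, ?_, fun y hy => ?_⟩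
        · rintro rfl
          obtain ⟨a, ha⟩ := hintg
          simpa using hl a ha
        · rw [← hcl, ← hEc.closure_interior_eq_closure_of_nonempty_interior hintg] at hy
          exact closure_minimal (fun a ha => (hl a ha).le) (isClosed_le l.continuous continuous_const) hy
      · rw [hEc.interior_nonempty_iff_affineSpan_eq_top] at hintg
        have hEne : E.Nonempty := by
          rw [← closure_nonempty_iff, hcl]; exact ⟨x, hx⟩
        obtain ⟨a, ha⟩ := hEne
        have hV : vectorSpan ℝ E ≠ ⊤ := fun h => hintg ((AffineSubspace.affineSpan_eq_top_iff_vectorSpan_eq_top_of_nonempty ℝ H H ⟨a, ha⟩).2 h)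
        obtain ⟨l, hl0, hl⟩ := Submodule.exists_le_ker_of_lt_top _ hV.lt_top
        have hla : ∀ y ∈ E, l y = l a := fun y hy => by
          have := hl (vsub_mem_vectorSpan ℝ hy ha)
          rw [LinearMap.mem_ker, vsub_eq_sub, map_sub, sub_eq_zero] at this
          exact this
        have hlD : ∀ y ∈ D, l y = l a := fun y hy => by
          rw [← hcl] at hy
          exact closure_minimal hla (isClosed_eq (LinearMap.continuous_of_finiteDimensional l) continuous_const) hy
        refine ⟨LinearMap.toContinuousLinearMap l, fun h => hl0 ?_, fun y hy => ?_⟩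
        · simpa using h
        · simp only [LinearMap.coe_toContinuousLinearMap']
          rw [hlD y hy, hlD x hx]
    let D1 : Set H := {y ∈ D | l y = l x}
    have hext : IsExtreme ℝ D D1 := by
      refine ⟨fun y hy => hy.1, ?_⟩
      rintro a ha b hb y ⟨hy, hyl⟩ ⟨s, t, hs, ht, hst, rfl⟩
      refine ⟨ha, le_antisymm (hl a ha) ?_⟩
      rw [map_add, map_smul, map_smul, smul_eq_mul, smul_eq_mul] at hyl
      have := hl b hb
      have h1 : t * l b ≤ t * l x := mul_le_mul_of_nonneg_left this ht.le
      have h2 : s * l x ≤ s * l a := by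
        have : l x = s * l x + t * l x := by rw [← add_mul, hst, one_mul]
        linarith
      exact le_of_mul_le_mul_left h2 hs
    let V := LinearMap.ker (l : H →ₗ[ℝ] ℝ)
    have hfr : Module.finrank ℝ V = n := by
      have h1 := LinearMap.finrank_range_add_finrank_ker (l : H →ₗ[ℝ] ℝ)
      have h2 : LinearMap.range (l : H →ₗ[ℝ] ℝ) = ⊤ := LinearMap.range_eq_top.2 (LinearMap.surjective fun h => hl0 (by ext y; exact LinearMap.congr_fun h y))
      rw [h2, finrank_top, Module.finrank_self, hH] at h1
      change 1 + Module.finrank ℝ V = n + 1 at h1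
      omega
    let ι : V →ᵃ[ℝ] H := (V.subtype.toAffineMap) + AffineMap.const ℝ V x
    have hι : ∀ v, ι v = (v : H) + x := fun v => rfl
    have hιc : Continuous ι := by
      show Continuous fun v : V => (v : H) + x
      fun_prop
    have hιe : Topology.IsClosedEmbedding ι := by
      have h1 : Topology.IsClosedEmbedding ((↑) : V → H) := (Submodule.closed_of_finiteDimensional V).isClosedEmbedding_subtypeVal
      exact (Homeomorph.addRight x).isClosedEmbedding.comp h1
    let D2 : Set V := ι ⁻¹' D1
    have hD1c : IsCompact D1 := hD.inter_right (isClosed_eq l.continuous continuous_const)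
    have hD1v : Convex ℝ D1 := by
      intro a ha b hb s t hs ht hst
      refine ⟨hc ha.1 hb.1 hs ht hst, ?_⟩
      rw [map_add, map_smul, map_smul, ha.2, hb.2, ← add_smul, hst, one_smul]
    have hlift : ∀ y ∈ D1, ∃ v : V, ι v = y := fun y hy =>
      ⟨⟨y - x, by show l (y - x) = 0; rw [map_sub, hy.2, sub_self]⟩, by rw [hι]; simp⟩
    have h0 : (0 : V) ∈ D2 := by
      show ι 0 ∈ D1
      rw [hι]; simp only [ZeroMemClass.coe_zero, zero_add]; exact ⟨hx, rfl⟩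
    have := ih V hfr D2 (hιe.isCompact_preimage hD1c) (hD1v.affine_preimage ι) h0
    have h2 : x ∈ ι '' convexHull ℝ (D2.extremePoints ℝ) := ⟨0, this, by rw [hι]; simp⟩
    rw [AffineMap.image_convexHull] at h2
    refine hxE (convexHull_mono ?_ h2)
    refine Subset.trans ?_ hext.extremePoints_subset_extremePoints
    rintro _ ⟨v, hv, rfl⟩
    refine mem_extremePoints_iff_left.2 ⟨hv.1, fun a ha b hb hab => ?_⟩
    obtain ⟨a', rfl⟩ := hlift a ha
    obtain ⟨b', rfl⟩ := hlift b hb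
    rw [← image_openSegment] at hab
    obtain ⟨v', hv', e⟩ := hab
    have := hιe.injective e
    subst this
    rw [(mem_extremePoints_iff_left.1 hv).2 a' ha b' hb hv']

lemma cone_caratheodory {H : Type*} [AddCommGroup H] [Module ℝ H] [FiniteDimensional ℝ H] {S : Set H} {y : H} {j : ℝ}
    (h : ∃ (t : Finset H) (c : H → ℝ), (∀ z ∈ t, z ∈ S ∧ 0 < c z) ∧ ∑ z ∈ t, c z ≤ j ∧ ∑ z ∈ t, c z • z = y) :
    ∃ (t : Finset H) (c : H → ℝ), t.card ≤ Module.finrank ℝ H ∧ (∀ z ∈ t, z ∈ S ∧ 0 < c z) ∧ ∑ z ∈ t, c z ≤ j ∧ ∑ z ∈ t, c z • z = y := by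
  classical
  obtain ⟨t, ht, hmin⟩ := WellFounded.has_min (measure (α := Finset H) Finset.card).wf
    {t | ∃ c : H → ℝ, (∀ z ∈ t, z ∈ S ∧ 0 < c z) ∧ ∑ z ∈ t, c z ≤ j ∧ ∑ z ∈ t, c z • z = y} h
  obtain ⟨c, hc, hj, hy⟩ := ht
  refine ⟨t, c, ?_, hc, hj, hy⟩
  by_contra hcard
  push Not at hcard
  have key : ∃ g : H → ℝ, ∑ e ∈ t, g e • e = 0 ∧ 0 ≤ ∑ e ∈ t, g e ∧ ∃ x ∈ t, 0 < g x := by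
    obtain ⟨g, hg, x, hx, hgx⟩ := Module.exists_nontrivial_relation_of_finrank_lt_card hcard
    have aux : ∀ g : H → ℝ, ∑ e ∈ t, g e • e = 0 → 0 ≤ ∑ e ∈ t, g e → g x ≠ 0 →
        ∃ g : H → ℝ, ∑ e ∈ t, g e • e = 0 ∧ 0 ≤ ∑ e ∈ t, g e ∧ ∃ x ∈ t, 0 < g x := by
      intro g hg hs hgx
      refine ⟨g, hg, hs, ?_⟩
      by_contra hn
      push Not at hn
      have h1 : ∑ e ∈ t, g e < ∑ e ∈ t, (0:ℝ) :=
        Finset.sum_lt_sum hn ⟨x, hx, lt_of_le_of_ne (hn x hx) hgx⟩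
      simp at h1
      linarith
    rcases le_total 0 (∑ e ∈ t, g e) with h0 | h0
    · exact aux g hg h0 hgx
    · refine aux (fun e => - g e) ?_ ?_ (by simpa using hgx)
      · simp only [neg_smul, Finset.sum_neg_distrib, hg, neg_zero]
      · simp only [Finset.sum_neg_distrib]; linarith
  obtain ⟨g, hg, hs, x, hx, hgx⟩ := key
  obtain ⟨e, he, hmin'⟩ := Finset.exists_min_image (t.filter fun z => 0 < g z) (fun z => c z / g z)
    ⟨x, by simp [hx, hgx]⟩
  rw [Finset.mem_filter] at he
  obtain ⟨het, hge⟩ := he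
  set θ := c e / g e with hθ
  have hθ0 : 0 < θ := div_pos (hc e het).2 hge
  have hnn : ∀ z ∈ t, 0 ≤ c z - θ * g z := by
    intro z hz
    rcases le_or_gt (g z) 0 with h | h
    · have := (hc z hz).2
      nlinarith
    · have := hmin' z (by simp [hz, h])
      rw [le_div_iff₀ h] at this
      linarith
  have hez : c e - θ * g e = 0 := by rw [hθ]; field_simp; ring
  refine hmin (t.filter fun z => c z - θ * g z ≠ 0) ⟨fun z => c z - θ * g z, ?_, ?_, ?_⟩ ?_
  · intro z hz
    rw [Finset.mem_filter] at hz
    exact ⟨(hc z hz.1).1, lt_of_le_of_ne (hnn z hz.1) (Ne.symm hz.2)⟩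
  · rw [Finset.sum_filter_ne_zero, Finset.sum_sub_distrib, ← Finset.mul_sum]
    have := mul_nonneg hθ0.le hs
    linarith
  · rw [Finset.sum_filter_of_ne (p := fun z => c z - θ * g z ≠ 0) (f := fun z => (c z - θ * g z) • z)
      (fun z _ h h0 => h (by simp only [h0, zero_smul]))]
    simp only [sub_smul, Finset.sum_sub_distrib, hy, mul_smul, ← Finset.smul_sum, hg, smul_zero, sub_zero]
  · show Finset.card _ < Finset.card _
    refine Finset.card_lt_card (Finset.filter_ssubset.2 ⟨e, het, by simpa using hez⟩)

lemma exists_min_cone {H : Type*} [NormedAddCommGroup H] [NormedSpace ℝ H] {D : Set H} (hD : IsCompact D)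
    (hne : D.Nonempty) {F : H → ℝ} (hF : LowerSemicontinuous F) (hb : BddBelow (range F)) :
    ∃ j : ℝ, 0 ≤ j ∧ ∃ x ∈ D, ∀ j' : ℝ, 0 ≤ j' → ∀ x' ∈ D, F (j • x) + j ≤ F (j' • x') + j' := by
  obtain ⟨b, hb⟩ := hb
  have hb' : ∀ y, b ≤ F y := fun y => hb ⟨y, rfl⟩
  let M := F 0 - b
  have hM : 0 ≤ M := sub_nonneg.2 (hb' 0)
  let g : ℝ × H → ℝ := fun p => F (p.1 • p.2) + p.1
  have hg : LowerSemicontinuous g := by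
    refine LowerSemicontinuous.add ?_ continuous_fst.lowerSemicontinuous
    exact hF.comp (by fun_prop : Continuous fun p : ℝ × H => p.1 • p.2)
  obtain ⟨⟨j, x⟩, ⟨hj, hx⟩, hmin⟩ := (hg.lowerSemicontinuousOn (Icc 0 M ×ˢ D)).exists_isMinOn
    ((nonempty_Icc.2 hM).prod hne) (isCompact_Icc.prod hD)
  refine ⟨j, hj.1, x, hx, fun j' hj' x' hx' => ?_⟩
  by_cases h : j' ≤ M
  · exact hmin (show ((j', x') : ℝ × H) ∈ Icc 0 M ×ˢ D from ⟨⟨hj', h⟩, hx'⟩)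
  · have h1 : F (j • x) + j ≤ F ((0:ℝ) • x) + 0 := hmin (show ((0, x) : ℝ × H) ∈ Icc 0 M ×ˢ D from ⟨⟨le_rfl, hM⟩, hx⟩)
    rw [zero_smul] at h1
    have h2 := hb' (j' • x')
    have h3 : F 0 - b < j' := not_le.1 h
    linarith

section sparse

variable {Ω : Set (Euc d)} {α β δ : ℝ} {H : Type} [NormedAddCommGroup H] [InnerProductSpace ℝ H] [FiniteDimensional ℝ H]
  {K : (ℝ → SignedMeasure (Euc d)) → H}

/-- images of unit energy characteristics -/
def Bset (α β δ : ℝ) (Ω : Set (Euc d)) (K : (ℝ → SignedMeasure (Euc d)) → H) : Set H :=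
  {y | ∃ η : GC d, η.Ok Ω ∧ η.E α β δ ≤ 1 ∧ y = K η.f}

lemma Bset_compact (hΩ : IsCompact Ω) (hα : 0 < α) (hβ : 0 < β) (hδ : 0 < δ) (hK : LinC Ω K) :
    IsCompact (Bset α β δ Ω K) := by
  refine IsSeqCompact.isCompact fun y hy => ?_
  choose η hok hE he using hy
  obtain ⟨φ, hφ, η', hok', hE', ht⟩ := GC.compactness hΩ hα hβ hδ η hok hE
  refine ⟨K η'.f, ⟨η', hok', hE', rfl⟩, φ, hφ, ?_⟩
  have : y ∘ φ = fun n => K ((η (φ n)).f) := by ext1 n; exact he _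
  rw [this]
  refine hK.cont _ _ (fun n => (hok _).cw hΩ) (hok'.cw hΩ) fun t _ ψ hψ => ?_
  have hp : Tendsto (fun n : ℕ => (n, t)) atTop (atTop ×ˢ 𝓝 t) := tendsto_id.prodMk tendsto_const_nhds
  exact GC.f_tendsto hΩ (fun n => η (φ n)) (fun _ => t) (fun n => hok _) ((ht t).1.comp hp) ((ht t).2.comp hp) hψ

lemma exists_GC_zero (hne : Ω.Nonempty) : ∃ η : GC d, η.Ok Ω ∧ (∀ t, η.u t = 0) ∧ ∀ α β δ : ℝ, η.E α β δ = 0 := by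
  obtain ⟨x, hx⟩ := hne
  have hu : ∀ (h1 : L2D (fun _ : ℝ => (0:ℝ))) (h2 h3 : L2D (fun _ : ℝ => (0:Euc d))) t, GC.u ⟨0, 0, _, _, _, h1, h2, h3⟩ t = 0 := fun _ _ _ t => by
    simp [GC.u]
  have hz : ∀ (h1 : L2D (fun _ : ℝ => (0:ℝ))) (h2 h3 : L2D (fun _ : ℝ => (0:Euc d))) t, GC.z ⟨0, 0, _, _, _, h1, h2, h3⟩ t = 0 := fun _ _ _ t => by
    simp [GC.z]
  have l1 : L2D (fun _ : ℝ => (0:ℝ)) := ⟨measurable_const, MemLp.zero', by simp⟩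
  have l2 : L2D (fun _ : ℝ => (0:Euc d)) := ⟨measurable_const, MemLp.zero', by simp⟩
  refine ⟨⟨0, 0, fun _ => 0, fun _ => 0, fun _ => 0, l1, l2, l2⟩, ⟨fun t => ?_, fun t => ⟨x, hx, ?_⟩, ?_⟩, fun t => hu _ _ _ t, fun α β δ => ?_⟩
  · rw [hu]
  · rw [hu, hz]; simp
  · exact Eventually.of_forall fun t => by simp
  · unfold GC.E
    simp only [hu]
    simp

lemma zero_mem_Bset (hne : Ω.Nonempty) (hα : 0 < α) (hβ : 0 < β) (hδ : 0 < δ) (hK : LinC Ω K) : (0:H) ∈ Bset α β δ Ω K := by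
  obtain ⟨η, h1, h2, h3⟩ := exists_GC_zero hne
  refine ⟨η, h1, by rw [h3]; norm_num, ?_⟩
  rw [GC.f_eq_zero hα hβ hδ (h3 α β δ), hK.zero]

lemma mem_scaled (hΩ : IsCompact Ω) (hne : Ω.Nonempty) (hα : 0 < α) (hβ : 0 < β) (hδ : 0 < δ) (hK : LinC Ω K)
    {f : ℝ → SignedMeasure (Euc d)} {m : VectorMeasure (XX d) (Euc d)} {μ : SignedMeasure (XX d)} (hf : IsCwCurve Ω f)
    (hJ : JCw α β δ f m μ ≠ ⊤) :
    ∃ x ∈ convexHull ℝ (Bset α β δ Ω K), K f = (JCw α β δ f m μ).toReal • x := by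
  set D := convexHull ℝ (Bset α β δ Ω K) with hD
  set J := (JCw α β δ f m μ).toReal with hJdef
  have hJ0 : 0 ≤ J := ENNReal.toReal_nonneg
  have h0 : (0:H) ∈ D := subset_convexHull ℝ _ (zero_mem_Bset hne hα hβ hδ hK)
  have hcl : IsClosed D := (compact_convexHull (Bset_compact hΩ hα hβ hδ hK)).isClosed
  have key : ∀ (l : StrongDual ℝ H) (s : ℝ), 0 ≤ s → (∀ x ∈ D, l x ≤ s) → l (K f) ≤ s * J := by
    intro l s hs hl
    have hL : LinC Ω (fun g => l (K g)) := by
      refine ⟨fun g₁ g₂ h1 h2 => ?_, fun c g h => ?_, fun gn g h1 h2 h3 => ?_⟩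
      · simp only [hK.add _ _ h1 h2, map_add]
      · simp only [hK.smul _ _ h, map_smul]
      · exact (l.continuous.tendsto _).comp (hK.cont gn g h1 h2 h3)
    exact main_ineq hΩ hne hα hβ hδ hL hs (fun η h1 h2 => hl _ (subset_convexHull ℝ _ ⟨η, h1, h2, rfl⟩)) hf hJ
  rcases hJ0.eq_or_lt with h | h
  · refine ⟨0, h0, ?_⟩
    rw [smul_zero]
    obtain ⟨C, hC⟩ := (compact_convexHull (Bset_compact hΩ hα hβ hδ hK)).isBounded.exists_norm_le
    have h1 := key (innerSL ℝ (K f)) (‖K f‖ * |C|) (by positivity) fun x hx => by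
      rw [innerSL_apply_apply]
      exact (real_inner_le_norm _ _).trans (mul_le_mul_of_nonneg_left ((hC x hx).trans (le_abs_self _)) (norm_nonneg _))
    rw [innerSL_apply_apply, ← h, mul_zero, real_inner_self_eq_norm_sq] at h1
    have : ‖K f‖ ^ 2 = 0 := le_antisymm h1 (sq_nonneg _)
    simpa using this
  · refine ⟨J⁻¹ • K f, ?_, by rw [smul_inv_smul₀ h.ne']⟩
    by_contra hn
    obtain ⟨l, s, hl, hs⟩ := geometric_hahn_banach_closed_point (convex_convexHull ℝ _) hcl hn
    have hs0 : 0 ≤ s := by simpa using (hl 0 h0).le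
    have h1 := key l s hs0 fun x hx => (hl x hx).le
    rw [map_smul, smul_eq_mul, inv_mul_eq_div, lt_div_iff₀ h] at hs
    linarith

/-- images of unit energy characteristics with connected positivity set -/
def Sset (α β δ : ℝ) (Ω : Set (Euc d)) (K : (ℝ → SignedMeasure (Euc d)) → H) : Set H :=
  {y | ∃ η : GC d, η.Ok Ω ∧ η.E α β δ ≤ 1 ∧ IsPreconnected {t | t ∈ Icc (0:ℝ) 1 ∧ 0 < η.u t} ∧ y = K η.f}

lemma precon {η : GC d} (h : η.Ok Ω) {c e : ℝ} (hce : η.Comp c e) {k : ℝ} (hk : 0 < k) :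
    IsPreconnected {t | t ∈ Icc (0:ℝ) 1 ∧ 0 < (GC.sc k (η.pt1 c e)).u t} := by
  have h1 : ∀ t ∈ {t | t ∈ Icc (0:ℝ) 1 ∧ 0 < (GC.sc k (η.pt1 c e)).u t}, t ∈ Icc c e := by
    rintro t ⟨ht, hp⟩
    rcases hce.cases h ht with ⟨m, -⟩ | ⟨-, -, -, e1, -⟩
    · exact m
    · rw [GC.sc_u, e1, mul_zero] at hp; exact absurd hp (lt_irrefl _)
  have h2 : ∀ t ∈ Ioo c e, t ∈ {t | t ∈ Icc (0:ℝ) 1 ∧ 0 < (GC.sc k (η.pt1 c e)).u t} := by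
    intro t ht
    refine ⟨⟨hce.hc.trans ht.1.le, ht.2.le.trans hce.he⟩, ?_⟩
    rw [GC.sc_u]
    exact mul_pos hk ((hce.pt1 h).pos t ht)
  refine OrdConnected.isPreconnected ⟨fun a ha b hb t ht => ?_⟩
  rcases ht.1.eq_or_lt with rfl | hat
  · exact ha
  rcases ht.2.eq_or_lt with rfl | htb
  · exact hb
  exact h2 t ⟨(h1 a ha).1.trans_lt hat, htb.trans_le (h1 b hb).2⟩

lemma ext_mem (hΩ : IsCompact Ω) (hne : Ω.Nonempty) (hα : 0 < α) (hβ : 0 < β) (hδ : 0 < δ) (hK : LinC Ω K)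
    {y : H} (hy : y ∈ (convexHull ℝ (Bset α β δ Ω K)).extremePoints ℝ) (hy0 : y ≠ 0) : y ∈ Sset α β δ Ω K := by
  obtain ⟨η, hok, hE, rfl⟩ := extremePoints_convexHull_subset hy
  have hex : ∃ t ∈ Icc (0:ℝ) 1, 0 < η.u t := by
    by_contra hn
    push Not at hn
    refine hy0 ?_
    have : η.f = 0 := by
      ext1 t
      rw [← GC.f_clamp]
      have h1 : η.u (clamp t) = 0 := le_antisymm (hn _ (clamp_mem t)) (hok.nn _)
      simp [GC.f, h1]
    rw [this, hK.zero]
  obtain ⟨t, ht, htp⟩ := hex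
  obtain ⟨c, e, hce⟩ := GC.exists_comp hok ht htp
  have ok1 := hce.ok1 hok
  have ok2 := hce.ok2 hok
  have hE1 := hce.E_pos hok hα hβ hδ
  have hE2 := GC.E_nonneg (δ := δ) hα.le hβ.le (η.pt2 c e)
  have hEa := hce.E_add hok α β δ
  have hKa : K η.f = K (η.pt1 c e).f + K (η.pt2 c e).f := by
    rw [hce.f_add hok, hK.add _ _ (ok1.cw hΩ) (ok2.cw hΩ)]
  set E1 := (η.pt1 c e).E α β δ
  set E2 := (η.pt2 c e).E α β δ
  have hk : 0 < (Real.sqrt E1)⁻¹ := by positivity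
  have norm1 : ∀ ζ : GC d, ζ.Ok Ω → 0 < ζ.E α β δ → (GC.sc (Real.sqrt (ζ.E α β δ))⁻¹ ζ).Ok Ω ∧
      (GC.sc (Real.sqrt (ζ.E α β δ))⁻¹ ζ).E α β δ ≤ 1 ∧ ζ.E α β δ • K (GC.sc (Real.sqrt (ζ.E α β δ))⁻¹ ζ).f = K ζ.f := by
    intro ζ hζ hp
    have hs : (Real.sqrt (ζ.E α β δ))⁻¹ ^ 2 = (ζ.E α β δ)⁻¹ := by rw [inv_pow, Real.sq_sqrt hp.le]
    refine ⟨GC.sc_ok hζ (by positivity), ?_, ?_⟩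
    · rw [GC.sc_E, hs, inv_mul_cancel₀ hp.ne']
    · rw [GC.sc_f (by positivity), hs, hK.smul _ _ (hζ.cw hΩ), smul_inv_smul₀ hp.ne']
  obtain ⟨a1, a2, a3⟩ := norm1 _ ok1 hE1
  have hS : K (GC.sc (Real.sqrt E1)⁻¹ (η.pt1 c e)).f ∈ Sset α β δ Ω K := ⟨_, a1, a2, precon hok hce hk, rfl⟩
  have m1 : K (GC.sc (Real.sqrt E1)⁻¹ (η.pt1 c e)).f ∈ convexHull ℝ (Bset α β δ Ω K) := subset_convexHull ℝ _ ⟨_, a1, a2, rfl⟩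
  have m0 : (0:H) ∈ convexHull ℝ (Bset α β δ Ω K) := subset_convexHull ℝ _ (zero_mem_Bset hne hα hβ hδ hK)
  have hE2' : E2 = 0 ∨ 0 < E2 := hE2.eq_or_lt.imp Eq.symm id
  -- the remaining part, normalised
  obtain ⟨v, hv, hvE⟩ : ∃ v ∈ convexHull ℝ (Bset α β δ Ω K), K (η.pt2 c e).f = (1 - E1) • v := by
    rcases hE2' with h | h
    · refine ⟨0, m0, ?_⟩
      rw [GC.f_eq_zero hα hβ hδ h, hK.zero, smul_zero]
    · obtain ⟨b1, b2, b3⟩ := norm1 _ ok2 h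
      have h1 : 0 < 1 - E1 := by linarith
      refine ⟨(E2 / (1 - E1)) • K (GC.sc (Real.sqrt E2)⁻¹ (η.pt2 c e)).f, ?_, ?_⟩
      · refine (convex_convexHull ℝ (Bset α β δ Ω K)).smul_mem_of_zero_mem m0 (subset_convexHull ℝ _ ⟨_, b1, b2, rfl⟩)
          ⟨by positivity, (div_le_one h1).2 (by linarith)⟩
      · rw [smul_smul, mul_div_cancel₀ _ h1.ne', b3]
  have hle : E1 ≤ 1 := by linarith
  rcases hle.eq_or_lt with h1 | h1
  · rw [hKa, hvE, h1, sub_self, zero_smul, add_zero, ← a3]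
    change E1 • _ ∈ _
    rw [h1, one_smul]
    exact hS
  · have := (mem_extremePoints_iff_left.1 hy).2 _ m1 v hv ⟨E1, 1 - E1, hE1, by linarith, by ring, by rw [hKa, hvE, ← a3]⟩
    rw [← this]
    exact hS

end sparse

/-- **Sparse representation of minimizers.**
For a linear, narrowly continuous observation operator `K` with values in a
finite-dimensional Hilbert space `H` and a convex, lower semicontinuous,
bounded-from-below fidelity `F`, the problem
`min F(Kρ) + J_{α,β,δ}(ρ,m,μ)` over `C_w([0,1];M(Ω)) × M(X_Ω;ℝ^d) × M(X_Ω)`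
admits a solution which is a finite positive combination of at most `dim H`
extremal characteristic triples in `𝒞`, whose coefficients sum to the energy
of the minimizer. -/
theorem sparse_minimizer (d : ℕ) (hd : 1 ≤ d) (Ω : Set (Euc d))
    (hΩ : IsClosureOfBoundedDomain Ω)
    (α β δ : ℝ) (hα : 0 < α) (hβ : 0 < β) (hδ : 0 < δ)
    (H : Type) [NormedAddCommGroup H] [InnerProductSpace ℝ H]
    [FiniteDimensional ℝ H]
    (K : (ℝ → SignedMeasure (Euc d)) → H)
    (hKadd : ∀ f₁ f₂ : ℝ → SignedMeasure (Euc d), IsCwCurve Ω f₁ → IsCwCurve Ω f₂ →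
      K (f₁ + f₂) = K f₁ + K f₂)
    (hKsmul : ∀ (c : ℝ) (f : ℝ → SignedMeasure (Euc d)), IsCwCurve Ω f →
      K (c • f) = c • K f)
    (hKcont : ∀ (fn : ℕ → ℝ → SignedMeasure (Euc d)) (f : ℝ → SignedMeasure (Euc d)),
      (∀ n, IsCwCurve Ω (fn n)) → IsCwCurve Ω f →
      (∀ t ∈ Icc (0:ℝ) 1, ∀ φ : Euc d → ℝ, Continuous φ →
        Tendsto (fun n => sInt (fn n t) φ) atTop (nhds (sInt (f t) φ))) →
      Tendsto (fun n => K (fn n)) atTop (nhds (K f)))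
    (F : H → ℝ) (hFconv : ConvexOn ℝ Set.univ F)
    (hFlsc : LowerSemicontinuous F) (hFbdd : BddBelow (Set.range F)) :
    ∃ (f : ℝ → SignedMeasure (Euc d)) (m : VectorMeasure (XX d) (Euc d))
      (μ : SignedMeasure (XX d)),
      IsCwCurve Ω f ∧
      (∀ (f' : ℝ → SignedMeasure (Euc d)) (m' : VectorMeasure (XX d) (Euc d))
          (μ' : SignedMeasure (XX d)), IsCwCurve Ω f' →
        ((F (K f) : EReal) + (JCw α β δ f m μ : ℝ≥0∞))
          ≤ ((F (K f') : EReal) + (JCw α β δ f' m' μ' : ℝ≥0∞))) ∧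
      ∃ (p : ℕ) (_ : p ≤ Module.finrank ℝ H) (c : Fin p → ℝ)
        (fi : Fin p → ℝ → SignedMeasure (Euc d))
        (mi : Fin p → VectorMeasure (XX d) (Euc d))
        (μi : Fin p → SignedMeasure (XX d)),
        (∀ i, 0 < c i) ∧
        (∀ i, MemCCw α β δ Ω (fi i) (mi i) (μi i)) ∧
        f = ∑ i, c i • fi i ∧ m = ∑ i, c i • mi i ∧ μ = ∑ i, c i • μi i ∧
        ENNReal.ofReal (∑ i, c i) = JCw α β δ f m μ := by
  obtain ⟨U, -, hUne, -, hUb, rfl⟩ := hΩ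
  set Ω : Set (Euc d) := closure U
  have hc : IsCompact Ω := hUb.isCompact_closure
  have hne : Ω.Nonempty := hUne.closure
  have hK : LinC Ω K := ⟨hKadd, hKsmul, hKcont⟩
  set D := convexHull ℝ (Bset α β δ Ω K) with hD
  have hDc : IsCompact D := compact_convexHull (Bset_compact hc hα hβ hδ hK)
  have hDv : Convex ℝ D := convex_convexHull ℝ _
  have hD0 : (0:H) ∈ D := subset_convexHull ℝ _ (zero_mem_Bset hne hα hβ hδ hK)
  obtain ⟨j, hj, x, hx, hmin⟩ := exists_min_cone hDc ⟨0, hD0⟩ hFlsc hFbdd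
  have hlow : ∀ (f' : ℝ → SignedMeasure (Euc d)) (m' : VectorMeasure (XX d) (Euc d)) (μ' : SignedMeasure (XX d)),
      IsCwCurve Ω f' → JCw α β δ f' m' μ' ≠ ⊤ → F (j • x) + j ≤ F (K f') + (JCw α β δ f' m' μ').toReal := by
    intro f' m' μ' hf' hJ'
    obtain ⟨x', hx', e⟩ := mem_scaled hc hne hα hβ hδ hK hf' hJ'
    rw [e]
    exact hmin _ ENNReal.toReal_nonneg x' hx'
  have hrep : ∃ (t : Finset H) (c : H → ℝ), (∀ z ∈ t, z ∈ Sset α β δ Ω K ∧ 0 < c z) ∧ ∑ z ∈ t, c z ≤ j ∧ ∑ z ∈ t, c z • z = j • x := by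
    rcases hj.eq_or_lt with h | h
    · exact ⟨∅, 0, by simp, by simp [h], by simp [← h]⟩
    have hx' := minkowski_aux _ H rfl D hDc hDv hx
    rw [convexHull_eq_union_convexHull_finite_subsets] at hx'
    simp only [mem_iUnion] at hx'
    obtain ⟨t, hts, hxt⟩ := hx'
    rw [Finset.mem_convexHull'] at hxt
    obtain ⟨w, hw0, hw1, hwx⟩ := hxt
    classical
    have hn : ∀ z ∈ t, 0 ≤ j * w z := fun z hz => mul_nonneg hj (hw0 z hz)
    refine ⟨t.filter fun z => (j * w z) • z ≠ 0, fun z => j * w z, ?_, ?_, ?_⟩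
    · intro z hz
      rw [Finset.mem_filter] at hz
      obtain ⟨hz, hz'⟩ := hz
      have h1 : z ≠ 0 := fun h => hz' (by rw [h, smul_zero])
      have h2 : j * w z ≠ 0 := fun h => hz' (by rw [h, zero_smul])
      exact ⟨ext_mem hc hne hα hβ hδ hK (hts hz) h1, lt_of_le_of_ne (hn z hz) h2.symm⟩
    · refine (Finset.sum_le_sum_of_subset_of_nonneg (Finset.filter_subset _ _) fun z hz _ => hn z hz).trans ?_
      rw [← Finset.mul_sum, hw1, mul_one]
    · rw [Finset.sum_filter_ne_zero, ← hwx, Finset.smul_sum]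
      simp only [mul_smul]
  obtain ⟨t, c, hcard, ht, hcj, hsum⟩ := cone_caratheodory hrep
  let p := t.card
  let ev : Fin p → H := fun i => (t.equivFin.symm i : H)
  have hev : ∀ i, ev i ∈ t := fun i => (t.equivFin.symm i).2
  have hsumS : ∀ {M : Type} [AddCommMonoid M] (g : H → M), ∑ i, g (ev i) = ∑ z ∈ t, g z := by
    intro M _ g
    rw [← Finset.sum_coe_sort t]
    exact Equiv.sum_comp t.equivFin.symm (fun z : t => g z)
  choose η hok hE hpre hKη using fun i => (ht _ (hev i)).1
  choose mi μi hadm hmem using fun i => (hok i).triple hc (δ := δ) hα.le hβ.le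
  let ci : Fin p → ℝ := fun i => c (ev i)
  have hci : ∀ i, 0 < ci i := fun i => (ht _ (hev i)).2
  have hcw : ∀ i, IsCwCurve Ω (η i).f := fun i => (hok i).cw hc
  have hJi : ∀ i, JCw α β δ (η i).f (mi i) (μi i) ≤ 1 := fun i =>
    (hadm i).le.trans (by rw [← ENNReal.ofReal_one]; exact ENNReal.ofReal_le_ofReal (hE i))
  have hJit : ∀ i, JCw α β δ (η i).f (mi i) (μi i) ≠ ⊤ := fun i => ne_top_of_le_ne_top ENNReal.one_ne_top (hJi i)
  have hcs : ∑ i, ci i ≤ j := by rw [hsumS c]; exact hcj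
  set f : ℝ → SignedMeasure (Euc d) := ∑ i, ci i • (η i).f with hf
  set m : VectorMeasure (XX d) (Euc d) := ∑ i, ci i • mi i with hm
  set μ : SignedMeasure (XX d) := ∑ i, ci i • μi i with hμ
  have hfcw : IsCwCurve Ω f := cw_sum hc _ fun i _ => cw_smul hc (hcw i) _
  have hKf : K f = j • x := by
    rw [hf, hK.sum hc _ fun i _ => hcw i, ← hsum, ← hsumS (fun z => c z • z)]
    exact Finset.sum_congr rfl fun i _ => congrArg (ci i • ·) (hKη i).symm
  have hJf : JCw α β δ f m μ ≤ ENNReal.ofReal (∑ i, ci i) := by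
    refine (Adm.sum hc Finset.univ hadm (fun i => (hci i).le)).le.trans ?_
    rw [ENNReal.ofReal_sum_of_nonneg fun i _ => (hci i).le]
    refine Finset.sum_le_sum fun i _ => ?_
    calc _ ≤ ENNReal.ofReal (ci i) * 1 := by
          gcongr
          rw [← ENNReal.ofReal_one]; exact ENNReal.ofReal_le_ofReal (hE i)
      _ = _ := mul_one _
  have hJft : JCw α β δ f m μ ≠ ⊤ := ne_top_of_le_ne_top ENNReal.ofReal_ne_top hJf
  have hc0 : 0 ≤ ∑ i, ci i := Finset.sum_nonneg fun i _ => (hci i).le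
  have hjle : j ≤ (JCw α β δ f m μ).toReal := by
    have := hlow f m μ hfcw hJft
    rw [hKf] at this
    linarith
  have hJr : (JCw α β δ f m μ).toReal ≤ ∑ i, ci i := ENNReal.toReal_le_of_le_ofReal hc0 hJf
  have hcsj : ∑ i, ci i = j := le_antisymm hcs (hjle.trans hJr)
  have hJeq : (JCw α β δ f m μ).toReal = j := le_antisymm (hJr.trans hcs) hjle
  have hJi1 : ∀ i, JCw α β δ (η i).f (mi i) (μi i) = 1 := by
    choose xi hxi hxe using fun i => mem_scaled hc hne hα hβ hδ hK (hcw i) (hJit i)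
    set Ji : Fin p → ℝ := fun i => (JCw α β δ (η i).f (mi i) (μi i)).toReal with hJidef
    have hJi0 : ∀ i, 0 ≤ Ji i := fun i => ENNReal.toReal_nonneg
    have hJi1 : ∀ i, Ji i ≤ 1 := fun i => ENNReal.toReal_le_of_le_ofReal zero_le_one (by rw [ENNReal.ofReal_one]; exact hJi i)
    have hs : j • x = ∑ i, (ci i * Ji i) • xi i := by
      rw [← hsum, ← hsumS (fun z => c z • z)]
      exact Finset.sum_congr rfl fun i _ => by rw [mul_smul]; exact congrArg (ci i • ·) ((hKη i).trans (hxe i))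
    set J' := ∑ i, ci i * Ji i with hJ'
    have hJ'0 : 0 ≤ J' := Finset.sum_nonneg fun i _ => mul_nonneg (hci i).le (hJi0 i)
    have hx' : ∃ x' ∈ D, j • x = J' • x' := by
      rcases hJ'0.eq_or_lt with h | h
      · refine ⟨0, hD0, ?_⟩
        rw [hs, smul_zero]
        refine Finset.sum_eq_zero fun i hi => ?_
        rw [(Finset.sum_eq_zero_iff_of_nonneg fun i _ => mul_nonneg (hci i).le (hJi0 i)).1 h.symm i hi, zero_smul]
      · refine ⟨Finset.univ.centerMass (fun i => ci i * Ji i) xi, ?_, ?_⟩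
        · exact hDv.centerMass_mem (fun i _ => mul_nonneg (hci i).le (hJi0 i)) h fun i _ => hxi i
        · rw [Finset.centerMass, smul_inv_smul₀ h.ne', hs]
    obtain ⟨x', hx', he⟩ := hx'
    have h1 := hmin J' hJ'0 x' hx'
    rw [← he] at h1
    have h2 : ∑ i, ci i ≤ ∑ i, ci i * Ji i := by rw [hcsj]; linarith
    intro i
    by_contra hn
    have h3 : Ji i < 1 := lt_of_le_of_ne (hJi1 i) fun h => hn ((ENNReal.toReal_eq_one_iff _).1 h)
    have h4 : ∑ i, ci i * Ji i < ∑ i, ci i := Finset.sum_lt_sum (fun i _ => mul_le_of_le_one_right (hci i).le (hJi1 i))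
      ⟨i, Finset.mem_univ _, by nlinarith [hci i]⟩
    linarith
  refine ⟨f, m, μ, hfcw, fun f' m' μ' hf' => ?_, p, hcard, ci, fun i => (η i).f, mi, μi, hci, fun i => hmem i (hpre i) (hJi1 i), hf, hm, hμ, ?_⟩
  · by_cases hJ' : JCw α β δ f' m' μ' = ⊤
    · rw [hJ', EReal.coe_ennreal_top, EReal.coe_add_top]
      exact le_top
    · rw [← ENNReal.ofReal_toReal hJ', ← ENNReal.ofReal_toReal hJft, EReal.coe_ennreal_ofReal, EReal.coe_ennreal_ofReal,
        max_eq_left ENNReal.toReal_nonneg, max_eq_left ENNReal.toReal_nonneg, hJeq, hKf]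
      exact_mod_cast hlow f' m' μ' hf' hJ'
  · rw [← ENNReal.ofReal_toReal hJft, hJeq, hcsj]

end Paper
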